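/- Let d ≥ 1, δ ∈ (0,1], p, q ∈ (1,∞). Then there exist constants â = â(d,δ,p,q) > 0 and N = N(d,δ,p,q) such that the following holds. Let a : ℝ^{1+d} → 𝕊_δ be measurable with a^♯ ≤ â, let 0 < r < ρ < ∞, let u be a real function which together with ∂_t u, Du, D²u is continuous on an open neighborhood of the closure of C_ρ, let c(x) = c₀ + Σ_i c_i x^i be any affine function of x, and set f = ∂_t u + Σ_{i,j} a^{ij}(t,x) D_{ij}u on C_ρ. Then ‖∂_t u‖_{𝕃_{q,p}(C_r)} + ‖D²u‖_{𝕃_{q,p}(C_r)} ≤ N ( ‖f‖_{𝕃_{q,p}(C_ρ)} + (ρ−r)^{−2} ‖u − c‖_{𝕃_{q,p}(C_ρ)} ). -/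

import Mathlib

open MeasureTheory Metric Set
open scoped ENNReal NNReal

noncomputable section

abbrev Spc (d : ℕ) : Type := EuclideanSpace ℝ (Fin d)

abbrev Pt (d : ℕ) : Type := ℝ × Spc d

instance matrixMeasurableSpace (d : ℕ) : MeasurableSpace (Matrix (Fin d) (Fin d) ℝ) :=
  (inferInstance : MeasurableSpace (Fin d → Fin d → ℝ))

/-- Membership in `𝕊_δ`: symmetric `d×d` matrices with
`δ|ξ|² ≤ (aξ,ξ) ≤ δ⁻¹|ξ|²`. -/
def inS (d : ℕ) (δ : ℝ) (a : Matrix (Fin d) (Fin d) ℝ) : Prop :=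
  a.IsSymm ∧ ∀ ξ : Fin d → ℝ,
    δ * (∑ i, ξ i ^ 2) ≤ (∑ i, ∑ j, a i j * ξ i * ξ j) ∧
    (∑ i, ∑ j, a i j * ξ i * ξ j) ≤ δ⁻¹ * (∑ i, ξ i ^ 2)

/-- `{a,u} = a^{ij} a^{kr} u_{ik} u_{jr}`. -/
def bra (d : ℕ) (a u : Matrix (Fin d) (Fin d) ℝ) : ℝ :=
  ∑ i, ∑ j, ∑ k, ∑ r, a i j * a k r * u i k * u j r

/-- Frobenius norm of a `d×d` array. -/
def mnorm {d : ℕ} (m : Fin d → Fin d → ℝ) : ℝ :=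
  Real.sqrt (∑ i, ∑ j, m i j ^ 2)

/-- Euclidean norm of a vector given as `Fin d → ℝ`. -/
def vnorm {d : ℕ} (v : Fin d → ℝ) : ℝ :=
  Real.sqrt (∑ i, v i ^ 2)

/-- Parabolic cylinder `C_R(t,x) = (t, t+R²) × B_R(x)`. -/
def cyl (d : ℕ) (R t : ℝ) (x : Spc d) : Set (Pt d) :=
  Ioo t (t + R ^ 2) ×ˢ ball x R

/-- Time derivative `∂_t u`. -/
def Dt {d : ℕ} (u : Pt d → ℝ) (z : Pt d) : ℝ :=
  deriv (fun s => u (s, z.2)) z.1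

/-- Spatial derivative `D_i u`. -/
def Dx {d : ℕ} (i : Fin d) (u : Pt d → ℝ) (z : Pt d) : ℝ :=
  fderiv ℝ (fun y => u (z.1, y)) z.2 (EuclideanSpace.single i 1)

/-- Second spatial derivative `D_{ij} u = D_i D_j u`. -/
def Dxx {d : ℕ} (i j : Fin d) (u : Pt d → ℝ) : Pt d → ℝ :=
  Dx i (Dx j u)

/-- `u ∈ C₀^∞(ℝ^{1+d})`. -/
def CinfC {d : ℕ} (u : Pt d → ℝ) : Prop :=
  ContDiff ℝ (⊤ : ℕ∞) u ∧ HasCompactSupport u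

/-- The kernel `p_{α,k}(s,r)`. -/
def pak (d : ℕ) (α k s r : ℝ) : ℝ :=
  if 0 < s then s ^ (-((d : ℝ) + 2 - α) / 2) * Real.exp (-(r ^ 2) / (k * s)) else 0

/-- Parabolic distance to the origin `ρ(t,x) = |x| + √|t|`. -/
def prho {d : ℕ} (z : Pt d) : ℝ := ‖z.2‖ + Real.sqrt |z.1|

/-- Average of (the positive part of) `g` over `C`, valued in `ℝ≥0∞`. -/
def aveLin {d : ℕ} (C : Set (Pt d)) (g : Pt d → ℝ) : ℝ≥0∞ :=
  (volume C)⁻¹ * ∫⁻ z in C, ENNReal.ofReal (g z)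

/-- Parabolic maximal function `𝕄_β g` (for `g ≥ 0`). -/
def maxF {d : ℕ} (β : ℝ) (g : Pt d → ℝ) (z : Pt d) : ℝ≥0∞ :=
  ⨆ (ρ : ℝ) (_ : 0 < ρ) (t : ℝ) (x : Spc d) (_ : z ∈ cyl d ρ t x),
    ENNReal.ofReal (ρ ^ β) * aveLin (cyl d ρ t x) g

/-- Oscillation of a matrix-valued function over `C`. -/
def oscC {d : ℕ} (C : Set (Pt d)) (g : Pt d → Fin d → Fin d → ℝ) : ℝ :=
  ⨍ z₁ in C, ⨍ z₂ in C, mnorm (fun i j => g z₁ i j - g z₂ i j)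

/-- Mixed norm `‖f‖_{𝕃_{q,p}}` (inner integration in `t`, outer in `x`). -/
def mixedNorm {d : ℕ} (q p : ℝ) (f : Pt d → ℝ) : ℝ :=
  (∫ x : Spc d, (∫ t : ℝ, |f (t, x)| ^ q) ^ (p / q)) ^ (1 / p)

/-- Mixed norm on a set `Γ`. -/
def mixedNormOn {d : ℕ} (q p : ℝ) (Γ : Set (Pt d)) (f : Pt d → ℝ) : ℝ :=
  mixedNorm q p (Γ.indicator f)

/-- Normalized (averaged) mixed norm over the cylinder `C_R(t,x)`, in `ℝ≥0∞`. -/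
def cylNormL {d : ℕ} (q p R t : ℝ) (x : Spc d) (f : Pt d → ℝ) : ℝ≥0∞ :=
  ((volume (ball x R))⁻¹ * ∫⁻ y in ball x R,
      ((volume (Ioo t (t + R ^ 2)))⁻¹ * ∫⁻ s in Ioo t (t + R ^ 2),
        ENNReal.ofReal |f (s, y)| ^ q) ^ (p / q)) ^ (1 / p)

/-- Mixed norm on a set, valued in `ℝ≥0∞`. -/
def mixedNormLe {d : ℕ} (q p : ℝ) (Γ : Set (Pt d)) (f : Pt d → ℝ) : ℝ≥0∞ :=
  (∫⁻ x : Spc d, (∫⁻ t : ℝ, ENNReal.ofReal |Γ.indicator f (t, x)| ^ q) ^ (p / q)) ^ (1 / p)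

/-- `ã_C(t)`: average of `a(t,·)` over the ball of the cylinder. -/
def aTilde {d : ℕ} (a : Pt d → Matrix (Fin d) (Fin d) ℝ) (R : ℝ) (x₀ : Spc d) (t : ℝ)
    (i j : Fin d) : ℝ :=
  ⨍ y in ball x₀ R, a (t, y) i j

/-- The mean oscillation of `a` w.r.t. `x` over one cylinder. -/
def aSharpCyl {d : ℕ} (a : Pt d → Matrix (Fin d) (Fin d) ℝ) (R t₀ : ℝ) (x₀ : Spc d) : ℝ≥0∞ :=
  (volume (cyl d R t₀ x₀))⁻¹ * ∫⁻ z in cyl d R t₀ x₀,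
    ENNReal.ofReal (mnorm (fun i j => a z i j - aTilde a R x₀ z.1 i j))

/-- `a^♯`. -/
def aSharp {d : ℕ} (a : Pt d → Matrix (Fin d) (Fin d) ℝ) : ℝ≥0∞ :=
  ⨆ (R : ℝ) (_ : 0 < R) (t₀ : ℝ) (x₀ : Spc d), aSharpCyl a R t₀ x₀

/-- `a^♯_ρ` (only cylinders of radius `≤ ρa`). -/
def aSharpRho {d : ℕ} (a : Pt d → Matrix (Fin d) (Fin d) ℝ) (ρa : ℝ) : ℝ≥0∞ :=
  ⨆ (R : ℝ) (_ : 0 < R) (_ : R ≤ ρa) (t₀ : ℝ) (x₀ : Spc d), aSharpCyl a R t₀ x₀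

/-- Homogeneous Morrey norm `‖g‖_{Ė_{p,β}}`. -/
def morreyP {d : ℕ} (p β : ℝ) (g : Pt d → ℝ) : ℝ≥0∞ :=
  ⨆ (ρ : ℝ) (_ : 0 < ρ) (t : ℝ) (x : Spc d),
    ENNReal.ofReal (ρ ^ β) *
      ((volume (cyl d ρ t x))⁻¹ * ∫⁻ z in cyl d ρ t x, ENNReal.ofReal |g z| ^ p) ^ (1 / p)

/-- Homogeneous mixed-norm Morrey norm `‖g‖_{Ė_{q,p,β}}`. -/
def morreyQP {d : ℕ} (q p β : ℝ) (g : Pt d → ℝ) : ℝ≥0∞ :=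
  ⨆ (ρ : ℝ) (_ : 0 < ρ) (t : ℝ) (x : Spc d),
    ENNReal.ofReal (ρ ^ β) * cylNormL q p ρ t x g

/-- Inhomogeneous mixed-norm Morrey norm `‖g‖_{E_{q,p,β}}` (radii `ρ ∈ (0,1]`). -/
def morreyI {d : ℕ} (q p β : ℝ) (g : Pt d → ℝ) : ℝ≥0∞ :=
  ⨆ (ρ : ℝ) (_ : 0 < ρ) (_ : ρ ≤ 1) (t : ℝ) (x : Spc d),
    ENNReal.ofReal (ρ ^ β) * cylNormL q p ρ t x g

/-- `b̄_{q',p',ρb}` for a vector field `b`. -/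
def bBar {d : ℕ} (q' p' : ℝ) (b : Pt d → Fin d → ℝ) (ρb : ℝ) : ℝ≥0∞ :=
  ⨆ (R : ℝ) (_ : 0 < R) (_ : R ≤ ρb) (t : ℝ) (x : Spc d),
    ENNReal.ofReal R * cylNormL q' p' R t x (fun z => vnorm (b z))

/-- Test function supported in the open set `Q`. -/
def IsTest {d : ℕ} (Q : Set (Pt d)) (φ : Pt d → ℝ) : Prop :=
  ContDiff ℝ (⊤ : ℕ∞) φ ∧ HasCompactSupport φ ∧ tsupport φ ⊆ Q

/-- `ut` is the weak time derivative of `u` on `Q`. -/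
def WeakDtOn {d : ℕ} (Q : Set (Pt d)) (u ut : Pt d → ℝ) : Prop :=
  ∀ φ, IsTest Q φ → ∫ z in Q, u z * Dt φ z = - ∫ z in Q, ut z * φ z

/-- `ui` is the weak `i`-th spatial derivative of `u` on `Q`. -/
def WeakDxOn {d : ℕ} (Q : Set (Pt d)) (i : Fin d) (u ui : Pt d → ℝ) : Prop :=
  ∀ φ, IsTest Q φ → ∫ z in Q, u z * Dx i φ z = - ∫ z in Q, ui z * φ z
set_option linter.all false
notation "ƥ" => (by positivity)
notation "ł" => (by linarith)
notation "ş" => (by simp)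
notation "ƒ" => (by finiteness)
notation "ñ" => (by norm_num)
notation "ʄ" => (by fun_prop)
notation "ŋ" => (by nlinarith)
notation:max "Mq" d:max => Matrix (Fin d) (Fin d) ℝ
notation "ℰ" => ℝ≥0∞
notation:max "Fn" d:max => Pt d → ℝ
notation "¿" => ?_
notation "ō" => (0 : ℝ)
notation "½" => (1 / 2 : ℝ)
open scoped Real FourierTransform ComplexConjugate
open ENNReal (ofReal rpow_ne_top_of_nonneg rpow_mul rpow_le_rpow rpow_one mul_ne_top ofReal_ne_top mul_rpow_of_nonneg ofReal_le_ofReal ofReal_mul zero_rpow_of_pos rpow_add toReal_mul toReal_ofReal ofReal_toReal ofReal_pow div_le_of_le_mul div_le_iff tsum_le_tsum toReal_mono rpow_neg ofReal_rpow_of_pos lintegral_mul_le_Lp_mul_Lq div_ne_top toReal_nonneg toReal_add sum_lt_top rpow_add_of_nonneg lintegral_Lp_add_le le_tsum tsum_geometric rpow_two ofReal_sum_of_nonneg ofReal_add mul_lt_top div_le_of_le_mul')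
open Filter.Eventually (of_forall)
open Real (exp smoothTransition norm_of_nonneg norm_eq_abs enorm_eq_ofReal_abs fourier_eq' sqrt_pos sqrt sq_sqrt dist_eq exp_le_exp sqrt_nonneg fourierInv_eq' volume_Ico sqrt_le_iff holderConjugate_iff fourierInv_eq_fourier_neg contDiff_exp abs_exp)
open Finset (sum_le_sum sum_congr mul_sum measurable_sum sum_mul single_le_sum sum_nonneg sum_add_distrib abs_sum_le_sum_abs sum_neg_distrib sum_fn)
open EuclideanSpace (single proj norm_eq)
open Function (uncurry onFun)
open Complex (norm_real abs_re_le_norm norm_exp_ofReal_mul_I re_mul_ofReal measurable_re measurable_ofReal)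
open Filter (atTop)
open WithLp (toLp)
open Real.HolderConjugate (conjExponent)
open PiLp (norm_apply_le)
open Prod (fst_zero)
namespace K14
variable {d : ℕ} {l δ q p R ε r m1 ρ s C K B η θ : ℝ} {f g v u W h : Fn d} {z : Pt d} {U : Set (Pt d)} {α : ℝ → Mq d} {a : Pt d → Mq d} {A : Mq d} {P : Spc d → ℂ} {κ : Pt d → Fn d} {m : ℕ}
structure Bx (α ι : Type*) [TopologicalSpace α] where
  B : ι → Set α
  B' : ι → Set α
  sz : ι → ℝ
  op : ∀ i, IsOpen (B i)
  ne : ∀ i, (B i).Nonempty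
  pos : ∀ i, 0 ≤ sz i
  eng : ∀ i j, (B i ∩ B j).Nonempty → sz i ≤ 2 * sz j → B i ⊆ B' j
lemma cover {α ι : Type*} [TopologicalSpace α] [SecondCountableTopology α] [MeasurableSpace α]
    [BorelSpace α] (b : Bx α ι) (ν μ : Measure α) (g : α → ℰ) (l : ℰ) (I : Set ι)
    (h : ∀ i ∈ I, l * ν (b.B' i) ≤ ∫⁻ z in b.B i, g z ∂μ) :
    l * ν (⋃ i ∈ I, b.B i) ≤ ∫⁻ z, g z ∂μ := by
  have e : (⋃ i ∈ I, b.B i) = ⋃ n : ℕ, ⋃ i ∈ {i | i ∈ I ∧ b.sz i ≤ n}, b.B i := by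
    ext z
    simp only [mem_iUnion, mem_ofPred_eq, exists_prop]
    constructor
    · rintro ⟨i, hi, hz⟩
      obtain ⟨n, hn⟩ := exists_nat_ge (b.sz i)
      exact ⟨n, i, ⟨hi, hn⟩, hz⟩
    · rintro ⟨n, i, ⟨hi, hn⟩, hz⟩
      exact ⟨i, hi, hz⟩
  have hm : Monotone (fun n : ℕ ↦ ⋃ i ∈ {i | i ∈ I ∧ b.sz i ≤ n}, b.B i) := by
    intro n m hnm
    refine biUnion_subset_biUnion_left ¿
    rintro i ⟨hi, hn⟩
    exact ⟨hi, hn.trans (by exact_mod_cast hnm)⟩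
  rw [e, hm.measure_iUnion, ENNReal.mul_iSup]
  refine iSup_le fun n ↦ ¿
  obtain ⟨u, hu, hd, hc⟩ := Vitali.exists_disjoint_subfamily_covering_enlargement b.B
    {i | i ∈ I ∧ b.sz i ≤ n} b.sz 2 ñ (fun a _ ↦ b.pos a) n (fun a ha ↦ ha.2)
    (fun a _ ↦ b.ne a)
  have hcu : u.Countable := hd.countable_of_isOpen (fun i _ ↦ b.op i) (fun i _ ↦ b.ne i)
  have hsub : (⋃ i ∈ {i | i ∈ I ∧ b.sz i ≤ n}, b.B i) ⊆ ⋃ j ∈ u, b.B' j := by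
    refine iUnion₂_subset fun i hi ↦ ¿
    obtain ⟨j, hj, hij, hs⟩ := hc i hi
    exact (b.eng i j hij hs).trans (subset_biUnion_of_mem (u := b.B') hj)
  calc l * ν (⋃ i ∈ {i | i ∈ I ∧ b.sz i ≤ n}, b.B i) ≤ l * ∑' j : u, ν (b.B' j) := by
        gcongr
        exact (measure_mono hsub).trans (measure_biUnion_le _ hcu _)
    _ = ∑' j : u, l * ν (b.B' j) := ENNReal.tsum_mul_left.symm
    _ ≤ ∑' j : u, ∫⁻ z in b.B j, g z ∂μ := tsum_le_tsum fun j ↦ h _ (hu j.2).1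
    _ = ∫⁻ z in ⋃ j ∈ u, b.B j, g z ∂μ :=
        (lintegral_biUnion hcu (fun i _ ↦ (b.op i).measurableSet) hd g).symm
    _ ≤ _ := setLIntegral_le_lintegral _ _
def Bx.M {α ι : Type*} [TopologicalSpace α] [MeasurableSpace α] (b : Bx α ι) (μ : Measure α)
    (f : α → ℰ) (z : α) : ℰ :=
  ⨆ (i : ι) (_ : z ∈ b.B i), (∫⁻ y in b.B i, f y ∂μ) / μ (b.B i)
section
variable {α ι : Type*} [TopologicalSpace α] [MeasurableSpace α] (b : Bx α ι) (μ : Measure α)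
lemma Bx.le_M (f : α → ℰ) {i : ι} {z : α} (hz : z ∈ b.B i) :
    (∫⁻ y in b.B i, f y ∂μ) / μ (b.B i) ≤ b.M μ f z :=
  le_iSup₂ (f := fun i (_ : z ∈ b.B i) ↦ (∫⁻ y in b.B i, f y ∂μ) / μ (b.B i)) i hz
lemma Bx.M_set (f : α → ℰ) (l : ℰ) : {z | l < b.M μ f z} =
    ⋃ i ∈ {i | l < (∫⁻ y in b.B i, f y ∂μ) / μ (b.B i)}, b.B i := by
  ext z
  simp only [Bx.M, mem_ofPred_eq, lt_iSup_iff, mem_iUnion, exists_prop]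
  exact exists_congr fun i ↦ and_comm
lemma Bx.M_meas [BorelSpace α] (f : α → ℰ) : Measurable (b.M μ f) := by
  refine measurable_of_Ioi fun l ↦ ¿
  have : b.M μ f ⁻¹' Ioi l = {z | l < b.M μ f z} := rfl
  rw [this, b.M_set]
  exact (isOpen_biUnion fun i _ ↦ b.op i).measurableSet
lemma Bx.M_mono {f g : α → ℰ} (h : f ≤ g) : b.M μ f ≤ b.M μ g := fun z ↦
  iSup₂_mono fun i _ ↦ ENNReal.div_le_div_right (lintegral_mono h) _
end
lemma geo (q : ℝ) (hq : 1 < q) (f : ℰ) (C : ℰ) (hC : C = (1 - 2 ^ (-(q - 1)))⁻¹) :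
    (∑' k : ℤ, if (2 : ℰ) ^ k < f then ((2 : ℰ) ^ k) ^ (q - 1) else 0) ≤ C * f ^ (q - 1) := by
  rcases eq_or_ne f 0 with rfl | hf0
  · simp
  have hC0 : C ≠ 0 := by
    rw [hC]; simp
  rcases eq_or_ne f ⊤ with rfl | hft
  · rw [ENNReal.top_rpow_of_pos ł, ENNReal.mul_top hC0]; exact le_top
  obtain ⟨J, hJ1, hJ2⟩ := ENNReal.exists_mem_Ioc_zpow (y := 2) hf0 hft ñ ñ
  have hinj : Function.Injective (fun n : ℕ ↦ J - (n : ℤ)) := fun a c h ↦ by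
    simp only at h; omega
  rw [← hinj.tsum_eq (f := fun k : ℤ ↦ if (2 : ℰ) ^ k < f then ((2 : ℰ) ^ k) ^ (q - 1) else 0)]
  · have hb : ∀ n : ℕ, (if (2 : ℰ) ^ (J - (n : ℤ)) < f then ((2 : ℰ) ^ (J - (n : ℤ))) ^ (q - 1)
        else 0) ≤ f ^ (q - 1) * ((2 : ℰ) ^ (-(q - 1))) ^ n := by
      intro n
      have e1 : (2 : ℰ) ^ (J - (n : ℤ)) = 2 ^ J * 2 ^ (-(n : ℤ)) := by
        rw [sub_eq_add_neg, ENNReal.zpow_add ñ ñ]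
      have e2 : ((2 : ℰ) ^ (-(n : ℤ))) ^ (q - 1) = ((2 : ℰ) ^ (-(q - 1))) ^ n := by
        rw [← ENNReal.rpow_intCast, ← rpow_mul, ← ENNReal.rpow_natCast, ← rpow_mul]
        congr 1; push_cast; ring
      split_ifs
      · rw [e1, mul_rpow_of_nonneg _ _ ł, e2]
        gcongr
      · exact zero_le
    refine (tsum_le_tsum hb).trans ¿
    rw [ENNReal.tsum_mul_left, tsum_geometric, ← hC, mul_comm]
  · intro k hk
    simp only [Function.mem_support, ne_eq, ite_eq_right_iff, not_forall] at hk
    obtain ⟨h1, -⟩ := hk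
    have : k ≤ J := by
      by_contra hc
      have : (2 : ℰ) ^ (J + 1) ≤ 2 ^ k := ENNReal.zpow_le_of_le ñ (by omega)
      exact absurd (h1.trans_le hJ2) (not_lt.2 this)
    exact ⟨(J - k).toNat, by simp only; omega⟩
def lC (q : ℝ) : ℰ := 4 ^ q * (1 - 2 ^ (-(q - 1)))⁻¹
lemma lC_ne (q : ℝ) (hq : 1 < q) : lC q ≠ ⊤ := by
  unfold lC
  refine mul_ne_top (rpow_ne_top_of_nonneg ł ñ) ¿
  rw [ENNReal.inv_ne_top]
  have : (2 : ℰ) ^ (-(q - 1)) < 1 := ENNReal.rpow_lt_one_of_one_lt_of_neg ñ ł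
  exact (tsub_pos_of_lt this).ne'
lemma layer {α : Type*} [MeasurableSpace α] (q : ℝ) (hq : 1 < q) (ν μ : Measure α)
    (f m : α → ℰ) (hf : Measurable f) (hm : Measurable m)
    (h : ∀ l : ℰ, l ≠ 0 → l ≠ ⊤ → l * ν {z | 2 * l < m z} ≤ ∫⁻ z in {z | l < f z}, f z ∂μ) :
    ∫⁻ z, m z ^ q ∂ν ≤ lC q * ∫⁻ z, f z ^ q ∂μ := by
  have two0 : (2 : ℰ) ≠ 0 := by norm_num
  have twot : (2 : ℰ) ≠ ⊤ := by norm_num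
  have zn : ∀ k : ℤ, (2 : ℰ) ^ k ≠ 0 := fun k ↦ (ENNReal.zpow_pos two0 twot k).ne'
  have zt : ∀ k : ℤ, (2 : ℰ) ^ k ≠ ⊤ := fun k ↦ (ENNReal.zpow_lt_top two0 twot k).ne
  have b1 : ∀ z, m z ^ q ≤ ∑' k : ℤ, ({z | 2 * 2 ^ k < m z}.indicator
      (fun _ ↦ (4 * (2 : ℰ) ^ k) ^ q) z) := by
    intro z
    rcases eq_or_ne (m z) 0 with h0 | h0
    · rw [h0, zero_rpow_of_pos ł]; exact zero_le
    rcases eq_or_ne (m z) ⊤ with ht | ht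
    · refine le_top.trans ¿
      have h1 : ∀ n : ℕ, (1 : ℰ) ≤ ({z | 2 * 2 ^ ((n : ℤ)) < m z}.indicator
        (fun _ ↦ (4 * (2 : ℰ) ^ (n : ℤ)) ^ q) z) := by
        intro n
        rw [indicator_of_mem]
        · refine ENNReal.one_le_rpow ¿ ł
          have : (1 : ℰ) ≤ 2 ^ (n : ℤ) := by
            rw [zpow_natCast]; exact one_le_pow₀ ñ
          calc (1 : ℰ) ≤ 4 * 1 := by norm_num
            _ ≤ _ := by gcongr
        · rw [mem_ofPred_eq, ht]
          exact (mul_ne_top twot (zt _)).lt_top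
      calc (⊤ : ℰ) = ∑' n : ℕ, 1 := (ENNReal.tsum_const_eq_top_of_ne_zero one_ne_zero).symm
        _ ≤ ∑' n : ℕ, ({z | 2 * 2 ^ ((n : ℤ)) < m z}.indicator
            (fun _ ↦ (4 * (2 : ℰ) ^ (n : ℤ)) ^ q) z) := tsum_le_tsum h1
        _ ≤ _ := ENNReal.tsum_comp_le_tsum_of_injective (f := fun n : ℕ ↦ (n : ℤ))
            Nat.cast_injective (fun k : ℤ ↦ ({z | 2 * 2 ^ k < m z}.indicator
            (fun _ ↦ (4 * (2 : ℰ) ^ k) ^ q) z))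
    · obtain ⟨J, hJ1, hJ2⟩ := ENNReal.exists_mem_Ioc_zpow (y := 2) h0 ht ñ twot
      refine le_trans ¿ (le_tsum (J - 1))
      have e : (2 : ℰ) * 2 ^ (J - 1) = 2 ^ J := by
        rw [ENNReal.zpow_sub two0 twot, zpow_one, ← mul_assoc, mul_comm (2:ℰ), mul_assoc,
          ENNReal.mul_inv_cancel two0 twot, mul_one]
      rw [indicator_of_mem (by rw [mem_ofPred_eq, e]; exact hJ1)]
      refine rpow_le_rpow (hJ2.trans ¿) ł
      rw [ENNReal.zpow_add two0 twot, zpow_one, ← e, show (4 : ℰ) = 2 * 2 by norm_num]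
      exact le_of_eq (by ring)
  have b2 : ∀ k : ℤ, ∫⁻ z, ({z | 2 * 2 ^ k < m z}.indicator (fun _ ↦ (4 * (2 : ℰ) ^ k) ^ q) z) ∂ν
      ≤ ∫⁻ z, 4 ^ q * (f z * if (2 : ℰ) ^ k < f z then ((2 : ℰ) ^ k) ^ (q - 1) else 0) ∂μ := by
    intro k
    rw [lintegral_indicator_const (measurableSet_lt measurable_const hm)]
    have e3 : (4 * (2 : ℰ) ^ k) ^ q = 4 ^ q * ((2 ^ k) ^ (q - 1) * 2 ^ k) := by
      rw [mul_rpow_of_nonneg _ _ ł]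
      congr 1
      nth_rewrite 3 [← rpow_one ((2 : ℰ) ^ k)]
      rw [← rpow_add _ _ (zn k) (zt k)]
      congr 1; ring
    rw [lintegral_const_mul' _ _ (rpow_ne_top_of_nonneg ł ñ), e3,
      mul_assoc, mul_assoc]
    gcongr
    refine (mul_le_mul_right (h _ (zn k) (zt k)) _).trans ¿
    rw [← lintegral_const_mul' _ _ (rpow_ne_top_of_nonneg ł (zt k)),
      ← lintegral_indicator (measurableSet_lt measurable_const hf)]
    refine lintegral_mono fun z ↦ ¿
    by_cases hz : 2 ^ k < f z
    · rw [indicator_of_mem (by exact hz), if_pos hz, mul_comm]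
    · rw [indicator_of_notMem (by exact hz)]; exact zero_le
  calc ∫⁻ z, m z ^ q ∂ν ≤ ∫⁻ z, ∑' k : ℤ, ({z | 2 * 2 ^ k < m z}.indicator
      (fun _ ↦ (4 * (2 : ℰ) ^ k) ^ q) z) ∂ν := lintegral_mono b1
    _ = ∑' k : ℤ, ∫⁻ z, ({z | 2 * 2 ^ k < m z}.indicator (fun _ ↦ (4 * (2 : ℰ) ^ k) ^ q) z) ∂ν :=
        lintegral_tsum fun k ↦ (measurable_const.indicator
          (measurableSet_lt measurable_const hm)).aemeasurable
    _ ≤ ∑' k : ℤ, ∫⁻ z, 4 ^ q * (f z * if (2 : ℰ) ^ k < f z then ((2 : ℰ) ^ k) ^ (q - 1) else 0) ∂μ :=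
        tsum_le_tsum b2
    _ = ∫⁻ z, ∑' k : ℤ, 4 ^ q * (f z * if (2 : ℰ) ^ k < f z then ((2 : ℰ) ^ k) ^ (q - 1) else 0) ∂μ := by
        refine (lintegral_tsum fun k ↦ ¿).symm
        exact (measurable_const.mul (hf.mul (Measurable.ite (measurableSet_lt measurable_const hf)
          measurable_const measurable_const))).aemeasurable
    _ ≤ ∫⁻ z, lC q * f z ^ q ∂μ := by
        refine lintegral_mono fun z ↦ ¿
        simp only
        rw [ENNReal.tsum_mul_left, ENNReal.tsum_mul_left, lC, mul_assoc]
        refine mul_le_mul_right ((mul_le_mul_right (geo q hq (f z) _ rfl) _).trans ¿) _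
        rw [mul_left_comm]
        gcongr
        nth_rewrite 1 [← rpow_one (f z)]
        rw [← rpow_add_of_nonneg _ _ ñ ł]
        exact le_of_eq (by congr 1; ring)
    _ = _ := lintegral_const_mul' _ _ (lC_ne q hq)
theorem strong {α ι : Type*} [TopologicalSpace α] [SecondCountableTopology α] [MeasurableSpace α]
    [BorelSpace α] (b : Bx α ι) (ν μ : Measure α) (V : α → ℰ) (hV : Measurable V)
    (hμ : ∀ i, μ (b.B i) ≠ 0) (hμ' : ∀ i, μ (b.B i) ≠ ⊤)
    (h : ∀ i, ∀ z ∈ b.B i, ν (b.B' i) ≤ μ (b.B i) * V z) (q : ℝ) (hq : 1 < q)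
    (f : α → ℰ) (hf : Measurable f) :
    ∫⁻ z, b.M μ f z ^ q ∂ν ≤ lC q * ∫⁻ z, f z ^ q * V z ∂μ := by
  have := layer q hq ν (μ.withDensity V) f (b.M μ f) hf (b.M_meas μ f) ¿
  · rwa [lintegral_withDensity_eq_lintegral_mul _ hV (hf.pow_const q),
      show (∫⁻ a, (V * fun z ↦ f z ^ q) a ∂μ) = ∫⁻ z, f z ^ q * V z ∂μ from
        lintegral_congr fun z ↦ mul_comm _ _] at this
  · intro l l0 lt
    have hms : MeasurableSet {z | l < f z} := measurableSet_lt measurable_const hf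
    rw [restrict_withDensity hms, lintegral_withDensity_eq_lintegral_mul _ hV hf, b.M_set,
      ← lintegral_indicator hms]
    refine cover b ν μ _ l _ ¿
    intro i hi
    simp only [mem_ofPred_eq] at hi
    set f1 : α → ℰ := {z | l < f z}.indicator f with hf1
    have h1 : ∫⁻ y in b.B i, f y ∂μ ≤ ∫⁻ y in b.B i, f1 y ∂μ + l * μ (b.B i) := by
      rw [← setLIntegral_const, ← lintegral_add_right _ measurable_const]
      refine lintegral_mono fun y ↦ ¿
      by_cases hy : l < f y
      · simp only [hf1]; rw [indicator_of_mem (by exact hy)]; exact le_self_add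
      · exact (not_lt.1 hy).trans le_add_self
    have h2 : l * μ (b.B i) ≤ ∫⁻ y in b.B i, f1 y ∂μ := by
      have h3 : 2 * l * μ (b.B i) < ∫⁻ y in b.B i, f y ∂μ :=
        (ENNReal.lt_div_iff_mul_lt (Or.inl (hμ i)) (Or.inl (hμ' i))).1 hi
      have h4 := h3.le.trans h1
      rw [two_mul, add_mul] at h4
      exact (ENNReal.add_le_add_iff_right (mul_ne_top lt (hμ' i))).1 h4
    have h5 : ∀ y ∈ b.B i, f1 y * (ν (b.B' i) / μ (b.B i)) ≤
        {z | l < f z}.indicator (V * f) y := by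
      intro y hy
      by_cases hy' : l < f y
      · rw [indicator_of_mem (by exact hy'), hf1, indicator_of_mem (by exact hy'), Pi.mul_apply,
          mul_comm (V y)]
        gcongr
        exact div_le_of_le_mul' (h i y hy)
      · rw [hf1, indicator_of_notMem (by exact hy'), zero_mul]; exact zero_le
    refine le_trans ¿ (setLIntegral_mono' (b.op i).measurableSet h5)
    rw [lintegral_mul_const _ (hf.indicator hms)]
    refine le_trans (le_of_eq ¿) (mul_le_mul_left h2 _)
    rw [mul_assoc, ENNReal.mul_div_cancel (hμ i) (hμ' i)]
def pbox {d : ℕ} (z : Pt d) (l : ℝ) : Set (Pt d) := Ioo (z.1 - l ^ 2) (z.1 + l ^ 2) ×ˢ ball z.2 l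
def xB (d : ℕ) : Bx (Spc d) (Spc d × Ioi ō) where
  B i := ball i.1 i.2
  B' i := ball i.1 (5 * i.2)
  sz i := i.2
  op i := isOpen_ball
  ne i := nonempty_ball.2 i.2.2
  pos i := i.2.2.le
  eng := by
    rintro ⟨x, l, hl⟩ ⟨y, m, hm⟩ ⟨z, hz1, hz2⟩ h w hw
    simp only [mem_ball] at *
    calc dist w y ≤ dist w x + dist z x + dist z y := by
          have := dist_triangle4 w x z y
          rwa [dist_comm x z] at this
      _ < 5 * m := by linarith
def pB (d : ℕ) : Bx (Pt d) (Pt d × Ioi ō) where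
  B i := pbox i.1 i.2
  B' i := pbox i.1 (5 * i.2)
  sz i := i.2
  op i := isOpen_Ioo.prod isOpen_ball
  ne i := by
    have : ō < i.2 := i.2.2
    refine ⟨i.1, ⟨¿, mem_ball_self this⟩⟩
    constructor <;> nlinarith
  pos i := i.2.2.le
  eng := by
    rintro ⟨x, l, hl⟩ ⟨y, m, hm⟩ ⟨z, hz1, hz2⟩ h w hw
    simp only [pbox, mem_prod, mem_ball, mem_Ioo] at *
    rw [mem_Ioi] at hl hm
    have h2 : l ^ 2 ≤ 4 * m ^ 2 := by nlinarith
    refine ⟨⟨by nlinarith, by nlinarith⟩, ¿⟩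
    calc dist w.2 y.2 ≤ dist w.2 x.2 + dist z.2 x.2 + dist z.2 y.2 := by
          have := dist_triangle4 w.2 x.2 z.2 y.2
          rwa [dist_comm x.2 z.2] at this
      _ < 5 * m := by linarith
lemma vball (x : Spc d) (hl : 0 < l) :
    volume (ball x l) = ofReal (l ^ d) * volume (ball (0 : Spc d) 1) := by
  rw [Measure.addHaar_ball_of_pos volume x hl, finrank_euclideanSpace_fin]
lemma vpbox (z : Pt d) (hl : 0 < l) :
    volume (pbox z l) = ofReal (2 * l ^ 2) * volume (ball z.2 l) := by
  rw [pbox, Measure.volume_eq_prod, Measure.prod_prod, Real.volume_Ioo]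
  congr 2; ring
lemma vball5 (x : Spc d) (hl : 0 < l) :
    volume (ball x (5 * l)) = 5 ^ d * volume (ball x l) := by
  rw [vball x hl, vball x ƥ, mul_pow, ofReal_mul ƥ,
    ofReal_pow ñ, mul_assoc]
  norm_num
lemma vpbox5 (z : Pt d) (hl : 0 < l) :
    volume (pbox z (5 * l)) = 5 ^ (d + 2) * volume (pbox z l) := by
  rw [vpbox z hl, vpbox z ƥ, vball5 _ hl,
    show 2 * (5 * l) ^ 2 = 5 ^ 2 * (2 * l ^ 2) by ring, ofReal_mul ƥ,
    ofReal_pow ñ, pow_add]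
  norm_num
  ring
lemma vball_ne0 (x : Spc d) (hl : 0 < l) : volume (ball x l) ≠ 0 :=
  (measure_ball_pos volume x hl).ne'
lemma vball_net (x : Spc d) (l : ℝ) : volume (ball x l) ≠ ⊤ := measure_ball_lt_top.ne
lemma vpbox_ne0 (z : Pt d) (hl : 0 < l) : volume (pbox z l) ≠ 0 := by
  rw [vpbox z hl]
  refine mul_ne_zero ¿ (vball_ne0 _ hl)
  simp; positivity
lemma vpbox_net (z : Pt d) (hl : 0 < l) : volume (pbox z l) ≠ ⊤ := by
  rw [vpbox z hl]
  exact mul_ne_top ofReal_ne_top (vball_net _ _)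
lemma pbox_meas (z : Pt d) (l : ℝ) : MeasurableSet (pbox z l) := measurableSet_Ioo.prod measurableSet_ball
abbrev Mx (W : Spc d → ℰ) : Spc d → ℰ := (xB d).M volume W
abbrev MM (f : Pt d → ℰ) : Pt d → ℰ := (pB d).M volume f
lemma le_Mx (W : Spc d → ℰ) {x y : Spc d} (hl : 0 < l) (h : x ∈ ball y l) :
    (∫⁻ y in ball y l, W y) / volume (ball y l) ≤ Mx W x :=
  (xB d).le_M volume W (i := (y, ⟨l, hl⟩)) h
lemma le_MM (f : Pt d → ℰ) {x y : Pt d} (hl : 0 < l) (h : x ∈ pbox y l) :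
    (∫⁻ y in pbox y l, f y) / volume (pbox y l) ≤ MM f x :=
  (pB d).le_M volume f (i := (y, ⟨l, hl⟩)) h
lemma tonelli (f : Pt d → ℰ) (hf : Measurable f) :
    ∫⁻ z, f z = ∫⁻ x : Spc d, ∫⁻ t : ℝ, f (t, x) := by
  rw [Measure.volume_eq_prod, lintegral_prod_symm' _ hf]
lemma tonelli_box (W : Spc d → ℰ) (hW : Measurable W) (z : Pt d) (hl : 0 < l) :
    ∫⁻ w in pbox z l, W w.2 = ofReal (2 * l ^ 2) * ∫⁻ x in ball z.2 l, W x := by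
  rw [pbox, Measure.volume_eq_prod, ← Measure.prod_restrict,
    lintegral_prod_symm' (fun w : ℝ × Spc d ↦ W w.2) (hW.comp measurable_snd)]
  simp only [lintegral_const, Measure.restrict_apply_univ, Real.volume_Ioo]
  rw [lintegral_mul_const _ hW, mul_comm]
  congr 2; ring
lemma Mx_strong (q : ℝ) (hq : 1 < q) (f : Spc d → ℰ) (hf : Measurable f) :
    ∫⁻ x, Mx f x ^ q ≤ lC q * 5 ^ d * ∫⁻ x, f x ^ q := by
  have := strong (xB d) volume volume (fun _ ↦ 5 ^ d) measurable_const
    (fun i ↦ vball_ne0 _ i.2.2) (fun i ↦ vball_net _ _)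
    (fun i z _ ↦ ((vball5 i.1 i.2.2).trans (mul_comm _ _)).le) q hq f hf
  rwa [lintegral_mul_const _ (hf.pow_const q), mul_comm _ (5 ^ d), ← mul_assoc] at this
lemma MM_strong (q : ℝ) (hq : 1 < q) (f : Pt d → ℰ) (hf : Measurable f) :
    ∫⁻ x, MM f x ^ q ≤ lC q * 5 ^ (d + 2) * ∫⁻ x, f x ^ q := by
  have := strong (pB d) volume volume (fun _ ↦ 5 ^ (d + 2)) measurable_const
    (fun i ↦ vpbox_ne0 _ i.2.2) (fun i ↦ vpbox_net _ i.2.2)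
    (fun i z _ ↦ ((vpbox5 i.1 i.2.2).trans (mul_comm _ _)).le) q hq f hf
  rwa [lintegral_mul_const _ (hf.pow_const q), mul_comm _ (5 ^ (d + 2)), ← mul_assoc] at this
lemma MM_weighted (q : ℝ) (hq : 1 < q) (f : Pt d → ℰ) (hf : Measurable f)
    (W : Spc d → ℰ) (hW : Measurable W) :
    ∫⁻ z, MM f z ^ q * W z.2 ≤ lC q * 5 ^ (d + 2) * ∫⁻ z, f z ^ q * Mx W z.2 := by
  have hW2 : Measurable fun z : Pt d ↦ W z.2 := hW.comp measurable_snd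
  have hMW : Measurable fun z : Pt d ↦ Mx W z.2 := ((xB d).M_meas volume W).comp measurable_snd
  have := strong (pB d) (volume.withDensity fun z ↦ W z.2) volume
    (fun z ↦ 5 ^ (d + 2) * Mx W z.2) (measurable_const.mul hMW)
    (fun i ↦ vpbox_ne0 _ i.2.2) (fun i ↦ vpbox_net _ i.2.2) ¿ q hq f hf
  · rw [lintegral_withDensity_eq_lintegral_mul _ hW2
      (((pB d).M_meas volume f).pow_const q)] at this
    refine (le_of_eq ¿).trans (this.trans (le_of_eq ¿))
    · exact lintegral_congr fun z ↦ mul_comm _ _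
    · rw [mul_assoc, ← lintegral_const_mul' ((5:ℰ) ^ (d + 2)) _ ƒ]
      congr 1
      exact lintegral_congr fun z ↦ by ring
  · rintro ⟨w, l, hl⟩ z hz
    simp only [mem_Ioi] at hl
    show (volume.withDensity fun z : Pt d ↦ W z.2) (pbox w (5 * l)) ≤ volume (pbox w l) * _
    have h5 : 0 < 5 * l := by positivity
    have hz' : z.2 ∈ ball w.2 (5 * l) := ball_subset_ball ł hz.2
    have h1 := le_Mx W h5 hz'
    rw [withDensity_apply _ (pbox_meas _ _), tonelli_box W hW _ h5, ← mul_assoc,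
      mul_comm (volume _), ← vpbox5 w hl, vpbox w h5, mul_assoc]
    refine mul_le_mul_right ¿ _
    rw [mul_comm (volume _)]
    exact (div_le_iff (vball_ne0 _ h5) (vball_net _ _)).1 h1
lemma MM_A1 (q : ℝ) (hq : 1 < q) (C : ℰ) (hC : C ≠ ⊤) (s : Spc d → ℰ) (hs : Measurable s)
    (hs0 : ∀ x, s x ≠ 0) (hst : ∀ x : Spc d, ∀ l, 0 < l → ∫⁻ y in ball x l, s y ≠ ⊤)
    (hA : ∀ x, Mx s x ≤ C * s x) (f : Pt d → ℰ) (hf : Measurable f) :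
    ∫⁻ z, MM f z ^ q * s z.2 ^ (1 - q) ≤
      C ^ q * (lC q * (5 ^ (d + 2) * C)) * ∫⁻ z, f z ^ q * s z.2 ^ (1 - q) := by
  have hs2 : Measurable fun z : Pt d ↦ s z.2 := hs.comp measurable_snd
  set ν : Measure (Pt d) := volume.withDensity fun z ↦ s z.2 with hν
  have hball0 : ∀ (x : Spc d) l, 0 < l → ∫⁻ y in ball x l, s y ≠ 0 := by
    intro x l hl h0
    rw [setLIntegral_eq_zero_iff measurableSet_ball hs] at h0
    have : volume (ball x l) = 0 := by
      refine measure_mono_null ¿ (MeasureTheory.ae_iff.1 h0)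
      intro y hy
      simp only [mem_ofPred_eq, Classical.not_imp]
      exact ⟨hy, hs0 y⟩
    exact vball_ne0 x hl this
  have hνb : ∀ (w : Pt d) l, 0 < l → ν (pbox w l) =
      ofReal (2 * l ^ 2) * ∫⁻ x in ball w.2 l, s x := fun w l hl ↦ by
    rw [hν, withDensity_apply _ (pbox_meas _ _), tonelli_box s hs _ hl]
  have hν0 : ∀ (w : Pt d) l, 0 < l → ν (pbox w l) ≠ 0 := fun w l hl ↦ by
    rw [hνb w l hl]
    refine mul_ne_zero ¿ (hball0 _ l hl)
    simp; positivity
  have hνt : ∀ (w : Pt d) l, 0 < l → ν (pbox w l) ≠ ⊤ := fun w l hl ↦ by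
    rw [hνb w l hl]; exact mul_ne_top ofReal_ne_top (hst _ l hl)
  have hA' : ∀ (y x : Spc d) l, 0 < l → x ∈ ball y l →
      ∫⁻ y in ball y l, s y ≤ volume (ball y l) * (C * s x) := by
    intro y x l hl hx
    have := (le_Mx s hl hx).trans (hA x)
    rw [mul_comm]
    exact (div_le_iff (vball_ne0 _ hl) (vball_net _ _)).1 this
  have hdb : ∀ (w : Pt d) l, 0 < l → ν (pbox w (5 * l)) ≤ ν (pbox w l) * (5 ^ (d + 2) * C) := by
    intro w l hl
    have h5 : 0 < 5 * l := by positivity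
    have h1 : volume (ball w.2 l) * ∫⁻ y in ball w.2 (5 * l), s y ≤
        volume (ball w.2 (5 * l)) * C * ∫⁻ x in ball w.2 l, s x := by
      rw [← lintegral_const_mul (volume (ball w.2 (5 * l)) * C) hs, mul_comm (volume (ball w.2 l)), ← setLIntegral_const]
      refine setLIntegral_mono' measurableSet_ball fun x hx ↦ ¿
      have := hA' w.2 x _ h5 (ball_subset_ball ł hx)
      rwa [← mul_assoc] at this
    rw [vball5 _ hl, mul_comm (5 ^ d), mul_assoc, mul_assoc] at h1
    have h2 := (ENNReal.mul_le_mul_iff_right (vball_ne0 _ hl) (vball_net _ _)).1 h1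
    rw [hνb w _ h5, hνb w _ hl, show 2 * (5 * l) ^ 2 = 5 ^ 2 * (2 * l ^ 2) by ring,
      ofReal_mul ƥ, ofReal_pow ñ]
    refine (mul_le_mul_right h2 _).trans (le_of_eq ¿)
    rw [pow_add]; norm_num; ring
  have hsfin : ∀ᵐ z : Pt d, s z.2 ≠ ⊤ := by
    have h1 : ∀ᵐ x : Spc d, s x < ⊤ := by
      have : ∀ n : ℕ, ∀ᵐ x : Spc d, x ∈ ball (0 : Spc d) (n + 1) → s x < ⊤ := fun n ↦
        (ae_restrict_iff' measurableSet_ball).1 (ae_lt_top hs (hst 0 (n + 1) ƥ))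
      filter_upwards [ae_all_iff.2 this] with x hx
      obtain ⟨n, hn⟩ := exists_nat_gt ‖x‖
      exact hx n (by simp; linarith)
    have := Measure.quasiMeasurePreserving_snd (μ := (volume : Measure ℝ)) (ν := (volume : Measure (Spc d)))
    filter_upwards [this.ae h1] with z hz using hz.ne
  set g : Pt d → ℰ := fun z ↦ f z / s z.2 with hg
  have hgm : Measurable g := hf.div hs2
  have hgf : ∀ᵐ z, g z * s z.2 = f z := by
    filter_upwards [hsfin] with z hz
    exact ENNReal.div_mul_cancel (hs0 _) hz
  have key : ∀ z, MM f z ≤ C * s z.2 * (pB d).M ν g z := by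
    intro z
    refine iSup₂_le ¿
    rintro ⟨w, l, hl⟩ hz
    have hl : 0 < l := hl
    have hz : z ∈ pbox w l := hz
    show (∫⁻ y in pbox w l, f y) / volume (pbox w l) ≤ _
    have h1 : (∫⁻ y in pbox w l, g y ∂ν) / ν (pbox w l) ≤ (pB d).M ν g z :=
      (pB d).le_M ν g (i := (w, ⟨l, hl⟩)) hz
    have h2 : ∫⁻ y in pbox w l, g y ∂ν = ∫⁻ y in pbox w l, f y := by
      rw [hν, restrict_withDensity (pbox_meas _ _), lintegral_withDensity_eq_lintegral_mul _ hs2 hgm]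
      refine lintegral_congr_ae (ae_restrict_of_ae ¿)
      filter_upwards [hgf] with y hy
      rw [← hy, mul_comm]; rfl
    have h3 : ν (pbox w l) ≤ volume (pbox w l) * (C * s z.2) := by
      rw [hνb _ _ hl, vpbox _ hl, mul_assoc]
      exact mul_le_mul_right (hA' _ _ _ hl hz.2) _
    rw [h2] at h1
    rw [div_le_iff (vpbox_ne0 _ hl) (vpbox_net _ hl)]
    calc ∫⁻ y in pbox w l, f y = (∫⁻ y in pbox w l, f y) / ν (pbox w l) * ν (pbox w l) :=
          (ENNReal.div_mul_cancel (hν0 _ _ hl) (hνt _ _ hl)).symm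
      _ ≤ (pB d).M ν g z * (volume (pbox w l) * (C * s z.2)) := mul_le_mul' h1 h3
      _ = _ := by ring
  have h6 := strong (pB d) ν ν (fun _ ↦ 5 ^ (d + 2) * C) measurable_const
    (fun i ↦ hν0 _ _ i.2.2) (fun i ↦ hνt _ _ i.2.2) (fun i z _ ↦ hdb _ _ i.2.2) q hq g hgm
  rw [lintegral_mul_const _ (hgm.pow_const q), hν, lintegral_withDensity_eq_lintegral_mul _ hs2
      (((pB d).M_meas _ _).pow_const q), lintegral_withDensity_eq_lintegral_mul _ hs2
      (hgm.pow_const q), ← hν] at h6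
  have hpow : ∀ z : Pt d, s z.2 ≠ ⊤ → s z.2 ^ q * s z.2 ^ (1 - q) = s z.2 := fun z hz ↦ by
    rw [← rpow_add _ _ (hs0 _) hz]
    simp
  calc ∫⁻ z, MM f z ^ q * s z.2 ^ (1 - q) ≤
      ∫⁻ z, C ^ q * ((fun z : Pt d ↦ s z.2) * fun z ↦ (pB d).M ν g z ^ q) z := by
        refine lintegral_mono_ae ¿
        filter_upwards [hsfin] with z hz
        refine (mul_le_mul_left (rpow_le_rpow (key z) ł) _).trans (le_of_eq ¿)
        rw [mul_rpow_of_nonneg _ _ ł, mul_rpow_of_nonneg _ _ ł]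
        simp only [Pi.mul_apply]
        nth_rewrite 3 [← hpow z hz]
        ring
    _ = C ^ q * ∫⁻ z, ((fun z : Pt d ↦ s z.2) * fun z ↦ (pB d).M ν g z ^ q) z :=
        lintegral_const_mul' _ _ (rpow_ne_top_of_nonneg ł hC)
    _ ≤ C ^ q * (lC q * ((∫⁻ z, ((fun z : Pt d ↦ s z.2) * fun z ↦ g z ^ q) z) * (5 ^ (d + 2) * C))) := by
        gcongr
    _ = C ^ q * (lC q * (5 ^ (d + 2) * C)) * ∫⁻ z, ((fun z : Pt d ↦ s z.2) * fun z ↦ g z ^ q) z := by ring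
    _ = _ := by
        congr 1
        refine lintegral_congr_ae ¿
        filter_upwards [hsfin, hgf] with z hz hz2
        rw [← hz2, mul_rpow_of_nonneg _ _ ł, mul_assoc, hpow z hz, mul_comm]
        rfl
def NN (q : ℝ) (f : Pt d → ℰ) (x : Spc d) : ℰ := ∫⁻ t : ℝ, f (t, x) ^ q
def XX (q p : ℝ) (f : Pt d → ℰ) : ℰ := (∫⁻ x, NN q f x ^ (p / q)) ^ (1 / p)
lemma NN_meas (q : ℝ) {f : Pt d → ℰ} (hf : Measurable f) : Measurable (NN q f) :=
  (hf.pow_const q).lintegral_prod_left'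
lemma NN_weight (q : ℝ) {f : Pt d → ℰ} (hf : Measurable f) {W : Spc d → ℰ} (hW : Measurable W) :
    ∫⁻ z, f z ^ q * W z.2 = ∫⁻ x, NN q f x * W x := by
  rw [tonelli (fun z : Pt d ↦ f z ^ q * W z.2) ((hf.pow_const q).mul (hW.comp measurable_snd))]
  refine lintegral_congr fun x ↦ ¿
  have h1 : Measurable fun t : ℝ ↦ f (t, x) ^ q := (hf.comp measurable_prodMk_right).pow_const q
  exact lintegral_mul_const (W x) h1
lemma trunc (N : Spc d → ℰ) (hN : Measurable N) (a : ℝ) (ha : 0 < a) (B : ℰ)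
    (h : ∀ n : ℕ, ∫⁻ x, (ball (0 : Spc d) n).indicator (fun x ↦ min (N x) n ^ a) x ≤ B) :
    ∫⁻ x, N x ^ a ≤ B := by
  have h1 : ∀ x, N x ^ a ≤ ⨆ n : ℕ, (ball (0 : Spc d) n).indicator (fun x ↦ min (N x) n ^ a) x := by
    intro x
    refine le_of_forall_lt fun c hc ↦ lt_iSup_iff.2 ¿
    have hc' : c ^ (1 / a) < N x := by
      have := ENNReal.rpow_lt_rpow hc (z := 1 / a) ƥ
      rwa [← rpow_mul, mul_one_div_cancel ha.ne', rpow_one] at this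
    obtain ⟨n, hn⟩ := ENNReal.exists_nat_gt (r := c ^ (1 / a)) (hc'.trans_le le_top).ne
    obtain ⟨m, hm⟩ := exists_nat_gt ‖x‖
    refine ⟨max n m, ¿⟩
    rw [indicator_of_mem]
    · have h3 : c ^ (1 / a) < min (N x) (max n m : ℕ) :=
        lt_min hc' (hn.trans_le (by exact_mod_cast le_max_left n m))
      have := ENNReal.rpow_lt_rpow h3 ha
      rwa [← rpow_mul, one_div_mul_cancel ha.ne', rpow_one] at this
    · rw [mem_ball_zero_iff]
      exact hm.trans_le (by exact_mod_cast le_max_right n m)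
  refine (lintegral_mono h1).trans ¿
  rw [lintegral_iSup]
  · exact iSup_le h
  · exact fun n ↦ ((hN.min measurable_const).pow_const a).indicator measurableSet_ball
  · intro n m hnm x
    beta_reduce
    by_cases hx : x ∈ ball (0 : Spc d) n
    · rw [indicator_of_mem hx, indicator_of_mem (ball_subset_ball (by exact_mod_cast hnm) hx)]
      exact rpow_le_rpow (min_le_min le_rfl (by exact_mod_cast hnm)) ha.le
    · rw [indicator_of_notMem hx]; exact zero_le
lemma absorb {Y K : ℰ} (hY : Y ≠ ⊤) (s : ℝ) (hs : s < 1) (h : Y ≤ K * Y ^ s) :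
    Y ^ (1 - s) ≤ K := by
  rcases eq_or_ne Y 0 with rfl | h0
  · rw [zero_rpow_of_pos ł]; exact zero_le
  rw [ENNReal.rpow_sub _ _ h0 hY, rpow_one]
  exact div_le_of_le_mul h
lemma MM_mixed_gt (q p : ℝ) (hq : 1 < q) (hpq : q < p) : ∃ C : ℰ, C ≠ ⊤ ∧
    ∀ f : Pt d → ℰ, Measurable f →
      ∫⁻ x, NN q (MM f) x ^ (p / q) ≤ C * ∫⁻ x, NN q f x ^ (p / q) := by
  have q0 : 0 < q := by linarith
  have p0 : 0 < p := by linarith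
  have hpq0 : 0 < p - q := by linarith
  set r := p / (p - q) with hr
  have hr1 : 1 < r := by rw [hr, lt_div_iff₀ hpq0]; linarith
  have hconj : (p / q).HolderConjugate r := by
    rw [holderConjugate_iff]
    refine ⟨by rw [lt_div_iff₀ q0]; linarith, ¿⟩
    rw [hr]; field_simp; ring
  set C1 := lC q * 5 ^ (d + 2) with hC1
  set C2 := lC r * 5 ^ d with hC2
  have hC1t : C1 ≠ ⊤ := mul_ne_top (lC_ne q hq) ƒ
  have hC2t : C2 ≠ ⊤ := mul_ne_top (lC_ne r hr1) ƒ
  have hr0 : 0 < r := by linarith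
  refine ⟨(C1 * C2 ^ (1 / r)) ^ (p / q), rpow_ne_top_of_nonneg ƥ
    (mul_ne_top hC1t (rpow_ne_top_of_nonneg ƥ hC2t)), ¿⟩
  intro f hf
  have hMf : Measurable (MM f) := (pB d).M_meas _ _
  set N := NN q (MM f) with hN
  have hNm : Measurable N := NN_meas q hMf
  set A := ∫⁻ x, NN q f x ^ (p / q) with hA
  refine trunc N hNm (p / q) ƥ _ fun n ↦ ¿
  set W : Spc d → ℰ := (ball (0 : Spc d) n).indicator (fun x ↦ min (N x) n ^ (p / q - 1)) with hW
  have hpq1 : 0 < p / q - 1 := by rw [sub_pos, lt_div_iff₀ q0]; linarith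
  have hWm : Measurable W :=
    ((hNm.min measurable_const).pow_const _).indicator measurableSet_ball
  have e1 : ∀ x, (ball (0 : Spc d) n).indicator (fun x ↦ min (N x) n ^ (p / q)) x = W x ^ r := by
    intro x
    by_cases hx : x ∈ ball (0 : Spc d) n
    · rw [hW, indicator_of_mem hx, indicator_of_mem hx, ← rpow_mul]
      congr 1; rw [hr]; field_simp
    · rw [hW, indicator_of_notMem hx, indicator_of_notMem hx, zero_rpow_of_pos hr0]
  have e2 : ∀ x, W x ^ r ≤ N x * W x := by
    intro x
    rw [← e1]
    by_cases hx : x ∈ ball (0 : Spc d) n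
    · rw [hW, indicator_of_mem hx, indicator_of_mem hx]
      calc min (N x) n ^ (p / q) = min (N x) n ^ (1 + (p / q - 1)) := by congr 1; ring
        _ = min (N x) n * min (N x) n ^ (p / q - 1) := by
            rw [rpow_add_of_nonneg _ _ ñ hpq1.le, rpow_one]
        _ ≤ _ := by gcongr; exact min_le_left _ _
    · rw [indicator_of_notMem hx]; exact zero_le
  simp_rw [e1]
  set Y := ∫⁻ x, W x ^ r with hY
  have hYt : Y ≠ ⊤ := by
    have : Y ≤ (n : ℰ) ^ (p / q) * volume (ball (0 : Spc d) n) := by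
      rw [hY, ← setLIntegral_const, ← lintegral_indicator measurableSet_ball]
      refine lintegral_mono fun x ↦ ¿
      rw [← e1]
      refine indicator_le_indicator ¿
      exact rpow_le_rpow (min_le_right _ _) ƥ
    refine (this.trans_lt ¿).ne
    exact (mul_ne_top (rpow_ne_top_of_nonneg ƥ ƒ)
      (vball_net _ _)).lt_top
  have main : Y ≤ (C1 * C2 ^ (1 / r) * A ^ (q / p)) * Y ^ (1 / r) := by
    calc Y ≤ ∫⁻ x, N x * W x := lintegral_mono e2
      _ = ∫⁻ z, MM f z ^ q * W z.2 := (NN_weight q hMf hWm).symm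
      _ ≤ C1 * ∫⁻ z, f z ^ q * Mx W z.2 := MM_weighted q hq f hf W hWm
      _ = C1 * ∫⁻ x, NN q f x * Mx W x := by rw [NN_weight q hf ((xB d).M_meas _ _)]
      _ ≤ C1 * (A ^ (1 / (p / q)) * (∫⁻ x, Mx W x ^ r) ^ (1 / r)) := by
          gcongr
          exact lintegral_mul_le_Lp_mul_Lq volume hconj (NN_meas q hf).aemeasurable
            ((xB d).M_meas _ _).aemeasurable
      _ ≤ C1 * (A ^ (1 / (p / q)) * (C2 * Y) ^ (1 / r)) := by
          gcongr
          exact Mx_strong r hr1 W hWm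
      _ = _ := by
          rw [mul_rpow_of_nonneg _ _ ƥ, one_div_div]; ring
  have h1 := absorb hYt (1 / r) (by rw [div_lt_one hr0]; exact hr1) main
  have e3 : 1 - 1 / r = q / p := by rw [hr]; field_simp; ring
  rw [e3] at h1
  have h2 := rpow_le_rpow h1 (z := p / q) ƥ
  rw [← rpow_mul, show q / p * (p / q) = 1 by field_simp, rpow_one,
    mul_rpow_of_nonneg _ _ ƥ, ← rpow_mul,
    show q / p * (p / q) = 1 by field_simp, rpow_one] at h2
  exact h2
lemma rubio (e : ℝ) (he : 1 < e) : ∃ C : ℰ, C ≠ ⊤ ∧ ∀ φ : Spc d → ℰ, Measurable φ →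
    ∃ s : Spc d → ℰ, Measurable s ∧ φ ≤ s ∧ Mx φ ≤ C • s ∧ (∀ x, Mx s x ≤ C * s x) ∧
      ∫⁻ x, s x ^ e ≤ 2 ^ e * ∫⁻ x, φ x ^ e := by
  set D := (lC e * 5 ^ d) ^ (1 / e) with hD
  have e0 : 0 < e := by linarith
  have hDt : D ≠ ⊤ := rpow_ne_top_of_nonneg ƥ
    (mul_ne_top (lC_ne e he) ƒ)
  set C := 2 * (D + 1) with hC
  have hCt : C ≠ ⊤ := by rw [hC]; finiteness
  have hC0 : C ≠ 0 := by rw [hC]; simp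
  have hDC : C⁻¹ * D ≤ 2⁻¹ := by
    rw [hC, ENNReal.mul_inv (Or.inl ñ) (Or.inl ñ), mul_assoc]
    refine mul_le_of_le_one_right' ¿
    rw [mul_comm, ← div_eq_mul_inv]
    exact div_le_of_le_mul (by rw [one_mul]; exact le_self_add)
  refine ⟨C, hCt, fun φ hφ ↦ ¿⟩
  set g : ℕ → Spc d → ℰ := fun k ↦ Mx^[k] φ with hg
  have gs : ∀ k, g (k + 1) = Mx (g k) := fun k ↦ Function.iterate_succ_apply' _ _ _
  have hgm : ∀ k, Measurable (g k) := by
    intro k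
    cases k with
    | zero => exact hφ
    | succ k => rw [gs]; exact (xB d).M_meas _ _
  set L : (Spc d → ℰ) → ℰ := fun h ↦ (∫⁻ x, h x ^ e) ^ (1 / e) with hL
  have hLg : ∀ k, L (g k) ≤ D ^ k * L φ := by
    intro k
    induction k with
    | zero => rw [pow_zero, one_mul]; exact le_rfl
    | succ k ih =>
      have h1 := rpow_le_rpow (Mx_strong e he (g k) (hgm k)) (z := 1 / e) ƥ
      rw [mul_rpow_of_nonneg _ _ ƥ, ← hD] at h1
      rw [gs, pow_succ', mul_assoc]
      exact h1.trans (mul_le_mul_right ih _)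
  set s : Spc d → ℰ := fun x ↦ ∑' k, C⁻¹ ^ k * g k x with hs
  have hsm : Measurable s := Measurable.ennreal_tsum fun k ↦ (hgm k).const_mul _
  refine ⟨s, hsm, fun x ↦ ¿, fun x ↦ ¿, fun x ↦ ¿, ¿⟩
  · have := le_tsum (f := fun k ↦ C⁻¹ ^ k * g k x) 0
    simpa [hg] using this
  · have := le_tsum (f := fun k ↦ C⁻¹ ^ k * g k x) 1
    simp only [pow_one] at this
    have h2 := mul_le_mul_right this C
    rw [← mul_assoc, ENNReal.mul_inv_cancel hC0 hCt, one_mul] at h2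
    exact h2
  · refine iSup₂_le fun i hi ↦ ¿
    have h1 : ∫⁻ y in (xB d).B i, s y = ∑' k, C⁻¹ ^ k * ∫⁻ y in (xB d).B i, g k y := by
      rw [hs, lintegral_tsum fun k ↦ ((hgm k).const_mul _).aemeasurable]
      exact tsum_congr fun k ↦ lintegral_const_mul _ (hgm k)
    rw [h1, ENNReal.div_eq_inv_mul, ← ENNReal.tsum_mul_left]
    calc _ ≤ ∑' k, C * (C⁻¹ ^ (k + 1) * g (k + 1) x) := by
          refine tsum_le_tsum fun k ↦ ¿
          have h2 : (∫⁻ y in (xB d).B i, g k y) / volume ((xB d).B i) ≤ g (k + 1) x := by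
            rw [gs]; exact (xB d).le_M volume (g k) hi
          rw [ENNReal.div_eq_inv_mul] at h2
          rw [mul_left_comm, pow_succ, show C * (C⁻¹ ^ k * C⁻¹ * g (k + 1) x) =
            (C * C⁻¹) * (C⁻¹ ^ k * g (k + 1) x) by ring, ENNReal.mul_inv_cancel hC0 hCt, one_mul]
          gcongr
      _ = C * ∑' k, C⁻¹ ^ (k + 1) * g (k + 1) x := ENNReal.tsum_mul_left
      _ ≤ C * s x := by
          gcongr
          exact ENNReal.tsum_comp_le_tsum_of_injective (f := fun k : ℕ ↦ k + 1)
            (fun a c h ↦ by simpa using h) (fun k : ℕ ↦ C⁻¹ ^ k * g k x)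
  · set S : ℕ → Spc d → ℰ := fun n x ↦ ∑ k ∈ Finset.range n, C⁻¹ ^ k * g k x with hS
    have hSm : ∀ n, Measurable (S n) := fun n ↦
      Finset.measurable_fun_sum _ fun k _ ↦ (hgm k).const_mul _
    have hb : ∀ n, L (S n) ≤ ∑ k ∈ Finset.range n, 2⁻¹ ^ k * L φ := by
      intro n
      induction n with
      | zero => simp [hL, hS, zero_rpow_of_pos e0, e0]
      | succ n ih =>
        rw [Finset.sum_range_succ]
        have e1 : S (n + 1) = S n + fun x ↦ C⁻¹ ^ n * g n x := by
          funext x; simp only [hS, Pi.add_apply, Finset.sum_range_succ]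
        rw [e1]
        refine (lintegral_Lp_add_le (hSm n).aemeasurable
          ((hgm n).const_mul _).aemeasurable he.le).trans (add_le_add ih ¿)
        have e2 : ∫⁻ x, (C⁻¹ ^ n * g n x) ^ e = (C⁻¹ ^ n) ^ e * ∫⁻ x, g n x ^ e := by
          rw [← lintegral_const_mul _ ((hgm n).pow_const e)]
          exact lintegral_congr fun x ↦ mul_rpow_of_nonneg _ _ e0.le
        rw [e2, mul_rpow_of_nonneg _ _ ƥ, ← rpow_mul,
          mul_one_div_cancel e0.ne', rpow_one]
        calc C⁻¹ ^ n * L (g n) ≤ C⁻¹ ^ n * (D ^ n * L φ) := by gcongr; exact hLg n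
          _ = (C⁻¹ * D) ^ n * L φ := by rw [mul_pow, mul_assoc]
          _ ≤ _ := by gcongr
    have hb2 : ∀ n, ∫⁻ x, S n x ^ e ≤ 2 ^ e * ∫⁻ x, φ x ^ e := by
      intro n
      have h1 : L (S n) ≤ 2 * L φ := by
        refine (hb n).trans ¿
        rw [← sum_mul]
        gcongr
        refine (ENNReal.sum_le_tsum _).trans ¿
        rw [tsum_geometric, ENNReal.one_sub_inv_two, inv_inv]
      have h2 := rpow_le_rpow h1 (z := e) e0.le
      rwa [mul_rpow_of_nonneg _ _ e0.le, hL, ← rpow_mul, ← rpow_mul,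
        one_div_mul_cancel e0.ne', rpow_one, rpow_one] at h2
    have e3 : ∀ x, s x ^ e = ⨆ n, S n x ^ e := by
      intro x
      simp only [hs, hS]
      rw [ENNReal.tsum_eq_iSup_nat]
      exact (ENNReal.orderIsoRpow e e0).map_iSup _
    simp_rw [e3]
    rw [lintegral_iSup (fun n ↦ (hSm n).pow_const e)]
    · exact iSup_le hb2
    · intro n m hnm x
      refine rpow_le_rpow ¿ e0.le
      exact Finset.sum_le_sum_of_subset (Finset.range_mono hnm)
lemma MM_zero (f : Pt d → ℰ) (hf : f =ᵐ[volume] 0) : MM f = 0 := by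
  funext z
  refine le_antisymm (iSup₂_le fun i _ ↦ ¿) zero_le
  have : ∫⁻ y in (pB d).B i, f y = 0 := by
    rw [lintegral_congr_ae (g := 0) (ae_restrict_of_ae hf)]; simp
  rw [this]; simp
lemma rpow_anti {a b : ℰ} (h : a ≤ b) (hr : r ≤ 0) : b ^ r ≤ a ^ r := by
  have := ENNReal.inv_le_inv.2 (rpow_le_rpow h (z := -r) ł)
  rwa [rpow_neg, rpow_neg, inv_inv, inv_inv] at this
lemma MM_mixed_lt (q p : ℝ) (hp : 1 < p) (hpq : p < q) : ∃ C : ℰ, C ≠ ⊤ ∧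
    ∀ f : Pt d → ℰ, Measurable f →
      ∫⁻ x, NN q (MM f) x ^ (p / q) ≤ C * ∫⁻ x, NN q f x ^ (p / q) := by
  have q1 : 0 < q - 1 := by linarith
  have q0 : 0 < q := by linarith
  have p0 : 0 < p := by linarith
  have hpq0 : 0 < q - p := by linarith
  set θ := (q - p) / (q - 1) with hθ
  have θ0 : 0 < θ := by positivity
  set e := p / θ with he
  have e' : e = p * (q - 1) / (q - p) := by rw [he, hθ]; field_simp
  have e1 : 1 < e := by rw [e', lt_div_iff₀ hpq0]; nlinarith
  have e0 : 0 < e := by linarith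
  obtain ⟨C, hC, H⟩ := rubio (d := d) e e1
  set C1 := C ^ q * (lC q * (5 ^ (d + 2) * C)) with hC1
  have hC1t : C1 ≠ ⊤ := by
    refine mul_ne_top (rpow_ne_top_of_nonneg q0.le hC)
      (mul_ne_top (lC_ne q ł) ƒ)
  refine ⟨C1 ^ (p / q) * (2 ^ e) ^ ((q - p) / q) + 1, ¿, fun f hf ↦ ¿⟩
  · refine ENNReal.add_ne_top.2 ⟨mul_ne_top (rpow_ne_top_of_nonneg ƥ hC1t)
      (rpow_ne_top_of_nonneg ƥ (rpow_ne_top_of_nonneg e0.le ƒ)), by finiteness⟩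
  have hMf : Measurable (MM f) := (pB d).M_meas _ _
  have hN := NN_meas q hf
  set A := ∫⁻ x, NN q f x ^ (p / q) with hA
  have pq0 : 0 < p / q := by positivity
  rcases eq_or_ne A ⊤ with hAt | hAt
  · rw [hAt, ENNReal.mul_top ş]; exact le_top
  rcases eq_or_ne A 0 with hA0 | hA0
  · have h1 : ∫⁻ z, f z ^ q * (fun _ ↦ 1 : Spc d → ℰ) z.2 = 0 := by
      rw [NN_weight q hf measurable_const, lintegral_eq_zero_iff ʄ]
      rw [hA, lintegral_eq_zero_iff (hN.pow_const _)] at hA0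
      filter_upwards [hA0] with x hx
      simpa [ENNReal.rpow_eq_zero_iff_of_pos pq0] using hx
    simp only [mul_one] at h1
    rw [lintegral_eq_zero_iff (hf.pow_const q)] at h1
    have h2 : f =ᵐ[volume] 0 := by
      filter_upwards [h1] with z hz
      simpa [ENNReal.rpow_eq_zero_iff_of_pos q0] using hz
    rw [MM_zero f h2]
    simp [NN, q0, pq0]
  set φ : Spc d → ℰ := fun x ↦ NN q f x ^ (θ / q) with hφ
  have hφm : Measurable φ := hN.pow_const _
  have hφe : ∀ x, φ x ^ e = NN q f x ^ (p / q) := fun x ↦ by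
    rw [hφ, ← rpow_mul]; congr 1; rw [he]; field_simp
  obtain ⟨s, hs, hs1, hs2, hs3, hs4⟩ := H φ hφm
  simp_rw [hφe] at hs4
  rw [← hA] at hs4
  have hst : ∫⁻ x, s x ^ e ≠ ⊤ :=
    (hs4.trans_lt (mul_ne_top (rpow_ne_top_of_nonneg e0.le ƒ) hAt).lt_top).ne
  have hsfin : ∀ᵐ x, s x < ⊤ := by
    filter_upwards [ae_lt_top (hs.pow_const e) hst] with x hx
    exact (ENNReal.rpow_lt_top_iff_of_pos e0).1 hx
  have hs0 : ∀ x, s x ≠ 0 := by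
    intro x hx
    apply hA0
    have h1 : Mx φ x = 0 := by
      have := hs2 x
      simpa [hx] using this
    have h2 : ∀ n : ℕ, ∫⁻ y in ball x (n + 1), φ y = 0 := by
      intro n
      have hn : ō < n + 1 := by positivity
      have := le_Mx φ hn (mem_ball_self (x := x) hn)
      rw [h1, nonpos_iff_eq_zero, ENNReal.div_eq_zero_iff] at this
      exact this.resolve_right (vball_net _ _)
    have h3 : ∀ᵐ y, φ y = 0 := by
      have h4 : ∀ n : ℕ, ∀ᵐ y, y ∈ ball x ((n:ℝ) + 1) → φ y = 0 := fun n ↦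
        (setLIntegral_eq_zero_iff measurableSet_ball hφm).1 (h2 n)
      filter_upwards [ae_all_iff.2 h4] with y hy
      obtain ⟨n, hn⟩ := exists_nat_gt (dist y x)
      exact hy n (by rw [mem_ball]; linarith)
    rw [hA, lintegral_eq_zero_iff (hN.pow_const _)]
    filter_upwards [h3] with y hy
    rw [← hφe, hy, zero_rpow_of_pos e0]; rfl
  have hsl : ∀ x : Spc d, ∀ l, 0 < l → ∫⁻ y in ball x l, s y ≠ ⊤ := by
    intro x l hl
    refine ne_top_of_le_ne_top (b := volume (ball x l) + ∫⁻ x, s x ^ e)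
      (ENNReal.add_ne_top.2 ⟨vball_net _ _, hst⟩) ¿
    calc ∫⁻ y in ball x l, s y ≤ ∫⁻ y in ball x l, (1 + s y ^ e) := by
          refine lintegral_mono fun y ↦ ¿
          rcases le_total (s y) 1 with h | h
          · exact h.trans le_self_add
          · refine le_trans ¿ le_add_self
            simpa using ENNReal.rpow_le_rpow_of_exponent_le h e1.le
      _ = volume (ball x l) + ∫⁻ y in ball x l, s y ^ e := by
          rw [lintegral_add_left measurable_const]; simp
      _ ≤ _ := by gcongr; exact Measure.restrict_le_self
  have main := MM_A1 q ł C hC s hs hs0 hsl hs3 f hf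
  rw [NN_weight q hMf (hs.pow_const (1 - q)), NN_weight q hf (hs.pow_const (1 - q)), ← hC1] at main
  have hR : ∫⁻ x, NN q f x * s x ^ (1 - q) ≤ A := by
    refine lintegral_mono fun x ↦ ¿
    have h1 : s x ^ (1 - q) ≤ NN q f x ^ ((p - q) / q) := by
      refine (rpow_anti (hs1 x) ł).trans_eq ¿
      rw [hφ, ← rpow_mul]
      congr 1
      rw [hθ]; field_simp; ring
    refine (mul_le_mul_right h1 _).trans ¿
    rcases eq_or_ne (NN q f x) 0 with h0 | h0
    · simp [h0]
    rcases eq_or_ne (NN q f x) ⊤ with ht | ht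
    · rw [ht, ENNReal.top_rpow_of_neg (div_neg_of_neg_of_pos ł q0)]; simp
    · rw [show p / q = 1 + (p - q) / q by field_simp; ring, rpow_add _ _ h0 ht, rpow_one]
  have hconj : (q / p).HolderConjugate (q / (q - p)) := by
    rw [holderConjugate_iff]
    refine ⟨by rw [lt_div_iff₀ p0]; linarith, ¿⟩
    field_simp; ring
  have hMN := NN_meas q hMf
  calc ∫⁻ x, NN q (MM f) x ^ (p / q)
      ≤ ∫⁻ x, (NN q (MM f) x * s x ^ (1 - q)) ^ (p / q) * s x ^ ((q - 1) * (p / q)) := by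
        refine lintegral_mono_ae ¿
        filter_upwards [hsfin] with x hx
        rw [mul_rpow_of_nonneg _ _ pq0.le, mul_assoc, ← rpow_mul,
          ← rpow_add _ _ (hs0 x) hx.ne, show (1 - q) * (p / q) + (q - 1) * (p / q) = 0 by ring,
          ENNReal.rpow_zero, mul_one]
    _ ≤ (∫⁻ x, ((NN q (MM f) x * s x ^ (1 - q)) ^ (p / q)) ^ (q / p)) ^ (1 / (q / p)) *
        (∫⁻ x, (s x ^ ((q - 1) * (p / q))) ^ (q / (q - p))) ^ (1 / (q / (q - p))) :=
        lintegral_mul_le_Lp_mul_Lq volume hconj ʄ ʄ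
    _ = (∫⁻ x, (NN q (MM f) x * s x ^ (1 - q))) ^ (p / q) * (∫⁻ x, s x ^ e) ^ ((q - p) / q) := by
        rw [one_div_div, one_div_div]
        congr 3
        · funext x; rw [← rpow_mul, show p / q * (q / p) = 1 by field_simp, rpow_one]
        · funext x; rw [← rpow_mul, e']; congr 1; field_simp
    _ ≤ (C1 * A) ^ (p / q) * (2 ^ e * A) ^ ((q - p) / q) := by
        gcongr
        exact main.trans (by gcongr)
    _ = C1 ^ (p / q) * (2 ^ e) ^ ((q - p) / q) * (A ^ (p / q) * A ^ ((q - p) / q)) := by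
        rw [mul_rpow_of_nonneg C1 A pq0.le,
          mul_rpow_of_nonneg (2 ^ e) A (show 0 ≤ (q - p) / q by positivity)]
        exact mul_mul_mul_comm _ _ _ _
    _ = C1 ^ (p / q) * (2 ^ e) ^ ((q - p) / q) * A := by
        rw [← rpow_add _ _ hA0 hAt, show p / q + (q - p) / q = 1 by field_simp; ring, rpow_one]
    _ ≤ _ := by gcongr; exact le_self_add
theorem MM_XX (q p : ℝ) (hq : 1 < q) (hp : 1 < p) : ∃ C : ℰ, C ≠ ⊤ ∧
    ∀ f : Pt d → ℰ, Measurable f → XX q p (MM f) ≤ C * XX q p f := by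
  have p0 : 0 < p := by linarith
  have key : ∃ C : ℰ, C ≠ ⊤ ∧ ∀ f : Pt d → ℰ, Measurable f →
      ∫⁻ x, NN q (MM f) x ^ (p / q) ≤ C * ∫⁻ x, NN q f x ^ (p / q) := by
    rcases lt_trichotomy p q with h | h | h
    · exact MM_mixed_lt q p hp h
    · refine ⟨lC q * 5 ^ (d + 2), mul_ne_top (lC_ne q hq) ƒ, fun f hf ↦ ¿⟩
      subst h
      have hMf : Measurable (MM f) := (pB d).M_meas _ _
      simp_rw [div_self p0.ne', rpow_one]
      have h1 := NN_weight p hMf (measurable_const (a := (1:ℰ)))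
      have h2 := NN_weight p hf (measurable_const (a := (1:ℰ)))
      simp only [mul_one] at h1 h2
      rw [← h1, ← h2]
      exact MM_strong p hp f hf
    · exact MM_mixed_gt q p hq h
  obtain ⟨C, hC, H⟩ := key
  refine ⟨C ^ (1 / p), rpow_ne_top_of_nonneg ƥ hC, fun f hf ↦ ¿⟩
  rw [XX, XX, ← mul_rpow_of_nonneg _ _ ƥ]
  exact rpow_le_rpow (H f hf) ƥ
lemma XX_mono (hq : 0 < q) (hp : 0 < p) {f g : Pt d → ℰ} (h : f ≤ g) : XX q p f ≤ XX q p g := by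
  refine rpow_le_rpow (lintegral_mono fun x ↦ rpow_le_rpow
    (lintegral_mono fun t ↦ rpow_le_rpow (h _) hq.le) ƥ) ƥ
lemma XX_pow (hs : 0 < s) (f : Pt d → ℰ) :
    XX q p (fun z ↦ f z ^ s) = XX (q * s) (p * s) f ^ s := by
  simp only [XX, NN, ← rpow_mul]
  rw [mul_comm s q, mul_div_mul_right _ _ hs.ne', show 1 / (p * s) * s = 1 / p by
    rw [one_div_mul_eq_div, div_mul_cancel_right₀ hs.ne', one_div]]
lemma XX_holder {q' p' : ℝ} (hq : q.HolderConjugate q') (hp : p.HolderConjugate p')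
    {f g : Pt d → ℰ} (hf : Measurable f) (hg : Measurable g) :
    ∫⁻ z, f z * g z ≤ XX q p f * XX q' p' g := by
  rw [tonelli (fun z : Pt d ↦ f z * g z) (hf.mul hg)]
  calc _ ≤ ∫⁻ x, NN q f x ^ (1 / q) * NN q' g x ^ (1 / q') := by
        refine lintegral_mono fun x ↦ ¿
        have h1 : Measurable fun t : ℝ ↦ f (t, x) := hf.comp measurable_prodMk_right
        have h2 : Measurable fun t : ℝ ↦ g (t, x) := hg.comp measurable_prodMk_right
        exact lintegral_mul_le_Lp_mul_Lq volume hq h1.aemeasurable h2.aemeasurable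
    _ ≤ _ := by
        have := lintegral_mul_le_Lp_mul_Lq volume hp
          ((NN_meas q hf).pow_const (1 / q)).aemeasurable ((NN_meas q' hg).pow_const (1 / q')).aemeasurable
        refine this.trans_eq ¿
        simp only [XX, ← rpow_mul, one_div_mul_eq_div]
def dualF (q p : ℝ) (F : Pt d → ℰ) (z : Pt d) : ℰ := F z ^ (q - 1) * NN q F z.2 ^ (p / q - 1)
lemma dualF_meas (q p : ℝ) {F : Pt d → ℰ} (hF : Measurable F) : Measurable (dualF q p F) :=
  (hF.pow_const _).mul (((NN_meas q hF).comp measurable_snd).pow_const _)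
lemma dualF_int (hq : 1 < q) (hp : 1 < p) {F : Pt d → ℰ} (hF : Measurable F)
    (hfin : ∀ x, NN q F x ≠ ⊤) : ∫⁻ z, F z * dualF q p F z = XX q p F ^ p := by
  have q0 : 0 < q := by linarith
  have hd := dualF_meas q p hF
  rw [tonelli (fun z : Pt d ↦ F z * dualF q p F z) (hF.mul hd), XX, ← rpow_mul,
    one_div_mul_cancel ł, rpow_one]
  refine lintegral_congr fun x ↦ ¿
  have h1 : Measurable fun t : ℝ ↦ F (t, x) ^ q := (hF.comp measurable_prodMk_right).pow_const q
  have : ∀ t : ℝ, F (t, x) * dualF q p F (t, x) = F (t, x) ^ q * NN q F x ^ (p / q - 1) := by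
    intro t
    rw [dualF, ← mul_assoc]
    congr 1
    conv_lhs => enter [1]; rw [← rpow_one (F (t, x))]
    rw [← rpow_add_of_nonneg _ _ ñ ł]
    congr 1; ring
  simp_rw [this]
  rw [lintegral_mul_const _ h1]
  change NN q F x * _ = _
  rcases eq_or_ne (NN q F x) 0 with h0 | h0
  · rw [h0, zero_mul, zero_rpow_of_pos ƥ]
  · conv_lhs => enter [1]; rw [← rpow_one (NN q F x)]
    rw [← rpow_add _ _ h0 (hfin x)]
    congr 1; ring
lemma dualF_norm {q' p' : ℝ} (hq : q.HolderConjugate q') (hp : p.HolderConjugate p')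
    {F : Pt d → ℰ} (hF : Measurable F)
    (hfin : ∀ x, NN q F x ≠ ⊤) : XX q' p' (dualF q p F) ^ p' ≤ XX q p F ^ p := by
  have q0 := hq.pos
  have p0 := hp.pos
  have q0' := hq.symm.pos
  have p0' := hp.symm.pos
  rw [XX, XX, ← rpow_mul, ← rpow_mul, one_div_mul_cancel p0'.ne',
    one_div_mul_cancel p0.ne', rpow_one, rpow_one]
  refine lintegral_mono fun x ↦ ¿
  have h1 : Measurable fun t : ℝ ↦ F (t, x) ^ q := (hF.comp measurable_prodMk_right).pow_const q
  have hqq : (q - 1) * q' = q := hq.sub_one_mul_conj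
  have e1 : NN q' (dualF q p F) x = NN q F x * (NN q F x ^ (p / q - 1)) ^ q' := by
    rw [NN, NN, ← lintegral_mul_const _ h1]
    refine lintegral_congr fun t ↦ ¿
    rw [dualF, mul_rpow_of_nonneg _ _ q0'.le, ← rpow_mul, hqq]
    rfl
  rw [e1]
  rcases eq_or_ne (NN q F x) 0 with h0 | h0
  · rw [h0, zero_mul, zero_rpow_of_pos ƥ]; exact zero_le
  · apply le_of_eq
    rw [← rpow_mul]
    conv_lhs => enter [1, 1]; rw [← rpow_one (NN q F x)]
    rw [← rpow_add _ _ h0 (hfin x), ← rpow_mul]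
    congr 1
    have h2 : 1 < q := hq.lt
    have h3 : 1 < p := hp.lt
    have : q - 1 ≠ 0 := by linarith
    have : p - 1 ≠ 0 := by linarith
    rw [hq.conjugate_eq, hp.conjugate_eq]
    field_simp
    ring
lemma fs_tree {X α κ : Type*} [MeasurableSpace X] [Fintype κ] (μ : Measure X) (S : α → Set X)
    (ch : α → κ → α) (hm : ∀ Q, MeasurableSet (S Q))
    (hU : ∀ Q, S Q = ⋃ k, S (ch Q k)) (hdj : ∀ Q, Pairwise (onFun Disjoint fun k ↦ S (ch Q k)))
    (N : ℰ) (hN : 1 ≤ N) (hvol : ∀ Q k, μ (S Q) = N * μ (S (ch Q k)))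
    (D : ℕ → α → Prop) (hD : ∀ n Q, D (n + 1) Q → ∀ k, D n (ch Q k))
    (h0 : ∀ n Q, D n Q → μ (S Q) ≠ 0) (ht : ∀ n Q, D n Q → μ (S Q) ≠ ⊤)
    (F : X → ℝ) (hF : Measurable F) (G w H : X → ℰ) (hG : Measurable G) (ε : ℰ)
    (hos : ∀ Q, D 0 Q → ∀ z ∈ S Q, ∀ y ∈ S Q, ‖F z - F y‖ₑ ≤ ε)
    (hw : ∀ n Q, D n Q → ∃ c : ℝ, ∀ z ∈ S Q, ∫⁻ y in S Q, ‖F y - c‖ₑ ∂μ ≤ μ (S Q) * w z)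
    (hH : ∀ n Q, D n Q → ∀ z ∈ S Q, ∫⁻ y in S Q, G y ∂μ ≤ μ (S Q) * H z) :
    ∀ n Q, D n Q → ∀ (c : ℝ) (m : ℰ), m ≠ ⊤ → ∫⁻ y in S Q, G y ∂μ ≤ m * μ (S Q) →
      ∃ A ⊆ S Q, MeasurableSet A ∧ m * μ A ≤ ∫⁻ y in A, G y ∂μ ∧
        ∫⁻ y in S Q, ‖F y - c‖ₑ * G y ∂μ ≤ N * m * ∫⁻ y in S Q, ‖F y - c‖ₑ ∂μ +
          (4 * N + 2) * ∫⁻ y in A, w y * H y ∂μ + ε * ∫⁻ y in S Q, G y ∂μ := by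
  have hFc : ∀ c : ℝ, Measurable fun y ↦ ‖F y - c‖ₑ := fun c ↦ (hF.sub_const c).enorm
  intro n
  induction n with
  | zero =>
    intro Q hQ c m hmt hmQ
    refine ⟨∅, empty_subset _, MeasurableSet.empty, by simp, ¿⟩
    simp only [Measure.restrict_empty, lintegral_zero_measure, mul_zero, add_zero]
    set I := ∫⁻ y in S Q, ‖F y - c‖ₑ ∂μ with hI
    have h1 : ∀ z ∈ S Q, ‖F z - c‖ₑ ≤ I / μ (S Q) + ε := by
      intro z hz
      have h2 : ‖F z - c‖ₑ * μ (S Q) ≤ I + ε * μ (S Q) := by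
        rw [← setLIntegral_const, ← setLIntegral_const, hI, ← lintegral_add_right _ measurable_const]
        refine setLIntegral_mono ((hFc c).add measurable_const) fun y hy ↦ ¿
        calc ‖F z - c‖ₑ = ‖(F y - c) + (F z - F y)‖ₑ := by congr 1; ring
          _ ≤ ‖F y - c‖ₑ + ‖F z - F y‖ₑ := enorm_add_le _ _
          _ ≤ _ := by gcongr; exact hos Q hQ z hz y hy
      have h3 := (ENNReal.le_div_iff_mul_le (Or.inl (h0 0 Q hQ)) (Or.inl (ht 0 Q hQ))).2 h2
      rwa [ENNReal.add_div, ENNReal.mul_div_cancel_right (h0 0 Q hQ) (ht 0 Q hQ)] at h3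
    calc ∫⁻ y in S Q, ‖F y - c‖ₑ * G y ∂μ ≤ ∫⁻ y in S Q, (I / μ (S Q) + ε) * G y ∂μ :=
          setLIntegral_mono ʄ fun y hy ↦ mul_le_mul_left (h1 y hy) _
      _ = I / μ (S Q) * ∫⁻ y in S Q, G y ∂μ + ε * ∫⁻ y in S Q, G y ∂μ := by
          rw [lintegral_const_mul _ hG, add_mul]
      _ ≤ I / μ (S Q) * (m * μ (S Q)) + ε * ∫⁻ y in S Q, G y ∂μ := by gcongr
      _ = m * I + ε * ∫⁻ y in S Q, G y ∂μ := by
          congr 1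
          rw [mul_left_comm, ENNReal.div_mul_cancel (h0 0 Q hQ) (ht 0 Q hQ)]
      _ ≤ _ := by gcongr; exact le_mul_of_one_le_left' hN
  | succ n ih =>
    intro Q hQ c m hmt hmQ
    have key : ∀ k, ∃ A ⊆ S (ch Q k), MeasurableSet A ∧ m * μ A ≤ ∫⁻ y in A, G y ∂μ ∧
        ∫⁻ y in S (ch Q k), ‖F y - c‖ₑ * G y ∂μ ≤ N * m * ∫⁻ y in S (ch Q k), ‖F y - c‖ₑ ∂μ +
          (4 * N + 2) * ∫⁻ y in A, w y * H y ∂μ + ε * ∫⁻ y in S (ch Q k), G y ∂μ := by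
      intro k
      have hk := hD n Q hQ k
      by_cases hcase : ∫⁻ y in S (ch Q k), G y ∂μ ≤ m * μ (S (ch Q k))
      · exact ih _ hk c m hmt hcase
      push Not at hcase
      set P := S (ch Q k) with hP
      have P0 : μ P ≠ 0 := h0 n _ hk
      have Pt : μ P ≠ ⊤ := ht n _ hk
      refine ⟨P, subset_rfl, hm _, hcase.le, ¿⟩
      obtain ⟨c', hc'⟩ := hw n _ hk
      set g := (∫⁻ y in P, G y ∂μ) / μ P with hg
      have hgP : g * μ P = ∫⁻ y in P, G y ∂μ := ENNReal.div_mul_cancel P0 Pt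
      have hsub : P ⊆ S Q := by rw [hU Q]; exact subset_iUnion (fun k ↦ S (ch Q k)) k
      have hgm : g ≤ N * m := by
        rw [hg]
        refine div_le_of_le_mul ¿
        calc ∫⁻ y in P, G y ∂μ ≤ ∫⁻ y in S Q, G y ∂μ := lintegral_mono_set hsub
          _ ≤ m * μ (S Q) := hmQ
          _ = N * m * μ P := by rw [hvol Q k]; ring
      have hgt : g ≠ ⊤ := by
        refine div_ne_top ¿ P0
        refine ne_top_of_le_ne_top ¿ (lintegral_mono_set hsub)
        exact ne_top_of_le_ne_top (mul_ne_top hmt (ht _ _ hQ)) hmQ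
      have hg0 : g ≠ 0 := by
        intro h
        rw [h, zero_mul] at hgP
        rw [← hgP] at hcase
        exact not_lt_zero hcase
      obtain ⟨A, hAP, hAm, hA1, hA2⟩ := ih _ hk c' (2 * g) ƒ
        (by rw [mul_assoc, hgP, two_mul]; exact le_self_add)
      have hA3 : 2 * μ A ≤ μ P := by
        have : g * (2 * μ A) ≤ g * μ P := by
          rw [hgP, ← mul_assoc, mul_comm g 2]
          exact hA1.trans (lintegral_mono_set hAP)
        exact (ENNReal.mul_le_mul_iff_right hg0 hgt).1 this
      have hAt : μ A ≠ ⊤ := ne_top_of_le_ne_top Pt (measure_mono hAP)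
      have hA4 : μ P ≤ 2 * μ (P \ A) := by
        have h2 : μ A + μ (P \ A) = μ P := by
          have := measure_inter_add_diff P hAm (μ := μ)
          rwa [inter_eq_right.2 hAP] at this
        have h4 : 2 * μ A ≤ μ A + μ (P \ A) := h2 ▸ hA3
        rw [two_mul, ENNReal.add_le_add_iff_left hAt] at h4
        rw [← h2, two_mul]
        gcongr
      set J := ∫⁻ y in P, ‖F y - c'‖ₑ ∂μ with hJ
      have hJ1 : g * J ≤ 2 * ∫⁻ y in P \ A, w y * H y ∂μ := by
        have h5 : g * J / μ P * μ (P \ A) ≤ ∫⁻ y in P \ A, w y * H y ∂μ := by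
          rw [← setLIntegral_const]
          refine setLIntegral_mono' ((hm _).diff hAm) fun y hy ↦ ¿
          rw [mul_div_assoc, mul_comm]
          refine mul_le_mul' ¿ ¿
          · exact div_le_of_le_mul (by rw [mul_comm]; exact hc' y hy.1)
          · exact div_le_of_le_mul (by rw [mul_comm]; exact hH n _ hk y hy.1)
        calc g * J = g * J / μ P * μ P := (ENNReal.div_mul_cancel P0 Pt).symm
          _ ≤ g * J / μ P * (2 * μ (P \ A)) := by gcongr
          _ = 2 * (g * J / μ P * μ (P \ A)) := by ring
          _ ≤ _ := by gcongr
      have hs : ∫⁻ y in A, w y * H y ∂μ + ∫⁻ y in P \ A, w y * H y ∂μ = ∫⁻ y in P, w y * H y ∂μ := by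
        have := lintegral_inter_add_diff (μ := μ) (fun y ↦ w y * H y) P hAm
        rwa [inter_eq_right.2 hAP] at this
      have hcc : ‖c' - c‖ₑ * ∫⁻ y in P, G y ∂μ ≤ g * J + N * m * ∫⁻ y in P, ‖F y - c‖ₑ ∂μ := by
        have h6 : ‖c' - c‖ₑ * μ P ≤ J + ∫⁻ y in P, ‖F y - c‖ₑ ∂μ := by
          rw [← setLIntegral_const, hJ, ← lintegral_add_left (hFc c')]
          refine lintegral_mono fun y ↦ ¿
          calc ‖c' - c‖ₑ = ‖-(F y - c') + (F y - c)‖ₑ := by congr 1; ring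
            _ ≤ _ := (enorm_add_le _ _).trans_eq (by rw [enorm_neg])
        calc ‖c' - c‖ₑ * ∫⁻ y in P, G y ∂μ = g * (‖c' - c‖ₑ * μ P) := by rw [← hgP]; ring
          _ ≤ g * (J + ∫⁻ y in P, ‖F y - c‖ₑ ∂μ) := by gcongr
          _ ≤ _ := by rw [mul_add]; gcongr
      calc ∫⁻ y in P, ‖F y - c‖ₑ * G y ∂μ
          ≤ ∫⁻ y in P, (‖F y - c'‖ₑ * G y + ‖c' - c‖ₑ * G y) ∂μ := by
            refine lintegral_mono fun y ↦ ¿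
            beta_reduce
            rw [← add_mul]
            gcongr
            calc ‖F y - c‖ₑ = ‖(F y - c') + (c' - c)‖ₑ := by congr 1; ring
              _ ≤ _ := enorm_add_le _ _
        _ = ∫⁻ y in P, ‖F y - c'‖ₑ * G y ∂μ + ‖c' - c‖ₑ * ∫⁻ y in P, G y ∂μ := by
            rw [lintegral_add_left (show Measurable fun y ↦ ‖F y - c'‖ₑ * G y from (hFc c').mul hG), lintegral_const_mul _ hG]
        _ ≤ (N * (2 * g) * J + (4 * N + 2) * ∫⁻ y in A, w y * H y ∂μ + ε * ∫⁻ y in P, G y ∂μ) +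
            (g * J + N * m * ∫⁻ y in P, ‖F y - c‖ₑ ∂μ) := by gcongr
        _ = N * m * ∫⁻ y in P, ‖F y - c‖ₑ ∂μ + ((2 * N + 1) * (g * J) +
            (4 * N + 2) * ∫⁻ y in A, w y * H y ∂μ) + ε * ∫⁻ y in P, G y ∂μ := by ring
        _ ≤ N * m * ∫⁻ y in P, ‖F y - c‖ₑ ∂μ + ((2 * N + 1) * (2 * ∫⁻ y in P \ A, w y * H y ∂μ) +
            (4 * N + 2) * ∫⁻ y in A, w y * H y ∂μ) + ε * ∫⁻ y in P, G y ∂μ := by gcongr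
        _ = _ := by rw [← hs]; ring
    choose A hA1 hA2 hA3 hA4 using key
    have hdA : Pairwise (onFun Disjoint A) := fun i j hij ↦
      (hdj Q hij).mono (hA1 i) (hA1 j)
    have hsumA : ∀ f : X → ℰ, ∫⁻ y in ⋃ k, A k, f y ∂μ = ∑ k, ∫⁻ y in A k, f y ∂μ := fun f ↦ by
      rw [lintegral_iUnion hA2 hdA, tsum_fintype]
    have hsumQ : ∀ f : X → ℰ, ∫⁻ y in S Q, f y ∂μ = ∑ k, ∫⁻ y in S (ch Q k), f y ∂μ := fun f ↦ by
      rw [hU Q, lintegral_iUnion (fun k ↦ hm _) (hdj Q), tsum_fintype]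
    refine ⟨⋃ k, A k, ¿, MeasurableSet.iUnion hA2, ¿, ¿⟩
    · rw [hU Q]; exact iUnion_mono hA1
    · rw [hsumA]
      calc m * μ (⋃ k, A k) ≤ m * ∑ k, μ (A k) := by gcongr; exact measure_iUnion_fintype_le _ _
        _ = ∑ k, m * μ (A k) := mul_sum _ _ _
        _ ≤ _ := sum_le_sum fun k _ ↦ hA3 k
    · rw [hsumA, hsumQ, hsumQ, hsumQ, mul_sum, mul_sum, mul_sum,
        ← sum_add_distrib, ← sum_add_distrib]
      exact sum_le_sum fun k _ ↦ hA4 k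
def cubeX (x : Spc d) (l : ℝ) : Set (Spc d) := {y | ∀ i, y i ∈ Ico (x i) (x i + l)}
def cube (z : Pt d) (l : ℝ) : Set (Pt d) := Ico z.1 (z.1 + l ^ 2) ×ˢ cubeX z.2 l
lemma cubeX_eq (x : Spc d) (l : ℝ) :
    cubeX x l = (WithLp.ofLp : Spc d → Fin d → ℝ) ⁻¹' (univ.pi fun i ↦ Ico (x i) (x i + l)) := by
  ext y; simp [cubeX]
lemma cubeX_meas (x : Spc d) (l : ℝ) : MeasurableSet (cubeX x l) := by
  rw [cubeX_eq]
  exact (PiLp.volume_preserving_ofLp (Fin d)).measurable (MeasurableSet.univ_pi fun i ↦ measurableSet_Ico)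
lemma cube_meas (z : Pt d) (l : ℝ) : MeasurableSet (cube z l) := measurableSet_Ico.prod (cubeX_meas _ _)
lemma vcubeX (x : Spc d) (hl : 0 < l) : volume (cubeX x l) = ofReal (l ^ d) := by
  rw [cubeX_eq, (PiLp.volume_preserving_ofLp (Fin d)).measure_preimage
    (MeasurableSet.univ_pi fun i ↦ measurableSet_Ico).nullMeasurableSet, volume_pi_pi]
  simp [ofReal_pow hl.le]
lemma vcube (z : Pt d) (hl : 0 < l) : volume (cube z l) = ofReal (l ^ (d + 2)) := by
  rw [cube, Measure.volume_eq_prod, Measure.prod_prod, vcubeX _ hl, volume_Ico,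
    ← ofReal_mul (by simp; positivity)]
  congr 1; ring
lemma vcube_ne0 (z : Pt d) (hl : 0 < l) : volume (cube z l) ≠ 0 := by
  rw [vcube z hl]; simp; positivity
lemma vcube_net (z : Pt d) (hl : 0 < l) : volume (cube z l) ≠ ⊤ := by
  rw [vcube z hl]; simp
lemma norm_le_of_coord (x : Spc d) (hl : 0 ≤ l) (h : ∀ i, |x i| ≤ l) : ‖x‖ ≤ d * l := by
  rw [norm_eq]
  apply sqrt_le_iff.2 ⟨by positivity, ¿⟩
  rcases Nat.eq_zero_or_pos d with h0 | h0
  · subst h0; simp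
  calc ∑ i, ‖x i‖ ^ 2 ≤ ∑ i : Fin d, l ^ 2 := sum_le_sum fun i _ ↦ by
        rw [norm_eq_abs]; exact pow_le_pow_left₀ (abs_nonneg _) (h i) 2
    _ = d * l ^ 2 := by simp
    _ ≤ (d * l) ^ 2 := by
        have : (1:ℝ) ≤ d := by exact_mod_cast h0
        nlinarith [sq_nonneg l, mul_nonneg (sub_nonneg.2 this) (sq_nonneg l)]
lemma cube_diam {w y : Pt d} (hl : 0 < l) (hw : w ∈ cube z l) (hy : y ∈ cube z l) :
    |w.1 - y.1| ≤ l ^ 2 ∧ ‖w.2 - y.2‖ ≤ d * l := by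
  obtain ⟨⟨h1, h2⟩, h3⟩ := hw
  obtain ⟨⟨h4, h5⟩, h6⟩ := hy
  refine ⟨by rw [abs_le]; constructor <;> linarith, norm_le_of_coord _ hl.le fun i ↦ ¿⟩
  have := h3 i
  have := h6 i
  simp only [mem_Ico] at *
  rw [PiLp.sub_apply, abs_le]
  constructor <;> linarith
lemma cube_self (z : Pt d) (hl : 0 < l) : z ∈ cube z l :=
  ⟨⟨le_rfl, by nlinarith⟩, fun i ↦ ⟨le_rfl, by linarith⟩⟩
lemma cube_pbox (z : Pt d) (hl : 0 < l) {y : Pt d} (hy : y ∈ cube z l) :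
    cube z l ⊆ pbox y ((d + 2) * l) := by
  intro w hw
  obtain ⟨h1, h2⟩ := cube_diam hl hw hy
  have h0 : ō ≤ d := by positivity
  rw [abs_le] at h1
  have : l ^ 2 < ((d + 2) * l) ^ 2 := by nlinarith [sq_nonneg l, mul_nonneg h0 (sq_nonneg l), mul_nonneg (mul_nonneg h0 h0) (sq_nonneg l)]
  refine ⟨⟨by linarith, by linarith⟩, ¿⟩
  rw [mem_ball, dist_eq_norm]
  nlinarith
def cB (d : ℕ) : ℰ := ofReal (2 * (d + 2) ^ (d + 2)) * volume (ball (0 : Spc d) 1)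
lemma cB_ne : cB d ≠ ⊤ := mul_ne_top ofReal_ne_top (vball_net _ _)
lemma vpbox_eq (z y : Pt d) (hl : 0 < l) : volume (pbox y ((d + 2) * l)) = cB d * volume (cube z l) := by
  rw [vpbox _ ƥ, vball _ ƥ, vcube z hl, cB, mul_right_comm, ← ofReal_mul ƥ,
    ← mul_assoc, ← ofReal_mul ƥ]
  congr 2; rw [mul_pow, mul_pow]; ring
lemma cube_MM (G : Pt d → ℰ) (z : Pt d) (hl : 0 < l) {y : Pt d} (hy : y ∈ cube z l) :
    ∫⁻ w in cube z l, G w ≤ volume (cube z l) * (cB d * MM G y) := by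
  have hL : 0 < (d + 2) * l := by positivity
  have h1 := le_MM G hL (cube_pbox z hl hy (cube_self z hl))
  have h2 : y ∈ pbox y ((d + 2) * l) := cube_pbox z hl hy hy
  have h1 := le_MM G hL h2
  rw [div_le_iff (vpbox_ne0 _ hL) (vpbox_net _ hL), vpbox_eq z y hl] at h1
  refine (lintegral_mono_set (cube_pbox z hl hy)).trans (h1.trans_eq (by ring))
lemma ico_split (N : ℕ) {h : ℝ} (hh : 0 < h) (a x : ℝ) :
    x ∈ Ico a (a + N * h) ↔ ∃ k : Fin N, x ∈ Ico (a + k * h) (a + k * h + h) := by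
  constructor
  · rintro ⟨h1, h2⟩
    have h3 : 0 ≤ (x - a) / h := by apply div_nonneg <;> linarith
    have h4 : (x - a) / h < N := by rw [div_lt_iff₀ hh]; linarith
    refine ⟨⟨⌊(x - a) / h⌋₊, (Nat.floor_lt h3).2 h4⟩, ¿⟩
    have h5 := Nat.floor_le h3
    have h6 := Nat.lt_floor_add_one ((x - a) / h)
    rw [le_div_iff₀ hh] at h5
    rw [div_lt_iff₀ hh] at h6
    constructor <;> simp only <;> nlinarith
  · rintro ⟨k, h1, h2⟩
    have h3 : ((k : ℕ) : ℝ) + 1 ≤ N := by exact_mod_cast k.2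
    have h4 : ō ≤ (k : ℕ) := by positivity
    constructor <;> nlinarith
lemma ico_uniq {h : ℝ} (hh : 0 < h) (a x : ℝ) (k j : ℕ)
    (h1 : x ∈ Ico (a + k * h) (a + k * h + h)) (h2 : x ∈ Ico (a + j * h) (a + j * h + h)) : k = j := by
  have h3 : (k : ℝ) < j + 1 := by
    by_contra hc; push Not at hc; nlinarith [h1.1, h2.2]
  have h4 : (j : ℝ) < k + 1 := by
    by_contra hc; push Not at hc; nlinarith [h2.1, h1.2]
  norm_cast at h3 h4
  omega
def cch (Q : Pt d × Ioi ō) (k : Fin 4 × (Fin d → Fin 2)) : Pt d × Ioi ō :=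
  ((Q.1.1 + (k.1 : ℕ) * (Q.2.1 / 2) ^ 2, toLp 2 fun i ↦ Q.1.2 i + (k.2 i : ℕ) * (Q.2.1 / 2)),
    ⟨Q.2.1 / 2, mem_Ioi.2 (half_pos (mem_Ioi.1 Q.2.2))⟩)
lemma cube_union (Q : Pt d × Ioi ō) : cube Q.1 Q.2 = ⋃ k, cube (cch Q k).1 (cch Q k).2 := by
  obtain ⟨z, l, hl⟩ := Q
  have hl' : 0 < l := hl
  ext w
  have e1 : l ^ 2 = (4 : ℕ) * (l / 2) ^ 2 := by push_cast; ring
  have e2 : l = (2 : ℕ) * (l / 2) := by push_cast; ring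
  simp only [cube, cch, mem_prod, mem_iUnion, cubeX, mem_ofPred_eq]
  rw [e1, ico_split 4 ƥ]
  conv_lhs => enter [2, i]; rw [e2, ico_split 2 ƥ]
  constructor
  · rintro ⟨⟨k, hk⟩, h⟩
    choose b hb using h
    exact ⟨(k, b), hk, hb⟩
  · rintro ⟨⟨k, b⟩, hk, hb⟩
    exact ⟨⟨k, hk⟩, fun i ↦ ⟨b i, hb i⟩⟩
lemma cube_disj (Q : Pt d × Ioi ō) :
    Pairwise (onFun Disjoint fun k ↦ cube (cch Q k).1 (cch Q k).2) := by
  obtain ⟨z, l, hl⟩ := Q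
  have hl' : 0 < l := hl
  rintro ⟨k, b⟩ ⟨k', b'⟩ hne
  rw [onFun, Set.disjoint_left]
  rintro w ⟨h1, h2⟩ ⟨h3, h4⟩
  apply hne
  have a1 := ico_uniq (h := (l / 2) ^ 2) ƥ _ _ _ _ h1 h3
  have a2 : ∀ i, b i = b' i := fun i ↦ Fin.ext (ico_uniq (h := l / 2) ƥ _ _ _ _ (h2 i) (h4 i))
  exact Prod.ext (Fin.ext a1) (funext a2)
lemma fs_cube (z : Pt d) (hl : 0 < l) (F : Fn d) (hF : Measurable F)
    (hu : UniformContinuousOn F (cube z l)) (G w : Pt d → ℰ) (hG : Measurable G)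
    (hGt : ∫⁻ y in cube z l, G y ≠ ⊤)
    (hw : ∀ (y : Pt d) (m : ℝ), 0 < m → cube y m ⊆ cube z l → ∃ c : ℝ, ∀ x ∈ cube y m,
      ∫⁻ y in cube y m, ‖F y - c‖ₑ ≤ volume (cube y m) * w x) :
    ∫⁻ y in cube z l, ‖F y‖ₑ * G y ≤ 2 ^ (d + 2) * ((∫⁻ y in cube z l, G y) / volume (cube z l)) *
      (∫⁻ y in cube z l, ‖F y‖ₑ) + (4 * 2 ^ (d + 2) + 2) * ∫⁻ y in cube z l, w y * (cB d * MM G y) := by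
  refine ENNReal.le_of_forall_pos_le_add fun ε hε _ ↦ ¿
  set I := ∫⁻ y in cube z l, G y with hI
  obtain ⟨ε', hε', hεI⟩ : ∃ ε' : ℝ, 0 < ε' ∧ ofReal ε' * I ≤ ε := by
    refine ⟨ε / (I.toReal + 1), by positivity, ¿⟩
    rw [← ofReal_toReal hGt, ← ofReal_mul ƥ, ← ENNReal.ofReal_coe_nnreal]
    refine ofReal_le_ofReal ¿
    rw [div_mul_eq_mul_div, div_le_iff₀ ƥ]
    have := ε.2
    rw [ofReal_toReal hGt]
    have : ō ≤ ε := ε.2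
    nlinarith
  obtain ⟨η, hη, hFη⟩ := Metric.uniformContinuousOn_iff_le.1 hu ε' hε'
  obtain ⟨n, hn⟩ : ∃ n : ℕ, (l / 2 ^ n) ^ 2 ≤ η ∧ d * (l / 2 ^ n) ≤ η := by
    have h1 : Filter.Tendsto (fun n : ℕ ↦ l / 2 ^ n) atTop (nhds 0) := by
      simp_rw [div_eq_mul_inv, ← inv_pow]
      simpa using (tendsto_pow_atTop_nhds_zero_of_lt_one (r := (2:ℝ)⁻¹) ñ ñ).const_mul l
    have h2 : Filter.Tendsto (fun n : ℕ ↦ (l / 2 ^ n) ^ 2) atTop (nhds 0) := by simpa using h1.pow 2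
    have h3 : Filter.Tendsto (fun n : ℕ ↦ d * (l / 2 ^ n)) atTop (nhds 0) := by simpa using h1.const_mul (d:ℝ)
    exact ((h2.eventually_le_const hη).and (h3.eventually_le_const hη)).exists
  set D : ℕ → Pt d × Ioi ō → Prop := fun k Q ↦ cube Q.1 Q.2 ⊆ cube z l ∧ Q.2.1 = l / 2 ^ n * 2 ^ k with hDdef
  have key := fs_tree volume (fun Q : Pt d × Ioi ō ↦ cube Q.1 Q.2) cch (fun Q ↦ cube_meas _ _)
    cube_union cube_disj (2 ^ (d + 2)) (one_le_pow₀ ñ) ¿ D ¿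
    (fun n Q _ ↦ vcube_ne0 _ Q.2.2) (fun n Q _ ↦ vcube_net _ Q.2.2) F hF G w (fun y ↦ cB d * MM G y) hG
    (ofReal ε') ¿ (fun n Q hQ ↦ hw Q.1 Q.2 Q.2.2 hQ.1) (fun n Q hQ y hy ↦ cube_MM G _ Q.2.2 hy)
    n (z, ⟨l, hl⟩) ⟨subset_rfl, by simp⟩ 0 (I / volume (cube z l))
    (div_ne_top hGt (vcube_ne0 _ hl)) (by rw [ENNReal.div_mul_cancel (vcube_ne0 _ hl) (vcube_net _ hl)])
  · obtain ⟨A, hA, -, -, hh⟩ := key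
    simp only [sub_zero] at hh
    refine hh.trans ¿
    gcongr
  · rintro ⟨y, m, hm⟩ k
    have hm' : 0 < m := hm
    show volume (cube y m) = 2 ^ (d + 2) * volume (cube _ (m / 2))
    rw [vcube _ hm', vcube _ (half_pos hm'), show m ^ (d + 2) = 2 ^ (d + 2) * (m / 2) ^ (d + 2) by
      rw [← mul_pow]; congr 1; ring, ofReal_mul ƥ, ofReal_pow ñ]
    norm_num
  · rintro k Q ⟨h1, h2⟩ j
    refine ⟨¿, ¿⟩
    · refine subset_trans ¿ h1
      rw [cube_union Q]
      exact subset_iUnion (fun j ↦ cube (cch Q j).1 (cch Q j).2) j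
    · show Q.2.1 / 2 = _
      rw [h2]; ring
  · rintro ⟨y, m, hm⟩ ⟨h1, h2⟩ a ha b hb
    simp only [pow_zero, mul_one] at h2
    obtain ⟨h3, h4⟩ := cube_diam hm ha hb
    have h5 := hFη a (h1 ha) b (h1 hb) (by
      rw [Prod.dist_eq, dist_eq, dist_eq_norm]
      subst h2
      exact max_le (h3.trans hn.1) (h4.trans hn.2))
    rw [← ofReal_norm_eq_enorm, ← dist_eq_norm]
    exact ofReal_le_ofReal h5
theorem FS (q p : ℝ) (hq : 1 < q) (hp : 1 < p) : ∃ K : ℰ, K ≠ ⊤ ∧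
    ∀ (z : Pt d) (l : ℝ), 0 < l → ∀ F : Fn d, Measurable F → UniformContinuousOn F (cube z l) →
      ∀ w : Pt d → ℰ, Measurable w →
      (∀ (y : Pt d) (m : ℝ), 0 < m → cube y m ⊆ cube z l → ∃ c : ℝ, ∀ x ∈ cube y m,
        ∫⁻ y in cube y m, ‖F y - c‖ₑ ≤ volume (cube y m) * w x) →
      ∀ B : ℝ, (∀ y ∈ cube z l, |F y| ≤ B) →
      XX q p ((cube z l).indicator fun y ↦ ‖F y‖ₑ) ≤ K *
        (XX q p ((cube z l).indicator 1) * ((∫⁻ y in cube z l, ‖F y‖ₑ) / volume (cube z l)) +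
          XX q p ((cube z l).indicator w)) := by
  have hqc := conjExponent hq
  have hpc := conjExponent hp
  set q' := q.conjExponent
  set p' := p.conjExponent
  have q0 := hqc.pos
  have p0 := hpc.pos
  have q0' := hqc.symm.pos
  have p0' := hpc.symm.pos
  obtain ⟨C, hC, HC⟩ := MM_XX (d := d) q' p' hqc.symm.lt hpc.symm.lt
  refine ⟨2 ^ (d + 2) + (4 * 2 ^ (d + 2) + 2) * (cB d * C), ¿, ¿⟩
  · have := cB_ne (d := d)
    finiteness
  intro z l hl F hF hu w hwm hw B hB
  set R := cube z l with hR
  have hRm : MeasurableSet R := cube_meas _ _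
  set f : Pt d → ℰ := R.indicator fun y ↦ ‖F y‖ₑ with hf
  have hfm : Measurable f := hF.enorm.indicator hRm
  have hfb : ∀ y, f y ≤ R.indicator (fun _ ↦ ofReal B) y := by
    intro y
    refine indicator_le_indicator' (fun hy ↦ ¿)
    rw [← ofReal_norm_eq_enorm]; exact ofReal_le_ofReal (hB y hy)
  have hN1 : ∀ x, NN q f x ≤ (cubeX z.2 l).indicator (fun _ ↦ ofReal B ^ q * ofReal (l ^ 2)) x := by
    intro x
    have : ∀ t, f (t, x) ^ q ≤ (Ico z.1 (z.1 + l ^ 2)).indicator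
        (fun _ ↦ (cubeX z.2 l).indicator (fun _ ↦ ofReal B ^ q) x) t := by
      intro t
      refine (rpow_le_rpow (hfb _) q0.le).trans ¿
      by_cases h : (t, x) ∈ R
      · rw [indicator_of_mem h, indicator_of_mem h.1, indicator_of_mem h.2]
      · rw [indicator_of_notMem h, zero_rpow_of_pos q0]; exact zero_le
    refine (lintegral_mono this).trans ¿
    rw [lintegral_indicator measurableSet_Ico, setLIntegral_const, volume_Ico]
    by_cases h : x ∈ cubeX z.2 l
    · rw [indicator_of_mem h, indicator_of_mem h]; simp
    · rw [indicator_of_notMem h, indicator_of_notMem h]; simp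
  have hcst : ofReal B ^ q * ofReal (l ^ 2) ≠ ⊤ :=
    mul_ne_top (rpow_ne_top_of_nonneg q0.le ofReal_ne_top) ofReal_ne_top
  have hNt : ∀ x, NN q f x ≠ ⊤ := fun x ↦ by
    refine ne_top_of_le_ne_top hcst ((hN1 x).trans (indicator_le_self' (fun _ _ ↦ zero_le) x))
  have hXt : XX q p f ≠ ⊤ := by
    refine rpow_ne_top_of_nonneg ƥ ¿
    have : ∀ x, NN q f x ^ (p / q) ≤ (cubeX z.2 l).indicator
        (fun _ ↦ (ofReal B ^ q * ofReal (l ^ 2)) ^ (p / q)) x := by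
      intro x
      refine (rpow_le_rpow (hN1 x) ƥ).trans ¿
      by_cases h : x ∈ cubeX z.2 l
      · rw [indicator_of_mem h, indicator_of_mem h]
      · rw [indicator_of_notMem h, zero_rpow_of_pos ƥ]; exact zero_le
    refine ne_top_of_le_ne_top ¿ (lintegral_mono this)
    rw [lintegral_indicator (cubeX_meas _ _), setLIntegral_const, vcubeX _ hl]
    exact mul_ne_top (rpow_ne_top_of_nonneg ƥ hcst) ofReal_ne_top
  set G := dualF q p f with hG
  have hGm : Measurable G := dualF_meas q p hfm
  set X := XX q p f with hX
  have hX'  : XX q' p' G ≤ X ^ (p - 1) := by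
    have h1 := dualF_norm hqc hpc hfm hNt
    have h2 := rpow_le_rpow h1 (z := 1 / p') ƥ
    rw [← rpow_mul, ← rpow_mul, mul_one_div_cancel p0'.ne', rpow_one] at h2
    refine h2.trans_eq ¿
    congr 1
    have := hpc.conjugate_eq
    have h3 : p - 1 ≠ 0 := by have := hpc.lt; linarith
    rw [this]; field_simp
  have h1m : Measurable (R.indicator (1 : Pt d → ℰ)) := measurable_one.indicator hRm
  have hIG : ∫⁻ y in R, G y ≤ XX q p (R.indicator 1) * X ^ (p - 1) := by
    have := XX_holder hqc hpc h1m hGm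
    calc ∫⁻ y in R, G y = ∫⁻ y, R.indicator 1 y * G y := by
          rw [← lintegral_indicator hRm]
          refine lintegral_congr fun y ↦ ¿
          by_cases h : y ∈ R <;> simp [h]
      _ ≤ _ := this
      _ ≤ _ := by gcongr
  have h1t : XX q p (R.indicator 1) ≠ ⊤ := by
    refine rpow_ne_top_of_nonneg ƥ ¿
    have : ∀ x, NN q (R.indicator 1) x ^ (p / q) ≤ (cubeX z.2 l).indicator
        (fun _ ↦ (ofReal (l ^ 2)) ^ (p / q)) x := by
      intro x
      by_cases h : x ∈ cubeX z.2 l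
      · rw [indicator_of_mem h]
        refine rpow_le_rpow ¿ ƥ
        calc NN q (R.indicator 1) x ≤ ∫⁻ t, (Ico z.1 (z.1 + l ^ 2)).indicator 1 t := by
              refine lintegral_mono fun t ↦ ¿
              by_cases ht : t ∈ Ico z.1 (z.1 + l ^ 2)
              · rw [indicator_of_mem ht, indicator_of_mem (show (t, x) ∈ R from ⟨ht, h⟩)]; simp
              · rw [indicator_of_notMem ht, indicator_of_notMem (fun hh : (t, x) ∈ R ↦ ht hh.1)]; simp [q0]
          _ = _ := by rw [lintegral_indicator_one measurableSet_Ico]; simp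
      · have : NN q (R.indicator 1) x = 0 := by
          rw [NN]
          simp_rw [indicator_of_notMem (fun hh : (_, x) ∈ R ↦ h hh.2), zero_rpow_of_pos q0]
          simp
        rw [this, zero_rpow_of_pos ƥ]; exact zero_le
    refine ne_top_of_le_ne_top ¿ (lintegral_mono this)
    rw [lintegral_indicator (cubeX_meas _ _), setLIntegral_const, vcubeX _ hl]
    exact mul_ne_top (rpow_ne_top_of_nonneg ƥ ofReal_ne_top) ofReal_ne_top
  have hXp : X ^ (p - 1) ≠ ⊤ := rpow_ne_top_of_nonneg (by have := hpc.lt; linarith) hXt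
  have hfs := fs_cube z hl F hF hu G w hGm (ne_top_of_le_ne_top (mul_ne_top h1t hXp) hIG) hw
  have hL : ∫⁻ y in R, ‖F y‖ₑ * G y = X ^ p := by
    rw [← dualF_int hq hp hfm hNt, ← lintegral_indicator hRm]
    refine lintegral_congr fun y ↦ ¿
    by_cases h : y ∈ R
    · rw [hf, indicator_of_mem h, indicator_of_mem h]
    · rw [hf, indicator_of_notMem h, indicator_of_notMem h, zero_mul]
  have hwG : ∫⁻ y in R, w y * (cB d * MM G y) ≤ cB d * (XX q p (R.indicator w) * (C * X ^ (p - 1))) := by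
    have hMG : Measurable (MM G) := (pB d).M_meas _ _
    have hwR : Measurable (R.indicator w) := hwm.indicator hRm
    calc ∫⁻ y in R, w y * (cB d * MM G y) = cB d * ∫⁻ y, R.indicator w y * MM G y := by
          rw [← lintegral_const_mul _ (show Measurable fun y ↦ R.indicator w y * MM G y from hwR.mul hMG), ← lintegral_indicator hRm]
          refine lintegral_congr fun y ↦ ¿
          by_cases h : y ∈ R
          · rw [indicator_of_mem h, indicator_of_mem h]; ring
          · rw [indicator_of_notMem h, indicator_of_notMem h]; simp
      _ ≤ cB d * (XX q p (R.indicator w) * XX q' p' (MM G)) := by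
          gcongr; exact XX_holder hqc hpc hwR hMG
      _ ≤ _ := by gcongr; exact (HC G hGm).trans (by gcongr)
  rw [hL] at hfs
  set V := (∫⁻ y in R, ‖F y‖ₑ) / volume R with hV
  have hfin : X ^ p ≤ ((2 ^ (d + 2) + (4 * 2 ^ (d + 2) + 2) * (cB d * C)) *
      (XX q p (R.indicator 1) * V + XX q p (R.indicator w))) * X ^ (p - 1) := by
    calc X ^ p ≤ 2 ^ (d + 2) * ((XX q p (R.indicator 1) * X ^ (p - 1)) / volume R) * (∫⁻ y in R, ‖F y‖ₑ) +
          (4 * 2 ^ (d + 2) + 2) * (cB d * (XX q p (R.indicator w) * (C * X ^ (p - 1)))) := by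
          refine hfs.trans ¿; gcongr
      _ = (2 ^ (d + 2) * (XX q p (R.indicator 1) * V) + ((4 * 2 ^ (d + 2) + 2) * (cB d * C)) * XX q p (R.indicator w))
            * X ^ (p - 1) := by
          rw [hV, ENNReal.div_eq_inv_mul, ENNReal.div_eq_inv_mul]; ring
      _ ≤ _ := by
          gcongr
          rw [mul_add]
          gcongr
          · exact le_self_add
          · exact le_add_self
  rcases eq_or_ne X 0 with h0 | h0
  · rw [h0]; exact zero_le
  have hX0 : X ^ (p - 1) ≠ 0 := by
    rw [Ne, ENNReal.rpow_eq_zero_iff]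
    push Not
    exact ⟨fun h ↦ absurd h h0, fun h ↦ absurd h hXt⟩
  have e : X ^ p = X * X ^ (p - 1) := by
    conv_rhs => enter [1]; rw [← rpow_one X]
    rw [← rpow_add _ _ h0 hXt]; congr 1; ring
  rw [e] at hfin
  exact (ENNReal.mul_le_mul_iff_left hX0 hXp).1 hfin
def EL (δ s : ℝ) (A : Mq d) : Prop :=
  (∀ i j, A i j = A j i) ∧ ∀ ξ : Fin d → ℝ, δ * s * (∑ i, ξ i ^ 2) ≤ (∑ i, ∑ j, A i j * ξ i * ξ j) ∧
    (∑ i, ∑ j, A i j * ξ i * ξ j) ≤ δ⁻¹ * s * (∑ i, ξ i ^ 2)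
def QF (A : Mq d) (ξ : Spc d) : ℝ := 4 * π ^ 2 * ∑ i, ∑ j, A i j * ξ i * ξ j
def gA (A : Mq d) (ξ : Spc d) : ℂ := (exp (-QF A ξ) : ℝ)
def JB (ξ : Spc d) : ℝ := ((1 + ‖ξ‖) ^ (d + 1))⁻¹
lemma JB_int : Integrable (JB : Spc d → ℝ) := by
  have := integrable_one_add_norm (E := Spc d) (μ := volume) (r := ((d + 1 : ℕ) : ℝ)) ş
  refine this.congr (of_forall fun x ↦ ¿)
  simp only [JB]
  rw [Real.rpow_neg ƥ, Real.rpow_natCast]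
lemma JB_nn (ξ : Spc d) : 0 ≤ JB ξ := by unfold JB; positivity
lemma EL_entry (hδ : 0 < δ) (hs : 0 ≤ s) (h : EL δ s A) (k l : Fin d) :
    |A k l| ≤ 2 * δ⁻¹ * s := by
  have key : ∀ σ : ℝ, σ ^ 2 = 1 → A k k + A l l + 2 * σ * A k l ≤ 4 * δ⁻¹ * s := by
    intro σ hσ
    have := (h.2 fun i ↦ (if i = k then 1 else 0) + σ * (if i = l then 1 else 0)).2
    have e : ∑ i, ∑ j, A i j * ((if i = k then 1 else 0) + σ * (if i = l then 1 else 0)) *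
        ((if j = k then 1 else 0) + σ * (if j = l then 1 else 0)) = A k k + σ ^ 2 * A l l + 2 * σ * A k l := by
      simp only [mul_add, add_mul, sum_add_distrib, mul_ite, ite_mul, mul_one, mul_zero, zero_mul, Finset.sum_ite_eq', Finset.sum_ite_eq, Finset.mem_univ, if_true]
      simp [h.1 l k]
      ring
    rw [e, hσ] at this
    have e2 : ∑ i, ((if i = k then 1 else 0) + σ * (if i = l then (1:ℝ) else 0)) ^ 2 ≤ 4 := by
      calc _ ≤ ∑ i, (2 * (if i = k then (1:ℝ) else 0) + 2 * (if i = l then 1 else 0)) := by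
            refine sum_le_sum fun i _ ↦ ¿
            split_ifs <;> nlinarith [sq_nonneg (σ - 1)]
        _ = 4 := by simp [sum_add_distrib]; norm_num
    have : 0 ≤ δ⁻¹ * s := by positivity
    nlinarith
  have hd : ∀ m, 0 ≤ A m m := by
    intro m
    have := (h.2 fun i ↦ if i = m then 1 else 0).1
    simp at this
    have h2 : 0 ≤ δ * s := by positivity
    linarith
  have h1 := key 1 ñ
  have h2 := key (-1) ñ
  have := hd k
  have := hd l
  rw [abs_le]; constructor <;> linarith
lemma pexp (c : ℝ) (hc : 0 < c) (M : ℕ) : ∃ C : ℝ, 0 < C ∧ ∀ r : ℝ, 0 ≤ r → (1 + r) ^ M * exp (-(c * r ^ 2)) ≤ C := by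
  refine ⟨M.factorial * exp (1 + 1 / (4 * c)), by positivity, fun r hr ↦ ¿⟩
  have h1 := Real.pow_div_factorial_le_exp (1 + r) ł M
  rw [div_le_iff₀ ƥ] at h1
  have h2 : exp (-(c * r ^ 2)) ≤ exp (1 / (4 * c) - r) := by
    apply exp_le_exp.2
    have : 0 ≤ (2 * c * r - 1) ^ 2 / (4 * c) := by positivity
    have e : (2 * c * r - 1) ^ 2 / (4 * c) = c * r ^ 2 - r + 1 / (4 * c) := by field_simp; ring
    linarith
  calc _ ≤ (exp (1 + r) * M.factorial) * exp (1 / (4 * c) - r) := by gcongr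
    _ = _ := by rw [mul_right_comm, ← Real.exp_add, mul_comm]; ring_nf
lemma coord_tg (k : Fin d) : Function.HasTemperateGrowth (fun ξ : Spc d ↦ ξ k) :=
  (proj (𝕜 := ℝ) k : Spc d →L[ℝ] ℝ).hasTemperateGrowth
lemma QF_lower (h : EL δ s A) (ξ : Spc d) :
    4 * π ^ 2 * δ * s * ‖ξ‖ ^ 2 ≤ QF A ξ := by
  have := (h.2 ξ).1
  rw [EuclideanSpace.norm_sq_eq, QF]
  simp only [norm_eq_abs, sq_abs]
  have h2 := mul_le_mul_of_nonneg_left this (show 0 ≤ 4 * π ^ 2 by positivity)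
  linarith
lemma QF_contDiff (A : Mq d) : ContDiff ℝ (⊤ : ℕ∞) (QF A) := by
  unfold QF
  refine contDiff_const.mul (ContDiff.sum fun i _ ↦ ContDiff.sum fun j _ ↦ ¿)
  exact (contDiff_const.mul (coord_tg i).1).mul (coord_tg j).1
lemma gA_deriv (δ : ℝ) (hδ : 0 < δ) (n : ℕ) : ∃ (N : ℕ) (C : ℝ), 0 ≤ C ∧ ∀ A : Mq d, EL δ 1 A →
    ∀ m ≤ n, ∀ ξ : Spc d, ‖iteratedFDeriv ℝ m (gA A) ξ‖ ≤ C * (1 + ‖ξ‖) ^ N * exp (-(4 * π ^ 2 * δ * ‖ξ‖ ^ 2)) := by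
  have hb : ∀ k l : Fin d, Function.HasTemperateGrowth (fun ξ : Spc d ↦ ξ k * ξ l) := fun k l ↦ (coord_tg k).mul (coord_tg l)
  choose N C hC hN using fun k l ↦ (hb k l).norm_iteratedFDeriv_le_uniform n
  set M := ∑ k, ∑ l, N k l with hM
  set D : ℝ := 1 + ∑ k, ∑ l, 4 * π ^ 2 * (2 * δ⁻¹) * C k l with hD
  have hD1 : 1 ≤ D := by
    rw [hD]; have : 0 ≤ ∑ k, ∑ l, 4 * π ^ 2 * (2 * δ⁻¹) * C k l :=
      sum_nonneg fun k _ ↦ sum_nonneg fun l _ ↦ by have := hC k l; positivity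
    linarith
  refine ⟨M * n, n.factorial * D ^ n, by positivity, fun A hA m hm ξ ↦ ¿⟩
  have e : gA A = Complex.ofRealLI ∘ (exp ∘ fun ξ ↦ -QF A ξ) := rfl
  have hf : ContDiff ℝ (⊤ : ℕ∞) (fun ξ ↦ -QF A ξ) := (QF_contDiff A).neg
  have h1 : 1 ≤ 1 + ‖ξ‖ := by linarith [norm_nonneg ξ]
  have hDD : 1 ≤ D * (1 + ‖ξ‖) ^ M := one_le_mul_of_one_le_of_one_le hD1 (one_le_pow₀ h1)
  rw [e, LinearIsometry.norm_iteratedFDeriv_comp_left _ ((contDiff_exp.comp hf).contDiffAt (n := (⊤ : ℕ∞))) (by exact_mod_cast le_top)]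
  have key := norm_iteratedFDeriv_comp_le (n := m) (N := (⊤ : ℕ∞)) (C := exp (-QF A ξ)) (D := D * (1 + ‖ξ‖) ^ M)
    contDiff_exp hf (by exact_mod_cast le_top) ξ ¿ ¿
  · refine key.trans ¿
    have h2 : exp (-QF A ξ) ≤ exp (-(4 * π ^ 2 * δ * ‖ξ‖ ^ 2)) := by
      apply exp_le_exp.2; have := QF_lower hA ξ; linarith
    calc (m.factorial : ℝ) * exp (-QF A ξ) * (D * (1 + ‖ξ‖) ^ M) ^ m
        ≤ n.factorial * exp (-(4 * π ^ 2 * δ * ‖ξ‖ ^ 2)) * (D * (1 + ‖ξ‖) ^ M) ^ n := by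
          gcongr
      _ = _ := by rw [mul_pow, ← pow_mul]; ring
  · intro i _
    rw [norm_iteratedFDeriv_eq_norm_iteratedDeriv, iteratedDeriv_eq_iterate, Real.iter_deriv_exp, norm_eq_abs, abs_exp]
  · intro i hi1 him
    refine le_trans ¿ (le_self_pow₀ hDD (by omega))
    have e2 : (fun ξ ↦ -QF A ξ) = fun ξ : Spc d ↦ ∑ p : Fin d × Fin d, (-(4 * π ^ 2 * A p.1 p.2)) • (ξ p.1 * ξ p.2) := by
      ext ξ; rw [QF, Fintype.sum_prod_type, mul_sum, ← sum_neg_distrib]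
      refine sum_congr rfl fun i _ ↦ ¿
      rw [mul_sum, ← sum_neg_distrib]
      refine sum_congr rfl fun j _ ↦ ¿
      simp only [smul_eq_mul]; ring
    have hcd : ∀ p : Fin d × Fin d, ContDiff ℝ i (fun ξ : Spc d ↦ ξ p.1 * ξ p.2) := fun p ↦ (hb p.1 p.2).1.of_le (by exact_mod_cast le_top)
    rw [e2, iteratedFDeriv_fun_sum_apply (f := fun (p : Fin d × Fin d) (ξ : Spc d) ↦ (-(4 * π ^ 2 * A p.1 p.2)) • (ξ p.1 * ξ p.2)) (fun p _ ↦ ((hcd p).const_smul _).contDiffAt)]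
    refine (norm_sum_le _ _).trans ¿
    calc ∑ p : Fin d × Fin d, ‖iteratedFDeriv ℝ i (fun ξ : Spc d ↦ (-(4 * π ^ 2 * A p.1 p.2)) • (ξ p.1 * ξ p.2)) ξ‖
        ≤ ∑ p : Fin d × Fin d, (4 * π ^ 2 * (2 * δ⁻¹) * C p.1 p.2) * (1 + ‖ξ‖) ^ M := by
          refine sum_le_sum fun p _ ↦ ¿
          rw [iteratedFDeriv_const_smul_apply' (hcd p).contDiffAt, norm_smul]
          have := EL_entry hδ zero_le_one hA p.1 p.2
          have h3 := hN p.1 p.2 i (him.trans hm) ξ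
          rw [norm_neg, norm_mul, norm_of_nonneg (show 0 ≤ 4 * π ^ 2 by positivity), norm_eq_abs, mul_assoc _ (C _ _)]
          have h4 : N p.1 p.2 ≤ M := (single_le_sum (f := fun l ↦ N p.1 l) (fun _ _ ↦ Nat.zero_le _) (Finset.mem_univ p.2)).trans
            (single_le_sum (f := fun k ↦ ∑ l, N k l) (fun _ _ ↦ Nat.zero_le _) (Finset.mem_univ p.1))
          have := hC p.1 p.2
          have h6 : (1 + ‖ξ‖) ^ N p.1 p.2 ≤ (1 + ‖ξ‖) ^ M := pow_le_pow_right₀ h1 h4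
          have h5 : ‖iteratedFDeriv ℝ i (fun ξ : Spc d ↦ ξ p.1 * ξ p.2) ξ‖ ≤ C p.1 p.2 * (1 + ‖ξ‖) ^ M := h3.trans (by gcongr)
          gcongr
          linarith
      _ = (D - 1) * (1 + ‖ξ‖) ^ M := by rw [← sum_mul, Fintype.sum_prod_type, hD]; ring
      _ ≤ _ := by gcongr; linarith
lemma gA_contDiff (A : Mq d) : ContDiff ℝ (⊤ : ℕ∞) (gA A) :=
  Complex.ofRealCLM.contDiff.comp (contDiff_exp.comp (QF_contDiff A).neg)
lemma PgA_deriv (δ : ℝ) (hδ : 0 < δ) (P : Spc d → ℂ) (hP : P.HasTemperateGrowth) (n : ℕ) : ∃ C : ℝ, 0 ≤ C ∧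
    ∀ A : Mq d, EL δ 1 A →
    ∀ m ≤ n, ∀ ξ : Spc d, ‖iteratedFDeriv ℝ m (fun ξ ↦ P ξ * gA A ξ) ξ‖ ≤ C * JB ξ := by
  obtain ⟨N, C, hC, h⟩ := gA_deriv (d := d) δ hδ n
  obtain ⟨N', C', hC', h'⟩ := hP.norm_iteratedFDeriv_le_uniform n
  obtain ⟨E, hE, hE'⟩ := pexp (4 * π ^ 2 * δ) ƥ (N' + N + (d + 1))
  refine ⟨2 ^ n * C' * C * E, by positivity, fun A hA m hm ξ ↦ ¿⟩
  refine (norm_iteratedFDeriv_mul_le (N := (⊤ : ℕ∞)) hP.1 (gA_contDiff A) ξ (by exact_mod_cast le_top)).trans ¿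
  have h0 := hE' ‖ξ‖ (norm_nonneg _)
  have h1 : ō < 1 + ‖ξ‖ := by positivity
  calc _ ≤ ∑ i ∈ Finset.range (m + 1), (m.choose i : ℝ) * (C' * (1 + ‖ξ‖) ^ N') * (C * (1 + ‖ξ‖) ^ N * exp (-(4 * π ^ 2 * δ * ‖ξ‖ ^ 2))) := by
        refine sum_le_sum fun i hi ↦ ¿
        rw [Finset.mem_range] at hi
        gcongr
        · exact h' i (by omega) ξ
        · exact h A hA _ (by omega) ξ
    _ = 2 ^ m * (C' * (1 + ‖ξ‖) ^ N') * (C * (1 + ‖ξ‖) ^ N * exp (-(4 * π ^ 2 * δ * ‖ξ‖ ^ 2))) := by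
        rw [← sum_mul, ← sum_mul]; congr 2
        exact_mod_cast Nat.sum_range_choose m
    _ = 2 ^ m * C' * C * ((1 + ‖ξ‖) ^ (N' + N + (d + 1)) * exp (-(4 * π ^ 2 * δ * ‖ξ‖ ^ 2))) * JB ξ := by
        rw [JB, pow_add, pow_add]; field_simp
    _ ≤ 2 ^ n * C' * C * E * JB ξ := by
        have := JB_nn ξ
        gcongr
        · norm_num
def KF (P : Spc d → ℂ) (A : Mq d) : Spc d → ℂ := 𝓕 (fun ξ ↦ P ξ * gA A ξ)
lemma KF_decay (δ : ℝ) (hδ : 0 < δ) (P : Spc d → ℂ) (hP : P.HasTemperateGrowth) (n : ℕ) : ∃ C : ℝ, 0 < C ∧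
    ∀ A : Mq d, EL δ 1 A → ∀ x, (1 + ‖x‖) ^ n * ‖KF P A x‖ ≤ C := by
  have key : ∀ n : ℕ, ∃ C : ℝ, 0 ≤ C ∧ ∀ A : Mq d, EL δ 1 A → ∀ x, ‖x‖ ^ n * ‖KF P A x‖ ≤ C := by
    intro n
    obtain ⟨C, hC, h⟩ := PgA_deriv δ hδ P hP n
    refine ⟨2 ^ n * ∑ m ∈ Finset.range (n + 1), ∫ ξ : Spc d, C * JB ξ, ¿, fun A hA x ↦ ¿⟩
    · have : 0 ≤ ∫ ξ : Spc d, C * JB ξ := integral_nonneg fun ξ ↦ mul_nonneg hC (JB_nn ξ)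
      positivity
    have hcd : ContDiff ℝ n (fun ξ ↦ P ξ * gA A ξ) := (hP.1.mul (gA_contDiff A)).of_le (by exact_mod_cast le_top)
    have hint : ∀ m ≤ n, Integrable (fun ξ ↦ ‖iteratedFDeriv ℝ m (fun ξ ↦ P ξ * gA A ξ) ξ‖) := by
      intro m hm
      refine (JB_int.const_mul C).mono' (hcd.continuous_iteratedFDeriv (by exact_mod_cast hm)).norm.aestronglyMeasurable (of_forall fun ξ ↦ ¿)
      rw [norm_norm]; exact h A hA m hm ξ
    have := Real.pow_mul_norm_iteratedFDeriv_fourier_le (K := 0) (N := n) (k := 0) (n := n) hcd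
      (by intro k m hk hm
          have hk : k = 0 := by simpa using hk
          subst hk
          simpa using hint m (by exact_mod_cast hm)) ş ş x
    rw [norm_iteratedFDeriv_zero] at this
    refine this.trans ¿
    simp only [pow_zero, one_mul, Nat.cast_zero, mul_zero, zero_add, Finset.range_one, Finset.product_eq_sprod, Finset.sum_product, Finset.sum_singleton]
    refine mul_le_mul_of_nonneg_left (sum_le_sum fun m hm ↦ ¿) ƥ
    rw [Finset.mem_range] at hm
    exact integral_mono (hint m (by omega)) (JB_int.const_mul C) fun ξ ↦ h A hA m (by omega) ξ
  obtain ⟨C1, h1, H1⟩ := key 0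
  obtain ⟨C2, h2, H2⟩ := key n
  refine ⟨2 ^ n * (C1 + C2) + 1, by positivity, fun A hA x ↦ ¿⟩
  have a := H1 A hA x
  have b := H2 A hA x
  have h3 : (1 + ‖x‖) ^ n ≤ 2 ^ n * (1 + ‖x‖ ^ n) := by
    calc (1 + ‖x‖) ^ n ≤ (2 * max 1 ‖x‖) ^ n := by
          gcongr; have := le_max_left 1 ‖x‖; have := le_max_right 1 ‖x‖; linarith
      _ = 2 ^ n * (max 1 ‖x‖) ^ n := mul_pow _ _ _
      _ ≤ _ := by
          gcongr
          rcases max_cases 1 ‖x‖ with h | h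
          · rw [h.1, one_pow]; have : 0 ≤ ‖x‖ ^ n := by positivity
            linarith
          · rw [h.1]; linarith
  simp only [pow_zero, one_mul] at a
  calc _ ≤ 2 ^ n * (1 + ‖x‖ ^ n) * ‖KF P A x‖ := by gcongr
    _ = 2 ^ n * (‖KF P A x‖ + ‖x‖ ^ n * ‖KF P A x‖) := by ring
    _ ≤ 2 ^ n * (C1 + C2) := by gcongr
    _ ≤ _ := by linarith
lemma KF_eq (P : Spc d → ℂ) (A : Mq d) (x : Spc d) :
    KF P A x = ∫ ξ, Complex.exp (-(2 * π * Complex.I * (inner ℝ ξ x : ℝ))) * (P ξ * gA A ξ) := by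
  rw [KF, fourier_eq']
  refine integral_congr_ae (of_forall fun ξ ↦ ¿)
  simp only [smul_eq_mul]
  congr 2; push_cast; ring
lemma QF_smul (A : Mq d) (r : ℝ) (ξ : Spc d) : QF (r ^ 2 • A) ξ = QF A (r • ξ) := by
  simp only [QF, Matrix.smul_apply, smul_eq_mul, PiLp.smul_apply]
  congr 1
  refine sum_congr rfl fun i _ ↦ sum_congr rfl fun j _ ↦ ¿
  ring
lemma EL_smul (hr : 0 ≤ r) (h : EL δ s A) : EL δ (r * s) (r • A) := by
  refine ⟨fun i j ↦ by simp [h.1 i j], fun ξ ↦ ¿⟩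
  have e : ∑ i, ∑ j, (r • A) i j * ξ i * ξ j = r * ∑ i, ∑ j, A i j * ξ i * ξ j := by
    simp only [Matrix.smul_apply, smul_eq_mul, mul_sum, mul_assoc]
  rw [e]
  have := h.2 ξ
  constructor <;> nlinarith [mul_le_mul_of_nonneg_left this.1 hr, mul_le_mul_of_nonneg_left this.2 hr]
def Hom (m : ℕ) (P : Spc d → ℂ) : Prop := P.HasTemperateGrowth ∧ ∀ (r : ℝ) (ξ : Spc d), P (r • ξ) = (r : ℂ) ^ m * P ξ
lemma Hom_coord (h : Hom m P) (k : Fin d) : Hom (m + 1) (fun ξ ↦ (ξ k : ℂ) * P ξ) := by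
  refine ⟨(Function.HasTemperateGrowth.comp Function.Complex.hasTemperateGrowth_ofReal (coord_tg k)).mul h.1, fun r ξ ↦ ¿⟩
  simp only [h.2, PiLp.smul_apply, smul_eq_mul]; push_cast; ring
lemma Hom_one : Hom 0 (fun _ : Spc d ↦ (1 : ℂ)) := ⟨Function.HasTemperateGrowth.const 1, fun r ξ ↦ by simp⟩
lemma KF_scale (hP : Hom m P) (A : Mq d) (hr : 0 < r) (x : Spc d) :
    (r : ℂ) ^ (d + m) * KF P (r ^ 2 • A) x = KF P A (r⁻¹ • x) := by
  rw [KF_eq, KF_eq]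
  set F : Spc d → ℂ := fun ξ ↦ Complex.exp (-(2 * π * Complex.I * (inner ℝ ξ (r⁻¹ • x) : ℝ))) * (P ξ * gA A ξ)
  have h := Measure.integral_comp_smul volume F r
  have e : ∀ ξ, F (r • ξ) = (r : ℂ) ^ m * (Complex.exp (-(2 * π * Complex.I * (inner ℝ ξ x : ℝ))) * (P ξ * gA (r ^ 2 • A) ξ)) := by
    intro ξ
    simp only [F, hP.2, gA, QF_smul, inner_smul_left, inner_smul_right, conj_trivial]
    rw [show r⁻¹ * (r * inner ℝ ξ x) = inner ℝ ξ x from inv_mul_cancel_left₀ hr.ne' _]; ring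
  simp_rw [e] at h
  rw [integral_const_mul] at h
  rw [pow_add, mul_assoc, h, finrank_euclideanSpace_fin, abs_of_pos ƥ]
  rw [Complex.real_smul, ← mul_assoc]
  push_cast
  rw [mul_inv_cancel₀ (by simp [hr.ne']), one_mul]
lemma KB (δ : ℝ) (hδ : 0 < δ) (hP : Hom m P) (n : ℕ) : ∃ C : ℝ, 0 < C ∧
    ∀ (r : ℝ), 0 < r → ∀ A : Mq d, EL δ (r ^ 2) A → ∀ x,
      r ^ (d + m) * (r + ‖x‖) ^ n * ‖KF P A x‖ ≤ C * r ^ n := by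
  obtain ⟨C, hC, h⟩ := KF_decay δ hδ P hP.1 n
  refine ⟨C, hC, fun r hr A hA x ↦ ¿⟩
  have hA' : EL δ 1 ((r ^ 2)⁻¹ • A) := by
    have := EL_smul (r := (r ^ 2)⁻¹) ƥ hA
    rwa [inv_mul_cancel₀ ƥ] at this
  have h1 := KF_scale hP ((r ^ 2)⁻¹ • A) hr x
  rw [smul_inv_smul₀ ƥ] at h1
  have h2 := h _ hA' (r⁻¹ • x)
  rw [← h1, norm_mul, norm_pow, norm_real, norm_of_nonneg hr.le, norm_smul, norm_of_nonneg ƥ] at h2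
  have e : (1 + r⁻¹ * ‖x‖) ^ n = (r + ‖x‖) ^ n / r ^ n := by rw [← div_pow]; congr 1; field_simp
  rw [e, div_mul_eq_mul_div, div_le_iff₀ ƥ] at h2
  linarith
lemma KB0 (δ : ℝ) (hδ : 0 < δ) (hP : Hom m P) : ∃ C : ℝ, 0 < C ∧
    ∀ (r R : ℝ), 0 < r → 0 < R → ∀ A : Mq d, EL δ (r ^ 2) A → ∀ x, R ≤ r + ‖x‖ →
      ‖KF P A x‖ ≤ C / R ^ (d + m) := by
  obtain ⟨C, hC, h⟩ := KB δ hδ hP (d + m)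
  refine ⟨C, hC, fun r R hr hR A hA x hx ↦ ¿⟩
  have := h r hr A hA x
  rw [le_div_iff₀ ƥ]
  have h2 : (r + ‖x‖) ^ (d + m) * ‖KF P A x‖ ≤ C := by
    have h3 : 0 < r ^ (d + m) := by positivity
    nlinarith
  calc _ ≤ ‖KF P A x‖ * (r + ‖x‖) ^ (d + m) := by gcongr
    _ ≤ C := by linarith
lemma KB2 (δ : ℝ) (hδ : 0 < δ) (hP : Hom m P) : ∃ C : ℝ, 0 < C ∧
    ∀ (r R : ℝ), 0 < r → 0 < R → ∀ A : Mq d, EL δ (r ^ 2) A → ∀ x, R ≤ r + ‖x‖ →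
      ‖KF P A x‖ ≤ C * r ^ 2 / R ^ (d + m + 2) := by
  obtain ⟨C, hC, h⟩ := KB δ hδ hP (d + m + 2)
  refine ⟨C, hC, fun r R hr hR A hA x hx ↦ ¿⟩
  have := h r hr A hA x
  rw [le_div_iff₀ ƥ]
  have h2 : (r + ‖x‖) ^ (d + m + 2) * ‖KF P A x‖ ≤ C * r ^ 2 := by
    have h3 : 0 < r ^ (d + m) := by positivity
    rw [pow_add r (d + m) 2] at this
    nlinarith
  calc _ ≤ ‖KF P A x‖ * (r + ‖x‖) ^ (d + m + 2) := by gcongr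
    _ ≤ _ := by linarith
lemma tg_exp_int (hP : P.HasTemperateGrowth) {c : ℝ} (hc : 0 < c) :
    Integrable fun ξ : Spc d ↦ ‖P ξ‖ * exp (-(c * ‖ξ‖ ^ 2)) := by
  obtain ⟨N, C, hC, h⟩ := hP.norm_iteratedFDeriv_le_uniform 0
  obtain ⟨E, hE, hE'⟩ := pexp c hc (N + (d + 1))
  refine (JB_int.const_mul (C * E)).mono' ¿ (of_forall fun ξ ↦ ¿)
  · exact (hP.1.continuous.norm.mul ʄ).aestronglyMeasurable
  have h1 := h 0 le_rfl ξ
  rw [norm_iteratedFDeriv_zero] at h1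
  rw [norm_of_nonneg ƥ]
  calc _ ≤ (C * (1 + ‖ξ‖) ^ N) * exp (-(c * ‖ξ‖ ^ 2)) := by gcongr
    _ = C * ((1 + ‖ξ‖) ^ (N + (d + 1)) * exp (-(c * ‖ξ‖ ^ 2))) * JB ξ := by
        rw [JB, pow_add]; field_simp
    _ ≤ _ := by have := JB_nn ξ; have := hE' ‖ξ‖ (norm_nonneg _); gcongr
lemma gA_norm (A : Mq d) (ξ : Spc d) : ‖gA A ξ‖ = exp (-QF A ξ) := by
  rw [gA, norm_real, norm_eq_abs, abs_exp]
lemma gA_le (h : EL δ s A) (ξ : Spc d) :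
    ‖gA A ξ‖ ≤ exp (-(4 * π ^ 2 * δ * s * ‖ξ‖ ^ 2)) := by
  rw [gA_norm]; apply exp_le_exp.2; have := QF_lower h ξ; linarith
lemma PgA_int (hδ : 0 < δ) (hs : 0 < s) (h : EL δ s A) (hP : P.HasTemperateGrowth) :
    Integrable fun ξ ↦ P ξ * gA A ξ := by
  refine (tg_exp_int hP (c := 4 * π ^ 2 * δ * s) ƥ).mono' (hP.1.mul (gA_contDiff A)).continuous.aestronglyMeasurable
    (of_forall fun ξ ↦ ¿)
  rw [norm_mul]; gcongr; exact gA_le h ξ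
lemma cexp_norm (y : ℝ) : ‖Complex.exp (-(2 * π * Complex.I * (y : ℝ)))‖ = 1 := by
  rw [show -(2 * π * Complex.I * (y : ℝ)) = ((-(2 * π * y) : ℝ) : ℂ) * Complex.I by push_cast; ring]
  exact norm_exp_ofReal_mul_I _
lemma cexp_int {x : Spc d} {F : Spc d → ℂ} (hF : Integrable F) :
    Integrable fun ξ ↦ Complex.exp (-(2 * π * Complex.I * (inner ℝ ξ x : ℝ))) * F ξ := by
  refine hF.norm.mono' ((Continuous.aestronglyMeasurable ʄ).mul hF.1) (of_forall fun ξ ↦ ¿)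
  rw [norm_mul, cexp_norm, one_mul]
lemma EL_conv {s0 s1 : ℝ} {A0 A1 : Mq d} (h0 : EL δ s0 A0) (h1 : EL δ s1 A1) (hθ : θ ∈ Icc ō 1) :
    EL δ ((1 - θ) * s0 + θ * s1) (A0 + θ • (A1 - A0)) := by
  refine ⟨fun i j ↦ by simp [h0.1 i j, h1.1 i j], fun ξ ↦ ¿⟩
  have e : ∑ i, ∑ j, (A0 + θ • (A1 - A0)) i j * ξ i * ξ j =
      (1 - θ) * (∑ i, ∑ j, A0 i j * ξ i * ξ j) + θ * ∑ i, ∑ j, A1 i j * ξ i * ξ j := by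
    simp only [Matrix.add_apply, Matrix.smul_apply, Matrix.sub_apply, smul_eq_mul, mul_sum, ← sum_add_distrib]
    refine sum_congr rfl fun i _ ↦ sum_congr rfl fun j _ ↦ ¿
    ring
  rw [e]
  have a := h0.2 ξ
  have b := h1.2 ξ
  have hθ' : 0 ≤ 1 - θ := by linarith [hθ.2]
  constructor <;> nlinarith [mul_le_mul_of_nonneg_left a.1 hθ', mul_le_mul_of_nonneg_left a.2 hθ',
    mul_le_mul_of_nonneg_left b.1 hθ.1, mul_le_mul_of_nonneg_left b.2 hθ.1]
lemma QF_lin (A0 B : Mq d) (θ : ℝ) (ξ : Spc d) : QF (A0 + θ • B) ξ = QF A0 ξ + θ * QF B ξ := by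
  simp only [QF, Matrix.add_apply, Matrix.smul_apply, smul_eq_mul, add_mul, sum_add_distrib, mul_add]
  congr 1
  simp only [mul_sum]
  refine sum_congr rfl fun i _ ↦ sum_congr rfl fun j _ ↦ ¿
  ring
lemma diffK (δ : ℝ) (hδ : 0 < δ) (hP : Hom m P) : ∃ C : ℝ, 0 < C ∧
    ∀ (s0 s1 R : ℝ), 0 < s0 → 0 < s1 → 0 < R → ∀ A0 A1 : Mq d, EL δ s0 A0 → EL δ s1 A1 → ∀ x0 x1 : Spc d,
      (∀ θ ∈ Icc ō 1, R ≤ sqrt ((1 - θ) * s0 + θ * s1) + ‖x0 + θ • (x1 - x0)‖) → ∀ a : ℝ, 0 ≤ a → (∀ k l, |A1 k l - A0 k l| ≤ a) →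
      ‖KF P A1 x1 - KF P A0 x0‖ ≤ C * (‖x1 - x0‖ / R ^ (d + (m + 1)) + a / R ^ (d + (m + 1 + 1))) := by
  choose C1 hC1 h1 using fun k ↦ KB0 δ hδ (Hom_coord hP k)
  choose C2 hC2 h2 using fun k l ↦ KB0 δ hδ (Hom_coord (Hom_coord hP l) k)
  have n1 : 0 ≤ ∑ k, 2 * π * C1 k := sum_nonneg fun k _ ↦ by have := hC1 k; positivity
  have n2 : 0 ≤ ∑ k, ∑ l, 4 * π ^ 2 * C2 k l := sum_nonneg fun k _ ↦ sum_nonneg fun l _ ↦ by have := hC2 k l; positivity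
  refine ⟨(∑ k, 2 * π * C1 k) + (∑ k, ∑ l, 4 * π ^ 2 * C2 k l) + 1, by positivity, ¿⟩
  intro s0 s1 R hs0 hs1 hR A0 A1 hA0 hA1 x0 x1 hRθ a ha0 ha
  set B := A1 - A0 with hB
  set y := x1 - x0 with hy
  set M : Spc d → ℂ := fun ξ ↦ -(2 * π * Complex.I * (inner ℝ ξ y : ℝ)) - (QF B ξ : ℝ) with hM
  set E : ℝ → Spc d → ℂ := fun θ ξ ↦ Complex.exp (-(2 * π * Complex.I * (inner ℝ ξ (x0 + θ • y) : ℝ))) * (P ξ * gA (A0 + θ • B) ξ) with hE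
  have hEform : ∀ θ ξ, E θ ξ = P ξ * Complex.exp (-(2 * π * Complex.I * (inner ℝ ξ x0 : ℝ)) - (QF A0 ξ : ℝ) + θ * M ξ) := by
    intro θ ξ
    simp only [hE, gA, hM, QF_lin, inner_add_right, inner_smul_right]
    rw [Complex.ofReal_exp, mul_left_comm, ← Complex.exp_add]
    congr 2; push_cast; ring
  have hder : ∀ ξ θ, HasDerivAt (fun θ : ℝ ↦ E θ ξ) (E θ ξ * M ξ) θ := by
    intro ξ θ
    simp_rw [hEform]
    have : HasDerivAt (fun θ : ℝ ↦ -(2 * π * Complex.I * (inner ℝ ξ x0 : ℝ)) - (QF A0 ξ : ℝ) + θ * M ξ) (M ξ) θ := by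
      have h := (Complex.ofRealCLM.hasDerivAt (x := θ)).mul_const (M ξ)
      simpa using h.const_add (-(2 * π * Complex.I * (inner ℝ ξ x0 : ℝ)) - (QF A0 ξ : ℝ))
    exact ((this.cexp).const_mul (P ξ)).congr_deriv (mul_assoc _ _ _).symm
  have hQc : ∀ A : Mq d, Continuous (QF A) := fun A ↦ (QF_contDiff A).continuous
  have hPc := hP.1.1.continuous
  have hMc : Continuous M := by
    have := hQc B
    simp only [hM]; fun_prop
  have hEc : Continuous (fun p : ℝ × Spc d ↦ E p.1 p.2 * M p.2) := by
    simp_rw [hEform]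
    have := hQc A0
    fun_prop
  have hfund : ∀ ξ, E 1 ξ - E 0 ξ = ∫ θ in ō..1, E θ ξ * M ξ := by
    intro ξ
    rw [intervalIntegral.integral_eq_sub_of_hasDerivAt (fun θ _ ↦ hder ξ θ)]
    exact (hEc.comp (by fun_prop : Continuous fun θ : ℝ ↦ (θ, ξ))).intervalIntegrable _ _
  have hsm : 0 < min s0 s1 := lt_min hs0 hs1
  have hPM : Function.HasTemperateGrowth (fun ξ ↦ P ξ * M ξ) := by
    refine hP.1.mul ¿
    refine Function.HasTemperateGrowth.sub (Function.HasTemperateGrowth.neg ¿) ¿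
    · refine (Function.HasTemperateGrowth.const _).mul (Function.HasTemperateGrowth.comp Function.Complex.hasTemperateGrowth_ofReal ¿)
      exact ((innerSL ℝ).flip y).hasTemperateGrowth
    · refine Function.HasTemperateGrowth.comp Function.Complex.hasTemperateGrowth_ofReal ¿
      refine (Function.HasTemperateGrowth.const _).mul (Function.HasTemperateGrowth.sum fun i _ ↦ Function.HasTemperateGrowth.sum fun j _ ↦ ¿)
      exact ((Function.HasTemperateGrowth.const _).mul (coord_tg i)).mul (coord_tg j)
  have hθs : ∀ θ ∈ Icc ō 1, min s0 s1 ≤ (1 - θ) * s0 + θ * s1 := by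
    intro θ hθ
    nlinarith [min_le_left s0 s1, min_le_right s0 s1, hθ.1, hθ.2]
  have hint : Integrable (uncurry fun θ ξ ↦ E θ ξ * M ξ) ((volume.restrict (Ioc ō 1)).prod volume) := by
    refine ((tg_exp_int hPM (c := 4 * π ^ 2 * δ * min s0 s1) ƥ).comp_snd (volume.restrict (Ioc ō 1))).mono' hEc.aestronglyMeasurable ¿
    rw [← Measure.restrict_univ (μ := (volume : Measure (Spc d))), Measure.prod_restrict]
    refine (ae_restrict_iff' (measurableSet_Ioc.prod MeasurableSet.univ)).2 (of_forall ¿)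
    rintro ⟨θ, ξ⟩ ⟨hθ, -⟩
    have hθ' : θ ∈ Icc ō 1 := ⟨hθ.1.le, hθ.2⟩
    simp only [uncurry, hE]
    rw [norm_mul, norm_mul, cexp_norm, one_mul, norm_mul, norm_mul, mul_right_comm]
    gcongr
    refine (gA_le (EL_conv hA0 hA1 hθ') ξ).trans (exp_le_exp.2 ¿)
    have := mul_le_mul_of_nonneg_left (hθs θ hθ') (show 0 ≤ 4 * π ^ 2 * δ * ‖ξ‖ ^ 2 by positivity)
    nlinarith
  have hA1' : A0 + (1:ℝ) • B = A1 := by rw [hB]; simp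
  have hx1' : x0 + (1:ℝ) • y = x1 := by rw [hy]; simp
  have hEint : ∀ θ ∈ Icc ō 1, Integrable (E θ) := fun θ hθ ↦
    cexp_int (PgA_int hδ (hsm.trans_le (hθs θ hθ)) (EL_conv hA0 hA1 hθ) hP.1)
  have e1 : KF P A1 x1 - KF P A0 x0 = ∫ θ in Ioc ō 1, ∫ ξ, E θ ξ * M ξ := by
    rw [integral_integral_swap hint]
    simp_rw [← intervalIntegral.integral_of_le (zero_le_one (α := ℝ)), ← hfund]
    rw [integral_sub (hEint 1 ş) (hEint 0 ş), KF_eq, KF_eq]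
    simp only [hE, hA1', hx1', zero_smul, add_zero]
  rw [e1]
  set Bd := (∑ k, 2 * π * C1 k) * (‖y‖ / R ^ (d + (m + 1))) + (∑ k, ∑ l, 4 * π ^ 2 * C2 k l) * (a / R ^ (d + (m + 1 + 1))) with hBd
  have hbound : ∀ θ ∈ Ioc ō 1, ‖∫ ξ, E θ ξ * M ξ‖ ≤ Bd := by
    intro θ hθ
    have hθ' : θ ∈ Icc ō 1 := ⟨hθ.1.le, hθ.2⟩
    set Aθ := A0 + θ • B
    set xθ := x0 + θ • y
    set sθ := (1 - θ) * s0 + θ * s1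
    have hsθ : 0 < sθ := hsm.trans_le (hθs θ hθ')
    have hEL : EL δ sθ Aθ := EL_conv hA0 hA1 hθ'
    have hEL' : EL δ (sqrt sθ ^ 2) Aθ := by rwa [sq_sqrt hsθ.le]
    have hi1 : ∀ k, Integrable fun ξ ↦ Complex.exp (-(2 * π * Complex.I * (inner ℝ ξ xθ : ℝ))) * (((ξ k : ℂ) * P ξ) * gA Aθ ξ) :=
      fun k ↦ cexp_int (PgA_int hδ hsθ hEL (Hom_coord hP k).1)
    have hi2 : ∀ k l, Integrable fun ξ ↦ Complex.exp (-(2 * π * Complex.I * (inner ℝ ξ xθ : ℝ))) * (((ξ k : ℂ) * ((ξ l : ℂ) * P ξ)) * gA Aθ ξ) :=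
      fun k l ↦ cexp_int (PgA_int hδ hsθ hEL (Hom_coord (Hom_coord hP l) k).1)
    have e2 : ∫ ξ, E θ ξ * M ξ = (∑ k, (-(2 * π * Complex.I * (y k : ℝ))) * KF (fun ξ ↦ (ξ k : ℂ) * P ξ) Aθ xθ) +
        ∑ k, ∑ l, (-(4 * π ^ 2 * B k l : ℝ) : ℂ) * KF (fun ξ ↦ (ξ k : ℂ) * ((ξ l : ℂ) * P ξ)) Aθ xθ := by
      simp_rw [KF_eq, ← integral_const_mul]
      rw [← integral_finset_sum _ (fun k _ ↦ (hi1 k).const_mul _)]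
      simp_rw [← integral_finset_sum _ (fun l _ ↦ (hi2 _ l).const_mul _)]
      rw [← integral_finset_sum _ (fun k _ ↦ integrable_finset_sum _ fun l _ ↦ (hi2 k l).const_mul _),
        ← integral_add (integrable_finset_sum _ fun k _ ↦ (hi1 k).const_mul _)
          (integrable_finset_sum _ fun k _ ↦ integrable_finset_sum _ fun l _ ↦ (hi2 k l).const_mul _)]
      refine integral_congr_ae (of_forall fun ξ ↦ ¿)
      simp only [hE, hM, QF, PiLp.inner_apply, RCLike.inner_apply, conj_trivial]
      push_cast
      rw [mul_sub, sub_eq_add_neg]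
      simp only [mul_sum, ← sum_neg_distrib]
      congr 1
      · refine sum_congr rfl fun k _ ↦ ¿
        ring
      · refine sum_congr rfl fun k _ ↦ sum_congr rfl fun l _ ↦ ¿
        ring
    rw [e2]
    refine (norm_add_le _ _).trans (add_le_add ((norm_sum_le _ _).trans ¿) ((norm_sum_le _ _).trans ¿))
    · rw [sum_mul]
      refine sum_le_sum fun k _ ↦ ¿
      have := h1 k _ R (sqrt_pos.2 hsθ) hR Aθ hEL' xθ (hRθ θ hθ')
      rw [norm_mul, norm_neg]
      simp only [norm_mul, norm_real, Complex.norm_I, Complex.norm_ofNat, mul_one, norm_of_nonneg Real.pi_pos.le]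
      calc _ ≤ 2 * π * ‖y‖ * (C1 k / R ^ (d + (m + 1))) := by
            gcongr; exact norm_apply_le y k
        _ = _ := by ring
    · rw [sum_mul]
      refine sum_le_sum fun k _ ↦ (norm_sum_le _ _).trans ¿
      rw [sum_mul]
      refine sum_le_sum fun l _ ↦ ¿
      have := h2 k l _ R (sqrt_pos.2 hsθ) hR Aθ hEL' xθ (hRθ θ hθ')
      rw [norm_mul, norm_neg, norm_real, norm_mul, norm_of_nonneg (show 0 ≤ 4 * π ^ 2 by positivity)]
      calc _ ≤ 4 * π ^ 2 * a * (C2 k l / R ^ (d + (m + 1 + 1))) := by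
            gcongr; exact ha k l
        _ = _ := by ring
  have := norm_setIntegral_le_of_norm_le_const (μ := volume) (s := Ioc ō 1) ş hbound
  refine this.trans ¿
  have e3 : volume.real (Ioc ō 1) = 1 := by simp
  rw [e3, mul_one, hBd, mul_add]
  have : 0 ≤ ‖y‖ / R ^ (d + (m + 1)) := by positivity
  have : 0 ≤ a / R ^ (d + (m + 1 + 1)) := by positivity
  gcongr <;> linarith
def phi (ε s : ℝ) : ℝ := max 0 (min 1 (s / ε - 1))
lemma phi_nn (ε s : ℝ) : 0 ≤ phi ε s := le_max_left _ _
lemma phi_le (ε s : ℝ) : phi ε s ≤ 1 := max_le zero_le_one (min_le_left _ _)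
lemma phi_zero (hε : 0 < ε) (h : s ≤ ε) : phi ε s = 0 := by
  have : s / ε ≤ 1 := (div_le_one hε).2 h
  rw [phi, max_eq_left]; exact (min_le_right _ _).trans ł
lemma phi_one (hε : 0 < ε) (h : 2 * ε ≤ s) : phi ε s = 1 := by
  have : 2 ≤ s / ε := (le_div_iff₀ hε).2 h
  rw [phi, min_eq_left ł, max_eq_right zero_le_one]
lemma phi_lip (hε : 0 < ε) (s t : ℝ) : |phi ε s - phi ε t| ≤ |s - t| / ε := by
  unfold phi
  refine (abs_max_sub_max_le_max _ _ _ _).trans ¿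
  rw [sub_self, abs_zero, max_eq_right (abs_nonneg _)]
  refine (abs_min_sub_min_le_max _ _ _ _).trans ¿
  rw [sub_self, abs_zero, max_eq_right (abs_nonneg _), sub_sub_sub_cancel_right, ← sub_div, abs_div, abs_of_pos hε]
lemma phi_diff (hε : 0 < ε) {t m : ℝ} (hm : 0 < m) (h1 : m ≤ s) (h2 : m ≤ t) : |phi ε s - phi ε t| ≤ 2 * |s - t| / m := by
  rcases le_total (2 * ε) m with h | h
  · rw [phi_one hε (h.trans h1), phi_one hε (h.trans h2)]; simp; positivity
  · refine (phi_lip hε s t).trans ¿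
    rw [div_le_div_iff₀ hε hm]
    nlinarith [abs_nonneg (s - t)]
def HH (P : Spc d → ℂ) (ε : ℝ) (A : Mq d) (s : ℝ) (x : Spc d) : ℝ := phi ε s * (KF P A x).re
lemma HH_le (P : Spc d → ℂ) (ε : ℝ) (A : Mq d) (s : ℝ) (x : Spc d) : |HH P ε A s x| ≤ ‖KF P A x‖ := by
  rw [HH, abs_mul, abs_of_nonneg (phi_nn _ _)]
  exact (mul_le_of_le_one_left (abs_nonneg _) (phi_le _ _)).trans (abs_re_le_norm _)
lemma Hreg (δ : ℝ) (hδ : 0 < δ) (hP : Hom 2 P) : ∃ C : ℝ, 0 < C ∧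
    ∀ ε, 0 < ε → ∀ (s0 s1 : ℝ) (A0 A1 : Mq d) (x0 x1 : Spc d) (l R : ℝ), 0 < l → 4 * l ≤ R →
      (0 < s0 → EL δ s0 A0) → (0 < s1 → EL δ s1 A1) → |s1 - s0| ≤ l ^ 2 → (∀ i j, |A1 i j - A0 i j| ≤ 2 * δ⁻¹ * l ^ 2) →
      ‖x1 - x0‖ ≤ l → (R ^ 2 ≤ |s0| ∨ R ≤ ‖x0‖) → |HH P ε A1 s1 x1 - HH P ε A0 s0 x0| ≤ C * l / R ^ (d + 3) := by
  obtain ⟨C, hC, hK⟩ := KB2 δ hδ hP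
  obtain ⟨D, hD, hK'⟩ := diffK δ hδ hP
  refine ⟨(2 * (C * 3) + 3 * C + D * (1 + 2 * δ⁻¹)) * 2 ^ (d + 4), by positivity, ¿⟩
  intro ε hε s0 s1 A0 A1 x0 x1 l R hl hlR hA0 hA1 hs hA hx hor
  have hR : 0 < R := by linarith
  have hR2 : 0 < R / 2 := by linarith
  have hs' := abs_le.1 hs
  have hx1 : ‖x0‖ - l ≤ ‖x1‖ := by
    have := norm_sub_norm_le x0 x1; rw [norm_sub_rev] at this; linarith
  have hl2 : l ^ 2 / (R / 2) ^ (d + 4) ≤ 2 ^ (d + 4) * (l / R ^ (d + 3)) := by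
    rw [div_pow, div_div_eq_mul_div, mul_comm (l ^ 2), mul_div_assoc]
    refine mul_le_mul_of_nonneg_left ¿ ƥ
    rw [div_le_div_iff₀ ƥ ƥ, pow_succ R (d + 3)]
    have : l ≤ R := by linarith
    have h3 : 0 ≤ l * R ^ (d + 3) := by positivity
    nlinarith
  have hl1 : l / (R / 2) ^ (d + 3) ≤ 2 ^ (d + 4) * (l / R ^ (d + 3)) := by
    rw [div_pow, div_div_eq_mul_div, mul_comm l, mul_div_assoc]
    refine mul_le_mul_of_nonneg_right (pow_le_pow_right₀ ñ (by omega)) ƥ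
  have hT : ∀ s A (x : Spc d), (0 < s → EL δ s A) → R / 2 ≤ sqrt s + ‖x‖ → |HH P ε A s x| ≤ C * max s 0 / (R / 2) ^ (d + 4) := by
    intro s A x hA hx
    rcases le_or_gt s 0 with h0 | h0
    · rw [HH, phi_zero hε ł, zero_mul, abs_zero]; positivity
    · refine (HH_le _ _ _ _ _).trans ¿
      have := hK _ (R / 2) (sqrt_pos.2 h0) hR2 A (by rw [sq_sqrt h0.le]; exact hA h0) x hx
      rwa [sq_sqrt h0.le, ← max_eq_left h0.le] at this
  set X := l / R ^ (d + 3) with hX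
  have hX0 : 0 ≤ X := by positivity
  have h2 : ō < 2 ^ (d + 4) := by positivity
  have hδi : 0 < δ⁻¹ := by positivity
  rw [mul_div_assoc, ← hX]
  rcases le_or_gt s0 (2 * l ^ 2) with hc | hc
  · rcases hor with ho | ho
    · have h1 : s0 < 0 := by
        by_contra h; push Not at h; rw [abs_of_nonneg h] at ho; nlinarith
      rw [abs_of_neg h1] at ho
      rw [HH, HH, phi_zero hε ŋ, phi_zero hε ł]; simp; positivity
    · have e0 := hT s0 A0 x0 hA0 (by have := sqrt_nonneg s0; linarith)
      have e1 := hT s1 A1 x1 hA1 (by have := sqrt_nonneg s1; linarith)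
      have m : ∀ s, s ≤ 3 * l ^ 2 → C * max s 0 / (R / 2) ^ (d + 4) ≤ C * 3 * (2 ^ (d + 4) * X) := by
        intro s h
        refine le_trans ¿ (mul_le_mul_of_nonneg_left hl2 ƥ)
        rw [← mul_div_assoc, mul_assoc]
        gcongr
        exact max_le h ƥ
      have := m s0 ŋ; have := m s1 ŋ
      refine (abs_sub _ _).trans ¿
      have q1 : 0 ≤ (3 * C + D * (1 + 2 * δ⁻¹)) * 2 ^ (d + 4) * X := by positivity
      nlinarith
  · have hs0 : 0 < s0 := by nlinarith
    have hs1 : s0 / 2 ≤ s1 := by nlinarith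
    have hs1' : 0 < s1 := by linarith
    have hRθ : ∀ θ ∈ Icc ō 1, R / 2 ≤ sqrt ((1 - θ) * s0 + θ * s1) + ‖x0 + θ • (x1 - x0)‖ := by
      intro θ hθ
      rcases hor with ho | ho
      · rw [abs_of_pos hs0] at ho
        have : R / 2 ≤ sqrt ((1 - θ) * s0 + θ * s1) := by
          apply Real.le_sqrt_of_sq_le
          nlinarith [hθ.1, hθ.2]
        linarith [norm_nonneg (x0 + θ • (x1 - x0))]
      · have h1 := norm_sub_le_norm_add x0 (θ • (x1 - x0))
        rw [norm_smul, norm_of_nonneg hθ.1] at h1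
        have : θ * ‖x1 - x0‖ ≤ l := (mul_le_of_le_one_left (norm_nonneg _) hθ.2).trans hx
        linarith [sqrt_nonneg ((1 - θ) * s0 + θ * s1)]
    have e1 := hK' s0 s1 (R / 2) hs0 hs1' hR2 A0 A1 (hA0 hs0) (hA1 hs1') x0 x1 hRθ (2 * δ⁻¹ * l ^ 2) ƥ hA
    have e2 := hK _ (R / 2) (sqrt_pos.2 hs1') hR2 A1 (by rw [sq_sqrt hs1'.le]; exact hA1 hs1') x1 (by
      have := hRθ 1 ş; simpa using this)
    rw [sq_sqrt hs1'.le] at e2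
    have e3 := phi_diff hε (half_pos hs0) hs1 (by linarith : s0 / 2 ≤ s0)
    have key : HH P ε A1 s1 x1 - HH P ε A0 s0 x0 = (phi ε s1 - phi ε s0) * (KF P A1 x1).re + phi ε s0 * (KF P A1 x1 - KF P A0 x0).re := by
      simp only [HH, Complex.sub_re]; ring
    rw [key]
    refine (abs_add_le _ _).trans ¿
    rw [abs_mul, abs_mul, abs_of_nonneg (phi_nn _ _)]
    have f1 : |phi ε s1 - phi ε s0| * |(KF P A1 x1).re| ≤ 6 * C * (2 ^ (d + 4) * X) := by
      calc _ ≤ (2 * l ^ 2 / (s0 / 2)) * (C * s1 / (R / 2) ^ (d + 2 + 2)) :=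
            mul_le_mul (e3.trans (by gcongr)) ((abs_re_le_norm _).trans e2) (abs_nonneg _) ƥ
        _ = 4 * C * (s1 / s0) * (l ^ 2 / (R / 2) ^ (d + 4)) := by field_simp; ring
        _ ≤ 4 * C * (3 / 2) * (2 ^ (d + 4) * X) := by
            have hq : s1 / s0 ≤ 3 / 2 := by rw [div_le_iff₀ hs0]; nlinarith
            exact mul_le_mul (mul_le_mul_of_nonneg_left hq ƥ) hl2 ƥ ƥ
        _ = _ := by ring
    have f2 : phi ε s0 * |(KF P A1 x1 - KF P A0 x0).re| ≤ D * (1 + 2 * δ⁻¹) * (2 ^ (d + 4) * X) := by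
      refine (mul_le_of_le_one_left (abs_nonneg _) (phi_le _ _)).trans ((abs_re_le_norm _).trans (e1.trans ¿))
      rw [mul_assoc D]
      refine mul_le_mul_of_nonneg_left ¿ hD.le
      rw [mul_div_assoc, add_mul, one_mul]
      refine add_le_add (le_trans ¿ hl1) (mul_le_mul_of_nonneg_left hl2 ƥ)
      gcongr
    have q1 : 0 ≤ C * 2 ^ (d + 4) * X := by positivity
    nlinarith
def Nice (h : Fn d) : Prop := Measurable h ∧ (∃ M, ∀ z, |h z| ≤ M) ∧ ∃ R, 0 < R ∧ ∀ z, z ∉ pbox 0 R → h z = 0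
def L2n (h : Fn d) : ℰ := ∫⁻ z, ‖h z‖ₑ ^ (2:ℝ)
structure CZ (κ : Pt d → Fn d) (C : ℝ) : Prop where
  meas : Measurable (uncurry κ)
  bdd : ∃ B, ∀ z w, |κ z w| ≤ B
  reg1 : ∀ z z' w : Pt d, ∀ l R : ℝ, 0 < l → 4 * l ≤ R → |z'.1 - z.1| ≤ l ^ 2 → ‖z'.2 - z.2‖ ≤ l → w ∉ pbox z R →
    |κ z' w - κ z w| ≤ C * l / R ^ (d + 3)
  reg2 : ∀ z z' w : Pt d, ∀ l R : ℝ, 0 < l → 4 * l ≤ R → |z'.1 - z.1| ≤ l ^ 2 → ‖z'.2 - z.2‖ ≤ l → w ∉ pbox z R →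
    |κ w z' - κ w z| ≤ C * l / R ^ (d + 3)
  l2 : ∀ h g : Fn d, Nice h → Nice g →
    ‖∫ z, (∫ w, κ z w * h w) * g z‖ₑ ≤ ofReal C * (L2n h + L2n g)
structure Al (δ : ℝ) (α : ℝ → Mq d) : Prop where
  meas : ∀ i j, Measurable fun t ↦ α t i j
  ell : ∀ t, EL δ 1 (α t)
def AA (α : ℝ → Mq d) (t τ : ℝ) : Mq d := fun i j ↦ ∫ s in t..τ, α s i j
lemma Al.bd (hδ : 0 < δ) (h : Al δ α) (t : ℝ) (i j : Fin d) : ‖α t i j‖ ≤ 2 * δ⁻¹ := by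
  simpa using EL_entry hδ zero_le_one (h.ell t) i j
lemma Al.int (hδ : 0 < δ) (h : Al δ α) (i j : Fin d) (a b : ℝ) :
    IntervalIntegrable (fun s ↦ α s i j) volume a b := by
  refine (intervalIntegrable_const (c := 2 * δ⁻¹)).mono_fun (h.meas i j).aestronglyMeasurable (of_forall fun t ↦ ¿)
  exact (h.bd hδ t i j).trans (le_abs_self _)
lemma AA_lip (hδ : 0 < δ) (h : Al δ α) (i j : Fin d) (t τ : ℝ) :
    |AA α t τ i j| ≤ 2 * δ⁻¹ * |τ - t| := by
  exact intervalIntegral.norm_integral_le_of_norm_le_const fun s _ ↦ h.bd hδ s i j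
lemma AA_add (hδ : 0 < δ) (h : Al δ α) (t σ τ : ℝ) :
    AA α t τ = AA α t σ + AA α σ τ := by
  ext i j
  exact (intervalIntegral.integral_add_adjacent_intervals (h.int hδ i j _ _) (h.int hδ i j _ _)).symm
lemma AA_EL (hδ : 0 < δ) (h : Al δ α) {t τ : ℝ} (ht : t ≤ τ) :
    EL δ (τ - t) (AA α t τ) := by
  refine ⟨fun i j ↦ ¿, fun ξ ↦ ¿⟩
  · simp only [AA, (h.ell _).1 i j]
  have hij : ∀ i j, IntervalIntegrable (fun s ↦ α s i j * ξ i * ξ j) volume t τ := fun i j ↦ ((h.int hδ i j t τ).mul_const _).mul_const _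
  have hii : ∀ i, IntervalIntegrable (fun s ↦ ∑ j, α s i j * ξ i * ξ j) volume t τ := fun i ↦ by
    simpa only [sum_fn] using IntervalIntegrable.sum Finset.univ (fun j _ ↦ hij i j)
  have hi : IntervalIntegrable (fun s ↦ ∑ i, ∑ j, α s i j * ξ i * ξ j) volume t τ := by
    simpa only [sum_fn] using IntervalIntegrable.sum Finset.univ (fun i _ ↦ hii i)
  have e : ∑ i, ∑ j, AA α t τ i j * ξ i * ξ j = ∫ s in t..τ, ∑ i, ∑ j, α s i j * ξ i * ξ j := by
    rw [intervalIntegral.integral_finset_sum fun i _ ↦ hii i]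
    refine sum_congr rfl fun i _ ↦ ¿
    rw [intervalIntegral.integral_finset_sum fun j _ ↦ hij i j]
    refine sum_congr rfl fun j _ ↦ ¿
    rw [intervalIntegral.integral_mul_const, intervalIntegral.integral_mul_const]; rfl
  rw [e]
  constructor
  · have := intervalIntegral.integral_mono_on ht (intervalIntegrable_const (c := δ * 1 * ∑ i, ξ i ^ 2)) hi fun s _ ↦ ((h.ell s).2 ξ).1
    rw [intervalIntegral.integral_const, smul_eq_mul] at this; linarith
  · have := intervalIntegral.integral_mono_on ht hi (intervalIntegrable_const (c := δ⁻¹ * 1 * ∑ i, ξ i ^ 2)) fun s _ ↦ ((h.ell s).2 ξ).2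
    rw [intervalIntegral.integral_const, smul_eq_mul] at this; linarith
lemma AA_cont (hδ : 0 < δ) (h : Al δ α) (i j : Fin d) :
    Continuous fun p : ℝ × ℝ ↦ AA α p.1 p.2 i j := by
  have e : (fun p : ℝ × ℝ ↦ AA α p.1 p.2 i j) = fun p ↦ AA α 0 p.2 i j - AA α 0 p.1 i j := by
    ext p; rw [AA_add hδ h 0 p.1 p.2]; simp
  have := intervalIntegral.continuous_primitive (h.int hδ i j) 0
  rw [e]
  exact (this.comp continuous_snd).sub (this.comp continuous_fst)
def PP (i j : Fin d) : Spc d → ℂ := fun ξ ↦ (ξ i : ℂ) * ((ξ j : ℂ) * (-(4 * π ^ 2) : ℝ))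
lemma PP_hom (i j : Fin d) : Hom 2 (PP i j) :=
  Hom_coord (Hom_coord (m := 0) ⟨Function.HasTemperateGrowth.const _, fun r ξ ↦ by simp⟩ j) i
lemma PP_norm (i j : Fin d) (ξ : Spc d) : ‖PP i j ξ‖ ≤ 4 * π ^ 2 * ‖ξ‖ ^ 2 := by
  rw [PP, norm_mul, norm_mul, norm_real, norm_real, norm_real, norm_neg, norm_of_nonneg (show 0 ≤ 4 * π ^ 2 by positivity)]
  have h1 := norm_apply_le ξ i
  have h2 := norm_apply_le ξ j
  calc _ ≤ ‖ξ‖ * (‖ξ‖ * (4 * π ^ 2)) := by gcongr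
    _ = _ := by ring
def kap (i j : Fin d) (ε : ℝ) (α : ℝ → Mq d) (z w : Pt d) : ℝ :=
  HH (PP i j) ε (AA α z.1 w.1) (w.1 - z.1) (w.2 - z.2)
lemma KF_meas (hδ : 0 < δ) (h : Al δ α) (hP : Continuous P) :
    Measurable fun p : Pt d × Pt d ↦ KF P (AA α p.1.1 p.2.1) (p.2.2 - p.1.2) := by
  simp_rw [KF_eq]
  have h' := AA_cont hδ h
  have hc : Continuous fun q : (Pt d × Pt d) × Spc d ↦ Complex.exp (-(2 * π * Complex.I * (inner ℝ q.2 (q.1.2.2 - q.1.1.2) : ℝ))) * (P q.2 * gA (AA α q.1.1.1 q.1.2.1) q.2) := by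
    have h2 : Continuous fun q : (Pt d × Pt d) × Spc d ↦ QF (AA α q.1.1.1 q.1.2.1) q.2 := by
      unfold QF
      refine continuous_const.mul (continuous_finset_sum _ fun i _ ↦ continuous_finset_sum _ fun j _ ↦ ¿)
      have := (h' i j).comp (show Continuous fun q : (Pt d × Pt d) × Spc d ↦ (q.1.1.1, q.1.2.1) by fun_prop)
      exact (this.mul ʄ).mul ʄ
    unfold gA
    fun_prop
  exact (hc.stronglyMeasurable.integral_prod_right (ν := volume)).measurable
lemma kap_reg (δ : ℝ) (hδ : 0 < δ) (i j : Fin d) : ∃ C : ℝ, 0 < C ∧ ∀ ε, 0 < ε → ∀ α : ℝ → Mq d, Al δ α →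
    Measurable (uncurry (kap i j ε α)) ∧ (∃ B, ∀ z w, |kap i j ε α z w| ≤ B) ∧
    (∀ z z' w : Pt d, ∀ l R : ℝ, 0 < l → 4 * l ≤ R → |z'.1 - z.1| ≤ l ^ 2 → ‖z'.2 - z.2‖ ≤ l → w ∉ pbox z R →
    |kap i j ε α z' w - kap i j ε α z w| ≤ C * l / R ^ (d + 3)) ∧
    (∀ z z' w : Pt d, ∀ l R : ℝ, 0 < l → 4 * l ≤ R → |z'.1 - z.1| ≤ l ^ 2 → ‖z'.2 - z.2‖ ≤ l → w ∉ pbox z R →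
    |kap i j ε α w z' - kap i j ε α w z| ≤ C * l / R ^ (d + 3)) := by
  obtain ⟨C, hC, hreg⟩ := Hreg δ hδ (PP_hom i j)
  obtain ⟨D, hD, hK⟩ := KB0 δ hδ (PP_hom i j)
  have box : ∀ (z w : Pt d) R, 0 < R → w ∉ pbox z R → R ^ 2 ≤ |w.1 - z.1| ∨ R ≤ ‖w.2 - z.2‖ := by
    intro z w R hR hw
    by_contra hc
    push Not at hc
    have h1 := abs_lt.1 hc.1
    exact hw ⟨⟨by linarith, by linarith⟩, by rw [mem_ball, dist_eq_norm]; exact hc.2⟩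
  refine ⟨C, hC, fun ε hε α h ↦ ⟨¿, ⟨D / (sqrt ε) ^ (d + 2), fun z w ↦ ¿⟩, ¿, ¿⟩⟩
  · have := KF_meas hδ h (PP_hom i j).1.1.continuous
    have hphi : Measurable (phi ε) := by unfold phi; fun_prop
    unfold kap HH uncurry
    exact (hphi.comp (show Measurable fun p : Pt d × Pt d ↦ p.2.1 - p.1.1 by fun_prop)).mul (measurable_re.comp this)
  · rcases le_or_gt (w.1 - z.1) ε with h1 | h1
    · rw [kap, HH, phi_zero hε h1, zero_mul, abs_zero]; positivity
    · refine (HH_le _ _ _ _ _).trans ¿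
      have h0 : 0 < w.1 - z.1 := by linarith
      refine hK (sqrt (w.1 - z.1)) _ (sqrt_pos.2 h0) (sqrt_pos.2 hε) _ ¿ _ ¿
      · rw [sq_sqrt h0.le]; exact AA_EL hδ h ł
      · have := Real.sqrt_le_sqrt h1.le; have := norm_nonneg (w.2 - z.2); linarith
  · intro z z' w l R hl hR ht hx hw
    refine hreg ε hε _ _ _ _ _ _ l R hl hR (fun h0 ↦ AA_EL hδ h ł) (fun h0 ↦ AA_EL hδ h ł) ¿ (fun a b ↦ ¿) ¿ (box z w R ł hw)
    · rwa [sub_sub_sub_cancel_left, abs_sub_comm]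
    · rw [AA_add hδ h z'.1 z.1 w.1, Matrix.add_apply, add_sub_cancel_right]
      refine (AA_lip hδ h a b _ _).trans ¿
      rw [abs_sub_comm]; gcongr
    · rwa [sub_sub_sub_cancel_left, norm_sub_rev]
  · intro z z' w l R hl hR ht hx hw
    refine hreg ε hε _ _ _ _ _ _ l R hl hR (fun h0 ↦ AA_EL hδ h ł) (fun h0 ↦ AA_EL hδ h ł) ¿ (fun a b ↦ ¿) ¿ ¿
    · rwa [sub_sub_sub_cancel_right]
    · rw [AA_add hδ h w.1 z.1 z'.1, Matrix.add_apply, add_sub_cancel_left]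
      refine (AA_lip hδ h a b _ _).trans ¿
      gcongr
    · rwa [sub_sub_sub_cancel_right]
    · have := box z w R ł hw
      rwa [abs_sub_comm, norm_sub_rev] at this
lemma four_cont {f : Spc d → ℂ} (hf : Integrable f) : Continuous (𝓕 f) :=
  VectorFourier.fourierIntegral_continuous Real.continuous_fourierChar continuous_inner hf
lemma four_bd (f : Spc d → ℂ) (ξ : Spc d) : ‖𝓕 f ξ‖ ≤ ∫ x, ‖f x‖ :=
  VectorFourier.norm_fourierIntegral_le_integral_norm _ _ _ _ _
lemma four_adj {f g : Spc d → ℂ} (hf : Integrable f) (hg : Integrable g) : ∫ ξ, 𝓕 f ξ * g ξ = ∫ ξ, f ξ * 𝓕 g ξ := by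
  simpa using! VectorFourier.integral_fourierIntegral_smul_eq_flip (L := innerₗ (Spc d)) Real.continuous_fourierChar continuous_inner hf hg
lemma four_adj' {f g : Spc d → ℂ} (hf : Integrable f) (hg : Integrable g) : ∫ ξ, 𝓕⁻ f ξ * g ξ = ∫ ξ, f ξ * 𝓕⁻ g ξ := by
  simp_rw [fourierInv_eq_fourier_neg f, Real.fourierInv_eq_fourier_comp_neg g]
  rw [← integral_neg_eq_self]
  simp_rw [neg_neg]
  exact four_adj hf hg.comp_neg
lemma four_int {f g : Spc d → ℂ} (hf : Integrable f) (hg : Integrable g) : Integrable fun ξ ↦ f ξ * 𝓕 g ξ :=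
  hf.mul_bdd (c := ∫ x, ‖g x‖) (four_cont hg).aestronglyMeasurable (of_forall fun ξ ↦ four_bd g ξ)
lemma slice1 {Φ H : Spc d → ℂ} (hΦ : Integrable Φ) (hH : Integrable H) (x : Spc d) :
    ∫ y, 𝓕 Φ (y - x) * H y = 𝓕⁻ (fun ξ ↦ Φ ξ * 𝓕 H ξ) x := by
  have hi : Integrable fun ξ ↦ Complex.exp (-(2 * π * Complex.I * (inner ℝ ξ (-x) : ℝ))) * Φ ξ := cexp_int hΦ
  have e : ∀ y, 𝓕 Φ (y - x) = 𝓕 (fun ξ ↦ Complex.exp (-(2 * π * Complex.I * (inner ℝ ξ (-x) : ℝ))) * Φ ξ) y := by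
    intro y
    rw [fourier_eq', fourier_eq']
    refine integral_congr_ae (of_forall fun ξ ↦ ¿)
    simp only [smul_eq_mul, ← mul_assoc, ← Complex.exp_add, inner_sub_right, inner_neg_right]
    congr 2; push_cast; ring
  simp_rw [e]
  rw [four_adj hi hH, fourierInv_eq']
  refine integral_congr_ae (of_forall fun ξ ↦ ¿)
  simp only [smul_eq_mul, ← mul_assoc, inner_neg_right]
  congr 3; push_cast; ring
lemma slice {Φ H G : Spc d → ℂ} (hΦ : Integrable Φ) (hH : Integrable H) (hG : Integrable G) :
    ∫ x, (∫ y, 𝓕 Φ (y - x) * H y) * G x = ∫ ξ, Φ ξ * 𝓕 H ξ * 𝓕⁻ G ξ := by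
  simp_rw [slice1 hΦ hH]
  exact four_adj' (four_int hΦ hH) hG
lemma inv_conj (G : Spc d → ℝ) (ξ : Spc d) : 𝓕⁻ (fun x ↦ (G x : ℂ)) ξ = conj (𝓕 (fun x ↦ (G x : ℂ)) ξ) := by
  rw [fourier_eq', fourierInv_eq', ← integral_conj]
  refine integral_congr_ae (of_forall fun x ↦ ¿)
  simp only [smul_eq_mul, map_mul, Complex.conj_ofReal, ← Complex.exp_conj, Complex.conj_I]
  congr 2; push_cast; ring
lemma KF_L1 (δ : ℝ) (hδ : 0 < δ) : ∃ C : ℝ, 0 < C ∧ ∀ r, 0 < r → ∀ A : Mq d, EL δ (r ^ 2) A →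
    Integrable (KF (fun _ ↦ 1) A) ∧ Integrable (fun x ↦ ‖x‖ * ‖KF (fun _ ↦ 1) A x‖) ∧ (∫ x, ‖KF (fun _ ↦ 1) A x‖) ≤ C ∧ (∫ x, ‖x‖ * ‖KF (fun _ ↦ 1) A x‖) ≤ C * r := by
  obtain ⟨C, hC, h⟩ := KB δ hδ (Hom_one (d := d)) (d + 2)
  have hJ : 0 ≤ ∫ x : Spc d, JB x := integral_nonneg JB_nn
  refine ⟨C * (∫ x : Spc d, JB x) + 1, by positivity, fun r hr A hA ↦ ¿⟩
  have hc : Continuous (KF (fun _ ↦ 1) A) := four_cont (PgA_int hδ ƥ hA (Function.HasTemperateGrowth.const 1))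
  have hJr : Integrable fun x : Spc d ↦ JB (r⁻¹ • x) := JB_int.comp_smul ƥ
  have hJi : ∫ x : Spc d, JB (r⁻¹ • x) = r ^ d * ∫ x : Spc d, JB x := by
    rw [Measure.integral_comp_smul, finrank_euclideanSpace_fin, inv_pow, inv_inv, abs_of_pos ƥ, smul_eq_mul]
  have b0 : ∀ x, (1 + ‖r⁻¹ • x‖) * ‖KF (fun _ ↦ 1) A x‖ ≤ C * (r ^ d)⁻¹ * JB (r⁻¹ • x) := by
    intro x
    have h1 := h r hr A hA x
    have e : r + ‖x‖ = r * (1 + ‖r⁻¹ • x‖) := by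
      rw [norm_smul, norm_inv, norm_of_nonneg hr.le]; field_simp
    rw [e, add_zero, mul_pow] at h1
    set Y := 1 + ‖r⁻¹ • x‖ with hY
    have hY0 : 0 < Y := by positivity
    rw [JB, ← hY, ← div_eq_mul_inv, ← div_eq_mul_inv, div_div, le_div_iff₀ ƥ]
    have : r ^ (d + 2) * (Y * ‖KF (fun _ ↦ 1) A x‖ * (r ^ d * Y ^ (d + 1))) ≤ r ^ (d + 2) * C := by
      calc _ = r ^ d * (r ^ (d + 2) * Y ^ (d + 2)) * ‖KF (fun _ ↦ 1) A x‖ := by ring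
        _ ≤ _ := by linarith
    exact le_of_mul_le_mul_left this ƥ
  have b1 : ∀ x, ‖KF (fun _ ↦ 1) A x‖ ≤ C * (r ^ d)⁻¹ * JB (r⁻¹ • x) := fun x ↦
    (le_mul_of_one_le_left (norm_nonneg _) (by have := norm_nonneg (r⁻¹ • x); linarith)).trans (b0 x)
  have b2 : ∀ x, ‖x‖ * ‖KF (fun _ ↦ 1) A x‖ ≤ r * (C * (r ^ d)⁻¹ * JB (r⁻¹ • x)) := fun x ↦ by
    have e : ‖x‖ = r * ‖r⁻¹ • x‖ := by rw [norm_smul, norm_inv, norm_of_nonneg hr.le]; field_simp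
    rw [e, mul_assoc]
    refine mul_le_mul_of_nonneg_left ((mul_le_mul_of_nonneg_right ¿ (norm_nonneg _)).trans (b0 x)) hr.le
    linarith
  have i1 : Integrable (KF (fun _ ↦ 1) A) := (hJr.const_mul (C * (r ^ d)⁻¹)).mono' hc.aestronglyMeasurable (of_forall b1)
  have i2 : Integrable (fun x ↦ ‖x‖ * ‖KF (fun _ ↦ 1) A x‖) := ((hJr.const_mul (C * (r ^ d)⁻¹)).const_mul r).mono' ʄ
    (of_forall fun x ↦ by rw [norm_of_nonneg ƥ]; exact b2 x)
  refine ⟨i1, i2, ¿, ¿⟩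
  · refine (integral_mono i1.norm (hJr.const_mul _) b1).trans ¿
    rw [integral_const_mul, hJi]
    field_simp; linarith
  · refine (integral_mono i2 ((hJr.const_mul _).const_mul r) b2).trans ¿
    rw [integral_const_mul, integral_const_mul, hJi]
    field_simp; linarith
lemma schur {E : Type*} [AddGroup E] [MeasurableSpace E] [MeasurableAdd₂ E] [MeasurableNeg E] (μ : Measure E) [SFinite μ] [μ.IsAddLeftInvariant] [μ.IsAddRightInvariant] [μ.IsNegInvariant]
    {k a b : E → ℰ} (hk : Measurable k) (ha : Measurable a) (hb : Measurable b) :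
    ∫⁻ x, ∫⁻ y, k (y - x) * (a y * b x) ∂μ ∂μ ≤ (∫⁻ s, k s ∂μ) * ((∫⁻ y, a y ^ (2:ℝ) ∂μ) + ∫⁻ y, b y ^ (2:ℝ) ∂μ) := by
  have sq : ∀ u v : ℰ, u * v ≤ u ^ (2:ℝ) + v ^ (2:ℝ) := by
    intro u v
    simp only [rpow_two, sq]
    rcases le_total u v with h | h
    · exact (mul_le_mul_left h v).trans le_add_self
    · exact (mul_le_mul_right h u).trans le_self_add
  have hk' : Measurable fun p : E × E ↦ k (p.2 - p.1) := hk.comp (measurable_snd.sub measurable_fst)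
  calc _ ≤ ∫⁻ x, ∫⁻ y, (k (y - x) * a y ^ (2:ℝ) + k (y - x) * b x ^ (2:ℝ)) ∂μ ∂μ := by
        refine lintegral_mono fun x ↦ lintegral_mono fun y ↦ ¿
        rw [← mul_add]; exact mul_le_mul_right (sq _ _) _
    _ = ∫⁻ x, ((∫⁻ y, k (y - x) * a y ^ (2:ℝ) ∂μ) + ∫⁻ y, k (y - x) * b x ^ (2:ℝ) ∂μ) ∂μ := by
        refine lintegral_congr fun x ↦ lintegral_add_left ¿ _
        exact (hk.comp (measurable_id.sub_const x)).mul (ha.pow_const _)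
    _ = (∫⁻ x, ∫⁻ y, k (y - x) * a y ^ (2:ℝ) ∂μ ∂μ) + ∫⁻ x, ∫⁻ y, k (y - x) * b x ^ (2:ℝ) ∂μ ∂μ := by
        refine lintegral_add_left ¿ _
        exact (hk'.mul ((ha.comp measurable_snd).pow_const _)).lintegral_prod_right'
    _ = _ := by
        rw [mul_add]; congr 1
        · rw [lintegral_lintegral_swap (hk'.mul ((ha.comp measurable_snd).pow_const _)).aemeasurable, mul_comm, ← lintegral_mul_const _ (ha.pow_const _)]
          refine lintegral_congr fun y ↦ ¿
          rw [lintegral_mul_const _ (show Measurable fun x ↦ k (y - x) from hk.comp (measurable_id.const_sub y)), lintegral_sub_left_eq_self (μ := μ) k y, mul_comm]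
        · rw [mul_comm, ← lintegral_mul_const _ (hb.pow_const _)]
          refine lintegral_congr fun x ↦ ¿
          rw [lintegral_mul_const _ (show Measurable fun y ↦ k (y - x) from hk.comp (measurable_id.sub_const x)), lintegral_sub_right_eq_self (μ := μ) k x, mul_comm]
lemma enR (x : ℝ) : ‖(x : ℂ)‖ₑ = ‖x‖ₑ := by rw [← ofReal_norm, norm_real, ofReal_norm]
lemma bessel : ∃ C : ℰ, C ≠ ⊤ ∧ ∀ H : Spc d → ℝ, Measurable H → Integrable H →
    ∫⁻ ξ, ‖𝓕 (fun x ↦ (H x : ℂ)) ξ‖ₑ ^ (2:ℝ) ≤ C * ∫⁻ x, ‖H x‖ₑ ^ (2:ℝ) := by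
  obtain ⟨C, hC, h⟩ := KF_L1 (d := d) 1 one_pos
  refine ⟨ofReal C * 2, by finiteness, fun H hm hi ↦ ¿⟩
  have hH : Integrable fun x ↦ (H x : ℂ) := hi.ofReal
  set F := 𝓕 (fun x ↦ (H x : ℂ)) with hF
  have hFc : Continuous F := four_cont hH
  have key : ∀ r : ℝ, 0 < r → ∫⁻ ξ, ‖gA (r ^ 2 • (1 : Mq d)) ξ‖ₑ * ‖F ξ‖ₑ ^ (2:ℝ) ≤ ofReal C * 2 * ∫⁻ x, ‖H x‖ₑ ^ (2:ℝ) := by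
    intro r hr
    set A : Mq d := r ^ 2 • 1 with hA
    have hEL : EL 1 (r ^ 2) A := by
      have h1 : EL 1 1 (1 : Mq d) := by
        refine ⟨fun i j ↦ by simp [Matrix.one_apply, eq_comm], fun ξ ↦ ¿⟩
        have : ∑ i, ∑ j, (1 : Mq d) i j * ξ i * ξ j = ∑ i, ξ i ^ 2 := by
          simp [Matrix.one_apply, sq]
        rw [this]; simp
      simpa using EL_smul (r := r ^ 2) ƥ h1
    obtain ⟨j1, -, j2, -⟩ := h r hr A hEL
    have hΦ := PgA_int one_pos ƥ hEL (Function.HasTemperateGrowth.const (1:ℂ))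
    have s := slice hΦ hH hH
    simp_rw [inv_conj, ← hF] at s
    have e1 : ∫⁻ ξ, ‖gA A ξ‖ₑ * ‖F ξ‖ₑ ^ (2:ℝ) = ‖∫ ξ, 1 * gA A ξ * F ξ * conj (F ξ)‖ₑ := by
      have e : ∀ ξ, 1 * gA A ξ * F ξ * conj (F ξ) = ((‖gA A ξ‖ * ‖F ξ‖ ^ 2 : ℝ) : ℂ) := by
        intro ξ
        rw [one_mul, mul_assoc, Complex.mul_conj, gA_norm, gA, Complex.normSq_eq_norm_sq]; push_cast; ring
      have i : Integrable fun ξ ↦ ‖gA A ξ‖ * ‖F ξ‖ ^ 2 := by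
        have := (four_int (four_int hΦ hH) hH).norm
        refine this.congr (of_forall fun ξ ↦ ¿)
        simp only [one_mul, norm_mul, ← hF]; ring
      simp_rw [e]
      rw [show (∫ ξ, ((‖gA A ξ‖ * ‖F ξ‖ ^ 2 : ℝ) : ℂ)) = ((∫ ξ, ‖gA A ξ‖ * ‖F ξ‖ ^ 2 : ℝ) : ℂ) from integral_ofReal, ← ofReal_norm, norm_real, norm_of_nonneg (integral_nonneg fun ξ ↦ by positivity), ofReal_integral_eq_lintegral_ofReal i (of_forall fun ξ ↦ by positivity)]
      refine lintegral_congr fun ξ ↦ ¿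
      rw [ofReal_mul (norm_nonneg _), ofReal_pow (norm_nonneg _), ofReal_norm, ofReal_norm, rpow_two]
    rw [e1, ← s]
    refine (enorm_integral_le_lintegral_enorm _).trans ¿
    calc _ ≤ ∫⁻ x, ∫⁻ y, ‖KF (fun _ ↦ 1) A (y - x)‖ₑ * (‖H y‖ₑ * ‖H x‖ₑ) := by
          refine lintegral_mono fun x ↦ ¿
          rw [enorm_mul]
          refine (mul_le_mul_left (enorm_integral_le_lintegral_enorm _) _).trans ¿
          rw [← lintegral_mul_const' _ _ ƒ]
          refine lintegral_mono fun y ↦ ¿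
          rw [enorm_mul, mul_assoc, enR, enR]; rfl
      _ ≤ _ := schur volume (four_cont hΦ).measurable.enorm hm.enorm hm.enorm
      _ ≤ _ := by
          rw [← two_mul, ← mul_assoc]
          refine mul_le_mul_left (mul_le_mul_left ¿ _) _
          show ∫⁻ s, ‖KF (fun _ ↦ 1) A s‖ₑ ≤ _
          rw [← ofReal_integral_norm_eq_lintegral_enorm j1]
          exact ofReal_le_ofReal j2
  have lim : ∀ ξ, Filter.Tendsto (fun n : ℕ ↦ ‖gA ((1 / ((n:ℝ) + 1)) ^ 2 • (1 : Mq d)) ξ‖ₑ * ‖F ξ‖ₑ ^ (2:ℝ)) atTop (nhds (‖F ξ‖ₑ ^ (2:ℝ))) := by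
    intro ξ
    nth_rw 2 [← one_mul (‖F ξ‖ₑ ^ (2:ℝ))]
    refine ENNReal.Tendsto.mul_const ¿ (Or.inr ƒ)
    have : Filter.Tendsto (fun n : ℕ ↦ ‖gA ((1 / ((n:ℝ) + 1)) ^ 2 • (1 : Mq d)) ξ‖) atTop (nhds 1) := by
      simp_rw [gA_norm, QF_smul]
      have h0 := (tendsto_one_div_add_atTop_nhds_zero_nat (𝕜 := ℝ)).smul_const ξ
      have := (Real.continuous_exp.tendsto _).comp (((QF_contDiff 1).continuous.tendsto _).comp h0).neg
      have q0 : QF (1 : Mq d) 0 = 0 := by simp [QF]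
      rw [zero_smul, q0, neg_zero, Real.exp_zero] at this
      exact this
    have := ENNReal.tendsto_ofReal this
    simpa only [ofReal_norm, ENNReal.ofReal_one] using this
  calc _ = ∫⁻ ξ, Filter.liminf (fun n : ℕ ↦ ‖gA ((1 / ((n:ℝ) + 1)) ^ 2 • (1 : Mq d)) ξ‖ₑ * ‖F ξ‖ₑ ^ (2:ℝ)) atTop :=
        lintegral_congr fun ξ ↦ (lim ξ).liminf_eq.symm
    _ ≤ _ := lintegral_liminf_le fun n ↦ ((gA_contDiff _).continuous.measurable.enorm).mul (hFc.measurable.enorm.pow_const _)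
    _ ≤ _ := by
      refine Filter.liminf_le_of_le (by isBoundedDefault) fun b hb ↦ ¿
      obtain ⟨n, hn⟩ := hb.exists
      exact hn.trans (key _ ƥ)
lemma bint {X E : Type*} [MeasurableSpace X] [NormedAddCommGroup E] {μ : Measure X} {f : X → E} (hf : AEStronglyMeasurable f μ) {M : ℝ} (hM : ∀ x, ‖f x‖ ≤ M)
    {S : Set X} (hS : μ S < ⊤) (h0 : ∀ x ∉ S, f x = 0) : Integrable f μ := by
  have : IntegrableOn f S μ := Measure.integrableOn_of_bounded hS.ne hf (M := M) (of_forall fun x ↦ hM x)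
  exact this.integrable_of_forall_notMem_eq_zero h0
lemma Nice.int (hh : Nice h) : Integrable h := by
  obtain ⟨h1, ⟨M, h2⟩, R, h3, h4⟩ := hh
  exact bint h1.aestronglyMeasurable h2 (vpbox_net _ h3).lt_top h4
lemma Nice.slice (hh : Nice h) (t : ℝ) : Integrable fun x ↦ h (t, x) := by
  obtain ⟨h1, ⟨M, h2⟩, R, h3, h4⟩ := hh
  exact bint (h1.comp measurable_prodMk_left).aestronglyMeasurable (fun x ↦ h2 (t, x)) (S := ball 0 R) measure_ball_lt_top fun x hx ↦ h4 _ fun hc ↦ hx hc.2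
@[irreducible] def kk (δ : ℝ) (ξ : Spc d) : ℝ → ℰ := (Ioi ō).indicator (fun s ↦ ofReal (4 * π ^ 2 * ‖ξ‖ ^ 2 * exp (-(4 * π ^ 2 * δ * s * ‖ξ‖ ^ 2))))
lemma kker (δ : ℝ) (hδ : 0 < δ) (ξ : Spc d) : ∫⁻ s, kk δ ξ s ≤ ofReal δ⁻¹ := by
  simp only [kk]
  rw [lintegral_indicator measurableSet_Ioi]
  set c := 4 * π ^ 2 * ‖ξ‖ ^ 2 with hc
  rcases eq_or_lt_of_le (show 0 ≤ c by positivity) with h0 | h0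
  · simp [← h0]
  have e : ∀ s : ℝ, c * exp (-(4 * π ^ 2 * δ * s * ‖ξ‖ ^ 2)) = c * exp ((-(δ * c)) * s) := by
    intro s; rw [hc]; ring_nf
  simp_rw [e]
  have hb : -(δ * c) < 0 := by have := mul_pos hδ h0; linarith
  rw [← ofReal_integral_eq_lintegral_ofReal ((integrableOn_exp_mul_Ioi hb 0).const_mul c) (of_forall fun s ↦ by positivity),
    integral_const_mul, integral_exp_mul_Ioi hb]
  apply ofReal_le_ofReal
  simp; field_simp; exact le_refl _
lemma kst (km : Measurable (uncurry κ)) (kB : ∀ z w, |κ z w| ≤ B) (hh : Nice h) (hg : Nice g) :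
    (Integrable fun z ↦ (∫ w, κ z w * h w) * g z) ∧ ∀ t, ‖∫ x, (∫ w, κ (t, x) w * h w) * g (t, x)‖ₑ ≤ ∫⁻ τ, ‖∫ x, (∫ y, κ (t, x) (τ, y) * h (τ, y)) * g (t, x)‖ₑ := by
  have hB0 : 0 ≤ B := (abs_nonneg _).trans (kB 0 0)
  obtain ⟨hm, ⟨M, hM⟩, R, hR, hh0⟩ := id hh
  obtain ⟨gm, ⟨M', hM'⟩, R', hR', hg0⟩ := id hg
  have hMn : 0 ≤ M := (abs_nonneg _).trans (hM 0)
  have bz : ∀ z w, ‖κ z w * h w‖ ≤ B * ‖h w‖ := fun z w ↦ by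
    rw [norm_mul]; exact mul_le_mul_of_nonneg_right (kB z w) (norm_nonneg _)
  have kw : ∀ z, Measurable fun w ↦ κ z w := fun z ↦ km.comp measurable_prodMk_left
  have inn : ∀ z, Integrable fun w ↦ κ z w * h w := fun z ↦
    (hh.int.norm.const_mul B).mono' ((kw z).mul hm).aestronglyMeasurable (of_forall (bz z))
  have khm : Measurable fun p : Pt d × Pt d ↦ κ p.1 p.2 * h p.2 := km.mul (hm.comp measurable_snd)
  have Tb : ∀ z, ‖∫ w, κ z w * h w‖ ≤ ∫ w, B * ‖h w‖ := fun z ↦ norm_integral_le_of_norm_le (hh.int.norm.const_mul B) (of_forall (bz z))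
  have out : Integrable fun z ↦ (∫ w, κ z w * h w) * g z :=
    hg.int.bdd_mul (khm.stronglyMeasurable.integral_prod_right (ν := volume)).aestronglyMeasurable (of_forall Tb)
  refine ⟨out, ¿⟩
  intro t
  have e : ∀ x, (∫ w, κ (t, x) w * h w) * g (t, x) = ∫ τ, (∫ y, κ (t, x) (τ, y) * h (τ, y)) * g (t, x) := fun x ↦ by
    rw [integral_mul_const, Measure.volume_eq_prod, integral_prod _ (by rw [← Measure.volume_eq_prod]; exact inn (t, x))]
  simp_rw [e]
  rw [integral_integral_swap]
  · exact enorm_integral_le_lintegral_enorm _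
  · have m1 : Measurable fun q : (Spc d × ℝ) × Spc d ↦ κ (t, q.1.1) (q.1.2, q.2) * h (q.1.2, q.2) :=
      khm.comp (show Measurable fun q : (Spc d × ℝ) × Spc d ↦ (((t, q.1.1) : Pt d), ((q.1.2, q.2) : Pt d)) by fun_prop)
    have m2 : Measurable fun p : Spc d × ℝ ↦ g (t, p.1) := gm.comp (show Measurable fun p : Spc d × ℝ ↦ (t, p.1) by fun_prop)
    have hyb : ∀ τ, (∫ y, ‖h (τ, y)‖) ≤ M * (volume (ball (0 : Spc d) R)).toReal := by
      intro τ
      have : ∫ y, ‖h (τ, y)‖ = ∫ y in ball (0 : Spc d) R, ‖h (τ, y)‖ := by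
        rw [setIntegral_eq_integral_of_forall_compl_eq_zero]
        intro y hy; rw [hh0 (τ, y) fun hc ↦ hy hc.2, norm_zero]
      rw [this]
      refine (Real.le_norm_self _).trans (norm_setIntegral_le_of_norm_le_const measure_ball_lt_top fun y _ ↦ ¿)
      rw [norm_norm]; exact hM _
    refine bint (M := B * (M * (volume (ball (0 : Spc d) R)).toReal) * M') (S := ball 0 R' ×ˢ Ioo (-R^2) (R^2)) ¿ ¿ ¿ ¿
    · exact ((m1.stronglyMeasurable.integral_prod_right (ν := volume)).measurable.mul m2).aestronglyMeasurable
    · rintro ⟨x, τ⟩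
      simp only [uncurry]
      rw [norm_mul]
      refine mul_le_mul ¿ (hM' _) (norm_nonneg _) ƥ
      refine (norm_integral_le_of_norm_le ((hh.slice τ).norm.const_mul B) (of_forall fun y ↦ bz _ _)).trans ¿
      rw [integral_const_mul]; exact mul_le_mul_of_nonneg_left (hyb τ) hB0
    · rw [Measure.prod_prod]; exact mul_lt_top measure_ball_lt_top ş
    · rintro ⟨x, τ⟩ hx
      simp only [uncurry]
      by_cases h1 : x ∈ ball (0 : Spc d) R'
      · have h2 : ∀ y, h (τ, y) = 0 := fun y ↦ hh0 _ fun hc ↦ hx ⟨h1, by simpa [pbox] using hc.1⟩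
        simp [h2]
      · rw [hg0 (t, x) fun hc ↦ h1 hc.2, mul_zero]
notation:70 "ɜ" i:max j:max α:max t:max τ:max x:max y:max h:max => KF (PP i j) (AA α t τ) (y - x) * (h (τ, y) : ℂ)
lemma ksl (hδ : 0 < δ) (i j : Fin d) (hε : 0 < ε) (hα : Al δ α) (hh : Nice h) (hg : Nice g) (t τ : ℝ) :
    ‖∫ x, (∫ y, kap i j ε α (t, x) (τ, y) * h (τ, y)) * g (t, x)‖ₑ ≤ ∫⁻ ξ, kk δ ξ (τ - t) * (‖𝓕 (fun y ↦ (h (τ, y) : ℂ)) ξ‖ₑ * ‖𝓕 (fun y ↦ (g (t, y) : ℂ)) ξ‖ₑ) := by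
  rcases le_or_gt (τ - t) ε with h1 | h1
  · simp [kap, HH, phi_zero hε h1]
  have h0 : 0 < τ - t := hε.trans h1
  have hEL := AA_EL hδ hα (sub_pos.1 h0).le
  have hΦ := PgA_int hδ h0 hEL (PP_hom i j).1
  have hhc : Integrable fun y ↦ (h (τ, y) : ℂ) := (hh.slice τ).ofReal
  have hgc : Integrable fun y ↦ (g (t, y) : ℂ) := (hg.slice t).ofReal
  have s := K14.slice hΦ hhc hgc
  have e : ((∫ x, (∫ y, kap i j ε α (t, x) (τ, y) * h (τ, y)) * g (t, x) : ℝ)) = phi ε (τ - t) * (∫ x, (∫ y, ɜ i j α t τ x y h) * (g (t, x) : ℂ)).re := by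
    have hKc : Continuous (KF (PP i j) (AA α t τ)) := four_cont hΦ
    have i1 : ∀ x, Integrable fun y ↦ ɜ i j α t τ x y h := fun x ↦
      hhc.bdd_mul (c := ∫ ξ, ‖PP i j ξ * gA (AA α t τ) ξ‖) (hKc.comp (continuous_id.sub continuous_const)).aestronglyMeasurable (of_forall fun y ↦ four_bd _ _)
    have i2 : Integrable fun x ↦ (∫ y, ɜ i j α t τ x y h) * (g (t, x) : ℂ) := by
      refine hgc.bdd_mul (c := ∫ ξ, ‖PP i j ξ * gA (AA α t τ) ξ * 𝓕 (fun y ↦ (h (τ, y) : ℂ)) ξ‖) ¿ (of_forall fun x ↦ ¿)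
      · have : (fun x ↦ ∫ y, ɜ i j α t τ x y h) = fun x ↦ 𝓕 (fun ξ ↦ PP i j ξ * gA (AA α t τ) ξ * 𝓕 (fun y ↦ (h (τ, y) : ℂ)) ξ) (-x) := by
          ext x; rw [← fourierInv_eq_fourier_neg]; exact slice1 hΦ hhc x
        rw [this]
        exact ((four_cont (four_int hΦ hhc)).comp continuous_neg).aestronglyMeasurable
      · have := slice1 hΦ hhc x
        rw [show (∫ y, ɜ i j α t τ x y h) = _ from this, fourierInv_eq_fourier_neg]
        exact four_bd _ _
    rw [show (∫ x, (∫ y, ɜ i j α t τ x y h) * (g (t, x) : ℂ)).re = ∫ x, ((∫ y, ɜ i j α t τ x y h) * (g (t, x) : ℂ)).re from (integral_re i2).symm, ← integral_const_mul]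
    refine integral_congr_ae (of_forall fun x ↦ ¿)
    simp only [re_mul_ofReal]
    rw [show (∫ y, ɜ i j α t τ x y h).re = ∫ y, (ɜ i j α t τ x y h).re from (integral_re (i1 x)).symm, ← mul_assoc, ← integral_const_mul]
    congr 1
    refine integral_congr_ae (of_forall fun y ↦ ¿)
    simp only [re_mul_ofReal, kap, HH]; ring
  rw [e]
  have e2 : ‖phi ε (τ - t) * (∫ x, (∫ y, ɜ i j α t τ x y h) * (g (t, x) : ℂ)).re‖ₑ ≤ ‖∫ x, (∫ y, ɜ i j α t τ x y h) * (g (t, x) : ℂ)‖ₑ := by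
    rw [← ofReal_norm, ← ofReal_norm]
    apply ofReal_le_ofReal
    rw [norm_mul, norm_of_nonneg (phi_nn _ _)]
    exact (mul_le_of_le_one_left (norm_nonneg _) (phi_le _ _)).trans (abs_re_le_norm _)
  refine e2.trans ¿
  rw [show (∫ x, (∫ y, ɜ i j α t τ x y h) * (g (t, x) : ℂ)) = _ from s]
  refine (enorm_integral_le_lintegral_enorm _).trans (lintegral_mono fun ξ ↦ ¿)
  rw [show 𝓕⁻ (fun x ↦ (g (t, x) : ℂ)) ξ = _ from inv_conj (fun x ↦ g (t, x)) ξ, enorm_mul, enorm_mul, mul_assoc, RCLike.enorm_conj]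
  refine mul_le_mul_left ¿ _
  rw [kk, indicator_of_mem (mem_Ioi.2 h0), ← ofReal_norm]
  apply ofReal_le_ofReal
  rw [norm_mul]
  exact mul_le_mul (PP_norm i j ξ) (gA_le hEL ξ) (norm_nonneg _) ƥ
lemma FM (hf : Nice f) : Measurable fun p : Spc d × ℝ ↦ ‖𝓕 (fun y ↦ (f (p.2, y) : ℂ)) p.1‖ₑ := by
  simp_rw [fourier_eq']
  have : Measurable fun q : (Spc d × ℝ) × Spc d ↦ Complex.exp ((-2 * π * inner ℝ q.2 q.1.1 : ℝ) * Complex.I) • (f (q.1.2, q.2) : ℂ) := by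
    have h1 := measurable_ofReal.comp (hf.1.comp (show Measurable fun q : (Spc d × ℝ) × Spc d ↦ (q.1.2, q.2) by fun_prop))
    exact (show Measurable fun q : (Spc d × ℝ) × Spc d ↦ Complex.exp ((-2 * π * inner ℝ q.2 q.1.1 : ℝ) * Complex.I) from Continuous.measurable ʄ).smul h1
  exact (this.stronglyMeasurable.integral_prod_right (ν := volume)).measurable.enorm
lemma kM (δ : ℝ) : Measurable fun p : Spc d × ℝ ↦ kk δ p.1 p.2 := by
  have e : (fun p : Spc d × ℝ ↦ kk δ p.1 p.2) = (univ ×ˢ Ioi ō).indicator (fun p ↦ ofReal (4 * π ^ 2 * ‖p.1‖ ^ 2 * exp (-(4 * π ^ 2 * δ * p.2 * ‖p.1‖ ^ 2)))) := by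
    ext p; simp [kk, indicator]
  rw [e]; exact Measurable.indicator ʄ (MeasurableSet.univ.prod measurableSet_Ioi)
lemma kfin (hδ : 0 < δ) {H G : ℝ → Spc d → ℰ} (hH : Measurable fun p : Spc d × ℝ ↦ H p.2 p.1) (hG : Measurable fun p : Spc d × ℝ ↦ G p.2 p.1) :
    ∫⁻ t, ∫⁻ τ, ∫⁻ ξ, kk δ ξ (τ - t) * (H τ ξ * G t ξ) ≤ ofReal δ⁻¹ * ((∫⁻ ξ, ∫⁻ t, H t ξ ^ (2:ℝ)) + ∫⁻ ξ, ∫⁻ t, G t ξ ^ (2:ℝ)) := by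
  have big : Measurable fun q : (ℝ × ℝ) × Spc d ↦ kk δ q.2 (q.1.2 - q.1.1) * (H q.1.2 q.2 * G q.1.1 q.2) :=
    ((kM δ).comp (show Measurable fun q : (ℝ × ℝ) × Spc d ↦ (q.2, q.1.2 - q.1.1) by fun_prop)).mul
      ((hH.comp (show Measurable fun q : (ℝ × ℝ) × Spc d ↦ (q.2, q.1.2) by fun_prop)).mul (hG.comp (show Measurable fun q : (ℝ × ℝ) × Spc d ↦ (q.2, q.1.1) by fun_prop)))
  have e1 : ∀ t, ∫⁻ τ, ∫⁻ ξ, kk δ ξ (τ - t) * (H τ ξ * G t ξ) = ∫⁻ ξ, ∫⁻ τ, kk δ ξ (τ - t) * (H τ ξ * G t ξ) := fun t ↦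
    lintegral_lintegral_swap (big.comp (show Measurable fun p : ℝ × Spc d ↦ ((t, p.1), p.2) by fun_prop)).aemeasurable
  simp_rw [e1]
  rw [lintegral_lintegral_swap (Measurable.lintegral_prod_right' (f := fun r : (ℝ × Spc d) × ℝ ↦ kk δ r.1.2 (r.2 - r.1.1) * (H r.2 r.1.2 * G r.1.1 r.1.2))
      (big.comp (show Measurable fun r : (ℝ × Spc d) × ℝ ↦ ((r.1.1, r.2), r.1.2) by fun_prop))).aemeasurable]
  have m0 : Measurable fun ξ ↦ ∫⁻ t, H t ξ ^ (2:ℝ) := Measurable.lintegral_prod_right' (f := fun p : Spc d × ℝ ↦ H p.2 p.1 ^ (2:ℝ)) (hH.pow_const _)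
  rw [← lintegral_add_left m0, ← lintegral_const_mul' _ _ ofReal_ne_top]
  refine lintegral_mono fun ξ ↦ ¿
  have m1 : Measurable fun t ↦ kk δ ξ t := (kM (d := d) δ).comp (measurable_prodMk_left (x := ξ))
  have m2 : Measurable fun t ↦ H t ξ := hH.comp (measurable_prodMk_left (x := ξ))
  have m3 : Measurable fun t ↦ G t ξ := hG.comp (measurable_prodMk_left (x := ξ))
  have S := schur (volume : Measure ℝ) (k := fun t ↦ kk δ ξ t) (a := fun t ↦ H t ξ) (b := fun t ↦ G t ξ) m1 m2 m3
  exact S.trans (mul_le_mul_left (kker δ hδ ξ) _)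
lemma kap_l2 (δ : ℝ) (hδ : 0 < δ) (i j : Fin d) : ∃ C : ℝ, 0 < C ∧ ∀ ε, 0 < ε → ∀ α : ℝ → Mq d, Al δ α →
    ∀ h g : Fn d, Nice h → Nice g →
    ‖∫ z, (∫ w, kap i j ε α z w * h w) * g z‖ₑ ≤ ofReal C * (L2n h + L2n g) := by
  obtain ⟨C, hC, hB⟩ := bessel (d := d)
  obtain ⟨C0, hC0, hreg⟩ := kap_reg δ hδ i j
  refine ⟨(ofReal δ⁻¹ * C).toReal + 1, by positivity, fun ε hε α hα h g hh hg ↦ ¿⟩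
  obtain ⟨km, ⟨B, kB⟩, -, -⟩ := hreg ε hε α hα
  have step1 : ‖∫ z, (∫ w, kap i j ε α z w * h w) * g z‖ₑ ≤ ∫⁻ t, ∫⁻ τ, ∫⁻ ξ, kk δ ξ (τ - t) * (‖𝓕 (fun y ↦ (h (τ, y) : ℂ)) ξ‖ₑ * ‖𝓕 (fun y ↦ (g (t, y) : ℂ)) ξ‖ₑ) := by
    rw [Measure.volume_eq_prod, integral_prod _ (by rw [← Measure.volume_eq_prod]; exact (kst km kB hh hg).1)]
    refine (enorm_integral_le_lintegral_enorm _).trans (lintegral_mono fun t ↦ ¿)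
    exact ((kst km kB hh hg).2 t).trans (lintegral_mono fun τ ↦ ksl hδ i j hε hα hh hg t τ)
  have bes : ∀ f : Fn d, Nice f → ∫⁻ ξ, ∫⁻ t, ‖𝓕 (fun y ↦ (f (t, y) : ℂ)) ξ‖ₑ ^ (2:ℝ) ≤ C * L2n f := by
    intro f hf
    rw [lintegral_lintegral_swap ((FM hf).pow_const _).aemeasurable, L2n, Measure.volume_eq_prod, lintegral_prod _ (hf.1.enorm.pow_const _).aemeasurable, ← lintegral_const_mul' _ _ hC]
    exact lintegral_mono fun t ↦ hB _ (hf.1.comp measurable_prodMk_left) (hf.slice t)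
  refine (step1.trans (kfin hδ (FM hh) (FM hg))).trans ¿
  refine (mul_le_mul_right (add_le_add (bes h hh) (bes g hg)) _).trans ¿
  rw [← mul_add, ← mul_assoc]
  refine mul_le_mul_left ¿ _
  rw [← ofReal_toReal (a := ofReal δ⁻¹ * C) ƒ]
  exact ofReal_le_ofReal (by rw [ofReal_toReal ƒ]; linarith)
lemma kap_CZ (δ : ℝ) (hδ : 0 < δ) (i j : Fin d) : ∃ C : ℝ, 0 < C ∧ ∀ ε, 0 < ε → ∀ α : ℝ → Mq d, Al δ α →
    CZ (kap i j ε α) C := by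
  obtain ⟨C, hC, h⟩ := kap_reg δ hδ i j
  obtain ⟨D, hD, h'⟩ := kap_l2 δ hδ i j
  have mono : ∀ l R : ℝ, 0 < l → 4 * l ≤ R → C * l / R ^ (d + 3) ≤ max C D * l / R ^ (d + 3) := by
    intro l R hl hR
    have : 0 < R := by linarith
    gcongr; exact le_max_left _ _
  refine ⟨max C D, lt_max_of_lt_left hC, fun ε hε α hα ↦ ¿⟩
  obtain ⟨h1, h2, h3, h4⟩ := h ε hε α hα
  refine ⟨h1, h2, fun z z' w l R hl hR a b c ↦ (h3 z z' w l R hl hR a b c).trans (mono l R hl hR),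
    fun z z' w l R hl hR a b c ↦ (h4 z z' w l R hl hR a b c).trans (mono l R hl hR), fun f g hf hg ↦ (h' ε hε α hα f g hf hg).trans ¿⟩
  exact mul_le_mul_left (ofReal_le_ofReal (le_max_right _ _)) _
lemma vpbox_eq' (y : Pt d) (hr : 0 < r) : volume (pbox y r) ≤ cB d * ofReal (r ^ (d + 2)) := by
  have h := vpbox_eq y y (l := r / (d + 2)) ƥ
  rw [mul_div_cancel₀ r ƥ] at h
  rw [h, vcube _ ƥ]
  refine mul_le_mul_right (ofReal_le_ofReal (pow_le_pow_left₀ ƥ ¿ _)) _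
  exact div_le_self hr.le (by have : ō ≤ d := by positivity
                              linarith)
lemma pbox_mono {a b : ℝ} (h0 : 0 ≤ a) (h : a ≤ b) : pbox z a ⊆ pbox z b := by
  have : a ^ 2 ≤ b ^ 2 := pow_le_pow_left₀ h0 h 2
  exact prod_mono (Ioo_subset_Ioo ł ł) (ball_subset_ball h)
lemma pbox_exh (z w : Pt d) (hR : 0 < R) : ∃ k : ℕ, w ∈ pbox z (2 ^ k * R) := by
  obtain ⟨n, hn⟩ := pow_unbounded_of_one_lt ((|w.1 - z.1| + ‖w.2 - z.2‖ + 1) / R) (one_lt_two : (1:ℝ) < 2)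
  rw [div_lt_iff₀ hR] at hn
  have h1 := abs_nonneg (w.1 - z.1); have h2 := norm_nonneg (w.2 - z.2)
  refine ⟨n, ⟨¿, ¿⟩, ¿⟩
  · have := neg_abs_le (w.1 - z.1); nlinarith
  · have := le_abs_self (w.1 - z.1); nlinarith
  · rw [mem_ball, dist_eq_norm]; linarith
lemma far (hC : 0 ≤ C)
    (hr : ∀ z z' w : Pt d, ∀ l R : ℝ, 0 < l → 4 * l ≤ R → |z'.1 - z.1| ≤ l ^ 2 → ‖z'.2 - z.2‖ ≤ l → w ∉ pbox z R → |κ z' w - κ z w| ≤ C * l / R ^ (d + 3))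
    {h : Pt d → ℰ} (hm : Measurable h) {z' x : Pt d} (hl : 0 < l) (hlR : 4 * l ≤ R) (h1 : |z'.1 - z.1| ≤ l ^ 2) (h2 : ‖z'.2 - z.2‖ ≤ l) (hx : x ∈ pbox z R) :
    ∫⁻ w in (pbox z R)ᶜ, ‖κ z' w - κ z w‖ₑ * h w ≤ 2 ^ (d + 3) * cB d * ofReal (C * l / R) * MM h x := by
  have hR : 0 < R := by linarith
  have pt : ∀ w ∈ (pbox z R)ᶜ, ‖κ z' w - κ z w‖ₑ * h w ≤ ∑' k : ℕ, ofReal (C * l / (2 ^ k * R) ^ (d + 3)) * (pbox z (2 ^ (k + 1) * R)).indicator h w := by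
    intro w hw
    classical
    have ex := pbox_exh z w hR
    obtain ⟨k, hk⟩ : ∃ k, Nat.find ex = k + 1 := Nat.exists_eq_succ_of_ne_zero fun h0 ↦ hw (by have := Nat.find_spec ex; rwa [h0, pow_zero, one_mul] at this)
    have k1 : w ∈ pbox z (2 ^ (k + 1) * R) := hk ▸ Nat.find_spec ex
    have k2 : w ∉ pbox z (2 ^ k * R) := Nat.find_min ex (by omega)
    refine le_trans ¿ (le_tsum k)
    rw [indicator_of_mem k1]
    refine mul_le_mul_left ¿ _
    rw [← ofReal_norm, norm_eq_abs]
    have : R ≤ 2 ^ k * R := le_mul_of_one_le_left hR.le (one_le_pow₀ one_le_two)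
    exact ofReal_le_ofReal (hr z z' w l _ hl ł h1 h2 k2)
  calc _ ≤ ∫⁻ w, ∑' k : ℕ, ofReal (C * l / (2 ^ k * R) ^ (d + 3)) * (pbox z (2 ^ (k + 1) * R)).indicator h w :=
        (setLIntegral_mono' (pbox_meas z R).compl pt).trans (setLIntegral_le_lintegral _ _)
    _ = ∑' k : ℕ, ofReal (C * l / (2 ^ k * R) ^ (d + 3)) * ∫⁻ w in pbox z (2 ^ (k + 1) * R), h w := by
        rw [lintegral_tsum fun k ↦ ((hm.indicator (pbox_meas _ _)).const_mul _).aemeasurable]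
        refine tsum_congr fun k ↦ ¿
        rw [lintegral_const_mul' _ _ ofReal_ne_top, lintegral_indicator (pbox_meas _ _)]
    _ ≤ ∑' k : ℕ, (2 ^ (d + 2) * cB d * ofReal (C * l / R) * MM h x) * 2⁻¹ ^ k := by
        refine tsum_le_tsum fun k ↦ ¿
        have hp : 0 < 2 ^ (k + 1) * R := by positivity
        have hx' : x ∈ pbox z (2 ^ (k + 1) * R) := pbox_mono hR.le (le_mul_of_one_le_left hR.le (one_le_pow₀ one_le_two)) hx
        have := le_MM h hp hx'
        rw [div_le_iff (vpbox_ne0 _ hp) (vpbox_net _ hp)] at this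
        refine (mul_le_mul_right (this.trans (mul_le_mul_right (vpbox_eq' z hp) _)) _).trans (le_of_eq ¿)
        have e : ofReal (C * l / (2 ^ k * R) ^ (d + 3)) * ofReal ((2 ^ (k + 1) * R) ^ (d + 2)) = 2 ^ (d + 2) * ofReal (C * l / R) * 2⁻¹ ^ k := by
          rw [show (2:ℰ) = ofReal 2 by simp, ← ENNReal.ofReal_inv_of_pos two_pos, ← ofReal_pow ƥ, ← ofReal_pow ƥ,
            ← ofReal_mul ƥ, ← ofReal_mul ƥ, ← ofReal_mul ƥ]
          congr 1
          rw [inv_pow]; field_simp; ring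
        calc _ = MM h x * cB d * (ofReal (C * l / (2 ^ k * R) ^ (d + 3)) * ofReal ((2 ^ (k + 1) * R) ^ (d + 2))) := by ring
          _ = _ := by rw [e]; ring
    _ = _ := by
        rw [ENNReal.tsum_mul_left, tsum_geometric, ENNReal.one_sub_inv_two, inv_inv]; ring
def TT (κ : Pt d → Fn d) (h : Fn d) (z : Pt d) : ℝ := ∫ w, κ z w * h w
def BS (κ : Pt d → Fn d) (s s' : ℝ) (D : ℰ) : Prop := ∀ h g : Fn d, Nice h → Nice g →
  ‖∫ z, TT κ h z * g z‖ₑ ≤ D * ((∫⁻ z, ‖h z‖ₑ ^ s) + ∫⁻ z, ‖g z‖ₑ ^ s')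
lemma CZ.BS2 (h : CZ κ C) : BS κ 2 2 (ofReal C) := h.l2
lemma TT_int (km : Measurable (uncurry κ)) (kB : ∀ z w, |κ z w| ≤ B) (hh : Nice h) (z : Pt d) :
    Integrable fun w ↦ κ z w * h w := by
  refine hh.int.bdd_mul (c := B) (km.comp measurable_prodMk_left).aestronglyMeasurable (of_forall fun w ↦ kB z w)
lemma TT_meas (km : Measurable (uncurry κ)) (hh : Measurable h) : Measurable (TT κ h) :=
  ((show Measurable fun p : Pt d × Pt d ↦ κ p.1 p.2 * h p.2 from km.mul (hh.comp measurable_snd)).stronglyMeasurable.integral_prod_right (ν := volume)).measurable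
lemma TT_bd (kB : ∀ z w, |κ z w| ≤ B) (hh : Nice h) (z : Pt d) : |TT κ h z| ≤ B * ∫ w, ‖h w‖ := by
  rw [show B * ∫ w, ‖h w‖ = ∫ w, B * ‖h w‖ from (integral_const_mul _ _).symm]
  show ‖∫ w, κ z w * h w‖ ≤ _
  refine norm_integral_le_of_norm_le (hh.int.norm.const_mul B) (of_forall fun w ↦ ¿)
  rw [norm_mul]; exact mul_le_mul_of_nonneg_right (kB z w) (norm_nonneg _)
lemma Nice.ind (hh : Nice h) {S : Set (Pt d)} (hS : MeasurableSet S) : Nice (S.indicator h) := by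
  obtain ⟨h1, ⟨M, h2⟩, R, h3, h4⟩ := hh
  refine ⟨h1.indicator hS, ⟨M, fun z ↦ ¿⟩, R, h3, fun z hz ↦ ¿⟩
  · by_cases hz : z ∈ S
    · rw [indicator_of_mem hz]; exact h2 z
    · rw [indicator_of_notMem hz, abs_zero]; exact (abs_nonneg _).trans (h2 z)
  · by_cases hz' : z ∈ S
    · rw [indicator_of_mem hz', h4 z hz]
    · rw [indicator_of_notMem hz']
lemma Nice.mk_ind (hf : Measurable f) {M : ℝ} (hM : ∀ z, |f z| ≤ M) (z : Pt d) (hl : 0 < l) : Nice ((cube z l).indicator f) := by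
  obtain ⟨k, hk⟩ := pbox_exh (0 : Pt d) (0 : Pt d) one_pos
  refine ⟨hf.indicator (cube_meas z l), ⟨M, fun w ↦ ¿⟩, |z.1| + ‖z.2‖ + 1 + l ^ 2 + d * l, by positivity, fun w hw ↦ indicator_of_notMem (fun h ↦ hw ¿) f⟩
  · by_cases hz : w ∈ cube z l
    · rw [indicator_of_mem hz]; exact hM w
    · rw [indicator_of_notMem hz, abs_zero]; exact (abs_nonneg _).trans (hM w)
  · obtain ⟨a, b⟩ := cube_diam hl h (cube_self z hl)
    have := norm_add_le (w.2 - z.2) z.2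
    rw [sub_add_cancel] at this
    have t := abs_add_le (w.1 - z.1) z.1
    rw [sub_add_cancel] at t
    have c1 := neg_abs_le w.1; have c2 := le_abs_self w.1
    have p1 := abs_nonneg z.1; have p2 := norm_nonneg z.2
    have p3 : 0 ≤ d * l := by positivity
    have p4 : 0 < l ^ 2 := by positivity
    set Y := |z.1| + ‖z.2‖ + 1 + l ^ 2 + d * l with hY
    have y1 : Y ≤ Y ^ 2 := by nlinarith
    refine ⟨⟨¿, ¿⟩, ¿⟩
    · show ō - Y ^ 2 < w.1; linarith
    · show w.1 < ō + Y ^ 2; linarith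
    · rw [mem_ball]; show dist w.2 0 < _; rw [dist_zero_right]; linarith
lemma near {s' : ℝ} (hs : s.HolderConjugate s') {D : ℰ} (hD : D ≠ ⊤) (km : Measurable (uncurry κ)) (kB : ∀ z w, |κ z w| ≤ B)
    (hB : BS κ s s' D) (hh : Nice h) (z : Pt d) (hl : 0 < l) :
    ∫⁻ y in cube z l, ‖TT κ h y‖ₑ ≤ volume (cube z l) * (2 * D * ((∫⁻ w, ‖h w‖ₑ ^ s) / volume (cube z l)) ^ (1 / s)) := by
  set V := volume (cube z l) with hV
  have V0 := vcube_ne0 z hl; have Vt := vcube_net z hl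
  set I := ∫⁻ w, ‖h w‖ₑ ^ s with hI
  set A := I / V with hA
  have hIt : I ≠ ⊤ := by
    obtain ⟨h1, ⟨M, h2⟩, R, h3, h4⟩ := id hh
    have : I ≤ ∫⁻ w in pbox (0 : Pt d) R, ofReal M ^ s := by
      rw [← lintegral_indicator (pbox_meas _ _)]
      refine lintegral_mono fun w ↦ ¿
      by_cases hw : w ∈ pbox (0 : Pt d) R
      · rw [indicator_of_mem hw, ← ofReal_norm]
        exact rpow_le_rpow (ofReal_le_ofReal (h2 w)) hs.pos.le
      · rw [h4 w hw, enorm_zero, zero_rpow_of_pos hs.pos]; exact zero_le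
    refine ne_top_of_le_ne_top ¿ this
    rw [setLIntegral_const]
    exact mul_ne_top (rpow_ne_top_of_nonneg hs.pos.le ofReal_ne_top) (vpbox_net _ h3)
  have hAt : A ≠ ⊤ := div_ne_top hIt V0
  rcases eq_or_ne I 0 with h0 | h0
  · have : ∀ y, TT κ h y = 0 := by
      intro y
      have e := (lintegral_eq_zero_iff (hh.1.enorm.pow_const s)).1 h0
      refine integral_eq_zero_of_ae ¿
      filter_upwards [e] with w hw
      have : h w = 0 := by simpa [hs.pos] using hw
      simp [this]
    simp [this]
  have hA0 : A ≠ 0 := ENNReal.div_ne_zero.2 ⟨h0, Vt⟩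
  set a := A.toReal with ha
  have a0 : 0 < a := ENNReal.toReal_pos hA0 hAt
  set lam := a ^ (1 / s') with hlam
  have lam0 : 0 < lam := Real.rpow_pos_of_pos a0 _
  set f : Fn d := fun y ↦ lam * SignType.sign (TT κ h y) with hf
  have fm : Measurable f := by
    have : f = fun y ↦ lam * (if 0 < TT κ h y then 1 else if TT κ h y < 0 then -1 else 0) := by
      ext y; simp only [hf]; congr 1
      rcases lt_trichotomy (TT κ h y) 0 with q | q | q
      · simp [q, q.not_gt]
      · simp [q]
      · simp [q]
    rw [this]
    have tm := TT_meas km hh.1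
    exact (Measurable.ite (measurableSet_lt measurable_const tm) measurable_const (Measurable.ite (measurableSet_lt tm measurable_const) measurable_const measurable_const)).const_mul _
  have fM : ∀ y, |f y| ≤ lam := by
    intro y; simp only [hf]; rw [abs_mul, abs_of_pos lam0]
    refine mul_le_of_le_one_right lam0.le ¿
    rcases SignType.trichotomy (SignType.sign (TT κ h y)) with q | q | q <;> simp [q]
  have b := hB h _ hh (Nice.mk_ind fm fM z hl)
  have lhs : ‖∫ y, TT κ h y * (cube z l).indicator f y‖ₑ = ofReal lam * ∫⁻ y in cube z l, ‖TT κ h y‖ₑ := by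
    have e : ∀ y, TT κ h y * (cube z l).indicator f y = (cube z l).indicator (fun y ↦ lam * |TT κ h y|) y := by
      intro y
      by_cases hy : y ∈ cube z l
      · rw [indicator_of_mem hy, indicator_of_mem hy]; simp only [hf]; rw [← self_mul_sign]; ring
      · rw [indicator_of_notMem hy, indicator_of_notMem hy, mul_zero]
    simp_rw [e]
    rw [integral_indicator (cube_meas z l), integral_const_mul, enorm_mul, Real.enorm_eq_ofReal lam0.le]
    congr 1
    rw [Real.enorm_eq_ofReal (integral_nonneg fun y ↦ abs_nonneg _), ofReal_integral_eq_lintegral_ofReal _ (of_forall fun y ↦ abs_nonneg _)]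
    · refine lintegral_congr fun y ↦ ¿
      rw [← norm_eq_abs, ofReal_norm]
    · exact (Measure.integrableOn_of_bounded Vt (TT_meas km hh.1).aestronglyMeasurable (of_forall fun y ↦ TT_bd kB hh y)).abs
  have rhs : ∫⁻ y, ‖(cube z l).indicator f y‖ₑ ^ s' ≤ I := by
    calc _ ≤ ∫⁻ y in cube z l, ofReal lam ^ s' := by
          rw [← lintegral_indicator (cube_meas z l)]
          refine lintegral_mono fun y ↦ ¿
          by_cases hy : y ∈ cube z l
          · rw [indicator_of_mem hy, indicator_of_mem hy, ← ofReal_norm]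
            exact rpow_le_rpow (ofReal_le_ofReal (fM y)) hs.symm.pos.le
          · rw [indicator_of_notMem hy, enorm_zero, zero_rpow_of_pos hs.symm.pos]; exact zero_le
      _ = A * V := by
          rw [setLIntegral_const, ofReal_rpow_of_pos lam0, hlam, ← Real.rpow_mul a0.le, one_div_mul_cancel hs.symm.pos.ne', Real.rpow_one, ha, ofReal_toReal hAt]
      _ = I := ENNReal.div_mul_cancel V0 Vt
  rw [lhs] at b
  have IV : I = A * V := (ENNReal.div_mul_cancel V0 Vt).symm
  have L : ofReal lam = A ^ (1 / s') := by
    rw [hlam, ← ofReal_rpow_of_pos a0, ha, ofReal_toReal hAt]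
  have Aex : A = A ^ (1 / s') * A ^ (1 / s) := by
    rw [← rpow_add _ _ hA0 hAt, one_div, one_div, add_comm, hs.inv_add_inv_eq_one, rpow_one]
  have l0 : A ^ (1 / s') ≠ 0 := by rw [← L]; simpa using lam0
  have lt : A ^ (1 / s') ≠ ⊤ := by rw [← L]; exact ofReal_ne_top
  rw [L] at b
  refine (ENNReal.mul_le_mul_iff_right l0 lt).1 (b.trans ((mul_le_mul_right (add_le_add le_rfl rhs) D).trans (le_of_eq ¿)))
  rw [← hI, IV]
  calc D * (A * V + A * V) = 2 * D * V * A := by ring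
    _ = 2 * D * V * (A ^ (1 / s') * A ^ (1 / s)) := by rw [← Aex]
    _ = _ := by ring
local notation:70 "ɞ" d:max C:max K:max => 2 ^ (d + 3) * cB d * ofReal (C * (d + 1) / K)
lemma sharp (hC : 0 ≤ C) (hκ : CZ κ C) {s' : ℝ} (hs : s.HolderConjugate s') {D : ℰ} (hD : D ≠ ⊤)
    (hB : BS κ s s' D) (hK : 4 * (d + 2) ≤ K) (hh : Nice h) (z : Pt d) (hl : 0 < l) :
    ∃ c : ℝ, ∀ x ∈ cube z l, ∫⁻ y in cube z l, ‖TT κ h y - c‖ₑ ≤ volume (cube z l) *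
      (2 * D * ((∫⁻ w in pbox z (K * l), ‖h w‖ₑ ^ s) / volume (cube z l)) ^ (1 / s) + ɞ d C K * MM (fun w ↦ ‖h w‖ₑ) x) := by
  obtain ⟨B, kB⟩ := hκ.bdd
  have dn : ō ≤ d := by positivity
  have K0 : 0 < K := by linarith
  set P := pbox z (K * l) with hP
  have Pm : MeasurableSet P := pbox_meas _ _
  have n1 := hh.ind Pm
  have n2 := hh.ind Pm.compl
  refine ⟨TT κ (Pᶜ.indicator h) z, fun x hx ↦ ¿⟩
  have split : ∀ y, TT κ h y = TT κ (P.indicator h) y + TT κ (Pᶜ.indicator h) y := by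
    intro y
    rw [TT, TT, TT, ← integral_add (TT_int hκ.meas kB n1 y) (TT_int hκ.meas kB n2 y)]
    refine integral_congr_ae (of_forall fun w ↦ ¿)
    simp only
    rw [← mul_add, indicator_self_add_compl_apply]
  have fr : ∀ y ∈ cube z l, ‖TT κ (Pᶜ.indicator h) y - TT κ (Pᶜ.indicator h) z‖ₑ ≤ ɞ d C K * MM (fun w ↦ ‖h w‖ₑ) x := by
    intro y hy
    obtain ⟨a, b⟩ := cube_diam hl hy (cube_self z hl)
    have f := far hC hκ.reg1 (h := fun w ↦ ‖h w‖ₑ) hh.1.enorm (z := z) (z' := y) (x := x) (l := (d + 1) * l) (R := K * l) ƥ ŋ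
      (a.trans (pow_le_pow_left₀ hl.le ŋ 2)) (b.trans ŋ)
      (pbox_mono ƥ ŋ (cube_pbox z hl (cube_self z hl) hx))
    rw [show C * ((d + 1) * l) / (K * l) = C * (d + 1) / K by field_simp] at f
    refine le_trans ¿ f
    rw [TT, TT, ← integral_sub (TT_int hκ.meas kB n2 y) (TT_int hκ.meas kB n2 z), ← lintegral_indicator Pm.compl]
    refine (enorm_integral_le_lintegral_enorm _).trans (lintegral_mono fun w ↦ ¿)
    by_cases hw : w ∈ Pᶜ
    · rw [indicator_of_mem hw, indicator_of_mem hw, ← sub_mul, enorm_mul]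
    · simp [indicator_of_notMem hw]
  have nr := near hs hD hκ.meas kB hB n1 z hl
  have e : ∫⁻ w, ‖P.indicator h w‖ₑ ^ s = ∫⁻ w in P, ‖h w‖ₑ ^ s := by
    rw [← lintegral_indicator Pm]
    refine lintegral_congr fun w ↦ ¿
    by_cases hw : w ∈ P
    · rw [indicator_of_mem hw, indicator_of_mem hw]
    · rw [indicator_of_notMem hw, indicator_of_notMem hw, enorm_zero, zero_rpow_of_pos hs.pos]
  rw [e] at nr
  rw [mul_add]
  calc _ ≤ ∫⁻ y in cube z l, ‖TT κ (P.indicator h) y‖ₑ + ɞ d C K * MM (fun w ↦ ‖h w‖ₑ) x := by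
        refine setLIntegral_mono' (cube_meas z l) fun y hy ↦ ¿
        rw [split y, add_sub_assoc]
        exact (enorm_add_le _ _).trans (add_le_add le_rfl (fr y hy))
    _ ≤ _ := by
        rw [lintegral_add_right _ measurable_const, setLIntegral_const, mul_comm _ (volume (cube z l))]
        exact add_le_add nr le_rfl
lemma fub (km : Measurable (uncurry κ)) (kB : ∀ z w, |κ z w| ≤ B) (hh : Nice h) (hg : Nice g) :
    ∫ z, TT κ h z * g z = ∫ w, TT (fun z w ↦ κ w z) g w * h w := by
  simp only [TT]
  simp_rw [← integral_mul_const]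
  rw [integral_integral_swap]
  · refine integral_congr_ae (of_forall fun w ↦ integral_congr_ae (of_forall fun z ↦ ¿))
    simp only; ring
  · refine ((hg.int.mul_prod hh.int).bdd_mul (c := B) km.aestronglyMeasurable (of_forall fun p ↦ kB p.1 p.2)).congr (of_forall fun p ↦ ¿)
    simp only [uncurry]; ring
lemma CZ.symm (h : CZ κ C) : CZ (fun z w ↦ κ w z) C := by
  obtain ⟨B, kB⟩ := h.bdd
  have km : Measurable (uncurry fun z w ↦ κ w z) := h.meas.comp measurable_swap
  refine ⟨km, ⟨B, fun z w ↦ kB w z⟩, h.reg2, h.reg1, fun f g hf hg ↦ ¿⟩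
  have := fub km (fun z w ↦ kB w z) hf hg
  simp only [TT] at this
  rw [this, add_comm]
  exact h.l2 g f hg hf
lemma XX_add (hq : 1 ≤ q) (hp : 1 ≤ p) {f g : Pt d → ℰ} (hf : Measurable f) (hg : Measurable g) :
    XX q p (fun z ↦ f z + g z) ≤ XX q p f + XX q p g := by
  have q0 : 0 < q := by linarith
  have e : ∀ F : Pt d → ℰ, XX q p F = (∫⁻ x, (NN q F x ^ (1 / q)) ^ p) ^ (1 / p) := by
    intro F; simp only [XX, ← rpow_mul]; rw [one_div_mul_eq_div]
  rw [e, e, e]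
  refine le_trans ¿ (lintegral_Lp_add_le ((NN_meas q hf).pow_const _).aemeasurable ((NN_meas q hg).pow_const _).aemeasurable hp)
  refine rpow_le_rpow (lintegral_mono fun x ↦ rpow_le_rpow ¿ ł) ƥ
  exact lintegral_Lp_add_le (f := fun t ↦ f (t, x)) (g := fun t ↦ g (t, x)) (hf.comp measurable_prodMk_right).aemeasurable (hg.comp measurable_prodMk_right).aemeasurable hq
lemma XX_cmul (hq : 0 < q) (hp : 0 < p) {c : ℰ} (hc : c ≠ ⊤) (f : Pt d → ℰ) : XX q p (fun z ↦ c * f z) = c * XX q p f := by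
  simp only [XX, NN]
  simp_rw [mul_rpow_of_nonneg _ _ hq.le]
  have : ∀ x : Spc d, (∫⁻ t : ℝ, c ^ q * f (t, x) ^ q) ^ (p / q) = c ^ p * (∫⁻ t : ℝ, f (t, x) ^ q) ^ (p / q) := by
    intro x
    rw [lintegral_const_mul' _ _ (rpow_ne_top_of_nonneg hq.le hc), mul_rpow_of_nonneg _ _ ƥ, ← rpow_mul, mul_div_cancel₀ _ hq.ne']
  simp_rw [this]
  rw [lintegral_const_mul' _ _ (rpow_ne_top_of_nonneg hp.le hc), mul_rpow_of_nonneg _ _ ƥ, ← rpow_mul, mul_one_div_cancel hp.ne', rpow_one]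
lemma XX_rr (hr : 0 < r) {f : Pt d → ℰ} (hf : Measurable f) : XX r r f = (∫⁻ z, f z ^ r) ^ (1 / r) := by
  rw [XX, div_self hr.ne', tonelli (fun z : Pt d ↦ f z ^ r) (hf.pow_const r)]
  simp only [NN, rpow_one]
lemma TT_uc (hC : 0 ≤ C) (hκ : CZ κ C) (hh : Nice h) : UniformContinuous (TT κ h) := by
  obtain ⟨B, kB⟩ := hκ.bdd
  obtain ⟨hm, ⟨M, hM⟩, -⟩ := id hh
  have B0 : 0 ≤ B := (abs_nonneg _).trans (kB 0 0)
  have M0 : 0 ≤ M := (abs_nonneg _).trans (hM 0)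
  set H := ∫ w, |h w| with hH
  have H0 : 0 ≤ H := integral_nonneg fun w ↦ abs_nonneg _
  rw [Metric.uniformContinuous_iff]
  intro ε hε
  set b := 2 * B * M * (cB d).toReal with hb
  have b0 : 0 ≤ b := by positivity
  set ρ := min 1 (ε / (4 * (b + 1))) with hρ
  have ρ0 : 0 < ρ := lt_min one_pos ƥ
  set l := min (ρ / 4) (ε * ρ ^ (d + 3) / (4 * (C * H + 1))) with hl
  have l0 : 0 < l := lt_min ƥ ƥ
  refine ⟨min l (l ^ 2), by positivity, fun {z z'} hz ↦ ¿⟩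
  rw [dist_comm, dist_eq]
  have d1 : |z'.1 - z.1| ≤ l ^ 2 := by
    have : dist z'.1 z.1 ≤ dist z z' := by rw [dist_comm z]; exact le_max_left _ _
    rw [dist_eq] at this; exact this.trans (hz.le.trans (min_le_right _ _))
  have d2 : ‖z'.2 - z.2‖ ≤ l := by
    have : dist z'.2 z.2 ≤ dist z z' := by rw [dist_comm z]; exact le_max_right _ _
    rw [dist_eq_norm] at this; exact this.trans (hz.le.trans (min_le_left _ _))
  rw [TT, TT, ← integral_sub (TT_int hκ.meas kB hh z') (TT_int hκ.meas kB hh z)]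
  have i1 : Integrable ((pbox z ρ).indicator fun _ ↦ 2 * B * M) := by
    rw [integrable_indicator_iff (pbox_meas _ _)]; exact integrableOn_const (vpbox_net _ ρ0)
  have i2 : Integrable fun w ↦ C * l / ρ ^ (d + 3) * |h w| := hh.int.abs.const_mul _
  have bd : |∫ w, (κ z' w * h w - κ z w * h w)| ≤ ∫ w, ((pbox z ρ).indicator (fun _ ↦ 2 * B * M) w + C * l / ρ ^ (d + 3) * |h w|) := by
    rw [← norm_eq_abs]
    refine norm_integral_le_of_norm_le (i1.add i2) (of_forall fun w ↦ ¿)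
    rw [← sub_mul, norm_mul, norm_eq_abs, norm_eq_abs]
    by_cases hw : w ∈ pbox z ρ
    · rw [indicator_of_mem hw]
      have a1 : |κ z' w - κ z w| ≤ 2 * B := (abs_sub _ _).trans (by linarith [kB z' w, kB z w])
      have : 0 ≤ C * l / ρ ^ (d + 3) * |h w| := by positivity
      have := mul_le_mul a1 (hM w) (abs_nonneg _) ƥ
      linarith
    · rw [indicator_of_notMem hw, zero_add]
      exact mul_le_mul_of_nonneg_right (hκ.reg1 z z' w l ρ l0 (by have := min_le_left (ρ/4) (ε * ρ ^ (d + 3) / (4 * (C * H + 1))); linarith) d1 d2 hw) (abs_nonneg _)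
  refine bd.trans_lt ¿
  rw [integral_add i1 i2, integral_const_mul, integral_indicator (pbox_meas _ _), setIntegral_const, smul_eq_mul]
  have v : volume.real (pbox z ρ) ≤ (cB d).toReal * ρ := by
    have := toReal_mono (mul_ne_top (cB_ne) ofReal_ne_top) (vpbox_eq' z ρ0)
    rw [toReal_mul, toReal_ofReal ƥ] at this
    refine this.trans (mul_le_mul_of_nonneg_left ¿ toReal_nonneg)
    calc ρ ^ (d + 2) ≤ ρ ^ 1 := pow_le_pow_of_le_one ρ0.le (min_le_left _ _) (by omega)
      _ = ρ := pow_one _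
  have t1 : volume.real (pbox z ρ) * (2 * B * M) ≤ ε / 4 := by
    calc _ ≤ (cB d).toReal * ρ * (2 * B * M) := mul_le_mul_of_nonneg_right v ƥ
      _ = b * ρ := by rw [hb]; ring
      _ ≤ (b + 1) * (ε / (4 * (b + 1))) := mul_le_mul ł (min_le_right _ _) ρ0.le ƥ
      _ = ε / 4 := by field_simp
  have t2 : C * l / ρ ^ (d + 3) * H ≤ ε / 4 := by
    have : l ≤ ε * ρ ^ (d + 3) / (4 * (C * H + 1)) := min_le_right _ _
    rw [le_div_iff₀ ƥ] at this
    rw [div_mul_eq_mul_div, div_le_iff₀ ƥ]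
    nlinarith
  linarith
lemma avg_MM (f : Pt d → ℰ) (z : Pt d) (hl : 0 < l) (hK : d + 2 ≤ K) {x : Pt d} (hx : x ∈ cube z l) :
    (∫⁻ w in pbox z (K * l), f w) / volume (cube z l) ≤ cB d * ofReal (K ^ (d + 2)) * MM f x := by
  have K0 : 0 < K := lt_of_lt_of_le ƥ hK
  have hp : 0 < K * l := by positivity
  have := le_MM f hp (pbox_mono ƥ ŋ (cube_pbox z hl (cube_self z hl) hx))
  rw [div_le_iff (vpbox_ne0 _ hp) (vpbox_net _ hp)] at this
  rw [div_le_iff (vcube_ne0 _ hl) (vcube_net _ hl), vcube z hl]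
  refine this.trans ((mul_le_mul_right (vpbox_eq' z hp) _).trans (le_of_eq ¿))
  rw [mul_pow, ofReal_mul ƥ]; ring
lemma MMs (hs : 0 < s) (hq : s < q) (hp : s < p) : ∃ C : ℰ, C ≠ ⊤ ∧ ∀ f : Pt d → ℰ, Measurable f →
    XX q p (fun z ↦ MM (fun w ↦ f w ^ s) z ^ (1 / s)) ≤ C * XX q p f := by
  obtain ⟨C, hC, h⟩ := MM_XX (d := d) (q / s) (p / s) ((one_lt_div hs).2 hq) ((one_lt_div hs).2 hp)
  refine ⟨C ^ (1 / s), rpow_ne_top_of_nonneg ƥ hC, fun f hf ↦ ¿⟩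
  have e1 := XX_pow (q := q) (p := p) (s := 1 / s) ƥ (MM fun w ↦ f w ^ s)
  have e2 := XX_pow (q := q / s) (p := p / s) hs f
  rw [mul_one_div, mul_one_div] at e1
  rw [div_mul_cancel₀ _ hs.ne', div_mul_cancel₀ _ hs.ne'] at e2
  rw [e1]
  refine (rpow_le_rpow (h _ (hf.pow_const s)) ƥ).trans ¿
  rw [e2, mul_rpow_of_nonneg _ _ ƥ, ← rpow_mul, mul_one_div_cancel hs.ne', rpow_one]
lemma pbox_cube (R : ℝ) (hR : 0 < R) (n : ℕ) (hn : 2 * (R + 1) ≤ n) : pbox (0 : Pt d) R ⊆ cube ((-((n:ℝ) ^ 2 / 2)), toLp 2 fun _ ↦ -((n:ℝ) / 2)) n := by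
  rintro w ⟨⟨h1, h2⟩, h3⟩
  rw [mem_ball, show dist w.2 (0 : Pt d).2 = ‖w.2‖ from dist_zero_right _] at h3
  change ō - R ^ 2 < w.1 at h1
  change w.1 < ō + R ^ 2 at h2
  refine ⟨⟨¿, ¿⟩, fun i ↦ ¿⟩
  · show -((n:ℝ)^2/2) ≤ w.1; nlinarith
  · show w.1 < -((n:ℝ)^2/2) + n ^ 2; nlinarith
  · have := (norm_eq w.2 ▸ norm_apply_le w.2 i : ‖w.2 i‖ ≤ _)
    rw [← norm_eq, norm_eq_abs] at this
    have a := abs_le.1 this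
    exact ⟨by simp only; linarith, by simp only; linarith⟩
theorem boot (C : ℝ) (hC : 0 ≤ C) (s r : ℝ) (hs : s.HolderConjugate r) (hr : 2 < r) : ∃ D : ℰ, D ≠ ⊤ ∧ ∀ κ : Pt d → Fn d, CZ κ C → BS κ s r D := by
  have r1 : 1 < r := by linarith
  have r0 : 0 < r := by linarith
  obtain ⟨Kf, hKf, FSr⟩ := FS (d := d) r r r1 r1
  obtain ⟨C1, hC1, M1⟩ := MM_XX (d := d) r r r1 r1
  obtain ⟨C2, hC2, M2⟩ := MMs (d := d) (q := r) (p := r) two_pos hr hr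
  have h22 : (2:ℝ).HolderConjugate 2 := by rw [holderConjugate_iff]; norm_num
  set K : ℝ := 4 * (d + 2) with hK
  set D0 := ofReal C
  set A1 : ℰ := 2 * D0 * (cB d * ofReal (K ^ (d + 2))) ^ ½ with hA1
  set A2 : ℰ := ɞ d C K with hA2
  have cbn := cB_ne (d := d)
  have A1t : A1 ≠ ⊤ := mul_ne_top ƒ (rpow_ne_top_of_nonneg ñ ƒ)
  have A2t : A2 ≠ ⊤ := by finiteness
  set A4 := Kf * (A1 * C2 + A2 * C1) with hA4
  refine ⟨1 + A4 ^ r, by have : A4 ^ r ≠ ⊤ := rpow_ne_top_of_nonneg r0.le ƒ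
                         finiteness, fun κ hκ h g hh hg ↦ ¿⟩
  obtain ⟨B, kB⟩ := hκ.bdd
  have hκ' := hκ.symm
  set κ' : Pt d → Fn d := fun z w ↦ κ w z with hκd
  set F := TT κ' g with hF
  have Fm : Measurable F := TT_meas hκ'.meas hg.1
  set G : Pt d → ℰ := fun z ↦ ‖g z‖ₑ with hG
  have Gm : Measurable G := hg.1.enorm
  set I2 := ∫⁻ w, G w ^ (2:ℝ) with hI2
  have I2t : I2 ^ ½ ≠ ⊤ := by
    refine rpow_ne_top_of_nonneg ñ ¿
    obtain ⟨m, ⟨M, hM⟩, R, hR, h0⟩ := id hg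
    have : Integrable fun w ↦ g w ^ 2 := bint (m.pow_const 2).aestronglyMeasurable (M := M ^ 2) (fun w ↦ by
      rw [norm_pow, norm_eq_abs]; exact pow_le_pow_left₀ (abs_nonneg _) (hM w) 2) (vpbox_net (0 : Pt d) hR).lt_top (fun w hw ↦ by rw [h0 w hw]; norm_num)
    have t := this.2.ne
    refine ne_of_eq_of_ne (lintegral_congr fun w ↦ ¿) t
    rw [hG]; simp only; rw [show g w ^ 2 = g w * g w by ring, enorm_mul, rpow_two, sq]
  set w : Pt d → ℰ := fun x ↦ A1 * MM (fun y ↦ G y ^ (2:ℝ)) x ^ ½ + A2 * MM G x with hw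
  have m1 : Measurable fun x ↦ MM (fun y ↦ G y ^ (2:ℝ)) x ^ ½ := ((pB d).M_meas _ _).pow_const _
  have m2 : Measurable fun x ↦ MM G x := (pB d).M_meas _ _
  have wX : XX r r w ≤ (A1 * C2 + A2 * C1) * XX r r G := by
    refine (XX_add r1.le r1.le (m1.const_mul A1) (m2.const_mul A2)).trans ¿
    rw [XX_cmul r0 r0 A1t, XX_cmul r0 r0 A2t, add_mul, mul_assoc A1, mul_assoc A2]
    exact add_le_add (mul_le_mul_right (M2 G Gm) _) (mul_le_mul_right (M1 G Gm) _)
  have shp : ∀ (y : Pt d) (m : ℝ), 0 < m → ∃ c : ℝ, ∀ x ∈ cube y m, ∫⁻ y in cube y m, ‖F y - c‖ₑ ≤ volume (cube y m) * w x := by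
    intro y m hm
    obtain ⟨c, hc⟩ := sharp hC hκ' h22 ofReal_ne_top hκ'.BS2 (K := K) le_rfl hg y hm
    refine ⟨c, fun x hx ↦ (hc x hx).trans (mul_le_mul_right (add_le_add ¿ le_rfl) _)⟩
    rw [hA1, mul_assoc (2 * D0), ← mul_rpow_of_nonneg _ _ ñ]
    exact mul_le_mul_right (rpow_le_rpow (avg_MM _ y hm (by rw [hK]; have : ō ≤ d := ƥ; linarith) hx) ñ) _
  obtain ⟨hm, -, R, hR, hh0⟩ := id hh
  have root : ∀ n : ℕ, 2 * (R + 1) ≤ n → XX r r ((pbox 0 R).indicator fun y ↦ ‖F y‖ₑ) ≤ Kf * (2 * D0 * I2 ^ ½ * (n : ℰ) ^ (-(1 / 2 - 1 / r)) + XX r r w) := by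
    intro n hn
    have n0 : ō < n := by linarith
    set z : Pt d := ((-((n:ℝ) ^ 2 / 2)), toLp 2 fun _ ↦ -((n:ℝ) / 2)) with hz
    have f := FSr z n n0 F Fm (TT_uc hC hκ' hg).uniformContinuousOn w ((m1.const_mul A1).add (m2.const_mul A2)) (fun y m hm _ ↦ shp y m hm) _ (fun y _ ↦ TT_bd (fun z w ↦ kB w z) hg y)
    refine le_trans (XX_mono r0 r0 (indicator_le_indicator_of_subset (pbox_cube R hR n hn) fun _ ↦ zero_le)) (f.trans (mul_le_mul_right (add_le_add ¿ (XX_mono r0 r0 (indicator_le_self _ _))) _))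
    set V := volume (cube z n) with hV
    have V0 : V ≠ 0 := vcube_ne0 z n0
    have Vt : V ≠ ⊤ := vcube_net z n0
    have nV : (n : ℰ) ≤ V := by
      rw [hV, vcube z n0, ← ENNReal.ofReal_natCast]
      exact ofReal_le_ofReal (le_self_pow₀ ł (by omega))
    have nr := near h22 ofReal_ne_top hκ'.meas (fun z w ↦ kB w z) hκ'.BS2 hg z n0
    have x1 : XX r r ((cube z n).indicator 1) = V ^ (1 / r) := by
      rw [XX_rr r0 (measurable_one.indicator (cube_meas z n))]
      congr 1
      rw [hV, ← setLIntegral_one, ← lintegral_indicator (cube_meas z n)]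
      refine lintegral_congr fun y ↦ ¿
      by_cases hy : y ∈ cube z n <;> simp [hy, r0]
    rw [x1]
    have d1 : (∫⁻ y in cube z n, ‖F y‖ₑ) / V ≤ 2 * D0 * (I2 / V) ^ ½ := div_le_of_le_mul' nr
    refine (mul_le_mul_right d1 _).trans ¿
    rw [ENNReal.div_rpow_of_nonneg _ _ (by norm_num : ō ≤ 1 / 2), show I2 ^ ½ / V ^ ½ = I2 ^ ½ * V ^ (-½) by rw [rpow_neg, div_eq_mul_inv]]
    calc _ = 2 * D0 * I2 ^ ½ * (V ^ (1 / r) * V ^ (-½)) := by ring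
      _ = 2 * D0 * I2 ^ ½ * V ^ (-(1 / 2 - 1 / r)) := by
          rw [← rpow_add _ _ V0 Vt]; congr 2; ring
      _ ≤ _ := by
          refine mul_le_mul_right ¿ _
          rw [rpow_neg, rpow_neg]
          refine ENNReal.inv_le_inv.2 (rpow_le_rpow nV ¿)
          have := one_div_le_one_div_of_le two_pos hr.le
          linarith
  have lim : XX r r ((pbox 0 R).indicator fun y ↦ ‖F y‖ₑ) ≤ Kf * XX r r w := by
    have e0 : 0 < 1 / 2 - 1 / r := by have := one_div_lt_one_div_of_lt two_pos hr; linarith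
    have t1 : Filter.Tendsto (fun n : ℕ ↦ (n : ℰ) ^ (-(1 / 2 - 1 / r))) atTop (nhds 0) := by
      have := (ENNReal.continuous_rpow_const (y := -(1 / 2 - 1 / r))).continuousAt.tendsto.comp ENNReal.tendsto_nat_nhds_top
      rwa [ENNReal.top_rpow_of_neg ł] at this
    have t2 := (ENNReal.Tendsto.const_mul (a := Kf) ((ENNReal.Tendsto.const_mul (a := 2 * D0 * I2 ^ ½) t1 (Or.inr ƒ)).add_const (XX r r w)) (Or.inr hKf))
    rw [mul_zero, zero_add] at t2
    refine ge_of_tendsto t2 ¿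
    filter_upwards [Filter.eventually_ge_atTop ⌈2 * (R + 1)⌉₊] with n hn
    exact root n (Nat.ceil_le.1 hn)
  have fin : ∫⁻ y, ((pbox 0 R).indicator (fun y ↦ ‖F y‖ₑ) y) ^ r ≤ A4 ^ r * ∫⁻ y, G y ^ r := by
    have := rpow_le_rpow (lim.trans (mul_le_mul_right wX Kf)) r0.le
    rw [← mul_assoc, ← hA4, XX_rr r0 Gm, XX_rr r0 (Fm.enorm.indicator (pbox_meas _ _)), mul_rpow_of_nonneg _ _ r0.le, ← rpow_mul, ← rpow_mul,
      one_div_mul_cancel r0.ne', rpow_one, rpow_one] at this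
    exact this
  rw [fub hκ.meas kB hh hg]
  refine (enorm_integral_le_lintegral_enorm _).trans ¿
  calc _ ≤ ∫⁻ y, (‖h y‖ₑ ^ s + ((pbox 0 R).indicator (fun y ↦ ‖F y‖ₑ) y) ^ r) := by
        refine lintegral_mono fun y ↦ ¿
        by_cases hy : y ∈ pbox 0 R
        · rw [indicator_of_mem hy, enorm_mul, mul_comm]
          refine (ENNReal.young_inequality _ _ hs).trans (add_le_add ¿ ¿)
          · exact div_le_of_le_mul (le_mul_of_one_le_right zero_le (by simpa using hs.lt.le))
          · exact div_le_of_le_mul (le_mul_of_one_le_right zero_le (by simpa using r1.le))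
        · rw [hh0 y hy]; simp
    _ ≤ (∫⁻ y, ‖h y‖ₑ ^ s) + A4 ^ r * ∫⁻ y, G y ^ r := by
        rw [lintegral_add_left (hm.enorm.pow_const s)]; exact add_le_add le_rfl fin
    _ ≤ _ := by
        rw [mul_add]
        refine add_le_add (le_mul_of_one_le_left zero_le le_self_add) (mul_le_mul_left le_add_self _)
structure C12 (v : Fn d) : Prop where
  c0 : Continuous v
  ct : Continuous (Dt v)
  cx : ∀ i, Continuous (Dx i v)
  cxx : ∀ i j, Continuous (Dxx i j v)
  dt : ∀ z : Pt d, DifferentiableAt ℝ (fun s ↦ v (s, z.2)) z.1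
  dx : ∀ z : Pt d, DifferentiableAt ℝ (fun y ↦ v (z.1, y)) z.2
  dxx : ∀ j, ∀ z : Pt d, DifferentiableAt ℝ (fun y ↦ Dx j v (z.1, y)) z.2
  supp : ∃ R, 0 < R ∧ tsupport v ⊆ pbox 0 R
lemma Dx_loc (h : u =ᶠ[nhds z] v) (i : Fin d) : Dx i u =ᶠ[nhds z] Dx i v := by
  filter_upwards [h.eventuallyEq_nhds] with w hw
  have : Filter.Tendsto (fun y ↦ (w.1, y)) (nhds w.2) (nhds w) := (Continuous.prodMk_right w.1).tendsto w.2
  have e : (fun y ↦ u (w.1, y)) =ᶠ[nhds w.2] fun y ↦ v (w.1, y) := this.eventually hw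
  simp only [Dx]
  rw [e.fderiv_eq]
lemma Dt_loc (h : u =ᶠ[nhds z] v) : Dt u =ᶠ[nhds z] Dt v := by
  filter_upwards [h.eventuallyEq_nhds] with w hw
  have : Filter.Tendsto (fun s ↦ (s, w.2)) (nhds w.1) (nhds w) := (Continuous.prodMk_left w.2).tendsto w.1
  exact Filter.EventuallyEq.deriv_eq (this.eventually hw)
lemma Dx_zero (i : Fin d) : Dx i (0 : Fn d) = 0 := by
  ext z; simp [Dx]
lemma Dt_zero : Dt (0 : Fn d) = 0 := by
  ext z; simp [Dt]
lemma supX (v : Fn d) (i : Fin d) : tsupport (Dx i v) ⊆ tsupport v := by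
  intro z hz
  by_contra h
  rw [notMem_tsupport_iff_eventuallyEq] at h
  exact notMem_tsupport_iff_eventuallyEq.2 (Dx_zero i ▸ Dx_loc h i) hz
lemma supT (v : Fn d) : tsupport (Dt v) ⊆ tsupport v := by
  intro z hz
  by_contra h
  rw [notMem_tsupport_iff_eventuallyEq] at h
  exact notMem_tsupport_iff_eventuallyEq.2 (Dt_zero (d := d) ▸ Dt_loc h) hz
lemma cpt_of (h : tsupport f ⊆ pbox 0 R) : HasCompactSupport f := by
  refine HasCompactSupport.of_support_subset_isCompact (K := closure (pbox 0 R)) ¿ ((subset_tsupport f).trans (h.trans subset_closure))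
  refine Bornology.IsBounded.isCompact_closure ¿
  exact (isBounded_Ioo _ _).prod isBounded_ball
lemma nice_of (hf : Continuous f) (hR : 0 < R) (h : tsupport f ⊆ pbox 0 R) : Nice f := by
  obtain ⟨M, hM⟩ := hf.bounded_above_of_compact_support (cpt_of h)
  exact ⟨hf.measurable, ⟨M, hM⟩, R, hR, fun z hz ↦ image_eq_zero_of_notMem_tsupport fun hc ↦ hz (h hc)⟩
lemma C12.nxx (hv : C12 v) (i j : Fin d) : Nice (Dxx i j v) := by
  obtain ⟨R, hR, h⟩ := hv.supp
  exact nice_of (hv.cxx i j) hR ((supX _ i).trans ((supX v j).trans h))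
lemma C12.nt (hv : C12 v) : Nice (Dt v) := by
  obtain ⟨R, hR, h⟩ := hv.supp
  exact nice_of hv.ct hR ((supT _).trans h)
lemma C12.nx (hv : C12 v) (i : Fin d) : Nice (Dx i v) := by
  obtain ⟨R, hR, h⟩ := hv.supp
  exact nice_of (hv.cx i) hR ((supX _ i).trans h)
lemma C12.n0 (hv : C12 v) : Nice v := by
  obtain ⟨R, hR, h⟩ := hv.supp
  exact nice_of hv.c0 hR h
@[irreducible] def VH (f : Fn d) (τ : ℝ) (ξ : Spc d) : ℂ := 𝓕 (fun y ↦ (f (τ, y) : ℂ)) ξ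
lemma VH_eq (f : Fn d) (τ : ℝ) (ξ : Spc d) : VH f τ ξ = ∫ y, Complex.exp ((-2 * π * inner ℝ y ξ : ℝ) * Complex.I) * (f (τ, y) : ℂ) := by
  rw [VH, fourier_eq']; rfl
lemma VH_meas (hf : Measurable f) : Measurable fun p : ℝ × Spc d ↦ VH f p.1 p.2 := by
  simp_rw [VH_eq]
  have : Measurable fun q : (ℝ × Spc d) × Spc d ↦ Complex.exp ((-2 * π * inner ℝ q.2 q.1.2 : ℝ) * Complex.I) * (f (q.1.1, q.2) : ℂ) := by
    have h1 := measurable_ofReal.comp (hf.comp (show Measurable fun q : (ℝ × Spc d) × Spc d ↦ (q.1.1, q.2) by fun_prop))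
    exact (show Measurable fun q : (ℝ × Spc d) × Spc d ↦ Complex.exp ((-2 * π * inner ℝ q.2 q.1.2 : ℝ) * Complex.I) from Continuous.measurable ʄ).mul h1
  exact (this.stronglyMeasurable.integral_prod_right (ν := volume)).measurable
lemma VH_bd (hf : Nice f) : ∃ M, 0 ≤ M ∧ ∀ τ ξ, ‖VH f τ ξ‖ ≤ M := by
  obtain ⟨h1, ⟨M, h2⟩, R, h3, h4⟩ := id hf
  have hM : 0 ≤ M := (abs_nonneg _).trans (h2 0)
  refine ⟨M * volume.real (ball (0 : Spc d) R), by positivity, fun τ ξ ↦ ¿⟩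
  rw [VH]
  refine (four_bd _ _).trans ¿
  rw [← setIntegral_eq_integral_of_forall_compl_eq_zero (s := ball (0 : Spc d) R) fun x hx ↦ by rw [h4 (τ, x) fun hc ↦ hx hc.2]; simp]
  refine (le_abs_self _).trans ¿
  rw [← norm_eq_abs]
  refine norm_setIntegral_le_of_norm_le_const measure_ball_lt_top fun x hx ↦ ¿
  simpa using h2 (τ, x)
lemma cE (y ξ : Spc d) : ‖Complex.exp ((-2 * π * inner ℝ y ξ : ℝ) * Complex.I)‖ = 1 := norm_exp_ofReal_mul_I _
lemma VH_dt (hv : C12 v) (τ : ℝ) (ξ : Spc d) : HasDerivAt (fun τ ↦ VH v τ ξ) (VH (Dt v) τ ξ) τ := by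
  simp_rw [VH_eq]
  obtain ⟨h1, ⟨M, h2⟩, R, h3, h4⟩ := id hv.nt
  have hM : 0 ≤ M := (abs_nonneg _).trans (h2 0)
  have mm : ∀ (f : Fn d) (hf : Continuous f) t, AEStronglyMeasurable (fun y ↦ Complex.exp ((-2 * π * inner ℝ y ξ : ℝ) * Complex.I) * (f (t, y) : ℂ)) volume := fun f hf t ↦
    Continuous.aestronglyMeasurable ʄ
  refine (hasDerivAt_integral_of_dominated_loc_of_deriv_le (s := univ) (F' := fun t y ↦ Complex.exp ((-2 * π * inner ℝ y ξ : ℝ) * Complex.I) * (Dt v (t, y) : ℂ)) (bound := (ball (0 : Spc d) R).indicator fun _ ↦ M) Filter.univ_mem (of_forall fun t ↦ mm v hv.c0 t) ¿ (mm _ hv.ct τ) (of_forall fun y t _ ↦ ¿) ¿ (of_forall fun y t _ ↦ ¿)).2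
  · have : Integrable fun y ↦ (v (τ, y) : ℂ) := (hv.n0.slice τ).ofReal
    exact this.bdd_mul (c := 1) (Continuous.aestronglyMeasurable ʄ) (of_forall fun y ↦ (cE y ξ).le)
  · rw [norm_mul, cE, one_mul, norm_real]
    by_cases hy : y ∈ ball (0 : Spc d) R
    · rw [indicator_of_mem hy]; exact h2 _
    · rw [indicator_of_notMem hy, h4 (t, y) (fun hc ↦ hy hc.2), norm_zero]
  · exact bint ((measurable_const.indicator measurableSet_ball).aestronglyMeasurable) (M := M) (fun y ↦ (norm_indicator_le_norm_self _ _).trans (by rw [norm_of_nonneg hM])) (S := ball (0 : Spc d) R) measure_ball_lt_top fun y hy ↦ indicator_of_notMem hy _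
  · have h : HasDerivAt (fun s ↦ v (s, y)) (Dt v (t, y)) t := (hv.dt (t, y)).hasDerivAt
    exact h.ofReal_comp.const_mul _
lemma F_dx {w w' : Spc d → ℝ} (i : Fin d) (hw : Integrable w) (hw' : Integrable w') (hd : ∀ y, HasLineDerivAt ℝ w (w' y) y (single i 1)) (ξ : Spc d) :
    𝓕 (fun y ↦ (w' y : ℂ)) ξ = (2 * π * Complex.I * (ξ i : ℂ)) * 𝓕 (fun y ↦ (w y : ℂ)) ξ := by
  rw [fourier_eq', fourier_eq']
  simp only [smul_eq_mul]
  have iw : Integrable fun y ↦ (w y : ℂ) := hw.ofReal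
  have iw' : Integrable fun y ↦ (w' y : ℂ) := hw'.ofReal
  have c1 : Continuous fun y : Spc d ↦ Complex.exp ((-2 * π * inner ℝ y ξ : ℝ) * Complex.I) := by fun_prop
  have bd : ∀ {f : Spc d → ℂ}, Integrable f → Integrable fun y ↦ Complex.exp ((-2 * π * inner ℝ y ξ : ℝ) * Complex.I) * f y := fun hf ↦
    hf.bdd_mul (c := 1) c1.aestronglyMeasurable (of_forall fun y ↦ (cE y ξ).le)
  have := integral_bilinear_hasLineDerivAt_right_eq_neg_left_of_integrable (μ := (volume : Measure (Spc d))) (B := ContinuousLinearMap.mul ℝ ℂ)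
    (f := fun y : Spc d ↦ Complex.exp ((-2 * π * inner ℝ y ξ : ℝ) * Complex.I)) (f' := fun y ↦ -(2 * π * Complex.I * (ξ i : ℂ)) * Complex.exp ((-2 * π * inner ℝ y ξ : ℝ) * Complex.I))
    (g := fun y ↦ (w y : ℂ)) (g' := fun y ↦ (w' y : ℂ)) (v := single i 1) ¿ (bd iw') (bd iw) ¿ ¿
  · simp only [ContinuousLinearMap.mul_apply'] at this
    rw [this, ← integral_const_mul, ← integral_neg]
    congr 1; ext y; ring
  · simp only [ContinuousLinearMap.mul_apply', mul_assoc]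
    have := (bd iw).const_mul (-(2 * π * Complex.I * (ξ i : ℂ)))
    simpa only [mul_assoc, neg_mul] using this
  · intro y _
    unfold HasLineDerivAt
    have e : ∀ s : ℝ, (inner ℝ (y + s • single i 1) ξ : ℝ) = inner ℝ y ξ + s * ξ i := fun s ↦ by
      rw [inner_add_left, real_inner_smul_left, EuclideanSpace.inner_single_left]; simp
    change HasDerivAt (fun s : ℝ ↦ Complex.exp ((-2 * π * inner ℝ (y + s • single i 1) ξ : ℝ) * Complex.I)) _ 0
    simp only [e]
    have h1 : HasDerivAt (fun s : ℝ ↦ -2 * π * (inner ℝ y ξ + s * ξ i)) (-2 * π * (1 * ξ i)) 0 := (((hasDerivAt_id ō).mul_const (ξ i)).const_add _).const_mul _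
    have h2 := (h1.ofReal_comp.mul_const Complex.I).cexp
    convert h2 using 1
    simp only [zero_mul, add_zero]; push_cast; ring
  · intro y _
    have := hd y
    unfold HasLineDerivAt at this ⊢
    exact this.ofReal_comp
lemma Dx_line (h : DifferentiableAt ℝ (fun y ↦ u (z.1, y)) z.2) (i : Fin d) : HasLineDerivAt ℝ (fun y ↦ u (z.1, y)) (Dx i u z) z.2 (single i 1) :=
  h.hasFDerivAt.hasLineDerivAt _
lemma VH_xx (hv : C12 v) (i j : Fin d) (τ : ℝ) (ξ : Spc d) : VH (Dxx i j v) τ ξ = PP i j ξ * VH v τ ξ := by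
  simp only [VH]
  rw [F_dx i ((hv.nx j).slice τ) ((hv.nxx i j).slice τ) (fun y ↦ Dx_line (hv.dxx j (τ, y)) i), F_dx j (hv.n0.slice τ) ((hv.nx j).slice τ) (fun y ↦ Dx_line (hv.dx (τ, y)) j), PP]
  push_cast
  have := Complex.I_sq
  linear_combination (4 * π ^ 2 * (ξ i : ℂ) * (ξ j : ℂ) * 𝓕 (fun y ↦ (v (τ, y) : ℂ)) ξ) * this
lemma swapI (hδ : 0 < δ) (hε : 0 < ε) (hα : Al δ α) (hP : Hom m P) (hf : Nice f) (t : ℝ) (x : Spc d)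
    {ψ : ℝ → ℝ} (hψ : Measurable ψ) (hB : ∀ τ, |ψ τ| ≤ B) (h0 : ∀ τ, τ ≤ t + ε → ψ τ = 0) :
    Integrable (fun p : ℝ × Spc d ↦ ψ p.1 * (Complex.exp ((2 * π * inner ℝ p.2 x : ℝ) * Complex.I) * (P p.2 * gA (AA α t p.1) p.2 * VH f p.1 p.2)).re) (volume.prod volume) := by
  obtain ⟨M, hM, hb⟩ := VH_bd hf
  obtain ⟨h1, -, R, hR, h4⟩ := id hf
  have v0 : ∀ τ, τ ∉ Ioo (-R^2) (R^2) → ∀ ξ, VH f τ ξ = 0 := fun τ hτ ξ ↦ by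
    rw [VH_eq]
    rw [show (fun y ↦ Complex.exp ((-2 * π * inner ℝ y ξ : ℝ) * Complex.I) * (f (τ, y) : ℂ)) = 0 from funext fun y ↦ by
      rw [h4 (τ, y) fun hc ↦ hτ (by have := hc.1; simpa using this)]; simp]
    simp
  have hB0 : 0 ≤ B := (abs_nonneg _).trans (hB 0)
  have cA := AA_cont hδ hα
  have mg : Measurable fun p : ℝ × Spc d ↦ gA (AA α t p.1) p.2 := by
    have : ∀ i j, Continuous fun p : ℝ × Spc d ↦ AA α t p.1 i j := fun i j ↦ (cA i j).comp (by fun_prop : Continuous fun p : ℝ × Spc d ↦ (t, p.1))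
    unfold gA QF
    exact Continuous.measurable ʄ
  have mP : Measurable fun p : ℝ × Spc d ↦ P p.2 := (hP.1.1.continuous.comp continuous_snd).measurable
  have I1 : Integrable ((Ioo (-R^2) (R^2)).indicator fun _ ↦ B * M) := by
    refine bint (measurable_const.indicator measurableSet_Ioo).aestronglyMeasurable (M := B * M) (fun y ↦ (norm_indicator_le_norm_self _ _).trans (by rw [norm_of_nonneg ƥ])) (S := Ioo (-R^2) (R^2)) measure_Ioo_lt_top fun y hy ↦ indicator_of_notMem hy _
  refine (I1.mul_prod (tg_exp_int hP.1 (c := 4 * π ^ 2 * δ * ε) ƥ)).mono' ¿ (of_forall fun p ↦ ¿)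
  · refine Measurable.aestronglyMeasurable ¿
    have e : Measurable fun p : ℝ × Spc d ↦ Complex.exp ((2 * π * inner ℝ p.2 x : ℝ) * Complex.I) := Continuous.measurable ʄ
    exact (hψ.comp measurable_fst).mul (measurable_re.comp (e.mul ((mP.mul mg).mul (VH_meas h1))))
  · by_cases hτ : p.1 ∈ Ioo (-R^2) (R^2)
    swap
    · rw [v0 _ hτ]; simp [indicator_of_notMem hτ]
    rw [indicator_of_mem hτ]
    rcases le_or_gt p.1 (t + ε) with h | h
    · rw [h0 _ h, zero_mul, norm_zero]; positivity
    have hEL := AA_EL hδ hα (show t ≤ p.1 by linarith)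
    rw [norm_mul, norm_eq_abs]
    have a1 := (abs_re_le_norm (Complex.exp ((2 * π * inner ℝ p.2 x : ℝ) * Complex.I) * (P p.2 * gA (AA α t p.1) p.2 * VH f p.1 p.2)))
    rw [norm_mul, norm_exp_ofReal_mul_I, one_mul, norm_mul, norm_mul] at a1
    have a2 := gA_le hEL p.2
    have a3 : exp (-(4 * π ^ 2 * δ * (p.1 - t) * ‖p.2‖ ^ 2)) ≤ exp (-(4 * π ^ 2 * δ * ε * ‖p.2‖ ^ 2)) := by
      apply exp_le_exp.2
      have : 4 * π ^ 2 * δ * ‖p.2‖ ^ 2 * ε ≤ 4 * π ^ 2 * δ * ‖p.2‖ ^ 2 * (p.1 - t) := mul_le_mul_of_nonneg_left ł ƥ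
      nlinarith
    calc _ ≤ B * (‖P p.2‖ * exp (-(4 * π ^ 2 * δ * ε * ‖p.2‖ ^ 2)) * M) := by
          refine mul_le_mul (hB _) (a1.trans ¿) (abs_nonneg _) hB0
          exact mul_le_mul (mul_le_mul_of_nonneg_left (a2.trans a3) (norm_nonneg _)) (hb _ _) (norm_nonneg _) ƥ
      _ = _ := by ring
lemma swap (hδ : 0 < δ) (hε : 0 < ε) (hα : Al δ α) (hP : Hom m P) (hf : Nice f) (t : ℝ) (x : Spc d)
    {ψ : ℝ → ℝ} (hψ : Measurable ψ) (hB : ∀ τ, |ψ τ| ≤ B) (h0 : ∀ τ, τ ≤ t + ε → ψ τ = 0) :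
    ∫ τ, ψ τ * (∫ y, KF P (AA α t τ) (y - x) * (f (τ, y) : ℂ)).re = ∫ ξ, ∫ τ, ψ τ * (Complex.exp ((2 * π * inner ℝ ξ x : ℝ) * Complex.I) * (P ξ * gA (AA α t τ) ξ * VH f τ ξ)).re := by
  rw [← integral_integral_swap (swapI hδ hε hα hP hf t x hψ hB h0)]
  refine integral_congr_ae (of_forall fun τ ↦ ¿)
  simp only
  rcases le_or_gt τ (t + ε) with h | h
  · simp [h0 _ h]
  have hEL := AA_EL hδ hα (show t ≤ τ by linarith)
  have hΦ := PgA_int hδ (show 0 < τ - t by linarith) hEL hP.1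
  have hhc : Integrable fun y ↦ (f (τ, y) : ℂ) := (hf.slice τ).ofReal
  rw [integral_const_mul]
  congr 1
  rw [show (∫ y, KF P (AA α t τ) (y - x) * (f (τ, y) : ℂ)) = _ from slice1 hΦ hhc x, fourierInv_eq']
  have i0 := four_int hΦ hhc
  have i1 : Integrable fun ξ ↦ Complex.exp ((2 * π * inner ℝ ξ x : ℝ) * Complex.I) * (P ξ * gA (AA α t τ) ξ * VH f τ ξ) := by
    simp only [VH]
    exact i0.bdd_mul (c := 1) (Continuous.aestronglyMeasurable ʄ) (of_forall fun ξ ↦ (norm_exp_ofReal_mul_I _).le)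
  rw [show ∫ ξ, (Complex.exp ((2 * π * inner ℝ ξ x : ℝ) * Complex.I) * (P ξ * gA (AA α t τ) ξ * VH f τ ξ)).re = (∫ ξ, (Complex.exp ((2 * π * inner ℝ ξ x : ℝ) * Complex.I) * (P ξ * gA (AA α t τ) ξ * VH f τ ξ))).re from integral_re i1]
  simp only [VH, smul_eq_mul]
lemma phi_der (hε : 0 < ε) (s : ℝ) (h1 : s ≠ ε) (h2 : s ≠ 2 * ε) : HasDerivAt (phi ε) ((Ioo ε (2 * ε)).indicator (fun _ ↦ ε⁻¹) s) s := by
  rcases lt_or_gt_of_ne h1 with h | h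
  · rw [indicator_of_notMem fun hc ↦ (hc.1.trans h).false]
    exact (hasDerivAt_const s ō).congr_of_eventuallyEq ((eventually_le_nhds h).mono fun r hr ↦ phi_zero hε hr)
  rcases lt_or_gt_of_ne h2 with h' | h'
  · rw [indicator_of_mem (show s ∈ Ioo ε (2 * ε) from ⟨h, h'⟩)]
    have : HasDerivAt (fun r : ℝ ↦ r / ε - 1) (1 / ε) s := ((hasDerivAt_id s).div_const ε).sub_const 1
    rw [one_div] at this
    refine this.congr_of_eventuallyEq ¿
    filter_upwards [eventually_ge_nhds h, eventually_le_nhds h'] with r hr hr'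
    have a : 1 ≤ r / ε := (one_le_div hε).2 hr
    have b : r / ε ≤ 2 := (div_le_iff₀ hε).2 hr'
    rw [phi, min_eq_right ł, max_eq_right ł]
  · rw [indicator_of_notMem fun hc ↦ (hc.2.trans h').false]
    exact (hasDerivAt_const s (1:ℝ)).congr_of_eventuallyEq ((eventually_ge_nhds h').mono fun r hr ↦ phi_one hε hr)
lemma exp_lip {a b : ℝ} (ha : 0 ≤ a) (hb : 0 ≤ b) : |exp (-a) - exp (-b)| ≤ |a - b| := by
  wlog h : a ≤ b generalizing a b
  · rw [abs_sub_comm, abs_sub_comm a]; exact this hb ha (le_of_not_ge h)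
  rw [abs_of_nonneg (sub_nonneg.2 (exp_le_exp.2 ł)), abs_sub_comm, abs_of_nonneg ł]
  have e : exp (-b) = exp (-a) * exp (-(b - a)) := by rw [← Real.exp_add]; congr 1; ring
  have := Real.add_one_le_exp (-(b - a))
  have h1 : exp (-a) ≤ 1 := Real.exp_le_one_iff.2 ł
  have h0 := Real.exp_pos (-a)
  rw [e]; nlinarith
lemma QF_AA (hδ : 0 < δ) (hα : Al δ α) (t τ : ℝ) (ξ : Spc d) : QF (AA α t τ) ξ = ∫ s in t..τ, QF (α s) ξ := by
  have hij : ∀ i j, IntervalIntegrable (fun s ↦ α s i j * ξ i * ξ j) volume t τ := fun i j ↦ ((hα.int hδ i j t τ).mul_const _).mul_const _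
  simp only [QF]
  rw [intervalIntegral.integral_const_mul, intervalIntegral.integral_finset_sum fun i _ ↦ by simpa only [sum_fn] using IntervalIntegrable.sum _ fun j _ ↦ hij i j]
  congr 1
  refine sum_congr rfl fun i _ ↦ ¿
  rw [intervalIntegral.integral_finset_sum fun j _ ↦ hij i j]
  refine sum_congr rfl fun j _ ↦ ¿
  rw [intervalIntegral.integral_mul_const, intervalIntegral.integral_mul_const]; rfl
local notation:max "ɨ" t:max ε:max => Set.indicator (Ioo (t + ε) (t + 2 * ε)) (fun _ ↦ ε⁻¹)
lemma ibp {β : ℝ → ℝ} (hm : Measurable β) (h0 : ∀ s, 0 ≤ β s) (hK : ∀ s, β s ≤ K) {w w' : ℝ → ℝ} (hw : ∀ s, HasDerivAt w (w' s) s) (hc : Continuous w') {t b : ℝ} (hb : t ≤ b)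
    (hwb : ∀ τ, b ≤ τ → w τ = 0 ∧ w' τ = 0) (hε : 0 < ε) :
    ∫ τ, phi ε (τ - t) * (exp (-∫ s in t..τ, β s) * (w' τ - β τ * w τ)) = -∫ τ, ɨ t ε τ * (exp (-∫ s in t..τ, β s) * w τ) := by
  have K0 : 0 ≤ K := (h0 0).trans (hK 0)
  have hn : ∀ s, ‖β s‖ ≤ K := fun s ↦ by rw [norm_of_nonneg (h0 s)]; exact hK s
  have li : LocallyIntegrable β := fun x ↦ ⟨Icc (x - 1) (x + 1), Icc_mem_nhds ł ł, Measure.integrableOn_of_bounded measure_Icc_lt_top.ne hm.aestronglyMeasurable (of_forall hn)⟩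
  have ii : ∀ a b, IntervalIntegrable β volume a b := fun a b ↦ (intervalIntegrable_const (c := K)).mono_fun hm.aestronglyMeasurable (of_forall fun t ↦ (hn t).trans (le_abs_self _))
  obtain ⟨Q, hQ⟩ : ∃ Q : ℝ → ℝ, Q = fun τ ↦ ∫ s in t..τ, β s := ⟨_, rfl⟩
  have hQ' : ∀ τ, ∫ s in t..τ, β s = Q τ := fun τ ↦ by rw [hQ]
  simp only [hQ']
  have Qc : Continuous Q := by rw [hQ]; exact intervalIntegral.continuous_primitive ii t
  have Q0 : ∀ τ, t ≤ τ → 0 ≤ Q τ := fun τ h ↦ by rw [hQ]; exact intervalIntegral.integral_nonneg h fun s _ ↦ h0 s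
  have Ql : ∀ a b, |Q a - Q b| ≤ K * |a - b| := fun a b ↦ by
    rw [hQ]; simp only
    rw [intervalIntegral.integral_interval_sub_left (ii _ _) (ii _ _)]
    exact intervalIntegral.norm_integral_le_of_norm_le_const fun s _ ↦ hn s
  have su : uIcc t b = Icc t b := uIcc_of_le hb
  have uA : AbsolutelyContinuousOnInterval (fun τ ↦ phi ε (τ - t) * exp (-Q τ)) t b := by
    refine LipschitzOnWith.absolutelyContinuousOnInterval (K := (ε⁻¹ + K).toNNReal) (LipschitzOnWith.of_dist_le_mul fun x hx y hy ↦ ¿)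
    rw [su] at hx hy
    rw [Real.coe_toNNReal _ ƥ, dist_eq, dist_eq]
    have a1 := phi_lip hε (x - t) (y - t)
    rw [sub_sub_sub_cancel_right] at a1
    have a2 := (exp_lip (Q0 x hx.1) (Q0 y hy.1)).trans (Ql x y)
    have e : phi ε (x - t) * exp (-Q x) - phi ε (y - t) * exp (-Q y) = (phi ε (x - t) - phi ε (y - t)) * exp (-Q x) + phi ε (y - t) * (exp (-Q x) - exp (-Q y)) := by ring
    rw [e]
    refine (abs_add_le _ _).trans ¿
    rw [abs_mul, abs_mul, abs_exp, abs_of_nonneg (phi_nn _ _), add_mul]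
    refine add_le_add ¿ ¿
    · refine (mul_le_of_le_one_right (abs_nonneg _) (Real.exp_le_one_iff.2 (by linarith [Q0 x hx.1]))).trans (a1.trans_eq ¿)
      rw [div_eq_mul_inv, mul_comm]
    · exact (mul_le_of_le_one_left (abs_nonneg _) (phi_le _ _)).trans a2
  have w1 : ContDiff ℝ 1 w := by
    rw [contDiff_one_iff_deriv]
    exact ⟨fun s ↦ (hw s).differentiableAt, by rw [show deriv w = w' from funext fun s ↦ (hw s).deriv]; exact hc⟩
  have wA : AbsolutelyContinuousOnInterval w t b := w1.contDiffOn.absolutelyContinuousOnInterval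
  have key := uA.integral_deriv_mul_eq_sub wA
  rw [sub_self, phi_zero hε hε.le, zero_mul, zero_mul, (hwb b le_rfl).1, mul_zero, sub_zero] at key
  have ae : ∀ᵐ τ, deriv (fun τ ↦ phi ε (τ - t) * exp (-Q τ)) τ * w τ + phi ε (τ - t) * exp (-Q τ) * deriv w τ
      = phi ε (τ - t) * (exp (-Q τ) * (w' τ - β τ * w τ)) + ɨ t ε τ * (exp (-Q τ) * w τ) := by
    have n1 : ∀ c : ℝ, ∀ᵐ τ : ℝ, τ ≠ c := fun c ↦ by simp [ae_iff]
    filter_upwards [LocallyIntegrable.ae_hasDerivAt_integral li, n1 (t + ε), n1 (t + 2 * ε)] with τ h1 h2 h3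
    have d1 : HasDerivAt Q (β τ) τ := by rw [hQ]; exact h1 t
    have d2 := (phi_der hε (τ - t) (fun h ↦ h2 ł) (fun h ↦ h3 ł)).comp_sub_const τ t
    have e : (Ioo ε (2 * ε)).indicator (fun _ ↦ ε⁻¹) (τ - t) = ɨ t ε τ := by
      simp only [indicator, mem_Ioo, lt_sub_iff_add_lt', sub_lt_iff_lt_add']
    rw [e] at d2
    rw [(d2.fun_mul d1.fun_neg.exp).deriv, (hw τ).deriv]; ring
  have iB : IntervalIntegrable (fun τ ↦ ɨ t ε τ * (exp (-Q τ) * w τ)) volume t b := by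
    have c : Continuous fun τ ↦ exp (-Q τ) * w τ := (Real.continuous_exp.comp Qc.neg).mul w1.continuous
    refine ((c.const_mul ε⁻¹).intervalIntegrable t b).mono_fun ((measurable_const.indicator measurableSet_Ioo).mul c.measurable).aestronglyMeasurable (of_forall fun τ ↦ ¿)
    simp only [norm_mul]
    exact mul_le_mul_of_nonneg_right (norm_indicator_le_norm_self (fun _ ↦ ε⁻¹) τ) ƥ
  have pc : Continuous fun τ ↦ phi ε (τ - t) := by unfold phi; fun_prop
  have iA : IntervalIntegrable (fun τ ↦ phi ε (τ - t) * (exp (-Q τ) * (w' τ - β τ * w τ))) volume t b := by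
    have wc := w1.continuous
    have c1 : Continuous fun τ ↦ phi ε (τ - t) * (exp (-Q τ) * w' τ) := by fun_prop
    have c2 : Continuous fun τ ↦ phi ε (τ - t) * (exp (-Q τ) * w τ) := by fun_prop
    refine ((c1.intervalIntegrable t b).sub ((ii t b).continuousOn_mul c2.continuousOn)).congr fun τ _ ↦ ¿
    ring
  rw [intervalIntegral.integral_congr_ae (ae.mono fun τ h _ ↦ h), intervalIntegral.integral_add iA iB] at key
  have cv : ∀ F : ℝ → ℝ, (∀ τ, τ ≤ t → F τ = 0) → (∀ τ, b ≤ τ → F τ = 0) → ∫ τ, F τ = ∫ τ in t..b, F τ := fun F f1 f2 ↦ by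
    rw [intervalIntegral.integral_of_le hb, setIntegral_eq_integral_of_forall_compl_eq_zero fun τ hτ ↦ ¿]
    rcases le_or_gt τ t with h | h
    · exact f1 τ h
    · exact f2 τ (le_of_not_gt fun h' ↦ hτ ⟨h, h'.le⟩)
  rw [cv _ (fun τ h ↦ by rw [phi_zero hε ł, zero_mul]) (fun τ h ↦ by rw [(hwb τ h).1, (hwb τ h).2]; ring),
    cv _ (fun τ h ↦ by rw [indicator_of_notMem (fun hc ↦ by have := hc.1; linarith), zero_mul]) (fun τ h ↦ by rw [(hwb τ h).1]; ring)]
  linarith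
def HV (α : ℝ → Mq d) (v : Fn d) (w : Pt d) : ℝ :=
  if 0 ≤ w.1 then Dt v w + ∑ i, ∑ j, α w.1 i j * Dxx i j v w else 0
lemma HV_nice (hδ : 0 < δ) (hα : Al δ α) (hv : C12 v) : Nice (HV α v) := by
  obtain ⟨R, hR, hs⟩ := id hv.supp
  have hs0 : ∀ z, z ∉ pbox 0 R → z ∉ tsupport v := fun z hz h ↦ hz (hs h)
  obtain ⟨-, ⟨M, hM⟩, -⟩ := hv.nt
  have := fun i j ↦ (hv.nxx i j).2.1
  choose N hN using this
  refine ⟨¿, ⟨M + ∑ i, ∑ j, 2 * δ⁻¹ * N i j, fun z ↦ ¿⟩, R, hR, fun z hz ↦ ¿⟩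
  · refine Measurable.ite (measurableSet_le measurable_const measurable_fst) ¿ measurable_const
    refine hv.ct.measurable.add (measurable_sum _ fun i _ ↦ measurable_sum _ fun j _ ↦ ¿)
    exact ((hα.meas i j).comp measurable_fst).mul (hv.cxx i j).measurable
  · unfold HV
    have hM0 := (abs_nonneg _).trans (hM z)
    have hN0 := fun i j ↦ (abs_nonneg _).trans (hN i j z)
    have s0 : 0 ≤ ∑ i, ∑ j, 2 * δ⁻¹ * N i j := sum_nonneg fun i _ ↦ sum_nonneg fun j _ ↦ mul_nonneg ƥ (hN0 i j)
    split_ifs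
    · refine (abs_add_le _ _).trans (add_le_add (hM z) ¿)
      refine (abs_sum_le_sum_abs _ _).trans (sum_le_sum fun i _ ↦ (abs_sum_le_sum_abs _ _).trans (sum_le_sum fun j _ ↦ ¿))
      rw [abs_mul]
      exact mul_le_mul (hα.bd hδ _ i j) (hN i j z) (abs_nonneg _) ƥ
    · rw [abs_zero]; linarith
  · have h1 : Dt v z = 0 := image_eq_zero_of_notMem_tsupport fun h ↦ hs0 z hz (supT v h)
    have h2 : ∀ i j, Dxx i j v z = 0 := fun i j ↦ image_eq_zero_of_notMem_tsupport fun h ↦ hs0 z hz (supX v j (supX _ i h))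
    simp [HV, h1, h2]
lemma VH_c (hc : Continuous f) (hf : Nice f) (ξ : Spc d) : Continuous fun τ ↦ VH f τ ξ := by
  simp_rw [VH_eq]
  obtain ⟨h1, ⟨M, h2⟩, R, h3, h4⟩ := id hf
  have hM : 0 ≤ M := (abs_nonneg _).trans (h2 0)
  refine continuous_of_dominated (bound := (ball (0 : Spc d) R).indicator fun _ ↦ M) (fun τ ↦ Continuous.aestronglyMeasurable ʄ) (fun t ↦ of_forall fun y ↦ ¿) ¿ (of_forall fun y ↦ by fun_prop)
  · rw [norm_mul, cE, one_mul, norm_real]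
    by_cases hy : y ∈ ball (0 : Spc d) R
    · rw [indicator_of_mem hy]; exact h2 _
    · rw [indicator_of_notMem hy, h4 (t, y) (fun hc ↦ hy hc.2), norm_zero]
  · exact bint ((measurable_const.indicator measurableSet_ball).aestronglyMeasurable) (M := M) (fun y ↦ (norm_indicator_le_norm_self _ _).trans (by rw [norm_of_nonneg hM])) (S := ball (0 : Spc d) R) measure_ball_lt_top fun y hy ↦ indicator_of_notMem hy _
lemma VH_HV (hv : C12 v) {τ : ℝ} (hτ : 0 ≤ τ) (ξ : Spc d) :
    VH (HV α v) τ ξ = VH (Dt v) τ ξ - (QF (α τ) ξ : ℂ) * VH v τ ξ := by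
  have e : VH (HV α v) τ ξ = VH (Dt v) τ ξ + ∑ i, ∑ j, (α τ i j : ℂ) * VH (Dxx i j v) τ ξ := by
    have bd : ∀ {f : Fn d}, Nice f → Integrable fun y ↦ Complex.exp ((-2 * π * inner ℝ y ξ : ℝ) * Complex.I) * (f (τ, y) : ℂ) := fun {f} hf ↦ by
      have : Integrable fun y ↦ (f (τ, y) : ℂ) := (hf.slice τ).ofReal
      exact this.bdd_mul (c := 1) (Continuous.aestronglyMeasurable ʄ) (of_forall fun y ↦ (cE y ξ).le)
    have I2 := fun i j ↦ (bd (hv.nxx i j)).const_mul (α τ i j : ℂ)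
    simp only [VH_eq, ← integral_const_mul]
    simp_rw [← integral_finset_sum _ fun j _ ↦ I2 _ j]
    rw [← integral_finset_sum _ fun i _ ↦ integrable_finset_sum _ fun j _ ↦ I2 i j, ← integral_add (bd hv.nt) (integrable_finset_sum _ fun i _ ↦ integrable_finset_sum _ fun j _ ↦ I2 i j)]
    congr 1; ext y
    simp only [HV, if_pos hτ]
    push_cast
    rw [mul_add, mul_sum]
    congr 1
    refine sum_congr rfl fun i _ ↦ ¿
    rw [mul_sum]
    exact sum_congr rfl fun j _ ↦ by ring
  rw [e, sub_eq_add_neg]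
  congr 1
  simp only [VH_xx hv, PP, QF]
  push_cast
  rw [mul_sum, sum_mul, ← sum_neg_distrib]
  refine sum_congr rfl fun i _ ↦ ¿
  rw [mul_sum, sum_mul, ← sum_neg_distrib]
  refine sum_congr rfl fun j _ ↦ ¿
  ring
lemma kap_slice (hδ : 0 < δ) (i j : Fin d) (hε : 0 < ε) (hα : Al δ α) (hh : Nice h) (z : Pt d) :
    TT (kap i j ε α) h z = ∫ τ, phi ε (τ - z.1) * (∫ y, KF (PP i j) (AA α z.1 τ) (y - z.2) * (h (τ, y) : ℂ)).re := by
  obtain ⟨C, hC, hκ⟩ := kap_CZ (d := d) δ hδ i j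
  have hk := hκ ε hε α hα
  obtain ⟨B, kB⟩ := hk.bdd
  rw [TT, Measure.volume_eq_prod, integral_prod _ (by rw [← Measure.volume_eq_prod]; exact TT_int hk.meas kB hh z)]
  refine integral_congr_ae (of_forall fun τ ↦ ¿)
  simp only
  rcases le_or_gt (τ - z.1) ε with h1 | h1
  · simp [kap, HH, phi_zero hε h1]
  have hEL := AA_EL hδ hα (show z.1 ≤ τ by linarith)
  have hΦ := PgA_int hδ (show 0 < τ - z.1 by linarith) hEL (PP_hom i j).1
  have hhc : Integrable fun y ↦ (h (τ, y) : ℂ) := (hh.slice τ).ofReal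
  have hKc : Continuous (KF (PP i j) (AA α z.1 τ)) := four_cont hΦ
  have i1 : Integrable fun y ↦ KF (PP i j) (AA α z.1 τ) (y - z.2) * (h (τ, y) : ℂ) :=
      hhc.bdd_mul (c := ∫ ξ, ‖PP i j ξ * gA (AA α z.1 τ) ξ‖) (hKc.comp (continuous_id.sub continuous_const)).aestronglyMeasurable (of_forall fun y ↦ four_bd _ _)
  rw [show (∫ y, KF (PP i j) (AA α z.1 τ) (y - z.2) * (h (τ, y) : ℂ)).re = ∫ y, (KF (PP i j) (AA α z.1 τ) (y - z.2) * (h (τ, y) : ℂ)).re from (integral_re i1).symm, ← integral_const_mul]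
  refine integral_congr_ae (of_forall fun y ↦ ¿)
  simp only [re_mul_ofReal, kap, HH]; ring
lemma repr (hδ : 0 < δ) (i j : Fin d) (hε : 0 < ε) (hα : Al δ α) (hv : C12 v) (z : Pt d) (hz : 0 ≤ z.1) :
    TT (kap i j ε α) (HV α v) z = -∫ τ, ɨ z.1 ε τ * (∫ y, KF (fun _ ↦ 1) (AA α z.1 τ) (y - z.2) * (Dxx i j v (τ, y) : ℂ)).re := by
  obtain ⟨t, x⟩ := z
  simp only at hz ⊢
  rw [kap_slice hδ i j hε hα (HV_nice hδ hα hv)]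
  have pm : Measurable fun τ ↦ phi ε (τ - t) := Continuous.measurable (by unfold phi; fun_prop)
  rw [swap hδ hε hα (PP_hom i j) (HV_nice hδ hα hv) t x pm (B := 1) (fun τ ↦ by rw [abs_of_nonneg (phi_nn _ _)]; exact phi_le _ _) (fun τ h ↦ phi_zero hε ł),
    swap hδ hε hα Hom_one (hv.nxx i j) t x (measurable_const.indicator measurableSet_Ioo) (B := ε⁻¹) (fun τ ↦ (norm_indicator_le_norm_self (fun _ ↦ ε⁻¹) τ).trans (by rw [norm_of_nonneg ƥ])) (fun τ h ↦ indicator_of_notMem (fun hc ↦ by have := hc.1; linarith) _),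
    ← integral_neg]
  refine integral_congr_ae (of_forall fun ξ ↦ ¿)
  simp only
  obtain ⟨E, hE⟩ : ∃ E : ℂ, Complex.exp ((2 * π * inner ℝ ξ x : ℝ) * Complex.I) = E := ⟨_, rfl⟩
  rw [hE]
  obtain ⟨R, hR, hs⟩ := hv.supp
  have z0 : ∀ f : Fn d, tsupport f ⊆ tsupport v → ∀ τ, R ^ 2 ≤ τ → VH f τ ξ = 0 := fun f hf τ hτ ↦ by
    rw [VH_eq, show (fun y ↦ Complex.exp ((-2 * π * inner ℝ y ξ : ℝ) * Complex.I) * (f (τ, y) : ℂ)) = 0 from funext fun y ↦ by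
      rw [image_eq_zero_of_notMem_tsupport (f := f) (x := (τ, y)) fun hc ↦ by have := (hs (hf hc)).1.2; simp at this; linarith]; simp]
    simp
  have ib := ibp (β := fun s ↦ QF (α s) ξ) (K := 4 * π ^ 2 * (δ⁻¹ * 1 * ∑ i, ξ i ^ 2)) (w := fun τ ↦ (E * (PP i j ξ * VH v τ ξ)).re) (w' := fun τ ↦ (E * (PP i j ξ * VH (Dt v) τ ξ)).re) (t := t) (b := t + R ^ 2)
    ¿ (fun s ↦ le_trans ƥ (QF_lower (hα.ell s) ξ)) (fun s ↦ mul_le_mul_of_nonneg_left ((hα.ell s).2 ξ).2 ƥ) ¿ ¿ ŋ ¿ hε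
  · simp only [← QF_AA hδ hα] at ib
    have g1 : ∀ τ (X : ℂ), exp (-QF (AA α t τ) ξ) * (E * X).re = (E * (gA (AA α t τ) ξ * X)).re := fun τ X ↦ by
      rw [gA, ← Complex.re_ofReal_mul]; congr 1; ring
    convert ib using 1
    · refine integral_congr_ae (of_forall fun τ ↦ ¿)
      simp only
      rcases le_or_gt τ t with h | h
      · rw [phi_zero hε ł]; simp
      rw [VH_HV hv (hz.trans h.le)]
      congr 1
      have : (E * (PP i j ξ * VH (Dt v) τ ξ)).re - QF (α τ) ξ * (E * (PP i j ξ * VH v τ ξ)).re = (E * (PP i j ξ * (VH (Dt v) τ ξ - (QF (α τ) ξ : ℂ) * VH v τ ξ))).re := by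
        rw [← Complex.re_ofReal_mul, ← Complex.sub_re]; congr 1; ring
      rw [this, g1]; congr 2; ring
    · congr 1
      refine integral_congr_ae (of_forall fun τ ↦ ¿)
      simp only
      rw [VH_xx hv, g1, one_mul]
  · unfold QF
    have := hα.meas
    fun_prop
  · intro s
    exact (Complex.reCLM.hasFDerivAt.comp_hasDerivAt s (((VH_dt hv s ξ).const_mul _).const_mul E))
  · have := VH_c hv.ct hv.nt ξ
    fun_prop
  · intro τ hτ
    rw [z0 v subset_rfl τ ł, z0 (Dt v) (supT v) τ ł]; simp
lemma KF_one (hδ : 0 < δ) (hr : 0 < r) (hA : EL δ (r ^ 2) A) : ∫ x, KF (fun _ ↦ 1) A x = 1 := by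
  obtain ⟨C, hC, h⟩ := KF_L1 (d := d) δ hδ
  have h1 := (h r hr A hA).1
  have hΦ := PgA_int hδ ƥ hA (Function.HasTemperateGrowth.const (1:ℂ))
  have hc : Continuous fun ξ : Spc d ↦ (1:ℂ) * gA A ξ := continuous_const.mul (gA_contDiff A).continuous
  have h2 := congrFun (hc.fourierInv_fourier_eq hΦ h1) 0
  rw [fourierInv_eq'] at h2
  have e : gA A (0 : Spc d) = 1 := by simp [gA, QF]
  simpa [e, KF] using h2
lemma conv1 (hδ : 0 < δ) : ∃ C : ℝ, 0 < C ∧ ∀ r, 0 < r → ∀ A : Mq d, EL δ (r ^ 2) A → ∀ g : Spc d → ℝ, Continuous g → ∀ x c M η a : ℝ, ∀ x : Spc d,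
    (∀ y, |g y| ≤ M) → (∀ y, |g y - c| ≤ η + a * ‖y - x‖) → 0 ≤ η → 0 ≤ a →
    |(∫ y, KF (fun _ ↦ 1) A (y - x) * (g y : ℂ)).re - c| ≤ C * η + a * (C * r) := by
  obtain ⟨C, hC, h⟩ := KF_L1 (d := d) δ hδ
  refine ⟨C, hC, fun r hr A hA g hg _ c M η a x hM hb hη ha ↦ ¿⟩
  obtain ⟨h1, h2, h3, h4⟩ := h r hr A hA
  have h1' := h1.comp_sub_right x
  have h2' := h2.comp_sub_right x
  have i1 : Integrable fun y ↦ KF (fun _ ↦ 1) A (y - x) * (g y : ℂ) :=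
    h1'.mul_bdd (c := M) ʄ (of_forall fun y ↦ by simpa using hM y)
  have e : (∫ y, KF (fun _ ↦ 1) A (y - x) * (g y : ℂ)) - c = ∫ y, KF (fun _ ↦ 1) A (y - x) * ((g y - c : ℝ) : ℂ) := by
    have : ((c:ℝ) : ℂ) = ∫ y, KF (fun _ ↦ 1) A (y - x) * (c : ℂ) := by
      rw [integral_mul_const, integral_sub_right_eq_self (fun y ↦ KF (fun _ ↦ 1) A y), KF_one hδ hr hA, one_mul]
    rw [this, ← integral_sub i1 (h1'.mul_const _)]
    refine integral_congr_ae (of_forall fun y ↦ ¿)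
    push_cast; ring
  calc |(∫ y, KF (fun _ ↦ 1) A (y - x) * (g y : ℂ)).re - c| = |((∫ y, KF (fun _ ↦ 1) A (y - x) * (g y : ℂ)) - c).re| := by simp
    _ ≤ ‖∫ y, KF (fun _ ↦ 1) A (y - x) * ((g y - c : ℝ) : ℂ)‖ := by rw [e]; exact abs_re_le_norm _
    _ ≤ ∫ y, (η * ‖KF (fun _ ↦ 1) A (y - x)‖ + a * (‖y - x‖ * ‖KF (fun _ ↦ 1) A (y - x)‖)) := by
      refine norm_integral_le_of_norm_le ((h1'.norm.const_mul _).add (h2'.const_mul _)) (of_forall fun y ↦ ¿)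
      rw [norm_mul, norm_real, norm_eq_abs]
      nlinarith [hb y, norm_nonneg (KF (fun _ ↦ 1) A (y - x))]
    _ = η * (∫ y, ‖KF (fun _ ↦ 1) A y‖) + a * ∫ y, ‖y‖ * ‖KF (fun _ ↦ 1) A y‖ := by
      rw [integral_add (h1'.norm.const_mul _) (h2'.const_mul _), integral_const_mul, integral_const_mul,
        integral_sub_right_eq_self (fun y ↦ ‖KF (fun _ ↦ 1) A y‖), integral_sub_right_eq_self (fun y ↦ ‖y‖ * ‖KF (fun _ ↦ 1) A y‖)]
    _ ≤ _ := by
      have := mul_le_mul_of_nonneg_left h3 hη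
      have := mul_le_mul_of_nonneg_left h4 ha
      linarith
lemma uc_bd (hf : Continuous f) (hn : Nice f) (hu : UniformContinuous f) (hη : 0 < η) : ∃ θ a : ℝ, 0 < θ ∧ 0 ≤ a ∧ ∀ t τ x y, |τ - t| < θ → |f (τ, y) - f (t, x)| ≤ η + a * ‖y - x‖ := by
  obtain ⟨-, ⟨M, hM⟩, -⟩ := hn
  obtain ⟨θ, hθ, h⟩ := Metric.uniformContinuous_iff.1 hu η hη
  have hM0 : 0 ≤ M := (abs_nonneg _).trans (hM 0)
  refine ⟨θ, 2 * M / θ, hθ, by positivity, fun t τ x y ht ↦ ¿⟩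
  have h0 : 0 ≤ 2 * M / θ := by positivity
  rcases lt_or_ge ‖y - x‖ θ with h1 | h1
  · have := (h (a := (τ, y)) (b := (t, x)) (by rw [Prod.dist_eq, max_lt_iff, dist_eq, dist_eq_norm]; exact ⟨ht, h1⟩)).le
    rw [dist_eq] at this
    have := mul_nonneg h0 (norm_nonneg (y - x))
    linarith
  · have h2 := abs_sub (f (τ, y)) (f (t, x))
    have h3 := mul_le_mul_of_nonneg_left h1 h0
    have h4 : 2 * M / θ * θ = 2 * M := by field_simp
    linarith [hM (τ, y), hM (t, x)]
lemma conv (hδ : 0 < δ) (hv : C12 v) (hη : 0 < η) : ∃ ε, 0 < ε ∧ ∀ i j, ∀ α : ℝ → Mq d, Al δ α → ∀ z : Pt d, 0 ≤ z.1 →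
    |TT (kap i j ε α) (HV α v) z + Dxx i j v z| ≤ η := by
  obtain ⟨C, hC, h⟩ := conv1 (d := d) hδ
  have hu : ∀ i j, UniformContinuous (Dxx i j v) := fun i j ↦ by
    obtain ⟨R, hR, hs⟩ := hv.supp
    exact (hv.cxx i j).uniformContinuous_of_tendsto_cocompact (x := 0) ((HasCompactSupport.is_zero_at_infty (cpt_of ((supX _ i).trans ((supX v j).trans hs)))))
  have key : ∀ i j, ∃ ε0 : ℝ, 0 < ε0 ∧ ∀ ε, 0 < ε → ε ≤ ε0 → ∀ α : ℝ → Mq d, Al δ α → ∀ z : Pt d, 0 ≤ z.1 →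
      |TT (kap i j ε α) (HV α v) z + Dxx i j v z| ≤ η := by
    intro i j
    obtain ⟨θ, a, hθ, ha, hb⟩ := uc_bd (hv.cxx i j) (hv.nxx i j) (hu i j) (show 0 < η / (2 * C) by positivity)
    obtain ⟨hm, ⟨M, hM⟩, -⟩ := hv.nxx i j
    set s := η / (2 * C * (a + 1)) with hs
    have hs0 : 0 < s := by positivity
    refine ⟨min (θ / 3) (s ^ 2 / 2), by positivity, fun ε hε hε0 α hα z hz ↦ ¿⟩
    have e1 : ε ≤ θ / 3 := hε0.trans (min_le_left _ _)
    have e2 : ε ≤ s ^ 2 / 2 := hε0.trans (min_le_right _ _)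
    rw [repr hδ i j hε hα hv z hz]
    set g : ℝ → ℝ := fun τ ↦ (∫ y, KF (fun _ ↦ 1) (AA α z.1 τ) (y - z.2) * (Dxx i j v (τ, y) : ℂ)).re with hg
    have gm : Measurable g := by
      have h1 := (KF_meas hδ hα (P := fun _ ↦ 1) continuous_const).comp (show Measurable fun p : ℝ × Spc d ↦ (z, ((p.1, p.2) : Pt d)) by fun_prop)
      have h2 : Measurable fun p : ℝ × Spc d ↦ KF (fun _ ↦ 1) (AA α z.1 p.1) (p.2 - z.2) * (Dxx i j v (p.1, p.2) : ℂ) :=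
        Measurable.mul h1 (measurable_ofReal.comp hm)
      exact measurable_re.comp h2.stronglyMeasurable.integral_prod_right'.measurable
    have gb : ∀ τ ∈ Ioo (z.1 + ε) (z.1 + 2 * ε), |g τ - Dxx i j v z| ≤ η := by
      intro τ hτ
      have p1 : 0 < τ - z.1 := by linarith [hτ.1]
      have := h (√(τ - z.1)) (sqrt_pos.2 p1) (AA α z.1 τ) (by rw [sq_sqrt p1.le]; exact AA_EL hδ hα ł) (fun y ↦ Dxx i j v (τ, y))
        ((hv.cxx i j).comp ʄ) 0 (Dxx i j v z) M (η / (2 * C)) a z.2 (fun y ↦ hM _) (fun y ↦ hb z.1 τ z.2 y (by rw [abs_of_pos p1]; linarith [hτ.2])) ƥ ha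
      refine this.trans ¿
      have q1 : √(τ - z.1) ≤ s := sqrt_le_iff.2 ⟨hs0.le, by linarith [hτ.2]⟩
      have q2 : C * (η / (2 * C)) = η / 2 := by field_simp
      have q3 : (a + 1) * (C * s) = η / 2 := by rw [hs]; field_simp
      have q4 : a * (C * √(τ - z.1)) ≤ (a + 1) * (C * s) := by gcongr; linarith
      linarith
    have i0 : Integrable fun τ ↦ ɨ z.1 ε τ :=
      (integrable_indicator_iff measurableSet_Ioo).2 (integrableOn_const ş)
    have i1 : ∫ τ, ɨ z.1 ε τ = 1 := by
      rw [integral_indicator measurableSet_Ioo, setIntegral_const, Real.volume_real_Ioo_of_le ł, smul_eq_mul]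
      field_simp; ring
    have nb : ∀ τ, ‖ɨ z.1 ε τ * (g τ - Dxx i j v z)‖ ≤ ɨ z.1 ε τ * η := by
      intro τ
      by_cases hτ : τ ∈ Ioo (z.1 + ε) (z.1 + 2 * ε)
      · rw [indicator_of_mem hτ, norm_mul, norm_of_nonneg ƥ, norm_eq_abs]
        have := gb τ hτ
        gcongr
      · simp [indicator_of_notMem hτ]
    have i2 : Integrable fun τ ↦ ɨ z.1 ε τ * (g τ - Dxx i j v z) :=
      (i0.mul_const η).mono' (((measurable_const.indicator measurableSet_Ioo).mul (gm.sub_const _)).aestronglyMeasurable) (of_forall nb)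
    have e3 : (-∫ τ, ɨ z.1 ε τ * g τ) + Dxx i j v z = -∫ τ, ɨ z.1 ε τ * (g τ - Dxx i j v z) := by
      have : (fun τ ↦ ɨ z.1 ε τ * g τ) = fun τ ↦ ɨ z.1 ε τ * (g τ - Dxx i j v z) + ɨ z.1 ε τ * Dxx i j v z := by
        ext τ; ring
      rw [this, integral_add i2 (i0.mul_const _), integral_mul_const, i1]; ring
    rw [e3, abs_neg]
    refine (norm_integral_le_of_norm_le (i0.mul_const η) (of_forall nb)).trans ¿
    rw [integral_mul_const, i1, one_mul]
  choose e he hk using key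
  obtain ⟨ε, h1, h2⟩ : ∃ ε : ℝ, 0 < ε ∧ ∀ i j, ε ≤ e i j := by
    have : ∀ᶠ ε in nhdsWithin ō (Ioi 0), ∀ i j, ε ≤ e i j := by
      simp only [Filter.eventually_all]
      exact fun i j ↦ nhdsWithin_le_nhds (eventually_le_nhds (he i j))
    exact (this.and self_mem_nhdsWithin).exists.imp fun ε h ↦ ⟨h.2, h.1⟩
  exact ⟨ε, h1, fun i j α hα z hz ↦ hk i j ε h1 (h2 i j) α hα z hz⟩
lemma inS_EL (h : inS d δ A) : EL δ 1 A :=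
  ⟨fun i j ↦ (h.1.apply i j).symm, fun ξ ↦ by simpa using h.2 ξ⟩
lemma a_ij (ha : Measurable a) (i j : Fin d) : Measurable fun z ↦ a z i j :=
  (measurable_pi_apply j).comp ((measurable_pi_apply i).comp ha)
lemma aT_Al (hδ : 0 < δ) (ha : Measurable a) (hS : ∀ z, inS d δ (a z)) (hR : 0 < R) (x₀ : Spc d) :
    Al δ (fun t ↦ (aTilde a R x₀ t : Mq d)) := by
  have hb : ∀ z i j, |a z i j| ≤ 2 * δ⁻¹ := fun z i j ↦ by simpa using EL_entry hδ zero_le_one (inS_EL (hS z)) i j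
  have hfin : volume (ball x₀ R) ≠ ⊤ := vball_net _ _
  have h0 : volume (ball x₀ R) ≠ 0 := vball_ne0 _ hR
  haveI : IsFiniteMeasure (volume.restrict (ball x₀ R)) := ⟨by simpa using hfin.lt_top⟩
  have hi : ∀ t i j, Integrable (fun y ↦ a (t, y) i j) (volume.restrict (ball x₀ R)) := fun t i j ↦
    Integrable.of_bound (((a_ij ha i j).comp (by fun_prop : Measurable fun y : Spc d ↦ (t, y))).aestronglyMeasurable) (2 * δ⁻¹) (of_forall fun y ↦ hb _ _ _)
  refine ⟨fun i j ↦ ¿, fun t ↦ ⟨fun i j ↦ ¿, fun ξ ↦ ¿⟩⟩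
  · have : Measurable fun t ↦ (∫ y in ball x₀ R, a (t, y) i j) := (a_ij ha i j).stronglyMeasurable.integral_prod_right'.measurable
    simp only [aTilde, setAverage_eq, smul_eq_mul]
    exact this.const_mul _
  · simp only [aTilde]; congr 1; ext y; exact ((hS (t, y)).1.apply i j).symm
  · have e : (∑ i, ∑ j, aTilde a R x₀ t i j * ξ i * ξ j) = ⨍ y in ball x₀ R, ∑ i, ∑ j, a (t, y) i j * ξ i * ξ j := by
      simp only [aTilde, setAverage_eq, smul_eq_mul]
      rw [integral_finset_sum _ fun i _ ↦ integrable_finset_sum _ fun j _ ↦ ((hi t i j).mul_const _).mul_const _, mul_sum]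
      refine sum_congr rfl fun i _ ↦ ¿
      rw [integral_finset_sum _ fun j _ ↦ ((hi t i j).mul_const _).mul_const _, mul_sum]
      refine sum_congr rfl fun j _ ↦ ¿
      rw [integral_mul_const, integral_mul_const]; ring
    have hI : IntegrableOn (fun y ↦ ∑ i, ∑ j, a (t, y) i j * ξ i * ξ j) (ball x₀ R) :=
      integrable_finset_sum _ fun i _ ↦ integrable_finset_sum _ fun j _ ↦ ((hi t i j).mul_const _).mul_const _
    rw [e, mul_one, mul_one]
    have := Convex.set_average_mem (convex_Icc (δ * ∑ i, ξ i ^ 2) (δ⁻¹ * ∑ i, ξ i ^ 2)) isClosed_Icc h0 hfin (f := fun y ↦ ∑ i, ∑ j, a (t, y) i j * ξ i * ξ j) (of_forall fun y ↦ (hS (t, y)).2 ξ) hI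
    exact this
def GG (v : Fn d) (z : Pt d) : ℰ := if 0 ≤ z.1 then ∑ i, ∑ j, ‖Dxx i j v z‖ₑ else 0
def LL (a : Pt d → Mq d) (v : Fn d) (z : Pt d) : ℰ := if 0 ≤ z.1 then ‖Dt v z + ∑ i, ∑ j, a z i j * Dxx i j v z‖ₑ else 0
def oo (a : Pt d → Mq d) (α : ℝ → Mq d) (z : Pt d) : ℰ :=
  ofReal (mnorm (fun i j ↦ a z i j - α z.1 i j))
lemma t_meas : MeasurableSet {z : Pt d | 0 ≤ z.1} := measurableSet_le measurable_const measurable_fst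
lemma GG_meas (hv : C12 v) : Measurable (GG v) := by
  refine Measurable.ite t_meas ¿ measurable_const
  exact measurable_sum _ fun i _ ↦ measurable_sum _ fun j _ ↦ (hv.cxx i j).measurable.enorm
lemma LL_meas (ha : Measurable a) (hv : C12 v) : Measurable (LL a v) := by
  refine Measurable.ite t_meas ¿ measurable_const
  exact (hv.ct.measurable.add (measurable_sum _ fun i _ ↦ measurable_sum _ fun j _ ↦ (a_ij ha i j).mul (hv.cxx i j).measurable)).enorm
lemma oo_meas (ha : Measurable a) (hα : Al δ α) : Measurable (oo a α) := by
  refine ENNReal.measurable_ofReal.comp (Real.continuous_sqrt.measurable.comp ¿)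
  refine measurable_sum _ fun i _ ↦ measurable_sum _ fun j _ ↦ ¿
  exact ((a_ij ha i j).sub ((hα.meas i j).comp measurable_fst)).pow_const 2
lemma mnorm_ge (m : Fin d → Fin d → ℝ) (i j : Fin d) : |m i j| ≤ mnorm m := by
  refine Real.le_sqrt_of_sq_le ¿
  rw [sq_abs]
  exact (single_le_sum (f := fun j ↦ m i j ^ 2) (fun _ _ ↦ sq_nonneg _) (Finset.mem_univ j)).trans
    (single_le_sum (f := fun i ↦ ∑ j, m i j ^ 2) (fun _ _ ↦ sum_nonneg fun _ _ ↦ sq_nonneg _) (Finset.mem_univ i))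
lemma mnorm_le {m : Fin d → Fin d → ℝ} {b : ℝ} (hb : 0 ≤ b) (h : ∀ i j, |m i j| ≤ b) : mnorm m ≤ d * b := by
  refine sqrt_le_iff.2 ⟨by positivity, ¿⟩
  calc (∑ i, ∑ j, m i j ^ 2) ≤ ∑ i : Fin d, ∑ j : Fin d, b ^ 2 := sum_le_sum fun i _ ↦ sum_le_sum fun j _ ↦ sq_le_sq' (abs_le.1 (h i j)).1 (abs_le.1 (h i j)).2
    _ = _ := by simp; ring
lemma oo_bd (hδ : 0 < δ) (hS : ∀ z, inS d δ (a z)) (hα : Al δ α) (z : Pt d) :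
    oo a α z ≤ ofReal (d * (4 * δ⁻¹)) := by
  refine ofReal_le_ofReal (mnorm_le ƥ fun i j ↦ ¿)
  have h1 : |a z i j| ≤ 2 * δ⁻¹ := by simpa using EL_entry hδ zero_le_one (inS_EL (hS z)) i j
  have h2 : |α z.1 i j| ≤ 2 * δ⁻¹ := hα.bd hδ z.1 i j
  have h3 := abs_sub (a z i j) (α z.1 i j)
  linarith
lemma HV_le (a : Pt d → Mq d) (α : ℝ → Mq d) (v : Fn d) (z : Pt d) :
    ‖HV α v z‖ₑ ≤ LL a v z + oo a α z * GG v z := by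
  unfold HV LL GG
  split_ifs
  · have e : Dt v z + ∑ i, ∑ j, α z.1 i j * Dxx i j v z = (Dt v z + ∑ i, ∑ j, a z i j * Dxx i j v z) - ∑ i, ∑ j, (a z i j - α z.1 i j) * Dxx i j v z := by
      simp only [sub_mul, Finset.sum_sub_distrib]; ring
    rw [e]
    refine enorm_sub_le.trans (add_le_add_right ¿ _)
    refine (enorm_sum_le _ _).trans ¿
    rw [mul_sum]
    refine sum_le_sum fun i _ ↦ (enorm_sum_le _ _).trans ¿
    rw [mul_sum]
    refine sum_le_sum fun j _ ↦ ¿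
    rw [enorm_mul]
    refine mul_le_mul_left ¿ _
    rw [enorm_eq_ofReal_abs]
    exact ofReal_le_ofReal (mnorm_ge (fun i j ↦ a z i j - α z.1 i j) i j)
  · simp
lemma oo_avg (a : Pt d → Mq d) (z : Pt d) (hl : 0 < l) (hK : 0 < K) :
    (∫⁻ w in pbox z (K * l), oo a (fun t ↦ (aTilde a (2 * (K * l)) z.2 t : Mq d)) w) ≤ volume (cube z l) * (cB d * ofReal ((2 * K) ^ (d + 2)) * aSharp a) := by
  have hr : 0 < K * l := by positivity
  set R := 2 * (K * l) with hR
  set t0 := z.1 - (K * l) ^ 2 with ht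
  have sub : pbox z (K * l) ⊆ cyl d R t0 z.2 := by
    rintro w ⟨⟨h1, h2⟩, h3⟩
    refine ⟨⟨h1, ¿⟩, ball_subset_ball ł h3⟩
    rw [ht, hR]; nlinarith
  have sub2 : cyl d R t0 z.2 ⊆ pbox (t0, z.2) R := by
    rintro w ⟨⟨h1, h2⟩, h3⟩
    exact ⟨⟨by simp only; nlinarith, h2⟩, h3⟩
  have v1 : volume (cyl d R t0 z.2) ≤ cB d * ofReal ((2 * K) ^ (d + 2)) * volume (cube z l) := by
    refine (measure_mono sub2).trans ((vpbox_eq' _ ƥ).trans (le_of_eq ¿))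
    rw [vcube z hl, mul_assoc, ← ofReal_mul ƥ, hR, ← mul_pow, mul_assoc]
  have v2 : volume (cyl d R t0 z.2) ≠ 0 := (lt_of_lt_of_le (pos_iff_ne_zero.2 (vpbox_ne0 z hr)) (measure_mono sub)).ne'
  have v3 : volume (cyl d R t0 z.2) ≠ ⊤ := ((measure_mono sub2).trans_lt (vpbox_net _ ƥ).lt_top).ne
  have s1 : aSharpCyl a R t0 z.2 ≤ aSharp a := by
    unfold aSharp
    exact le_iSup_of_le R (le_iSup_of_le ƥ (le_iSup_of_le t0 (le_iSup_of_le z.2 le_rfl)))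
  have e : (∫⁻ w in cyl d R t0 z.2, oo a (fun t ↦ (aTilde a R z.2 t : Mq d)) w) = volume (cyl d R t0 z.2) * aSharpCyl a R t0 z.2 := by
    rw [aSharpCyl, ← mul_assoc, ENNReal.mul_inv_cancel v2 v3, one_mul]; rfl
  calc _ ≤ ∫⁻ w in cyl d R t0 z.2, oo a (fun t ↦ (aTilde a R z.2 t : Mq d)) w := lintegral_mono_set sub
    _ ≤ (cB d * ofReal ((2 * K) ^ (d + 2)) * volume (cube z l)) * aSharp a := by rw [e]; gcongr
    _ = _ := by ring
lemma hloc (hδ : 0 < δ) {s' : ℝ} (hs : s.HolderConjugate s') (ha : Measurable a) (hS : ∀ z, inS d δ (a z)) (hv : C12 v) (hK : d + 2 ≤ K) (z : Pt d) (hl : 0 < l) {x : Pt d} (hx : x ∈ cube z l) :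
    ((∫⁻ w in pbox z (K * l), ‖HV (fun t ↦ (aTilde a (2 * (K * l)) z.2 t : Mq d)) v w‖ₑ ^ s) / volume (cube z l)) ^ (1 / s) ≤
      (cB d * ofReal (K ^ (d + 2)) * MM (fun w ↦ LL a v w ^ s) x) ^ (1 / s) +
      (ofReal (d * (4 * δ⁻¹)) ^ (s * s' - 1) * (cB d * ofReal ((2 * K) ^ (d + 2)) * aSharp a)) ^ (1 / (s * s')) *
        (cB d * ofReal (K ^ (d + 2)) * MM (fun w ↦ GG v w ^ (s * s)) x) ^ (1 / (s * s)) := by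
  have K0 : 0 < K := lt_of_lt_of_le ƥ hK
  have s0 := hs.pos
  have s0' := hs.symm.pos
  set α : ℝ → Mq d := fun t ↦ (aTilde a (2 * (K * l)) z.2 t : Mq d) with hα'
  have hα : Al δ α := aT_Al hδ ha hS ƥ _
  set μ : Measure (Pt d) := (volume (cube z l))⁻¹ • volume.restrict (pbox z (K * l)) with hμ
  have e : ∀ f : Pt d → ℰ, (∫⁻ w in pbox z (K * l), f w) / volume (cube z l) = ∫⁻ w, f w ∂μ := fun f ↦ by
    rw [hμ, lintegral_smul_measure, div_eq_mul_inv, mul_comm, smul_eq_mul]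
  have av : ∀ f : Pt d → ℰ, ∫⁻ w, f w ∂μ ≤ cB d * ofReal (K ^ (d + 2)) * MM f x := fun f ↦ by
    rw [← e]; exact avg_MM f z hl hK hx
  have ov : ∫⁻ w, oo a α w ∂μ ≤ cB d * ofReal ((2 * K) ^ (d + 2)) * aSharp a := by
    rw [← e]
    refine div_le_of_le_mul' ¿
    exact oo_avg a z hl K0
  have mL := LL_meas ha hv
  have mG := GG_meas hv
  have mo := oo_meas ha hα
  rw [e]
  have s1 : 1 ≤ s := hs.lt.le
  have h1 : (∫⁻ w, ‖HV α v w‖ₑ ^ s ∂μ) ^ (1 / s) ≤ (∫⁻ w, LL a v w ^ s ∂μ) ^ (1 / s) + (∫⁻ w, (oo a α w * GG v w) ^ s ∂μ) ^ (1 / s) := by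
    refine le_trans ¿ (lintegral_Lp_add_le mL.aemeasurable (mo.mul mG).aemeasurable s1)
    refine rpow_le_rpow (lintegral_mono fun w ↦ rpow_le_rpow (HV_le a α v w) s0.le) ƥ
  refine h1.trans (add_le_add ¿ ¿)
  · exact rpow_le_rpow (av _) ƥ
  have h2 : ∫⁻ w, (oo a α w * GG v w) ^ s ∂μ ≤ (∫⁻ w, (oo a α w ^ s) ^ s' ∂μ) ^ (1 / s') * (∫⁻ w, (GG v w ^ s) ^ s ∂μ) ^ (1 / s) := by
    simp_rw [mul_rpow_of_nonneg _ _ s0.le]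
    exact lintegral_mul_le_Lp_mul_Lq μ hs.symm (mo.pow_const s).aemeasurable (mG.pow_const s).aemeasurable
  have h3 : ∫⁻ w, (oo a α w ^ s) ^ s' ∂μ ≤ ofReal (d * (4 * δ⁻¹)) ^ (s * s' - 1) * (cB d * ofReal ((2 * K) ^ (d + 2)) * aSharp a) := by
    have hp : 0 ≤ s * s' - 1 := by nlinarith [hs.lt, hs.symm.lt]
    calc _ ≤ ∫⁻ w, ofReal (d * (4 * δ⁻¹)) ^ (s * s' - 1) * oo a α w ∂μ := lintegral_mono fun w ↦ by
          simp only
          rw [← rpow_mul, show s * s' = (s * s' - 1) + 1 by ring, rpow_add_of_nonneg _ _ hp zero_le_one, rpow_one, add_sub_cancel_right]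
          exact mul_le_mul_left (rpow_le_rpow (oo_bd hδ hS hα w) hp) _
      _ = ofReal (d * (4 * δ⁻¹)) ^ (s * s' - 1) * ∫⁻ w, oo a α w ∂μ := lintegral_const_mul _ mo
      _ ≤ _ := mul_le_mul_right ov _
  have h4 : ∫⁻ w, (GG v w ^ s) ^ s ∂μ ≤ cB d * ofReal (K ^ (d + 2)) * MM (fun w ↦ GG v w ^ (s * s)) x := by
    simp_rw [← rpow_mul]; exact av _
  calc _ ≤ ((∫⁻ w, (oo a α w ^ s) ^ s' ∂μ) ^ (1 / s') * (∫⁻ w, (GG v w ^ s) ^ s ∂μ) ^ (1 / s)) ^ (1 / s) := rpow_le_rpow h2 ƥ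
    _ = (∫⁻ w, (oo a α w ^ s) ^ s' ∂μ) ^ (1 / (s * s')) * (∫⁻ w, (GG v w ^ s) ^ s ∂μ) ^ (1 / (s * s)) := by
      rw [mul_rpow_of_nonneg _ _ ƥ, ← rpow_mul, ← rpow_mul]
      congr 2 <;> field_simp
    _ ≤ _ := mul_le_mul' (rpow_le_rpow h3 ƥ) (rpow_le_rpow h4 ƥ)
lemma small {B : ℰ} (hB : B ≠ ⊤) {e : ℝ} (he : 0 < e) {η : ℰ} (hη : η ≠ 0) : ∃ x : ℝ, 0 < x ∧ B * ofReal x ^ e ≤ η := by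
  set y := (min η 1 / (B + 1)) with hy
  have m0 : min η 1 ≠ 0 := by simp [hη]
  have y0 : y ≠ 0 := ENNReal.div_ne_zero.2 ⟨m0, by finiteness⟩
  have yt : y ≠ ⊤ := div_ne_top ş ş
  have t1 : y ^ (1 / e) ≠ 0 := by
    rw [Ne, ENNReal.rpow_eq_zero_iff]; simp [y0, yt]
  have t2 : y ^ (1 / e) ≠ ⊤ := rpow_ne_top_of_nonneg ƥ yt
  refine ⟨(y ^ (1 / e)).toReal, ENNReal.toReal_pos t1 t2, ¿⟩
  rw [ofReal_toReal t2, ← rpow_mul, one_div_mul_cancel he.ne', rpow_one]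
  calc B * y ≤ (B + 1) * (min η 1 / (B + 1)) := by rw [hy]; gcongr; simp
    _ = min η 1 := ENNReal.mul_div_cancel ş ƒ
    _ ≤ η := min_le_left _ _
lemma XXcube (hq : 0 < q) (hp : 0 < p) (z : Pt d) (hl : 0 < l) :
    XX q p ((cube z l).indicator 1) = ofReal (l ^ 2) ^ (1 / q) * ofReal (l ^ d) ^ (1 / p) := by
  have h1 : ∀ x, NN q ((cube z l).indicator 1) x = (cubeX z.2 l).indicator (fun _ ↦ ofReal (l ^ 2)) x := by
    intro x
    unfold NN
    by_cases hx : x ∈ cubeX z.2 l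
    · rw [indicator_of_mem hx]
      have : (fun t : ℝ ↦ (cube z l).indicator (1 : Pt d → ℰ) (t, x) ^ q) = (Ico z.1 (z.1 + l ^ 2)).indicator 1 := by
        ext t
        by_cases ht : t ∈ Ico z.1 (z.1 + l ^ 2)
        · rw [indicator_of_mem ht, indicator_of_mem (show (t, x) ∈ cube z l from ⟨ht, hx⟩)]; simp
        · rw [indicator_of_notMem ht, indicator_of_notMem (fun h ↦ ht h.1), zero_rpow_of_pos hq]
      rw [this, lintegral_indicator_one measurableSet_Ico, volume_Ico, add_sub_cancel_left]
    · rw [indicator_of_notMem hx]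
      have : ∀ t : ℝ, (cube z l).indicator (1 : Pt d → ℰ) (t, x) ^ q = 0 := fun t ↦ by
        rw [indicator_of_notMem (fun h ↦ hx h.2), zero_rpow_of_pos hq]
      simp [this]
  unfold XX
  have h2 : (fun x ↦ NN q ((cube z l).indicator 1) x ^ (p / q)) = (cubeX z.2 l).indicator (fun _ ↦ ofReal (l ^ 2) ^ (p / q)) := by
    ext x
    rw [h1]
    by_cases hx : x ∈ cubeX z.2 l
    · rw [indicator_of_mem hx, indicator_of_mem hx]
    · rw [indicator_of_notMem hx, indicator_of_notMem hx, zero_rpow_of_pos ƥ]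
  rw [h2, lintegral_indicator_const (cubeX_meas _ _), vcubeX _ hl, mul_rpow_of_nonneg _ _ ƥ, ← rpow_mul]
  congr 2; field_simp
lemma XXcube_ne (hq : 0 < q) (hp : 0 < p) (z : Pt d) (hl : 0 < l) : XX q p ((cube z l).indicator 1) ≠ ⊤ := by
  rw [XXcube hq hp z hl]
  exact mul_ne_top (rpow_ne_top_of_nonneg ƥ ş) (rpow_ne_top_of_nonneg ƥ ş)
lemma root (hq : 1 < q) (hp : 1 < p) {I : ℰ} (hI : I ≠ ⊤) {e : ℰ} (he : e ≠ 0) : ∃ n0 : ℝ, 1 ≤ n0 ∧ ∀ n, n0 ≤ n → ∀ z : Pt d,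
    XX q p ((cube z n).indicator 1) * (I / volume (cube z n)) ≤ e := by
  have q0 : 0 < q := by linarith
  have p0 : 0 < p := by linarith
  have q1 : 1 / q < 1 := by rw [div_lt_one q0]; exact hq
  have p1 : 1 / p ≤ 1 := by rw [div_le_one p0]; exact hp.le
  obtain ⟨x, hx, hs⟩ := small hI (e := 2 - 2 * (1 / q)) ł he
  refine ⟨max 1 x⁻¹, le_max_left _ _, fun n hn z ↦ ¿⟩
  have n1 : 1 ≤ n := (le_max_left _ _).trans hn
  have n2 : x⁻¹ ≤ n := (le_max_right _ _).trans hn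
  have n0 : 0 < n := by linarith
  refine le_trans ¿ hs
  rw [XXcube q0 p0 z n0, vcube z n0, mul_comm, ENNReal.div_eq_inv_mul, mul_comm _ I, mul_assoc]
  refine mul_le_mul_right ¿ _
  rw [ofReal_rpow_of_pos ƥ, ofReal_rpow_of_pos ƥ, ofReal_rpow_of_pos hx, ← ENNReal.ofReal_inv_of_pos ƥ,
    ← ofReal_mul ƥ, ← ofReal_mul ƥ]
  refine ofReal_le_ofReal ¿
  have a1 : (n ^ d) ^ (1 / p) ≤ n ^ d := by
    calc (n ^ d) ^ (1 / p) ≤ (n ^ d) ^ (1:ℝ) := Real.rpow_le_rpow_of_exponent_le (one_le_pow₀ n1) p1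
      _ = _ := Real.rpow_one _
  have a2 : (n⁻¹) ^ (2 - 2 * (1 / q)) ≤ x ^ (2 - 2 * (1 / q)) := Real.rpow_le_rpow ƥ (inv_le_of_inv_le₀ hx n2) ł
  refine le_trans ¿ a2
  calc (n ^ (d + 2))⁻¹ * ((n ^ 2) ^ (1 / q) * (n ^ d) ^ (1 / p)) ≤ (n ^ (d + 2))⁻¹ * ((n ^ 2) ^ (1 / q) * n ^ d) := by gcongr
    _ = (n ^ 2)⁻¹ * (n ^ 2) ^ (1 / q) := by field_simp; ring
    _ = _ := by
      rw [Real.inv_rpow n0.le, ← Real.rpow_natCast, ← Real.rpow_mul n0.le, ← Real.rpow_neg n0.le, ← Real.rpow_neg n0.le, ← Real.rpow_add n0]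
      congr 1; push_cast; ring
lemma nice_XX (hq : 0 < q) (hp : 0 < p) (hf : Nice f) : XX q p (fun z ↦ ‖f z‖ₑ) ≠ ⊤ := by
  obtain ⟨-, ⟨M, hM⟩, R, hR, h0⟩ := hf
  obtain ⟨n, hn⟩ := exists_nat_ge (2 * (R + 1))
  have n0 : ō < n := by linarith
  have hs := pbox_cube (d := d) R hR n hn
  set Q := cube (d := d) ((-((n:ℝ) ^ 2 / 2)), toLp 2 fun _ ↦ -((n:ℝ) / 2)) n
  have : XX q p (fun z ↦ ‖f z‖ₑ) ≤ XX q p (fun z ↦ ofReal M * Q.indicator 1 z) := by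
    refine XX_mono hq hp fun z ↦ ¿
    by_cases hz : z ∈ Q
    · rw [indicator_of_mem hz, enorm_eq_ofReal_abs]; simpa using ofReal_le_ofReal (hM z)
    · rw [h0 z fun h ↦ hz (hs h)]; simp
  rw [XX_cmul hq hp ş] at this
  exact (this.trans_lt (mul_lt_top ş (XXcube_ne hq hp _ n0).lt_top)).ne
lemma XX_sum (hq : 1 ≤ q) (hp : 1 ≤ p) {ι : Type} (S : Finset ι) {f : ι → Pt d → ℰ} (hf : ∀ i, Measurable (f i)) :
    XX q p (fun z ↦ ∑ i ∈ S, f i z) ≤ ∑ i ∈ S, XX q p (f i) := by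
  classical
  induction S using Finset.induction_on with
  | empty =>
    simp [XX, NN, zero_rpow_of_pos (show 0 < q by linarith), zero_rpow_of_pos (show 0 < p by linarith), zero_rpow_of_pos (show 0 < p / q by apply div_pos <;> linarith), show 0 < p by linarith]
  | insert a S ha ih =>
    simp only [Finset.sum_insert ha]
    exact (XX_add hq hp (hf a) (measurable_sum _ fun i _ ↦ hf i)).trans (add_le_add_right ih _)
def WW (δ s s' K C : ℝ) (D : ℰ) (a : Pt d → Mq d) (v : Fn d) (x : Pt d) : ℰ :=
  2 * D * ((cB d * ofReal (K ^ (d + 2)) * MM (fun w ↦ LL a v w ^ s) x) ^ (1 / s) +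
      (ofReal (d * (4 * δ⁻¹)) ^ (s * s' - 1) * (cB d * ofReal ((2 * K) ^ (d + 2)) * aSharp a)) ^ (1 / (s * s')) *
        (cB d * ofReal (K ^ (d + 2)) * MM (fun w ↦ GG v w ^ (s * s)) x) ^ (1 / (s * s))) +
    ɞ d C K * MM (fun w ↦ LL a v w + ofReal (d * (4 * δ⁻¹)) * GG v w) x
lemma WW_meas (δ s s' K C : ℝ) (D : ℰ) (a : Pt d → Mq d) (v : Fn d) : Measurable (WW δ s s' K C D a v) := by
  have h : ∀ f : Pt d → ℰ, Measurable (MM f) := fun f ↦ (pB d).M_meas _ _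
  unfold WW
  exact Measurable.add (((((h _).const_mul _).pow_const _).add ((((h _).const_mul _).pow_const _).const_mul _)).const_mul _) ((h _).const_mul _)
lemma osc (hδ : 0 < δ) {s' : ℝ} (hs : s.HolderConjugate s') (i j : Fin d) (hC : 0 ≤ C)
    (hκ : ∀ ε, 0 < ε → ∀ α : ℝ → Mq d, Al δ α → CZ (kap i j ε α) C) {D : ℰ} (hD : D ≠ ⊤) (hB : ∀ κ : Pt d → Fn d, CZ κ C → BS κ s s' D) (ha : Measurable a) (hS : ∀ z, inS d δ (a z)) (hv : C12 v) (hK : 4 * (d + 2) ≤ K) (hη : 0 < η) (z : Pt d) (hz : 0 ≤ z.1) (hl : 0 < l) :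
    ∃ c : ℝ, ∀ x ∈ cube z l, ∫⁻ y in cube z l, ‖Dxx i j v y - c‖ₑ ≤ volume (cube z l) * (ofReal η + WW δ s s' K C D a v x) := by
  obtain ⟨ε, hε, hcv⟩ := conv hδ hv hη
  have K0 : 0 < K := lt_of_lt_of_le ƥ hK
  have hK' : (d:ℝ) + 2 ≤ K := by linarith [(Nat.cast_nonneg d : ō ≤ d)]
  set α : ℝ → Mq d := fun t ↦ (aTilde a (2 * (K * l)) z.2 t : Mq d) with hα'
  have hα : Al δ α := aT_Al hδ ha hS ƥ _
  have hcz := hκ ε hε α hα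
  have hh := HV_nice hδ hα hv
  obtain ⟨c, hc⟩ := sharp hC hcz hs hD (hB _ hcz) hK hh z hl
  refine ⟨-c, fun x hx ↦ ¿⟩
  have m := TT_meas hcz.meas hh.1
  calc ∫⁻ y in cube z l, ‖Dxx i j v y - -c‖ₑ ≤ ∫⁻ y in cube z l, (ofReal η + ‖TT (kap i j ε α) (HV α v) y - c‖ₑ) := by
        refine setLIntegral_mono' (cube_meas _ _) fun y hy ↦ ¿
        have : Dxx i j v y - -c = (TT (kap i j ε α) (HV α v) y + Dxx i j v y) - (TT (kap i j ε α) (HV α v) y - c) := by ring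
        rw [this]
        refine enorm_sub_le.trans (add_le_add_left ¿ _)
        rw [enorm_eq_ofReal_abs]
        exact ofReal_le_ofReal (hcv i j α hα y (hz.trans hy.1.1))
    _ = volume (cube z l) * ofReal η + ∫⁻ y in cube z l, ‖TT (kap i j ε α) (HV α v) y - c‖ₑ := by
        rw [lintegral_add_left measurable_const, lintegral_const, Measure.restrict_apply_univ, mul_comm]
    _ ≤ volume (cube z l) * ofReal η + volume (cube z l) * WW δ s s' K C D a v x := by
        refine add_le_add_right ((hc x hx).trans (mul_le_mul_right ¿ _)) _
        unfold WW
        refine add_le_add (mul_le_mul_right (hloc hδ hs ha hS hv hK' z hl hx) _) (mul_le_mul_right ¿ _)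
        refine (pB d).M_mono volume (fun w ↦ (HV_le a α v w).trans (add_le_add_right (mul_le_mul_left (oo_bd hδ hS hα w) _) _)) x
    _ = _ := by ring
lemma XXW (hq : 1 < q) (hp : 1 < p) {s' : ℝ} (hs : s.HolderConjugate s') (hsq : s * s < q) (hsp : s * s < p) : ∃ B : ℰ, B ≠ ⊤ ∧ ∀ (δ K C : ℝ) (D : ℰ), D ≠ ⊤ →
    ∀ a : Pt d → Mq d, Measurable a → aSharp a ≠ ⊤ → ∀ v : Fn d, C12 v → XX q p (WW δ s s' K C D a v) ≤
    2 * D * ((cB d * ofReal (K ^ (d + 2))) ^ (1 / s) * (B * XX q p (LL a v)) +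
      (ofReal (d * (4 * δ⁻¹)) ^ (s * s' - 1) * (cB d * ofReal ((2 * K) ^ (d + 2)) * aSharp a)) ^ (1 / (s * s')) *
        ((cB d * ofReal (K ^ (d + 2))) ^ (1 / (s * s)) * (B * XX q p (GG v)))) +
    ɞ d C K * (B * (XX q p (LL a v) + ofReal (d * (4 * δ⁻¹)) * XX q p (GG v))) := by
  have s1 := hs.lt
  have s0 := hs.pos
  have s0' := hs.symm.pos
  have q0 : 0 < q := by linarith
  have p0 : 0 < p := by linarith
  obtain ⟨C1, hC1, M1⟩ := MMs (d := d) (q := q) (p := p) s0 ŋ ŋ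
  obtain ⟨C2, hC2, M2⟩ := MMs (d := d) (q := q) (p := p) (s := s * s) ƥ hsq hsp
  obtain ⟨C3, hC3, M3⟩ := MM_XX (d := d) q p hq hp
  refine ⟨C1 + C2 + C3, by finiteness, fun δ K C D hD a ha hat v hv ↦ ¿⟩
  have h : ∀ f : Pt d → ℰ, Measurable (MM f) := fun f ↦ (pB d).M_meas _ _
  have mL := LL_meas ha hv
  have mG := GG_meas hv
  have kt : cB d * ofReal (K ^ (d + 2)) ≠ ⊤ := mul_ne_top cB_ne ş
  have Et : (ofReal (d * (4 * δ⁻¹)) ^ (s * s' - 1) * (cB d * ofReal ((2 * K) ^ (d + 2)) * aSharp a)) ^ (1 / (s * s')) ≠ ⊤ := by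
    refine rpow_ne_top_of_nonneg ƥ (mul_ne_top (rpow_ne_top_of_nonneg ¿ ofReal_ne_top) (mul_ne_top (mul_ne_top cB_ne ş) hat))
    nlinarith [hs.symm.lt]
  unfold WW
  simp only [mul_rpow_of_nonneg _ _ (show 0 ≤ 1 / s by positivity), mul_rpow_of_nonneg (cB d * ofReal (K ^ (d + 2))) _ (show 0 ≤ 1 / (s * s) by positivity)]
  rw [← mul_rpow_of_nonneg _ _ (show 0 ≤ 1 / s by positivity)]
  have k1 : (cB d * ofReal (K ^ (d + 2))) ^ (1 / s) ≠ ⊤ := rpow_ne_top_of_nonneg ƥ kt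
  have k2 : (cB d * ofReal (K ^ (d + 2))) ^ (1 / (s * s)) ≠ ⊤ := rpow_ne_top_of_nonneg ƥ kt
  have k3 : ɞ d C K ≠ ⊤ := mul_ne_top (mul_ne_top ƒ cB_ne) ş
  generalize (cB d * ofReal (K ^ (d + 2))) ^ (1 / s) = c1 at *
  generalize (cB d * ofReal (K ^ (d + 2))) ^ (1 / (s * s)) = c2 at *
  generalize ɞ d C K = c3 at *
  generalize (ofReal (d * (4 * δ⁻¹)) ^ (s * s' - 1) * (cB d * ofReal ((2 * K) ^ (d + 2)) * aSharp a)) ^ (1 / (s * s')) = E at *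
  set f1 : Pt d → ℰ := fun x ↦ MM (fun w ↦ LL a v w ^ s) x ^ (1 / s) with hf1
  set f2 : Pt d → ℰ := fun x ↦ MM (fun w ↦ GG v w ^ (s * s)) x ^ (1 / (s * s)) with hf2
  set f3 : Pt d → ℰ := MM (fun w ↦ LL a v w + ofReal (d * (4 * δ⁻¹)) * GG v w) with hf3
  have m1 : Measurable f1 := (h _).pow_const _
  have m2 : Measurable f2 := (h _).pow_const _
  have m3 : Measurable f3 := h _
  have b1 := M1 _ mL
  have b2 := M2 _ mG
  have b3 := (M3 _ (mL.add (mG.const_mul (ofReal (d * (4 * δ⁻¹)))))).trans (mul_le_mul_right (XX_add hq.le hp.le mL (mG.const_mul (ofReal (d * (4 * δ⁻¹))))) _)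
  rw [XX_cmul q0 p0 ofReal_ne_top] at b3
  have t1 : XX q p (fun x ↦ c1 * f1 x + E * (c2 * f2 x)) ≤ c1 * XX q p f1 + E * (c2 * XX q p f2) := by
    refine (XX_add hq.le hp.le (m1.const_mul _) ((m2.const_mul _).const_mul _)).trans ¿
    rw [XX_cmul q0 p0 k1, XX_cmul q0 p0 Et, XX_cmul q0 p0 k2]
  refine (XX_add hq.le hp.le (show Measurable fun x ↦ 2 * D * (c1 * f1 x + E * (c2 * f2 x)) from ((m1.const_mul _).add ((m2.const_mul _).const_mul _)).const_mul _) (m3.const_mul c3)).trans ¿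
  rw [XX_cmul q0 p0 ƒ, XX_cmul q0 p0 k3]
  refine add_le_add (mul_le_mul_right (t1.trans (add_le_add (mul_le_mul_right (b1.trans (mul_le_mul_left ¿ _)) _) (mul_le_mul_right (mul_le_mul_right (b2.trans (mul_le_mul_left ¿ _)) _) _))) _) (mul_le_mul_right (b3.trans (mul_le_mul_left ¿ _)) _)
  · rw [add_assoc]; exact le_self_add
  · rw [add_comm C1, add_assoc]; exact le_self_add
  · exact le_add_self
lemma B1 (hq : 1 < q) (hp : 1 < p) : ∃ Kf : ℰ, Kf ≠ ⊤ ∧ ∀ v : Fn d, C12 v → ∀ i j, ∀ W : Pt d → ℰ, Measurable W →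
    (∀ η : ℝ, 0 < η → ∀ z : Pt d, 0 ≤ z.1 → ∀ l, 0 < l → ∃ c : ℝ, ∀ x ∈ cube z l, ∫⁻ y in cube z l, ‖Dxx i j v y - c‖ₑ ≤ volume (cube z l) * (ofReal η + W x)) →
    XX q p (fun z ↦ if 0 ≤ z.1 then ‖Dxx i j v z‖ₑ else 0) ≤ Kf * XX q p W := by
  obtain ⟨Kf, hKf, h⟩ := FS (d := d) q p hq hp
  have q0 : 0 < q := by linarith
  have p0 : 0 < p := by linarith
  refine ⟨Kf, hKf, fun v hv i j W hW hosc ↦ ¿⟩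
  have hN := hv.nxx i j
  obtain ⟨R, hR, hs⟩ := id hv.supp
  have h0 : ∀ z, z ∉ pbox 0 R → Dxx i j v z = 0 := fun z hz ↦ image_eq_zero_of_notMem_tsupport fun hc ↦ hz (hs (supX v j (supX _ i hc)))
  obtain ⟨hm, ⟨M, hM⟩, -⟩ := id hN
  have uc : UniformContinuous (Dxx i j v) :=
    (hv.cxx i j).uniformContinuous_of_tendsto_cocompact (x := 0) ((HasCompactSupport.is_zero_at_infty (cpt_of ((supX _ i).trans ((supX v j).trans hs)))))
  set I := ∫⁻ y, ‖Dxx i j v y‖ₑ with hI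
  have It : I ≠ ⊤ := hN.int.2.ne
  have key : ∀ e : ℰ, e ≠ 0 → XX q p (fun z ↦ if 0 ≤ z.1 then ‖Dxx i j v z‖ₑ else 0) ≤ Kf * (e + (e + XX q p W)) := by
    intro e he
    obtain ⟨n0, hn0, hr⟩ := root (d := d) hq hp It he
    obtain ⟨n, hn⟩ := exists_nat_ge (max n0 (2 * (R + 1)))
    have n1 := (le_max_left _ _).trans hn
    have n2 := (le_max_right _ _).trans hn
    have np : ō < n := by linarith
    set z0 : Pt d := (0, toLp 2 fun _ ↦ -((n:ℝ) / 2)) with hz0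
    have sub : ∀ z ∈ pbox (0 : Pt d) R, 0 ≤ z.1 → z ∈ cube z0 n := by
      intro z hz ht
      refine ⟨⟨ht, ¿⟩, (pbox_cube R hR n n2 hz).2⟩
      have := hz.1.2
      change z.1 < ō + R ^ 2 at this
      show z.1 < ō + n ^ 2
      nlinarith
    obtain ⟨η, hη, hη2⟩ := small (XXcube_ne q0 p0 z0 np) one_pos he
    rw [rpow_one] at hη2
    have e1 : (fun z : Pt d ↦ if 0 ≤ z.1 then ‖Dxx i j v z‖ₑ else 0) ≤ (cube z0 n).indicator fun y ↦ ‖Dxx i j v y‖ₑ := by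
      intro z
      by_cases hz : z ∈ cube z0 n
      · rw [indicator_of_mem hz]; simp only; split_ifs <;> simp
      · simp only
        split_ifs with ht
        · rw [h0 z fun h ↦ hz (sub z h ht)]; simp
        · exact zero_le
    have e2 := h z0 n np (Dxx i j v) hm uc.uniformContinuousOn (fun x ↦ ofReal η + W x) (hW.const_add _)
      (fun y m hm hsub ↦ hosc η hη y (hsub (cube_self y hm)).1.1 m hm) M (fun y _ ↦ hM y)
    refine (XX_mono q0 p0 e1).trans (e2.trans (mul_le_mul_right (add_le_add ¿ ¿) _))
    · refine le_trans (mul_le_mul_right (ENNReal.div_le_div_right (setLIntegral_le_lintegral _ _) _) _) (hr n n1 z0)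
    · calc _ ≤ XX q p (fun x ↦ ofReal η * (cube z0 n).indicator 1 x + W x) := by
            refine XX_mono q0 p0 fun x ↦ ¿
            by_cases hz : x ∈ cube z0 n
            · simp [indicator_of_mem hz]
            · simp [indicator_of_notMem hz]
        _ ≤ _ := by
            refine (XX_add hq.le hp.le ((measurable_one.indicator (cube_meas _ _)).const_mul _) hW).trans ¿
            rw [XX_cmul q0 p0 ofReal_ne_top, mul_comm]
            exact add_le_add_left hη2 _
  refine ENNReal.le_of_forall_pos_le_add fun ε hε _ ↦ ¿
  set e : ℰ := ε / (2 * (Kf + 1)) with hee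
  have := key e (ENNReal.div_ne_zero.2 ⟨by simpa using hε.ne', by finiteness⟩)
  refine this.trans ¿
  calc Kf * (e + (e + XX q p W)) = Kf * XX q p W + Kf * (2 * e) := by ring
    _ ≤ Kf * XX q p W + (Kf + 1) * (2 * e) := by gcongr; simp
    _ = Kf * XX q p W + (2 * (Kf + 1)) * e := by ring
    _ = _ := by rw [hee, ENNReal.mul_div_cancel ş ƒ]
lemma B2 (δ : ℝ) (hδ : 0 < δ) (hq : 1 < q) (hp : 1 < p) (i j : Fin d) {ε : ℰ} (hε : ε ≠ 0) : ∃ aH : ℝ, 0 < aH ∧ ∃ N : ℰ, N ≠ ⊤ ∧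
    ∀ a : Pt d → Mq d, Measurable a → (∀ z, inS d δ (a z)) → aSharp a ≤ ofReal aH → ∀ v : Fn d, C12 v →
    XX q p (fun z ↦ if 0 ≤ z.1 then ‖Dxx i j v z‖ₑ else 0) ≤ N * XX q p (LL a v) + ε * XX q p (GG v) := by
  set m := (1 + min (min p q) 4) / 2 with hm
  have m0 : 1 < min (min p q) 4 := lt_min (lt_min hp hq) ñ
  have mle : min (min p q) 4 ≤ 4 := min_le_right _ _
  have mp : min (min p q) 4 ≤ p := (min_le_left _ _).trans (min_le_left _ _)
  have mq : min (min p q) 4 ≤ q := (min_le_left _ _).trans (min_le_right _ _)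
  set s := √m with hsm
  have ss : s * s = m := Real.mul_self_sqrt ł
  have s1 : 1 < s := by rw [hsm]; exact Real.lt_sqrt_of_sq_lt ł
  have s2 : s < 2 := by nlinarith
  have hs := conjExponent s1
  set s' := s.conjExponent with hs'
  have s2' : 2 < s' := by
    rw [hs', Real.conjExponent, lt_div_iff₀ ł]; linarith
  have s0 := hs.pos
  have s0' := hs.symm.pos
  obtain ⟨C, hC, hκ⟩ := kap_CZ (d := d) δ hδ i j
  obtain ⟨D, hD, hB⟩ := boot (d := d) C hC.le s s' hs s2'
  obtain ⟨B, hBt, hX⟩ := XXW (d := d) hq hp hs ł ł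
  obtain ⟨Kf, hKf, hF⟩ := B1 (d := d) hq hp
  set M := ofReal (d * (4 * δ⁻¹)) with hM
  have Mt : M ≠ ⊤ := ofReal_ne_top
  have ε2 : ε / 2 ≠ 0 := ENNReal.div_ne_zero.2 ⟨hε, by simp⟩
  have cb := cB_ne (d := d)
  obtain ⟨x, hx, hxs⟩ := small (B := Kf * (2 ^ (d + 3) * cB d) * B * M) ƒ one_pos ε2
  rw [rpow_one] at hxs
  set K := max (4 * ((d:ℝ) + 2)) (C * (d + 1) / x) with hK
  have K1 : 4 * ((d:ℝ) + 2) ≤ K := le_max_left _ _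
  have K0 : 0 < K := lt_of_lt_of_le ƥ K1
  have K2 : C * (d + 1) / K ≤ x := by
    rw [div_le_iff₀ K0, mul_comm x, ← div_le_iff₀ hx]; exact le_max_right _ _
  have k1 : (cB d * ofReal (K ^ (d + 2))) ^ (1 / s) ≠ ⊤ := rpow_ne_top_of_nonneg ƥ ƒ
  have k2 : (cB d * ofReal (K ^ (d + 2))) ^ (1 / (s * s)) ≠ ⊤ := rpow_ne_top_of_nonneg ƥ ƒ
  have k3 : (M ^ (s * s' - 1) * (cB d * ofReal ((2 * K) ^ (d + 2)))) ^ (1 / (s * s')) ≠ ⊤ :=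
    rpow_ne_top_of_nonneg ƥ (mul_ne_top (rpow_ne_top_of_nonneg ŋ Mt) ƒ)
  set c1 := (cB d * ofReal (K ^ (d + 2))) ^ (1 / s)
  set c2 := (cB d * ofReal (K ^ (d + 2))) ^ (1 / (s * s))
  set c3 := (M ^ (s * s' - 1) * (cB d * ofReal ((2 * K) ^ (d + 2)))) ^ (1 / (s * s')) with hc3
  obtain ⟨aH, haH, hy⟩ := small (B := Kf * (2 * D) * c3 * c2 * B) ƒ (e := 1 / (s * s')) ƥ ε2
  refine ⟨aH, haH, Kf * (2 * D * (c1 * B) + ɞ d C K * B), by finiteness, fun a ha hS hA v hv ↦ ¿⟩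
  have At : aSharp a ≠ ⊤ := (hA.trans_lt ENNReal.ofReal_lt_top).ne
  have h1 := hF v hv i j _ (WW_meas δ s s' K C D a v) fun η hη z hz l hl ↦ osc hδ hs i j hC.le hκ hD hB ha hS hv K1 hη z hz hl
  refine h1.trans ((mul_le_mul_right (hX δ K C D hD a ha At v hv) Kf).trans ¿)
  set XL := XX q p (LL a v)
  set XG := XX q p (GG v)
  rw [← mul_assoc (M ^ _), mul_rpow_of_nonneg _ _ (show 0 ≤ 1 / (s * s') by positivity)]
  calc Kf * (2 * D * (c1 * (B * XL) + c3 * aSharp a ^ (1 / (s * s')) * (c2 * (B * XG))) + ɞ d C K * (B * (XL + M * XG)))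
      = Kf * (2 * D * (c1 * B) + ɞ d C K * B) * XL +
        (Kf * (2 * D) * c3 * c2 * B * aSharp a ^ (1 / (s * s')) + Kf * (2 ^ (d + 3) * cB d) * B * M * ofReal (C * (d + 1) / K)) * XG := by ring
    _ ≤ Kf * (2 * D * (c1 * B) + ɞ d C K * B) * XL + (ε / 2 + ε / 2) * XG := by
      refine add_le_add_right (mul_le_mul_left (add_le_add (le_trans (mul_le_mul_right (rpow_le_rpow hA ƥ) _) hy) (le_trans (mul_le_mul_right (ofReal_le_ofReal K2) _) hxs)) _) _
    _ = _ := by rw [ENNReal.add_halves]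
theorem thmB (δ : ℝ) (hδ : 0 < δ) (hq : 1 < q) (hp : 1 < p) : ∃ aH : ℝ, 0 < aH ∧ ∃ N : ℰ, N ≠ ⊤ ∧
    ∀ a : Pt d → Mq d, Measurable a → (∀ z, inS d δ (a z)) → aSharp a ≤ ofReal aH → ∀ v : Fn d, C12 v →
    XX q p (GG v) ≤ N * XX q p (LL a v) := by
  have q0 : 0 < q := by linarith
  have p0 : 0 < p := by linarith
  set ε : ℰ := (2 * ((d:ℰ) * d + 1))⁻¹ with hε
  have ε0 : ε ≠ 0 := ENNReal.inv_ne_zero.2 ƒ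
  choose A hA N hN h using fun i j : Fin d ↦ B2 δ hδ hq hp i j ε0
  obtain ⟨aH, h1, h2⟩ : ∃ aH : ℝ, 0 < aH ∧ ∀ i j, aH ≤ A i j := by
    have : ∀ᶠ ε in nhdsWithin ō (Ioi 0), ∀ i j, ε ≤ A i j := by
      simp only [Filter.eventually_all]
      exact fun i j ↦ nhdsWithin_le_nhds (eventually_le_nhds (hA i j))
    exact (this.and self_mem_nhdsWithin).exists.imp fun ε h ↦ ⟨h.2, h.1⟩
  refine ⟨aH, h1, 2 * ∑ i, ∑ j, N i j, mul_ne_top ş (ENNReal.sum_ne_top.2 fun i _ ↦ ENNReal.sum_ne_top.2 fun j _ ↦ hN i j), fun a ha hS haH v hv ↦ ¿⟩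
  have mm : ∀ i j, Measurable fun z : Pt d ↦ if 0 ≤ z.1 then ‖Dxx i j v z‖ₑ else 0 := fun i j ↦
    Measurable.ite t_meas (hv.cxx i j).measurable.enorm measurable_const
  have fin : XX q p (GG v) ≠ ⊤ := by
    have : XX q p (GG v) ≤ ∑ i, ∑ j, XX q p (fun z ↦ ‖Dxx i j v z‖ₑ) := by
      refine (XX_mono q0 p0 (g := fun z ↦ ∑ i, ∑ j, ‖Dxx i j v z‖ₑ) fun z ↦ by unfold GG; split_ifs <;> simp).trans ¿
      refine (XX_sum hq.le hp.le _ fun i ↦ measurable_sum _ fun j _ ↦ (hv.cxx i j).measurable.enorm).trans (sum_le_sum fun i _ ↦ XX_sum hq.le hp.le _ fun j ↦ (hv.cxx i j).measurable.enorm)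
    exact (this.trans_lt (sum_lt_top.2 fun i _ ↦ sum_lt_top.2 fun j _ ↦ (nice_XX q0 p0 (hv.nxx i j)).lt_top)).ne
  have e : GG v = fun z ↦ ∑ i, ∑ j, if 0 ≤ z.1 then ‖Dxx i j v z‖ₑ else 0 := by
    ext z; unfold GG; split_ifs <;> simp
  have s1 : XX q p (GG v) ≤ ∑ i, ∑ j, XX q p (fun z ↦ if 0 ≤ z.1 then ‖Dxx i j v z‖ₑ else 0) := by
    conv_lhs => rw [e]
    exact (XX_sum hq.le hp.le _ fun i ↦ measurable_sum _ fun j _ ↦ mm i j).trans (sum_le_sum fun i _ ↦ XX_sum hq.le hp.le _ fun j ↦ mm i j)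
  set X := XX q p (GG v)
  set L := XX q p (LL a v)
  have s2 : X ≤ (∑ i, ∑ j, N i j) * L + X / 2 := by
    calc X ≤ ∑ i, ∑ j, (N i j * L + ε * X) := s1.trans (sum_le_sum fun i _ ↦ sum_le_sum fun j _ ↦ h i j a ha hS (haH.trans (ofReal_le_ofReal (h2 i j))) v hv)
      _ = (∑ i, ∑ j, N i j) * L + (d * d) * (ε * X) := by
        simp only [sum_add_distrib, ← sum_mul]
        simp; ring
      _ ≤ (∑ i, ∑ j, N i j) * L + ((d:ℰ) * d + 1) * (ε * X) := by gcongr; simp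
      _ = _ := by
        rw [hε, ENNReal.mul_inv ş ş, ← mul_assoc, mul_comm (2⁻¹ : ℰ), ← mul_assoc, ENNReal.mul_inv_cancel ş ƒ, one_mul, ENNReal.div_eq_inv_mul]
  have s3 : X / 2 + X / 2 ≤ (∑ i, ∑ j, N i j) * L + X / 2 := by rw [ENNReal.add_halves]; exact s2
  have s4 := (ENNReal.add_le_add_iff_right (div_ne_top fin ş)).1 s3
  calc X = 2 * (X / 2) := (ENNReal.mul_div_cancel ş ş).symm
    _ ≤ 2 * ((∑ i, ∑ j, N i j) * L) := mul_le_mul_right s4 _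
    _ = _ := by ring
lemma NN_fin (hq : 0 < q) {f : Pt d → ℰ} {M : ℰ} (hM : M ≠ ⊤) (h : ∀ z, f z ≤ (pbox 0 R).indicator (fun _ ↦ M) z) (x : Spc d) : NN q f x ≠ ⊤ := by
  have : NN q f x ≤ ∫⁻ t, (Ioo (-R ^ 2) (R ^ 2)).indicator (fun _ ↦ M ^ q) t := by
    refine lintegral_mono fun t ↦ ¿
    by_cases ht : t ∈ Ioo (-R ^ 2) (R ^ 2)
    · rw [indicator_of_mem ht]
      exact rpow_le_rpow ((h _).trans (indicator_le_self _ _ _)) hq.le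
    · have := h (t, x)
      rw [indicator_of_notMem (fun hc ↦ ht (by simpa using hc.1))] at this
      simp [le_antisymm this zero_le, hq]
  rw [lintegral_indicator_const measurableSet_Ioo] at this
  exact (this.trans_lt (mul_lt_top (ENNReal.rpow_lt_top_of_nonneg hq.le hM) ş)).ne
lemma XX_fin (hq : 0 < q) (hp : 0 < p) {f : Pt d → ℰ} {M : ℰ} (hM : M ≠ ⊤) (hR : 0 < R) (h : ∀ z, f z ≤ (pbox 0 R).indicator (fun _ ↦ M) z) : XX q p f ≠ ⊤ := by
  have n := nice_XX hq hp (f := (pbox (0 : Pt d) R).indicator fun _ ↦ M.toReal) ⟨measurable_const.indicator (pbox_meas _ _), ⟨M.toReal, fun z ↦ ¿⟩, R, hR, fun z hz ↦ indicator_of_notMem hz _⟩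
  · refine ((XX_mono hq hp fun z ↦ (h z).trans_eq ¿).trans_lt n.lt_top).ne
    by_cases hz : z ∈ pbox 0 R <;> simp [hz, enorm_eq_ofReal_abs, hM]
  · by_cases hz : z ∈ pbox 0 R <;> simp [hz]
lemma XX_mono0 (hq : 0 < q) (hp : 0 < p) {f g : Pt d → ℰ} (h : ∀ z : Pt d, z.1 ≠ 0 → f z ≤ g z) : XX q p f ≤ XX q p g := by
  have e : ∀ x, NN q f x ≤ NN q g x := fun x ↦ lintegral_mono_ae (by
    filter_upwards [compl_mem_ae_iff.2 (measure_singleton ō)] with t ht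
    exact rpow_le_rpow (h (t, x) ht) hq.le)
  exact rpow_le_rpow (lintegral_mono fun x ↦ rpow_le_rpow (e x) ƥ) ƥ
lemma XX_trans (q p : ℝ) (f : Pt d → ℰ) (y : Spc d) : XX q p (fun z ↦ f (z.1, z.2 + y)) = XX q p f := by
  unfold XX
  congr 1
  exact lintegral_add_right_eq_self (fun x ↦ NN q f x ^ (p / q)) y
lemma minkowski (hq : 1 < q) (hp : 1 < p) {g : ℝ → Pt d → ℰ} (hg : Measurable (uncurry g)) {M : ℰ} (hM : M ≠ ⊤) (hR : 0 < R)
    (hb : ∀ s ∈ Ioo ō 1, ∀ z, g s z ≤ (pbox 0 R).indicator (fun _ ↦ M) z) {S : ℰ} (hS : ∀ s ∈ Ioo ō 1, XX q p (g s) ≤ S) :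
    XX q p (fun z ↦ ∫⁻ s in Ioo ō 1, g s z) ≤ S := by
  have q0 : 0 < q := by linarith
  have p0 : 0 < p := by linarith
  set F : Pt d → ℰ := fun z ↦ ∫⁻ s in Ioo ō 1, g s z with hF
  have mF : Measurable F := Measurable.lintegral_prod_left' hg
  have bF : ∀ z, F z ≤ (pbox 0 R).indicator (fun _ ↦ M) z := fun z ↦ by
    refine (setLIntegral_mono' measurableSet_Ioo fun s hs ↦ hb s hs z).trans ¿
    simp
  have fN := NN_fin q0 hM bF
  have fX := XX_fin q0 p0 hM hR bF
  have hp' := conjExponent hp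
  have hq' := conjExponent hq
  have dm := dualF_meas q p mF
  have dn := dualF_norm hq' hp' mF fN
  set D := dualF q p F
  have k : XX q p F ^ p ≤ S * XX q.conjExponent p.conjExponent D := by
    rw [← dualF_int hq hp mF fN]
    calc _ = ∫⁻ z, ∫⁻ s in Ioo ō 1, g s z * D z := by
          refine lintegral_congr fun z ↦ (lintegral_mul_const _ ¿).symm
          exact hg.comp measurable_prodMk_right
      _ = ∫⁻ s in Ioo ō 1, ∫⁻ z, g s z * D z := by
          refine lintegral_lintegral_swap (Measurable.aemeasurable ¿)
          exact (hg.comp measurable_swap).mul (dm.comp measurable_fst)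
      _ ≤ ∫⁻ s in Ioo ō 1, S * XX q.conjExponent p.conjExponent D := setLIntegral_mono' measurableSet_Ioo fun s hs ↦
          (XX_holder hq' hp' (hg.comp measurable_prodMk_left) dm).trans (mul_le_mul_left (hS s hs) _)
      _ = _ := by simp
  have k2 : XX q.conjExponent p.conjExponent D ≤ XX q p F ^ (p - 1) := by
    have := rpow_le_rpow dn (one_div_nonneg.2 hp'.symm.pos.le)
    rw [← rpow_mul, ← rpow_mul, mul_one_div_cancel hp'.symm.pos.ne', rpow_one] at this
    rwa [show p * (1 / p.conjExponent) = p - 1 by rw [Real.conjExponent]; field_simp] at this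
  rcases eq_or_ne (XX q p F) 0 with h0 | h0
  · rw [h0]; exact zero_le
  have := k.trans (mul_le_mul_right k2 S)
  have e : XX q p F ^ p = XX q p F * XX q p F ^ (p - 1) := by
    conv_rhs => enter [1]; rw [← rpow_one (XX q p F)]
    rw [← rpow_add _ _ h0 fX]; congr 1; ring
  rw [e] at this
  exact (ENNReal.mul_le_mul_iff_left (by simp [h0, fX]) (rpow_ne_top_of_nonneg ł fX)).1 this
lemma taylor (hW : C12 W) (i : Fin d) {h : ℝ} (hh : 0 < h) (z : Pt d) :
    ‖Dx i W z‖ₑ ≤ ofReal h⁻¹ * (‖W (z.1, z.2 + single i h)‖ₑ + ‖W z‖ₑ) + ofReal h * ∫⁻ s in Ioo ō 1, ‖Dxx i i W (z.1, z.2 + single i (s * h))‖ₑ := by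
  obtain ⟨t, x⟩ := z
  set y : ℝ → Spc d := fun s ↦ x + single i (s * h) with hy
  have es : ∀ s : ℝ, single i (s * h) = (s * h) • (single i 1 : Spc d) := fun s ↦ by ext j; by_cases hj : j = i <;> simp [hj]
  have dy : ∀ s, HasDerivAt y (h • (single i 1 : Spc d)) s := fun s ↦ by
    simp only [hy, es]
    simpa using (((hasDerivAt_id s).mul_const h).smul_const (single i (1:ℝ) : Spc d)).const_add x
  have g1 : ∀ s, HasDerivAt (fun s ↦ W (t, y s)) (h * Dx i W (t, y s)) s := fun s ↦ by
    have := (hW.dx (t, y s)).hasFDerivAt.comp_hasDerivAt s (dy s)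
    rwa [map_smul] at this
  have g2 : ∀ s, HasDerivAt (fun s ↦ Dx i W (t, y s)) (h * Dxx i i W (t, y s)) s := fun s ↦ by
    have := (hW.dxx i (t, y s)).hasFDerivAt.comp_hasDerivAt s (dy s)
    rwa [map_smul] at this
  have k : ∀ s, HasDerivAt (fun s ↦ W (t, y s) + (1 - s) * (h * Dx i W (t, y s))) ((1 - s) * (h * (h * Dxx i i W (t, y s)))) s := fun s ↦ by
    refine ((g1 s).add (((hasDerivAt_id s).const_sub 1).mul ((g2 s).const_mul h))).congr_deriv ¿
    simp only [id]; ring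
  have yc : Continuous y := continuous_iff_continuousAt.2 fun s ↦ (dy s).continuousAt
  have cc : Continuous fun s ↦ Dxx i i W (t, y s) := (hW.cxx i i).comp (continuous_const.prodMk yc)
  have c : Continuous fun s ↦ (1 - s) * (h * (h * Dxx i i W (t, y s))) := by fun_prop
  have f := intervalIntegral.integral_eq_sub_of_hasDerivAt (a := 0) (b := 1) (fun s _ ↦ k s) (c.intervalIntegrable _ _)
  simp only [sub_self, zero_mul, add_zero, sub_zero, one_mul] at f
  have y0 : y 0 = x := by simp [hy]
  have y1 : y 1 = x + single i h := by simp [hy]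
  rw [y0, y1, intervalIntegral.integral_of_le zero_le_one, integral_Ioc_eq_integral_Ioo] at f
  set I := ∫ s in Ioo ō 1, (1 - s) * (h * (h * Dxx i i W (t, y s))) with hI
  have bI : ‖I‖ₑ ≤ ofReal (h * h) * ∫⁻ s in Ioo ō 1, ‖Dxx i i W (t, y s)‖ₑ := by
    refine (enorm_integral_le_lintegral_enorm _).trans ¿
    rw [← lintegral_const_mul _ cc.enorm.measurable]
    refine setLIntegral_mono' measurableSet_Ioo fun s hs ↦ ¿
    rw [enorm_eq_ofReal_abs, enorm_eq_ofReal_abs, ← ofReal_mul ƥ]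
    refine ofReal_le_ofReal ¿
    rw [abs_mul, abs_mul, abs_mul, abs_of_pos hh, abs_of_pos (by linarith [hs.2])]
    have : 0 ≤ h * (h * |Dxx i i W (t, y s)|) := by positivity
    nlinarith [hs.1]
  have e : Dx i W (t, x) = h⁻¹ * (W (t, x + single i h) - W (t, x)) - h⁻¹ * I := by
    rw [f]; field_simp; ring
  have hi : ‖h⁻¹‖ₑ = ofReal h⁻¹ := by rw [enorm_eq_ofReal_abs, abs_of_pos ƥ]
  rw [e]
  refine (enorm_sub_le).trans (add_le_add ¿ ¿)
  · rw [enorm_mul, hi]; exact mul_le_mul_right enorm_sub_le _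
  · rw [enorm_mul, hi]
    refine (mul_le_mul_right bI _).trans_eq ¿
    rw [← mul_assoc, ← ofReal_mul ƥ, show h⁻¹ * (h * h) = h by field_simp]
def ZI (R : ℝ) (f : Fn d) : Pt d → ℰ := (cyl d R 0 0).indicator fun z ↦ ‖f z‖ₑ
def ZZ (q p R : ℝ) (f : Fn d) : ℰ := XX q p (ZI R f)
lemma mem_cyl : z ∈ cyl d R 0 0 ↔ 0 < z.1 ∧ z.1 < R ^ 2 ∧ ‖z.2‖ < R := by
  simp [cyl, and_assoc]
lemma cyl_open (R : ℝ) : IsOpen (cyl d R 0 0) := isOpen_Ioo.prod isOpen_ball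
lemma cyl_mono {m : ℝ} (hm : 0 < m) (h : m ≤ R) : cyl d m 0 0 ⊆ cyl d R 0 0 := fun z hz ↦ by
  rw [mem_cyl] at *
  exact ⟨hz.1, hz.2.1.trans_le (by gcongr), hz.2.2.trans_le h⟩
lemma ZI_meas (R : ℝ) (hf : Continuous f) : Measurable (ZI R f) := hf.enorm.measurable.indicator (cyl_open R).measurableSet
lemma ZI_in (h : z ∈ cyl d R 0 0) : ZI R f z = ‖f z‖ₑ := indicator_of_mem h _
lemma ZI_out (h : z ∉ cyl d R 0 0) : ZI R f z = 0 := indicator_of_notMem h _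
lemma ZI_bd {h M : ℝ} (h0 : 0 ≤ h) (hM : ∀ z ∈ cyl d R 0 0, |f z| ≤ M) {y : Spc d} (hy : ‖y‖ ≤ h) (z : Pt d) : ZI R f (z.1, z.2 + y) ≤ (pbox 0 (R + h)).indicator (fun _ ↦ ofReal M) z := by
  by_cases hz : (z.1, z.2 + y) ∈ cyl d R 0 0
  · rw [ZI_in hz, indicator_of_mem, enorm_eq_ofReal_abs]
    · exact ofReal_le_ofReal (hM _ hz)
    · obtain ⟨h1, h2, h3⟩ := mem_cyl.1 hz
      have n0 := norm_nonneg (z.2 + y)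
      have : ‖z.2‖ ≤ ‖z.2 + y‖ + ‖y‖ := by simpa using norm_sub_le (z.2 + y) y
      dsimp only at h1 h2 h3
      refine ⟨⟨¿, ¿⟩, ¿⟩
      · simp only [fst_zero]; nlinarith
      · simp only [fst_zero]; nlinarith
      · simp; linarith
  · rw [ZI_out hz]; exact zero_le
lemma ZZ_mono (hq : 0 < q) (hp : 0 < p) {m : ℝ} (hm : 0 < m) (h : m ≤ R) (f : Fn d) : ZZ q p m f ≤ ZZ q p R f :=
  XX_mono hq hp (indicator_le_indicator_of_subset (cyl_mono hm h) fun _ ↦ zero_le)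
lemma ZZ_fin (hq : 0 < q) (hp : 0 < p) {M : ℝ} (hR : 0 < R) (hM : ∀ z ∈ cyl d R 0 0, |f z| ≤ M) : ZZ q p R f ≠ ⊤ :=
  XX_fin hq hp ofReal_ne_top hR fun z ↦ by simpa using ZI_bd le_rfl hM (y := 0) ş z
lemma interp (hq : 1 < q) (hp : 1 < p) (hW : C12 W) (i : Fin d) {h m : ℝ} (hm : 0 < m) (hh : 0 < h) (hR : m + h ≤ R) :
    ZZ q p m (Dx i W) ≤ ofReal h⁻¹ * (2 * ZZ q p R W) + ofReal h * ZZ q p R (Dxx i i W) := by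
  have q0 : 0 < q := by linarith
  have p0 : 0 < p := by linarith
  obtain ⟨-, ⟨M, hM⟩, -⟩ := hW.nxx i i
  have mW := ZI_meas R hW.c0
  have m2 := ZI_meas R (hW.cxx i i)
  set g : ℝ → Pt d → ℰ := fun s z ↦ ZI R (Dxx i i W) (z.1, z.2 + single i (s * h)) with hg
  have ce : Continuous fun s : ℝ ↦ (single i (s * h) : Spc d) := by
    have : (fun s : ℝ ↦ (single i (s * h) : Spc d)) = fun s ↦ (s * h) • single i (1:ℝ) := by
      ext s j; by_cases hj : j = i <;> simp [hj]
    rw [this]; fun_prop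
  have mg : Measurable (uncurry g) := m2.comp (show Measurable fun w : ℝ × Pt d ↦ (w.2.1, w.2.2 + (single i (w.1 * h) : Spc d)) from Continuous.measurable ((by fun_prop : Continuous fun w : ℝ × Pt d ↦ w.2.1).prodMk ((by fun_prop : Continuous fun w : ℝ × Pt d ↦ w.2.2).add (ce.comp continuous_fst))))
  have key := minkowski hq hp mg (M := ofReal M) ofReal_ne_top (R := R + h) ł
    (fun s hs z ↦ ZI_bd hh.le (fun z _ ↦ hM z) (by simp [abs_of_pos hs.1, abs_of_pos hh]; nlinarith [hs.2]) z) (S := ZZ q p R (Dxx i i W)) (fun s _ ↦ (XX_trans q p _ _).le)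
  have mF : Measurable fun z ↦ ∫⁻ s in Ioo ō 1, g s z := Measurable.lintegral_prod_left' mg
  have mT : Measurable fun z : Pt d ↦ ZI R W (z.1, z.2 + single i h) := mW.comp ʄ
  have pt : ZI m (Dx i W) ≤ fun z ↦ ofReal h⁻¹ * (ZI R W (z.1, z.2 + single i h) + ZI R W z) + ofReal h * ∫⁻ s in Ioo ō 1, g s z := by
    intro z
    by_cases hz : z ∈ cyl d m 0 0
    · rw [ZI_in hz]
      obtain ⟨h1, h2, h3⟩ := mem_cyl.1 hz
      have sh : ∀ s : ℝ, 0 ≤ s → s ≤ h → (z.1, z.2 + single i s) ∈ cyl d R 0 0 := fun s s0 s1 ↦ by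
        refine mem_cyl.2 ⟨h1, ¿, ¿⟩
        · dsimp only; nlinarith
        · refine (norm_add_le _ _).trans_lt ¿
          simp [abs_of_nonneg s0]; linarith
      refine (taylor hW i hh z).trans_eq ¿
      beta_reduce
      rw [ZI_in (sh h hh.le le_rfl), ZI_in (cyl_mono hm ł hz)]
      congr 2
      refine setLIntegral_congr_fun measurableSet_Ioo fun s hs ↦ ¿
      exact (ZI_in (sh _ (mul_nonneg hs.1.le hh.le) (by nlinarith [hs.2]))).symm
    · rw [ZI_out hz]; exact zero_le
  refine (XX_mono q0 p0 pt).trans ((XX_add hq.le hp.le ((mT.add mW).const_mul _) (mF.const_mul _)).trans (add_le_add ¿ ¿))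
  · rw [XX_cmul q0 p0 ofReal_ne_top]
    refine mul_le_mul_right ((XX_add hq.le hp.le mT mW).trans_eq ¿) _
    rw [XX_trans q p (ZI R W), two_mul]; rfl
  · rw [XX_cmul q0 p0 ofReal_ne_top]
    exact mul_le_mul_right key _
abbrev CI : WithTop ℕ∞ := ((⊤ : ℕ∞) : WithTop ℕ∞)
structure LC (U : Set (Pt d)) (u : Fn d) : Prop where
  c0 : ContinuousOn u U
  dt : ∀ z ∈ U, DifferentiableAt ℝ (fun s ↦ u (s, z.2)) z.1
  dx : ∀ z ∈ U, DifferentiableAt ℝ (fun y ↦ u (z.1, y)) z.2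
  dxx : ∀ j, ∀ z ∈ U, DifferentiableAt ℝ (fun y ↦ Dx j u (z.1, y)) z.2
  ct : ContinuousOn (Dt u) U
  cx : ∀ i, ContinuousOn (Dx i u) U
  cxx : ∀ i j, ContinuousOn (Dxx i j u) U
lemma Dx_eqOn (o : IsOpen U) (h : EqOn u v U) (i : Fin d) : EqOn (Dx i u) (Dx i v) U :=
  fun z hz ↦ (Dx_loc (h.eventuallyEq_of_mem (o.mem_nhds hz)) i).eq_of_nhds
lemma Dt_eqOn (o : IsOpen U) (h : EqOn u v U) : EqOn (Dt u) (Dt v) U :=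
  fun z hz ↦ (Dt_loc (h.eventuallyEq_of_mem (o.mem_nhds hz))).eq_of_nhds
lemma Dx_cong (o : IsOpen U) (h : EqOn u v U) (hz : z ∈ U) : (fun y ↦ u (z.1, y)) =ᶠ[nhds z.2] fun y ↦ v (z.1, y) :=
  ((Continuous.prodMk_right z.1).tendsto z.2).eventually (h.eventuallyEq_of_mem (o.mem_nhds hz))
lemma LC.congr (o : IsOpen U) (hu : LC U u) (h : EqOn v u U) : LC U v where
  c0 := hu.c0.congr h
  dt z hz := (hu.dt z hz).congr_of_eventuallyEq (((Continuous.prodMk_left z.2).tendsto z.1).eventually (h.eventuallyEq_of_mem (o.mem_nhds hz)))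
  dx z hz := (hu.dx z hz).congr_of_eventuallyEq (Dx_cong o h hz)
  dxx j z hz := (hu.dxx j z hz).congr_of_eventuallyEq (Dx_cong o (Dx_eqOn o h j) hz)
  ct := hu.ct.congr (Dt_eqOn o h)
  cx i := (hu.cx i).congr (Dx_eqOn o h i)
  cxx i j := (hu.cxx i j).congr (Dx_eqOn o (Dx_eqOn o h j) i)
lemma Dx_mul (hf : DifferentiableAt ℝ (fun y ↦ f (z.1, y)) z.2) (hg : DifferentiableAt ℝ (fun y ↦ g (z.1, y)) z.2) (i : Fin d) :
    Dx i (fun z ↦ f z * g z) z = Dx i f z * g z + f z * Dx i g z := by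
  simp only [Dx]
  rw [fderiv_fun_mul hf hg]
  simp; ring
lemma Dx_add (hf : DifferentiableAt ℝ (fun y ↦ f (z.1, y)) z.2) (hg : DifferentiableAt ℝ (fun y ↦ g (z.1, y)) z.2) (i : Fin d) :
    Dx i (fun z ↦ f z + g z) z = Dx i f z + Dx i g z := by
  simp only [Dx]
  rw [fderiv_fun_add hf hg]
  simp
lemma LC.mt (hf : LC U f) (hg : LC U g) : EqOn (Dt fun z ↦ f z * g z) (fun z ↦ Dt f z * g z + f z * Dt g z) U :=
  fun z hz ↦ deriv_fun_mul (hf.dt z hz) (hg.dt z hz)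
lemma LC.mx (hf : LC U f) (hg : LC U g) (i : Fin d) : EqOn (Dx i fun z ↦ f z * g z) (fun z ↦ Dx i f z * g z + f z * Dx i g z) U :=
  fun z hz ↦ Dx_mul (hf.dx z hz) (hg.dx z hz) i
lemma LC.mxx (o : IsOpen U) (hf : LC U f) (hg : LC U g) (i j : Fin d) : EqOn (Dxx i j fun z ↦ f z * g z)
    (fun z ↦ Dxx i j f z * g z + Dx j f z * Dx i g z + (Dx i f z * Dx j g z + f z * Dxx i j g z)) U := fun z hz ↦ by
  refine (Dx_eqOn o (hf.mx hg j) i hz).trans ¿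
  rw [Dx_add ((hf.dxx j z hz).mul (hg.dx z hz)) ((hf.dx z hz).mul (hg.dxx j z hz)), Dx_mul (hf.dxx j z hz) (hg.dx z hz), Dx_mul (hf.dx z hz) (hg.dxx j z hz)]
  rfl
lemma LC.mul (o : IsOpen U) (hf : LC U f) (hg : LC U g) : LC U (fun z ↦ f z * g z) where
  c0 := hf.c0.mul hg.c0
  dt z hz := (hf.dt z hz).mul (hg.dt z hz)
  dx z hz := (hf.dx z hz).mul (hg.dx z hz)
  dxx j z hz := (((hf.dxx j z hz).mul (hg.dx z hz)).add ((hf.dx z hz).mul (hg.dxx j z hz))).congr_of_eventuallyEq (Dx_cong o (hf.mx hg j) hz)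
  ct := ((hf.ct.mul hg.c0).add (hf.c0.mul hg.ct)).congr (hf.mt hg)
  cx i := (((hf.cx i).mul hg.c0).add (hf.c0.mul (hg.cx i))).congr (hf.mx hg i)
  cxx i j := ((((hf.cxx i j).mul hg.c0).add ((hf.cx j).mul (hg.cx i))).add (((hf.cx i).mul (hg.cx j)).add (hf.c0.mul (hg.cxx i j)))).congr (hf.mxx o hg i j)
lemma Dx_sm {η : Fn d} (h : ContDiff ℝ CI η) (i : Fin d) : ContDiff ℝ CI (Dx i η) := by
  have : Dx i η = fun z ↦ fderiv ℝ η z (0, single i 1) := by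
    ext z
    have := ((h.differentiable ş z).hasFDerivAt.comp z.2 (hasFDerivAt_prodMk_right (𝕜 := ℝ) z.1 z.2)).fderiv
    simp only [Dx]
    erw [this]; rfl
  rw [this]
  exact (h.fderiv_right (m := CI) ş).clm_apply contDiff_const
lemma Dt_sm {η : Fn d} (h : ContDiff ℝ CI η) : ContDiff ℝ CI (Dt η) := by
  have : Dt η = fun z ↦ fderiv ℝ η z (1, 0) := by
    ext z
    have := ((h.differentiable ş z).hasFDerivAt.comp_hasDerivAt z.1 ((hasDerivAt_id z.1).prodMk (hasDerivAt_const z.1 z.2))).deriv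
    exact this
  rw [this]
  exact (h.fderiv_right (m := CI) ş).clm_apply contDiff_const
lemma LC.sm {η : Fn d} (h : ContDiff ℝ CI η) (U : Set (Pt d)) : LC U η where
  c0 := h.continuous.continuousOn
  dt z _ := (h.comp (contDiff_id.prodMk contDiff_const)).differentiable ş _
  dx z _ := (h.comp (contDiff_const.prodMk contDiff_id)).differentiable ş _
  dxx j z _ := ((Dx_sm h j).comp (contDiff_const.prodMk contDiff_id)).differentiable ş _
  ct := (Dt_sm h).continuous.continuousOn
  cx i := (Dx_sm h i).continuous.continuousOn
  cxx i j := (Dx_sm (Dx_sm h j) i).continuous.continuousOn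
lemma C12.lc (h : C12 v) (U : Set (Pt d)) : LC U v := ⟨h.c0.continuousOn, fun z _ ↦ h.dt z, fun z _ ↦ h.dx z, fun j z _ ↦ h.dxx j z, h.ct.continuousOn, fun i ↦ (h.cx i).continuousOn, fun i j ↦ (h.cxx i j).continuousOn⟩
lemma C12.of (h : ∀ z, ∃ U, IsOpen U ∧ z ∈ U ∧ LC U v) (hR : 0 < R) (hs : tsupport v ⊆ pbox 0 R) : C12 v := by
  have c : ∀ f : Fn d, (∀ U, LC U v → ContinuousOn f U) → Continuous f := fun f hf ↦ continuous_iff_continuousAt.2 fun z ↦ by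
    obtain ⟨U, o, hz, l⟩ := h z
    exact (hf U l).continuousAt (o.mem_nhds hz)
  refine ⟨c _ fun U l ↦ l.c0, c _ fun U l ↦ l.ct, fun i ↦ c _ fun U l ↦ l.cx i, fun i j ↦ c _ fun U l ↦ l.cxx i j, ¿, ¿, ¿, R, hR, hs⟩
  · intro z; obtain ⟨U, o, hz, l⟩ := h z; exact l.dt z hz
  · intro z; obtain ⟨U, o, hz, l⟩ := h z; exact l.dx z hz
  · intro j z; obtain ⟨U, o, hz, l⟩ := h z; exact l.dxx j z hz
lemma C12.cut {η : Fn d} (hv : C12 v) (h : ContDiff ℝ CI η) : C12 fun z ↦ η z * v z := by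
  obtain ⟨R, hR, s⟩ := hv.supp
  exact C12.of (fun z ↦ ⟨univ, isOpen_univ, trivial, (LC.sm h _).mul isOpen_univ (hv.lc _)⟩) hR ((tsupport_mul_subset_right).trans s)
lemma extend {K : Set (Pt d)} (o : IsOpen U) (hK : IsCompact K) (hKU : K ⊆ U) (hu : LC U u) : ∃ W, C12 W ∧ EqOn W u K := by
  obtain ⟨η, h1, h2, h3, h4⟩ : ∃ η : Fn d, ContDiff ℝ CI η ∧ HasCompactSupport η ∧ tsupport η ⊆ U ∧ EqOn η 1 K := by
    obtain ⟨L, hL, h1, h2⟩ := exists_compact_between hK o hKU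
    obtain ⟨f, f1, f2, -⟩ := exists_contMDiffMap_one_nhds_of_subset_interior (n := ⊤) (modelWithCornersSelf ℝ (Pt d)) hK.isClosed h1
    have sf : Function.support f ⊆ L := fun z hz ↦ by_contra fun h ↦ hz (f2 z h)
    exact ⟨f, f.contMDiff.contDiff, .of_support_subset_isCompact hL sf, (closure_minimal sf hL.isClosed).trans h2, fun z hz ↦ (f1.self_of_nhdsSet z hz)⟩
  obtain ⟨R, hR, hs⟩ : ∃ R : ℝ, 0 < R ∧ tsupport η ⊆ pbox 0 R := by
    obtain ⟨C, hC⟩ := h2.isCompact.isBounded.exists_norm_le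
    refine ⟨|C| + 1, by positivity, fun z hz ↦ ¿⟩
    have := hC z hz
    have a1 := norm_fst_le z
    have a2 := norm_snd_le z
    have a3 := le_abs_self C
    have a4 := abs_nonneg C
    rw [norm_eq_abs] at a1
    have := abs_le.1 a1
    refine ⟨⟨¿, ¿⟩, ¿⟩
    · simp only [fst_zero]; nlinarith
    · simp only [fst_zero]; nlinarith
    · simp; linarith
  refine ⟨fun z ↦ η z * u z, C12.of (fun z ↦ ¿) hR ((tsupport_mul_subset_left).trans hs), fun z hz ↦ by simp [h4 hz]⟩
  by_cases hz : z ∈ tsupport η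
  · exact ⟨U, o, h3 hz, (LC.sm h1 _).mul o hu⟩
  · refine ⟨(tsupport η)ᶜ, (isClosed_tsupport η).isOpen_compl, hz, (LC.sm (contDiff_const (c := ō)) _).congr (isClosed_tsupport η).isOpen_compl fun w hw ↦ ¿⟩
    simp [image_eq_zero_of_notMem_tsupport hw]
lemma stb : ∃ K : ℝ, 0 < K ∧ ∀ x, |deriv smoothTransition x| ≤ K ∧ |deriv (deriv smoothTransition) x| ≤ K ∧ (x < 0 → deriv smoothTransition x = 0 ∧ deriv (deriv smoothTransition) x = 0) := by
  have s : ContDiff ℝ 2 smoothTransition := smoothTransition.contDiff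
  have s1 : ContDiff ℝ 1 (deriv smoothTransition) := ContDiff.deriv' (n := 1) s
  have z1 : ∀ x < 0, deriv smoothTransition x = 0 := fun x hx ↦ by
    have : smoothTransition =ᶠ[nhds x] fun _ ↦ 0 := by
      filter_upwards [Iio_mem_nhds hx] with y hy using smoothTransition.zero_of_nonpos (le_of_lt hy)
    rw [this.deriv_eq, deriv_const]
  have z2 : ∀ x > 1, deriv smoothTransition x = 0 := fun x hx ↦ by
    have : smoothTransition =ᶠ[nhds x] fun _ ↦ 1 := by
      filter_upwards [Ioi_mem_nhds hx] with y hy using smoothTransition.one_of_one_le (le_of_lt hy)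
    rw [this.deriv_eq, deriv_const]
  have cs : HasCompactSupport (deriv smoothTransition) := .of_support_subset_isCompact (K := Icc 0 1) isCompact_Icc fun x hx ↦ by
    by_contra h
    rw [mem_Icc, not_and_or, not_le, not_le] at h
    exact hx (h.elim (z1 x) (z2 x))
  obtain ⟨A, hA⟩ := s1.continuous.bounded_above_of_compact_support cs
  obtain ⟨B, hB⟩ := (s1.continuous_deriv le_rfl).bounded_above_of_compact_support cs.deriv
  refine ⟨|A| + |B| + 1, by positivity, fun x ↦ ⟨¿, ¿, fun hx ↦ ⟨z1 x hx, ¿⟩⟩⟩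
  · have := hA x; rw [norm_eq_abs] at this; linarith [le_abs_self A, abs_nonneg B]
  · have := hB x; rw [norm_eq_abs] at this; linarith [le_abs_self B, abs_nonneg A]
  · have : deriv smoothTransition =ᶠ[nhds x] fun _ ↦ 0 := by
      filter_upwards [Iio_mem_nhds hx] with y hy using z1 y hy
    rw [this.deriv_eq, deriv_const]
lemma Dx_comp {k : ℝ → ℝ} (hk : Differentiable ℝ k) {g : Spc d → ℝ} {g' : Spc d →L[ℝ] ℝ} (hg : HasFDerivAt g g' z.2) (i : Fin d) :
    Dx i (fun z ↦ k (g z.2)) z = deriv k (g z.2) * g' (single i 1) := by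
  have := ((hk (g z.2)).hasDerivAt.comp_hasFDerivAt z.2 hg).fderiv
  simp only [Dx]
  erw [this]; rfl
lemma Dx_cm (ψ : ℝ → ℝ) {F : Fn d} (hF : DifferentiableAt ℝ (fun y ↦ F (z.1, y)) z.2) (i : Fin d) : Dx i (fun z ↦ ψ z.1 * F z) z = ψ z.1 * Dx i F z := by
  simp only [Dx]
  rw [fderiv_const_mul hF]; rfl
lemma cutoff : ∃ C : ℝ, 0 < C ∧ ∀ m R : ℝ, 0 < m → m < R → ∃ ζ : Fn d, ContDiff ℝ CI ζ ∧ (∀ z, |ζ z| ≤ 1) ∧ (∀ z ∈ cyl d m 0 0, ζ z = 1) ∧ (tsupport ζ ⊆ {z | z.1 ≤ R ^ 2 ∧ ‖z.2‖ ≤ R}) ∧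
    (∀ z, |Dt ζ z| ≤ C * (R - m)⁻¹ ^ 2) ∧ (∀ i z, |Dx i ζ z| ≤ C * (R - m)⁻¹) ∧ ∀ i j z, |Dxx i j ζ z| ≤ C * (R - m)⁻¹ ^ 2 := by
  obtain ⟨K, hK, st⟩ := stb
  refine ⟨6 * K, by positivity, fun m R hm hR ↦ ¿⟩
  set S := smoothTransition with hS
  have sS : ContDiff ℝ CI S := smoothTransition.contDiff
  have s1 : ContDiff ℝ 1 (deriv S) := ContDiff.deriv' (n := 1) (smoothTransition.contDiff (n := 2))
  have dS : Differentiable ℝ S := sS.differentiable ş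
  have dS1 : Differentiable ℝ (deriv S) := s1.differentiable ş
  have R0 : 0 < R := hm.trans hR
  set D := R ^ 2 - m ^ 2 with hD
  set e := (R - m)⁻¹ with he
  have e0 : 0 < e := inv_pos.2 ł
  have eq : e * (R - m) = 1 := inv_mul_cancel₀ ł
  have D0 : 0 < D := by rw [hD]; nlinarith
  have De : D⁻¹ ≤ e ^ 2 := by
    rw [he, inv_pow, hD]; exact inv_anti₀ ŋ ŋ
  have Re : R * D⁻¹ ≤ e := by
    rw [he, ← div_eq_mul_inv, div_le_iff₀ D0, inv_mul_eq_div, le_div_iff₀ ł, hD]; nlinarith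
  have Di := inv_pos.2 D0
  set g : Spc d → ℝ := fun x ↦ (R ^ 2 - ‖x‖ ^ 2) * D⁻¹ with hg
  set ψ : ℝ → ℝ := fun t ↦ S ((R ^ 2 - t) * D⁻¹) with hψ
  have sg : ContDiff ℝ CI g := (contDiff_const.sub (contDiff_norm_sq ℝ)).mul contDiff_const
  have S01 : ∀ x, |S x| ≤ 1 := fun x ↦ by rw [abs_of_nonneg (smoothTransition.nonneg x)]; exact smoothTransition.le_one x
  have hgd : ∀ x, HasFDerivAt g (-(D⁻¹ • (2 • innerSL ℝ x))) x := fun x ↦ by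
    have := ((hasStrictFDerivAt_norm_sq x).hasFDerivAt.const_sub (R ^ 2)).mul_const D⁻¹
    rwa [smul_neg] at this
  have ge : ∀ (x : Spc d) i, (-(D⁻¹ • (2 • innerSL ℝ x))) (single i 1) = -(2 * D⁻¹) * x i := fun x i ↦ by
    simp [EuclideanSpace.inner_single_right]; ring
  have x1 : ∀ i (z : Pt d), Dx i (fun z ↦ S (g z.2)) z = deriv S (g z.2) * (-(2 * D⁻¹) * z.2 i) := fun i z ↦ by
    rw [Dx_comp dS (hgd z.2), ge]
  have dd : ∀ z : Pt d, DifferentiableAt ℝ (fun y ↦ S (g y)) z.2 := fun z ↦ (sS.comp sg).differentiable ş _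
  have dg : ∀ z : Pt d, DifferentiableAt ℝ (fun y ↦ deriv S (g y)) z.2 := fun z ↦ (dS1.comp (sg.differentiable ş)) _
  have dl : ∀ i, ∀ z : Pt d, DifferentiableAt ℝ (fun y : Spc d ↦ -(2 * D⁻¹) * y i) z.2 := fun i z ↦ by fun_prop
  have X1 : ∀ i, Dx i (fun z : Pt d ↦ ψ z.1 * S (g z.2)) = fun z ↦ ψ z.1 * (deriv S (g z.2) * (-(2 * D⁻¹) * z.2 i)) := fun i ↦ by
    ext z; rw [Dx_cm ψ (F := fun z ↦ S (g z.2)) (dd z), x1]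
  have X2 : ∀ i j, ∀ z : Pt d, Dxx i j (fun z : Pt d ↦ ψ z.1 * S (g z.2)) z = ψ z.1 * (deriv (deriv S) (g z.2) * (-(2 * D⁻¹) * z.2 i) * (-(2 * D⁻¹) * z.2 j) + deriv S (g z.2) * (-(2 * D⁻¹) * if j = i then 1 else 0)) := fun i j z ↦ by
    rw [Dxx, X1, Dx_cm ψ (F := fun z ↦ deriv S (g z.2) * (-(2 * D⁻¹) * z.2 j)) ((dg z).mul (dl j z)), Dx_mul (f := fun z ↦ deriv S (g z.2)) (g := fun z ↦ -(2 * D⁻¹) * z.2 j) (dg z) (dl j z), Dx_comp dS1 (hgd z.2), ge]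
    congr 3
    have : HasFDerivAt (fun y : Spc d ↦ -(2 * D⁻¹) * y j) (-(2 * D⁻¹) • proj (𝕜 := ℝ) j) z.2 := (proj (𝕜 := ℝ) j).hasFDerivAt.const_mul _
    simp only [Dx]
    rw [this.fderiv]
    by_cases hj : j = i <;> simp [hj]
  have cx : ∀ x : Spc d, ∀ i, ‖x‖ ≤ R → |-(2 * D⁻¹) * x i| ≤ 2 * e := fun x i hx ↦ by
    have : |x i| ≤ R := (norm_apply_le x i).trans hx
    rw [abs_mul, abs_neg, abs_of_pos ƥ]
    nlinarith [abs_nonneg (x i)]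
  have out : ∀ x : Spc d, R < ‖x‖ → g x < 0 := fun x hx ↦ mul_neg_of_neg_of_pos ŋ Di
  have P : ∀ t, |ψ t| ≤ 1 := fun t ↦ S01 _
  refine ⟨fun z ↦ ψ z.1 * S (g z.2), ¿, fun z ↦ ¿, fun z hz ↦ ¿, ¿, fun z ↦ ¿, fun i z ↦ ¿, fun i j z ↦ ¿⟩
  · exact (sS.comp ((contDiff_const.sub contDiff_fst).mul contDiff_const)).mul (sS.comp (sg.comp contDiff_snd))
  · rw [abs_mul]; exact mul_le_one₀ (P _) (abs_nonneg _) (S01 _)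
  · obtain ⟨-, h2, h3⟩ := mem_cyl.1 hz
    have n := norm_nonneg z.2
    have : ∀ y : ℝ, y ≤ m ^ 2 → S ((R ^ 2 - y) * D⁻¹) = 1 := fun y hy ↦ smoothTransition.one_of_one_le (by
      rw [← div_eq_mul_inv, one_le_div D0, hD]; linarith)
    simp only [hψ, hg]
    rw [this _ h2.le, this _ (by gcongr), one_mul]
  · refine closure_minimal (fun z hz ↦ ¿) ((isClosed_le continuous_fst continuous_const).inter (isClosed_le continuous_snd.norm continuous_const))
    by_contra h
    rw [mem_ofPred_eq, not_and_or, not_le, not_le] at h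
    refine hz ¿
    rcases h with h | h
    · simp only [hψ]; rw [hS, smoothTransition.zero_of_nonpos (mul_nonpos_of_nonpos_of_nonneg ł Di.le), zero_mul]
    · beta_reduce; rw [hS, smoothTransition.zero_of_nonpos (out _ h).le, mul_zero]
  · have : Dt (fun z : Pt d ↦ ψ z.1 * S (g z.2)) z = deriv S ((R ^ 2 - z.1) * D⁻¹) * -D⁻¹ * S (g z.2) := by
      have h1 : HasDerivAt (fun t : ℝ ↦ (R ^ 2 - t) * D⁻¹) (-D⁻¹) z.1 := by simpa using ((hasDerivAt_id z.1).const_sub (R ^ 2)).mul_const D⁻¹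
      exact (((dS _).hasDerivAt.comp z.1 h1).mul_const (S (g z.2))).deriv
    rw [this, abs_mul, abs_mul, abs_neg, abs_of_pos Di]
    calc _ ≤ K * e ^ 2 * 1 := by
          gcongr
          · exact (st _).1
          · exact S01 _
      _ ≤ _ := by nlinarith [mul_pos hK (pow_pos e0 2)]
  · rw [X1]
    beta_reduce
    rcases le_or_gt ‖z.2‖ R with h | h
    · rw [abs_mul, abs_mul]
      calc _ ≤ 1 * (K * (2 * e)) := by
            gcongr
            · exact P _
            · exact (st _).1
            · exact cx _ _ h
        _ ≤ _ := by nlinarith [mul_pos hK e0]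
    · rw [((st _).2.2 (out _ h)).1]; simp; positivity
  · rw [X2]
    rcases le_or_gt ‖z.2‖ R with h | h
    · have hi : |(-(2 * D⁻¹) * if j = i then (1:ℝ) else 0)| ≤ 2 * e ^ 2 := by
        rw [abs_mul, abs_neg, abs_of_pos ƥ]
        split_ifs <;> simp <;> nlinarith
      have hx := cx z.2 i h
      have hy := cx z.2 j h
      generalize -(2 * D⁻¹) * z.2 i = A at *
      generalize -(2 * D⁻¹) * z.2 j = B at *
      generalize (-(2 * D⁻¹) * if j = i then (1:ℝ) else 0) = E at *
      rw [abs_mul]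
      calc _ ≤ 1 * (K * (2 * e) * (2 * e) + K * (2 * e ^ 2)) := by
            refine mul_le_mul (P _) ((abs_add_le _ _).trans ¿) (abs_nonneg _) zero_le_one
            rw [abs_mul, abs_mul, abs_mul]
            gcongr
            · exact (st _).2.1
            · exact (st _).1
        _ = _ := by ring
    · rw [((st _).2.2 (out _ h)).1, ((st _).2.2 (out _ h)).2]; simp; positivity
def Lf (a : Pt d → Mq d) (u : Fn d) (z : Pt d) : ℝ := Dt u z + ∑ i, ∑ j, a z i j * Dxx i j u z
def A2 (q p : ℝ) (W : Fn d) (m : ℝ) : ℰ := XX q p fun z ↦ ∑ i, ∑ j, ZI m (Dxx i j W) z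
lemma Lcut (ζ zt w wt : ℝ) (zx wx : Fin d → ℝ) (zxx wxx a : Fin d → Fin d → ℝ) {c1 c2 M : ℝ} (hM : 0 ≤ M) (c0 : 0 ≤ c1) (h0 : |ζ| ≤ 1) (ht : |zt| ≤ c2) (hx : ∀ i, |zx i| ≤ c1) (hxx : ∀ i j, |zxx i j| ≤ c2) (ha : ∀ i j, |a i j| ≤ M) :
    |(zt * w + ζ * wt) + ∑ i, ∑ j, a i j * (zxx i j * w + zx j * wx i + (zx i * wx j + ζ * wxx i j))| ≤ |wt + ∑ i, ∑ j, a i j * wxx i j| + (1 + M * d ^ 2) * c2 * |w| + 2 * M * d * c1 * ∑ i, |wx i| := by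
  have e : (zt * w + ζ * wt) + ∑ i, ∑ j, a i j * (zxx i j * w + zx j * wx i + (zx i * wx j + ζ * wxx i j)) = ζ * (wt + ∑ i, ∑ j, a i j * wxx i j) + zt * w + ∑ i, ∑ j, a i j * (zxx i j * w + zx j * wx i + zx i * wx j) := by
    rw [mul_add, mul_sum]
    simp only [mul_sum]
    have : ∀ i j, a i j * (zxx i j * w + zx j * wx i + (zx i * wx j + ζ * wxx i j)) = ζ * (a i j * wxx i j) + a i j * (zxx i j * w + zx j * wx i + zx i * wx j) := fun i j ↦ by ring
    simp only [this, sum_add_distrib]; ring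
  have c2' := (abs_nonneg zt).trans ht
  have s : |∑ i, ∑ j, a i j * (zxx i j * w + zx j * wx i + zx i * wx j)| ≤ ∑ i : Fin d, ∑ j : Fin d, M * (c2 * |w| + c1 * |wx i| + c1 * |wx j|) := by
    refine (abs_sum_le_sum_abs _ _).trans (sum_le_sum fun i _ ↦ (abs_sum_le_sum_abs _ _).trans (sum_le_sum fun j _ ↦ ¿))
    rw [abs_mul]
    refine mul_le_mul (ha i j) ((abs_add_three _ _ _).trans ¿) (abs_nonneg _) hM
    rw [abs_mul, abs_mul, abs_mul]
    gcongr
    · exact hxx i j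
    · exact hx j
    · exact hx i
  have s2 : ∑ i : Fin d, ∑ j : Fin d, M * (c2 * |w| + c1 * |wx i| + c1 * |wx j|) = M * d ^ 2 * c2 * |w| + 2 * M * d * c1 * ∑ i, |wx i| := by
    simp only [mul_add, sum_add_distrib, Finset.sum_const, Finset.card_univ, Fintype.card_fin, nsmul_eq_mul, ← mul_sum]; ring
  rw [e]
  refine (abs_add_three _ _ _).trans ¿
  rw [s2] at s
  rw [abs_mul, abs_mul]
  have h1 : |ζ| * |wt + ∑ i, ∑ j, a i j * wxx i j| ≤ |wt + ∑ i, ∑ j, a i j * wxx i j| := mul_le_of_le_one_left (abs_nonneg _) h0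
  have h2 : |zt| * |w| ≤ c2 * |w| := by gcongr
  linarith
lemma Lf_meas (ha : Measurable a) (hv : C12 v) : Measurable (Lf a v) :=
  hv.ct.measurable.add (measurable_sum _ fun i _ ↦ measurable_sum _ fun j _ ↦ (a_ij ha i j).mul (hv.cxx i j).measurable)
lemma step (hδ : 0 < δ) (hq : 1 < q) (hp : 1 < p) : ∃ aH : ℝ, 0 < aH ∧ ∃ K : ℝ, 0 < K ∧
    ∀ a : Pt d → Mq d, Measurable a → (∀ z, inS d δ (a z)) → aSharp a ≤ ofReal aH → ∀ W : Fn d, C12 W → ∀ m r R, 0 < m → m < r → r < R →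
    A2 q p W m ≤ ofReal K * (ZZ q p R (Lf a W) + ofReal ((r - m)⁻¹ ^ 2) * ZZ q p R W + ofReal (r - m)⁻¹ * ∑ i, ZZ q p R (Dx i W)) := by
  have q0 : 0 < q := by linarith
  have p0 : 0 < p := by linarith
  obtain ⟨aH, aH0, N, hN, B⟩ := thmB (d := d) δ hδ hq hp
  obtain ⟨C, hC, cut⟩ := cutoff (d := d)
  set M := 2 * δ⁻¹ with hM
  have M0 : 0 < M := by positivity
  set L := 1 + (1 + M * d ^ 2) * C + 2 * M * d * C with hL
  have L0 : 0 < L := by positivity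
  refine ⟨aH, aH0, N.toReal * L + 1, by positivity, fun a ha hS hs W hW m r R hm hr hR ↦ ¿⟩
  obtain ⟨ζ, zs, z1, zm, zt, b1, b2, b3⟩ := cut m r hm hr
  set e := (r - m)⁻¹
  have e0 : 0 < e := inv_pos.2 ł
  have lz := LC.sm zs univ
  have lw := hW.lc univ
  have hv := hW.cut zs
  have key := B a ha hS hs _ hv
  have h1 : A2 q p W m ≤ XX q p (GG fun z ↦ ζ z * W z) := XX_mono q0 p0 fun z ↦ by
    by_cases hz : z ∈ cyl d m 0 0
    · rw [GG, if_pos (mem_cyl.1 hz).1.le]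
      refine (sum_congr rfl fun i _ ↦ sum_congr rfl fun j _ ↦ ¿).le
      have E : EqOn W (fun z ↦ ζ z * W z) (cyl d m 0 0) := fun z hz ↦ by simp [zm z hz]
      rw [ZI_in hz]
      exact congrArg _ (Dx_eqOn (cyl_open m) (Dx_eqOn (cyl_open m) E j) i hz)
    · simp [ZI_out hz]
  set T : Pt d → ℰ := fun z ↦ ofReal L * (ZI R (Lf a W) z + ofReal (e ^ 2) * ZI R W z + ofReal e * ∑ i, ZI R (Dx i W) z) with hT
  have h2 : XX q p (LL a fun z ↦ ζ z * W z) ≤ XX q p T := XX_mono0 q0 p0 fun z hz0 ↦ by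
    rcases lt_or_ge z.1 0 with h | h
    · rw [LL, if_neg ł]; exact zero_le
    have h : 0 < z.1 := lt_of_le_of_ne h hz0.symm
    rw [LL, if_pos h.le]
    by_cases hz : z ∈ cyl d R 0 0
    · simp only [hT, ZI_in hz, enorm_eq_ofReal_abs]
      rw [← ofReal_sum_of_nonneg (fun _ _ ↦ abs_nonneg _), ← ofReal_mul ƥ, ← ofReal_mul ƥ, ← ofReal_add ƥ ƥ, ← ofReal_add ƥ ƥ, ← ofReal_mul L0.le]
      refine ofReal_le_ofReal ¿
      rw [lz.mt lw trivial]
      simp only [lz.mxx isOpen_univ lw _ _ (mem_univ z)]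
      refine (Lcut (ζ z) (Dt ζ z) (W z) (Dt W z) (fun i ↦ Dx i ζ z) (fun i ↦ Dx i W z) (fun i j ↦ Dxx i j ζ z) (fun i j ↦ Dxx i j W z) (fun i j ↦ a z i j) M0.le ƥ (z1 z) (b1 z) (fun i ↦ b2 i z) (fun i j ↦ b3 i j z) (fun i j ↦ by simpa using EL_entry hδ zero_le_one (inS_EL (hS z)) i j)).trans ¿
      change |Lf a W z| + _ + _ ≤ _
      have x0 : 0 ≤ |Lf a W z| := abs_nonneg _
      have x1 : 0 ≤ e ^ 2 * |W z| := by positivity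
      have x2 : 0 ≤ e * ∑ i, |Dx i W z| := by positivity
      have l1 : 1 ≤ L := by rw [hL, add_assoc]; exact le_add_of_nonneg_right ƥ
      have l2 : (1 + M * d ^ 2) * C ≤ L := by rw [hL]; linarith [show 0 ≤ 2 * M * d * C by positivity]
      have l3 : 2 * M * d * C ≤ L := by rw [hL]; linarith [show 0 ≤ (1 + M * d ^ 2) * C by positivity]
      linarith [mul_le_mul_of_nonneg_right l1 x0, mul_le_mul_of_nonneg_right l2 x1, mul_le_mul_of_nonneg_right l3 x2]
    · have nz : z ∉ tsupport fun z ↦ ζ z * W z := fun hc ↦ hz (by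
        obtain ⟨y1, y2⟩ := zt (tsupport_mul_subset_left hc)
        exact mem_cyl.2 ⟨h, y1.trans_lt (by gcongr; linarith), y2.trans_lt hR⟩)
      rw [image_eq_zero_of_notMem_tsupport (fun hc ↦ nz (supT _ hc))]
      have : ∀ i j, Dxx i j (fun z ↦ ζ z * W z) z = 0 := fun i j ↦ image_eq_zero_of_notMem_tsupport fun hc ↦ nz (supX _ j (supX _ i hc))
      simp [this]
  have m1 : Measurable (ZI R (Lf a W)) := (Lf_meas ha hW).enorm.indicator (cyl_open R).measurableSet
  have m2 := ZI_meas R hW.c0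
  have m3 : ∀ i, Measurable (ZI R (Dx i W)) := fun i ↦ ZI_meas R (hW.cx i)
  have h3 : XX q p T ≤ ofReal L * (ZZ q p R (Lf a W) + ofReal (e ^ 2) * ZZ q p R W + ofReal e * ∑ i, ZZ q p R (Dx i W)) := by
    rw [hT, XX_cmul q0 p0 ofReal_ne_top]
    refine mul_le_mul_right ((XX_add hq.le hp.le (m1.add (m2.const_mul _)) ((measurable_sum _ fun i _ ↦ m3 i).const_mul _)).trans (add_le_add ((XX_add hq.le hp.le m1 (m2.const_mul _)).trans (add_le_add_right ¿ _)) ¿)) _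
    · rw [XX_cmul q0 p0 ofReal_ne_top]; rfl
    · rw [XX_cmul q0 p0 ofReal_ne_top]
      exact mul_le_mul_right (XX_sum hq.le hp.le _ m3) _
  refine (h1.trans (key.trans (mul_le_mul_right (h2.trans h3) N))).trans ¿
  rw [← mul_assoc]
  refine mul_le_mul_left ¿ _
  rw [← ofReal_toReal hN, ← ofReal_mul toReal_nonneg, toReal_ofReal toReal_nonneg]
  exact ofReal_le_ofReal ł
lemma iter {A : ℝ → ℝ} {P Q M : ℝ} (hP : 0 ≤ P) (hQ : 0 ≤ Q) (hA : ∀ r, 0 < r → r < ρ → A r ≤ M) (h : ∀ r, 0 < r → r < ρ → A r ≤ P + Q * (ρ - r)⁻¹ ^ 2 + A (r + (ρ - r) / 2) / 8)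
    (r : ℝ) (hr : 0 < r) (hρ : r < ρ) : A r ≤ 2 * P + 2 * Q * (ρ - r)⁻¹ ^ 2 := by
  have c : ∀ n : ℕ, ∀ r, 0 < r → r < ρ → A r ≤ 2 * P + 2 * Q * (ρ - r)⁻¹ ^ 2 + (1 / 8) ^ n * M := by
    intro n
    induction n with
    | zero =>
      intro r h1 h2
      have := hA r h1 h2
      have : 0 ≤ 2 * Q * (ρ - r)⁻¹ ^ 2 := by positivity
      simp only [pow_zero]; linarith
    | succ n ih =>
      intro r h1 h2
      have i := ih (r + (ρ - r) / 2) ł ł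
      rw [show ρ - (r + (ρ - r) / 2) = (ρ - r) / 2 by ring, inv_div, show 2 / (ρ - r) = 2 * (ρ - r)⁻¹ from div_eq_mul_inv _ _, mul_pow] at i
      have j := h r h1 h2
      rw [pow_succ (1 / 8 : ℝ)]
      generalize (ρ - r)⁻¹ ^ 2 = X at i j ⊢
      generalize A (r + (ρ - r) / 2) = Y at i j
      linarith
  have := ((tendsto_pow_atTop_nhds_zero_of_lt_one (r := (1:ℝ) / 8) ñ ñ).mul_const M).const_add (2 * P + 2 * Q * (ρ - r)⁻¹ ^ 2)
  refine ge_of_tendsto' (by simpa using this) fun n ↦ c n r hr hρ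
lemma Lf_bd (hδ : 0 < δ) (hS : ∀ z, inS d δ (a z)) (hW : C12 W) : ∃ M, ∀ z, |Lf a W z| ≤ M := by
  obtain ⟨-, ⟨M, hM⟩, -⟩ := hW.nt
  have := fun i j ↦ (hW.nxx i j).2.1
  choose B hB using this
  refine ⟨M + ∑ i, ∑ j, 2 * δ⁻¹ * B i j, fun z ↦ (abs_add_le _ _).trans (add_le_add (hM z) ((abs_sum_le_sum_abs _ _).trans (sum_le_sum fun i _ ↦ (abs_sum_le_sum_abs _ _).trans (sum_le_sum fun j _ ↦ ¿))))⟩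
  rw [abs_mul]
  exact mul_le_mul (by simpa using EL_entry hδ zero_le_one (inS_EL (hS z)) i j) (hB i j z) (abs_nonneg _) ƥ
lemma A2_fin (hq : 1 < q) (hp : 1 < p) (hW : C12 W) (hR : 0 < R) : A2 q p W R ≠ ⊤ := by
  have m := fun i j ↦ ZI_meas R (hW.cxx i j)
  refine ((XX_sum hq.le hp.le _ fun i ↦ measurable_sum _ fun j _ ↦ m i j).trans_lt (sum_lt_top.2 fun i _ ↦ (XX_sum hq.le hp.le _ fun j ↦ m i j).trans_lt (sum_lt_top.2 fun j _ ↦ ¿))).ne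
  obtain ⟨-, ⟨M, hM⟩, -⟩ := hW.nxx i j
  exact (ZZ_fin ł ł hR fun z _ ↦ hM z).lt_top
lemma A2_mono (hq : 0 < q) (hp : 0 < p) (W : Fn d) {m : ℝ} (hm : 0 < m) (h : m ≤ R) : A2 q p W m ≤ A2 q p W R :=
  XX_mono hq hp fun z ↦ sum_le_sum fun i _ ↦ sum_le_sum fun j _ ↦ indicator_le_indicator_of_subset (cyl_mono hm h) (fun _ ↦ zero_le) z
lemma A2_ge (hq : 0 < q) (hp : 0 < p) (W : Fn d) (R : ℝ) (i j : Fin d) : ZZ q p R (Dxx i j W) ≤ A2 q p W R :=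
  XX_mono hq hp fun z ↦ (single_le_sum (f := fun j ↦ ZI R (Dxx i j W) z) (fun _ _ ↦ zero_le) (Finset.mem_univ j)).trans (single_le_sum (f := fun i ↦ ∑ j, ZI R (Dxx i j W) z) (fun _ _ ↦ zero_le) (Finset.mem_univ i))
lemma inter (hδ : 0 < δ) (hq : 1 < q) (hp : 1 < p) : ∃ aH : ℝ, 0 < aH ∧ ∃ K : ℝ, 0 < K ∧
    ∀ a : Pt d → Mq d, Measurable a → (∀ z, inS d δ (a z)) → aSharp a ≤ ofReal aH → ∀ W : Fn d, C12 W → ∀ r ρ, 0 < r → r < ρ →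
    (A2 q p W r).toReal ≤ K * ((ZZ q p ρ (Lf a W)).toReal + (ρ - r)⁻¹ ^ 2 * (ZZ q p ρ W).toReal) := by
  have q0 : 0 < q := by linarith
  have p0 : 0 < p := by linarith
  obtain ⟨aH, aH0, K, K0, st⟩ := step (d := d) hδ hq hp
  set θ := (32 * K * d + 2)⁻¹ with hθ
  have θ0 : 0 < θ := by positivity
  have θ1 : θ ≤ 2⁻¹ := inv_anti₀ ñ (by linarith [show 0 ≤ 32 * K * d by positivity])
  have θ2 : 4 * K * d * θ ≤ 1 / 8 := by
    rw [hθ, ← div_eq_mul_inv, div_le_iff₀ ƥ]; linarith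
  set Q := 4 * (16 * K + 8 * K * d * θ⁻¹) with hQ
  have Q0 : 0 < Q := by positivity
  refine ⟨aH, aH0, 2 * (K + Q), by positivity, fun a ha hS hs W hW r ρ hr hρ ↦ ¿⟩
  have ρ0 := hr.trans hρ
  obtain ⟨M1, b1⟩ := Lf_bd hδ hS hW
  obtain ⟨-, ⟨M2, b2⟩, -⟩ := hW.n0
  have fF : ZZ q p ρ (Lf a W) ≠ ⊤ := ZZ_fin q0 p0 ρ0 fun z _ ↦ b1 z
  have fG : ZZ q p ρ W ≠ ⊤ := ZZ_fin q0 p0 ρ0 fun z _ ↦ b2 z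
  have := iter (A := fun r ↦ (A2 q p W r).toReal) (ρ := ρ) (P := K * (ZZ q p ρ (Lf a W)).toReal) (Q := Q * (ZZ q p ρ W).toReal) (M := (A2 q p W ρ).toReal) ƥ ƥ
    (fun r h1 h2 ↦ toReal_mono (A2_fin hq hp hW ρ0) (A2_mono q0 p0 W h1 h2.le)) ¿ r hr hρ
  · refine this.trans ¿
    have x1 : 0 ≤ (ZZ q p ρ (Lf a W)).toReal := by positivity
    have x2 : 0 ≤ (ρ - r)⁻¹ ^ 2 * (ZZ q p ρ W).toReal := by positivity
    nlinarith [mul_nonneg Q0.le x1, mul_nonneg K0.le x2]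
  intro r hr hρ
  set τ := (ρ - r) / 2 with hτ
  have τ0 : 0 < τ := by rw [hτ]; linarith
  have fA := A2_fin hq hp hW (show 0 < r + τ by linarith)
  have k := st a ha hS hs W hW r (r + τ / 4) (r + τ / 2) hr ł ł
  rw [add_sub_cancel_left] at k
  have ki : ∀ i, ZZ q p (r + τ / 2) (Dx i W) ≤ ofReal (θ * τ)⁻¹ * (2 * ZZ q p ρ W) + ofReal (θ * τ) * A2 q p W (r + τ) := fun i ↦
    (interp hq hp hW i (h := θ * τ) (m := r + τ / 2) (R := r + τ) ł ƥ ŋ).trans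
      (add_le_add (mul_le_mul_right (mul_le_mul_right (ZZ_mono q0 p0 ł ł _) _) _) (mul_le_mul_right (A2_ge q0 p0 W _ i i) _))
  have k2 : A2 q p W r ≤ ofReal K * (ZZ q p ρ (Lf a W) + ofReal ((τ / 4)⁻¹ ^ 2) * ZZ q p ρ W + ofReal (τ / 4)⁻¹ * (d * (ofReal (θ * τ)⁻¹ * (2 * ZZ q p ρ W) + ofReal (θ * τ) * A2 q p W (r + τ)))) := by
    refine k.trans (mul_le_mul_right (add_le_add (add_le_add (ZZ_mono q0 p0 ł ł _) (mul_le_mul_right (ZZ_mono q0 p0 ł ł _) _)) (mul_le_mul_right ((sum_le_sum fun i _ ↦ ki i).trans_eq ¿) _)) _)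
    rw [Finset.sum_const, Finset.card_univ, Fintype.card_fin, nsmul_eq_mul]
  have k3 := toReal_mono ƒ k2
  rw [toReal_mul, toReal_add ƒ ƒ, toReal_add ƒ ƒ, toReal_mul, toReal_mul, toReal_mul, toReal_add ƒ ƒ, toReal_mul, toReal_mul, toReal_mul, toReal_ofReal ƥ, toReal_ofReal ƥ, toReal_ofReal ƥ, toReal_ofReal ƥ, toReal_ofReal ƥ] at k3
  simp only [ENNReal.toReal_natCast, ENNReal.toReal_ofNat] at k3
  refine k3.trans ¿
  beta_reduce
  have e : (ρ - r)⁻¹ = τ⁻¹ / 2 := by rw [hτ, inv_div]; field_simp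
  rw [e, hQ]
  generalize (ZZ q p ρ (Lf a W)).toReal = f
  generalize (ZZ q p ρ W).toReal = g
  have x : 0 ≤ (A2 q p W (r + τ)).toReal := toReal_nonneg
  generalize (A2 q p W (r + τ)).toReal = α at x ⊢
  have : K * (f + (τ / 4)⁻¹ ^ 2 * g + (τ / 4)⁻¹ * (d * ((θ * τ)⁻¹ * (2 * g) + θ * τ * α))) = K * f + 4 * (16 * K + 8 * K * d * θ⁻¹) * g * (τ⁻¹ / 2) ^ 2 + (4 * K * d * θ) * α := by
    field_simp; ring
  rw [this]
  linarith [mul_le_mul_of_nonneg_right θ2 x]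
lemma LC.ax (hf : LC U f) (hg : LC U g) (i : Fin d) : EqOn (Dx i fun z ↦ f z + g z) (fun z ↦ Dx i f z + Dx i g z) U :=
  fun z hz ↦ Dx_add (hf.dx z hz) (hg.dx z hz) i
lemma LC.at (hf : LC U f) (hg : LC U g) : EqOn (Dt fun z ↦ f z + g z) (fun z ↦ Dt f z + Dt g z) U :=
  fun z hz ↦ deriv_fun_add (hf.dt z hz) (hg.dt z hz)
lemma LC.axx (o : IsOpen U) (hf : LC U f) (hg : LC U g) (i j : Fin d) : EqOn (Dxx i j fun z ↦ f z + g z) (fun z ↦ Dxx i j f z + Dxx i j g z) U :=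
  fun z hz ↦ (Dx_eqOn o (hf.ax hg j) i hz).trans (Dx_add (hf.dxx j z hz) (hg.dxx j z hz) i)
lemma LC.add (o : IsOpen U) (hf : LC U f) (hg : LC U g) : LC U (fun z ↦ f z + g z) where
  c0 := hf.c0.add hg.c0
  dt z hz := (hf.dt z hz).add (hg.dt z hz)
  dx z hz := (hf.dx z hz).add (hg.dx z hz)
  dxx j z hz := ((hf.dxx j z hz).add (hg.dxx j z hz)).congr_of_eventuallyEq (Dx_cong o (hf.ax hg j) hz)
  ct := (hf.ct.add hg.ct).congr (hf.at hg)
  cx i := ((hf.cx i).add (hg.cx i)).congr (hf.ax hg i)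
  cxx i j := ((hf.cxx i j).add (hg.cxx i j)).congr (hf.axx o hg i j)
def aff (c₀ : ℝ) (cv : Fin d → ℝ) (z : Pt d) : ℝ := -(c₀ + ∑ i, cv i * z.2 i)
lemma aff_sm (c₀ : ℝ) (cv : Fin d → ℝ) : ContDiff ℝ CI (aff c₀ cv) := by
  unfold aff; fun_prop
lemma aff_t (c₀ : ℝ) (cv : Fin d → ℝ) (z : Pt d) : Dt (aff c₀ cv) z = 0 := by simp [Dt, aff]
lemma aff_xx (c₀ : ℝ) (cv : Fin d → ℝ) (i j : Fin d) (z : Pt d) : Dxx i j (aff c₀ cv) z = 0 := by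
  have : Dx j (aff c₀ cv) = fun _ ↦ -(∑ i, cv i • proj (𝕜 := ℝ) i : Spc d →L[ℝ] ℝ) (single j 1) := by
    ext z
    have h : HasFDerivAt (fun y : Spc d ↦ -(c₀ + ∑ i, cv i * y i)) (-(∑ i, cv i • proj (𝕜 := ℝ) i)) z.2 :=
      ((HasFDerivAt.fun_sum fun i _ ↦ (proj (𝕜 := ℝ) i).hasFDerivAt.const_mul (cv i)).const_add c₀).neg
    simp only [Dx, aff]
    rw [h.fderiv]; rfl
  rw [Dxx, this]
  simp [Dx]
lemma mixed_eq (hq : 0 < q) (hp : 0 < p) {M : ℝ} (hf : Measurable f) (hM : ∀ z, |f z| ≤ M) : mixedNormOn q p (cyl d R 0 0) f = (ZZ q p R f).toReal := by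
  have mi := hf.indicator (cyl_open (d := d) R).measurableSet
  have e : ∀ z, ZI R f z = ‖(cyl d R 0 0).indicator f z‖ₑ := fun z ↦ (enorm_indicator_eq_indicator_enorm _ _).symm
  have mz : Measurable (ZI R f) := hf.enorm.indicator (cyl_open R).measurableSet
  have nf := NN_fin hq ofReal_ne_top (f := ZI R f) fun z ↦ by simpa using ZI_bd le_rfl (fun z _ ↦ hM z) (y := 0) ş z
  have h1 : ∀ x, ∫ t : ℝ, |(cyl d R 0 0).indicator f (t, x)| ^ q = (NN q (ZI R f) x).toReal := fun x ↦ by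
    have mm : Measurable fun t : ℝ ↦ |(cyl d R 0 0).indicator f (t, x)| ^ q := (mi.comp (measurable_prodMk_right (y := x))).abs.pow_const q
    rw [integral_eq_lintegral_of_nonneg_ae (of_forall fun t ↦ by positivity) mm.aestronglyMeasurable, NN]
    refine congrArg _ (lintegral_congr fun t ↦ ¿)
    rw [e, enorm_eq_ofReal_abs, ENNReal.ofReal_rpow_of_nonneg (abs_nonneg _) hq.le]
  rw [mixedNormOn, mixedNorm, ZZ, XX]
  simp_rw [h1, ENNReal.toReal_rpow]
  rw [integral_toReal ((NN_meas q mz).pow_const _).aemeasurable (of_forall fun x ↦ ENNReal.rpow_lt_top_of_nonneg ƥ (nf x)), ENNReal.toReal_rpow]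
lemma mix_cong (h : EqOn f g (cyl d R 0 0)) : mixedNormOn q p (cyl d R 0 0) f = mixedNormOn q p (cyl d R 0 0) g := by
  rw [mixedNormOn, mixedNormOn, indicator_congr h]
lemma cpt (R : ℝ) : IsCompact (closure (cyl d R 0 0)) := (isBounded_Ioo _ _ |>.prod isBounded_ball).isCompact_closure
lemma fin1 (hδ : 0 < δ) (hq : 1 < q) (hp : 1 < p) (ha : Measurable a) (hS : ∀ z, inS d δ (a z)) (hW : C12 W) :
    ZZ q p r (Dt W) ≤ ZZ q p r (Lf a W) + ofReal (2 * δ⁻¹) * A2 q p W r ∧ ZZ q p r (fun z ↦ mnorm fun i j ↦ Dxx i j W z) ≤ ofReal d * A2 q p W r := by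
  have q0 : 0 < q := by linarith
  have p0 : 0 < p := by linarith
  have e : ∀ z, ofReal (∑ i, ∑ j, |Dxx i j W z|) = ∑ i, ∑ j, ‖Dxx i j W z‖ₑ := fun z ↦ by
    rw [ofReal_sum_of_nonneg fun i _ ↦ sum_nonneg fun j _ ↦ abs_nonneg _]
    refine sum_congr rfl fun i _ ↦ ¿
    rw [ofReal_sum_of_nonneg fun j _ ↦ abs_nonneg _]
    exact sum_congr rfl fun j _ ↦ (enorm_eq_ofReal_abs _).symm
  have mA : Measurable fun z : Pt d ↦ ∑ i, ∑ j, ZI r (Dxx i j W) z := measurable_sum _ fun i _ ↦ measurable_sum _ fun j _ ↦ ZI_meas r (hW.cxx i j)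
  constructor
  · rw [A2, ← XX_cmul q0 p0 ofReal_ne_top]
    refine (XX_mono q0 p0 fun z ↦ ¿).trans (XX_add hq.le hp.le (f := ZI r (Lf a W)) ((Lf_meas ha hW).enorm.indicator (cyl_open r).measurableSet) (mA.const_mul _))
    by_cases hz : z ∈ cyl d r 0 0
    · simp only [ZI_in hz]
      rw [← e, enorm_eq_ofReal_abs, enorm_eq_ofReal_abs, ← ofReal_mul ƥ, ← ofReal_add (abs_nonneg _) ƥ]
      refine ofReal_le_ofReal ¿
      have : |∑ i, ∑ j, a z i j * Dxx i j W z| ≤ 2 * δ⁻¹ * ∑ i, ∑ j, |Dxx i j W z| := by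
        simp only [mul_sum]
        refine (abs_sum_le_sum_abs _ _).trans (sum_le_sum fun i _ ↦ (abs_sum_le_sum_abs _ _).trans (sum_le_sum fun j _ ↦ ¿))
        rw [abs_mul]
        exact mul_le_mul_of_nonneg_right (by simpa using EL_entry hδ zero_le_one (inS_EL (hS z)) i j) (abs_nonneg _)
      have e2 : Dt W z = Lf a W z - ∑ i, ∑ j, a z i j * Dxx i j W z := by rw [Lf]; ring
      rw [e2]
      exact (abs_sub _ _).trans (by gcongr)
    · rw [ZI_out hz]; exact zero_le
  · rw [A2, ← XX_cmul q0 p0 ofReal_ne_top]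
    refine XX_mono q0 p0 fun z ↦ ¿
    by_cases hz : z ∈ cyl d r 0 0
    · simp only [ZI_in hz]
      rw [← e, enorm_eq_ofReal_abs, ← ofReal_mul ƥ, abs_of_nonneg (show 0 ≤ mnorm _ from sqrt_nonneg _)]
      exact ofReal_le_ofReal (mnorm_le ƥ fun i j ↦ (single_le_sum (f := fun j ↦ |Dxx i j W z|) (fun _ _ ↦ abs_nonneg _) (Finset.mem_univ j)).trans (single_le_sum (f := fun i ↦ ∑ j, |Dxx i j W z|) (fun _ _ ↦ by positivity) (Finset.mem_univ i)))
    · rw [ZI_out hz]; exact zero_le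
end K14
open K14 in
theorem stmt14 (d : ℕ) (hd : 1 ≤ d) (δ : ℝ) (hδ0 : 0 < δ) (hδ1 : δ ≤ 1)
    (p q : ℝ) (hp : 1 < p) (hq : 1 < q) :
    ∃ aHat N : ℝ, 0 < aHat ∧ 0 < N ∧
      ∀ a : Pt d → Matrix (Fin d) (Fin d) ℝ, Measurable a → (∀ z, inS d δ (a z)) →
        aSharp a ≤ ENNReal.ofReal aHat →
      ∀ r ρ : ℝ, 0 < r → r < ρ →
      ∀ u : Pt d → ℝ,
        (∃ U : Set (Pt d), IsOpen U ∧ closure (cyl d ρ 0 0) ⊆ U ∧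
          ContinuousOn u U ∧
          (∀ z ∈ U, DifferentiableAt ℝ (fun s => u (s, z.2)) z.1) ∧
          (∀ z ∈ U, DifferentiableAt ℝ (fun y => u (z.1, y)) z.2) ∧
          (∀ j : Fin d, ∀ z ∈ U, DifferentiableAt ℝ (fun y => Dx j u (z.1, y)) z.2) ∧
          ContinuousOn (Dt u) U ∧
          (∀ i : Fin d, ContinuousOn (Dx i u) U) ∧
          (∀ i j : Fin d, ContinuousOn (Dxx i j u) U)) →
      ∀ c₀ : ℝ, ∀ cv : Fin d → ℝ,
        mixedNormOn q p (cyl d r 0 0) (Dt u) +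
          mixedNormOn q p (cyl d r 0 0) (fun z => mnorm fun i j => Dxx i j u z) ≤
          N * (mixedNormOn q p (cyl d ρ 0 0)
              (fun z => Dt u z + ∑ i, ∑ j, a z i j * Dxx i j u z) +
            ((ρ - r) ^ 2)⁻¹ *
              mixedNormOn q p (cyl d ρ 0 0)
                (fun z => u z - (c₀ + ∑ i, cv i * z.2 i))) := by
  have q0 : 0 < q := by linarith
  have p0 : 0 < p := by linarith
  obtain ⟨aH, aH0, K, K0, I⟩ := inter (d := d) hδ0 hq hp
  refine ⟨aH, 1 + (2 * δ⁻¹ + d) * K, aH0, by positivity, fun a ha hS hs r ρ hr hρ u ⟨U, o, hU, h1, h2, h3, h4, h5, h6, h7⟩ c₀ cv ↦ ¿⟩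
  have lu : LC U u := ⟨h1, h2, h3, h4, h5, h6, h7⟩
  have la : LC U (aff c₀ cv) := LC.sm (aff_sm c₀ cv) U
  obtain ⟨W, hW, eW⟩ := extend o (cpt ρ) hU (lu.add o la)
  have cU : cyl d ρ 0 0 ⊆ U := subset_closure.trans hU
  have e0 : EqOn W (fun z ↦ u z + aff c₀ cv z) (cyl d ρ 0 0) := eW.mono subset_closure
  have oc := cyl_open (d := d) ρ
  have et : EqOn (Dt u) (Dt W) (cyl d ρ 0 0) := fun z hz ↦ by
    rw [Dt_eqOn oc e0 hz, lu.at la (cU hz)]; simp [aff_t]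
  have exx : ∀ i j, EqOn (Dxx i j u) (Dxx i j W) (cyl d ρ 0 0) := fun i j z hz ↦ by
    refine .trans ¿ ((lu.axx o la i j (cU hz)).symm.trans (Dx_eqOn oc (Dx_eqOn oc e0 j) i hz).symm)
    simp [aff_xx]
  have sub := cyl_mono (d := d) hr hρ.le
  obtain ⟨M1, b1⟩ := Lf_bd hδ0 hS hW
  obtain ⟨-, ⟨M2, b2⟩, -⟩ := hW.n0
  obtain ⟨-, ⟨M3, b3⟩, -⟩ := hW.nt
  have := fun i j ↦ (hW.nxx i j).2.1
  choose B hB using this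
  have ρ0 := hr.trans hρ
  have cm : Continuous fun z ↦ mnorm fun i j ↦ Dxx i j W z := Real.continuous_sqrt.comp (continuous_finset_sum _ fun i _ ↦ continuous_finset_sum _ fun j _ ↦ (hW.cxx i j).pow 2)
  have bm : ∀ z, |mnorm fun i j ↦ Dxx i j W z| ≤ d * ∑ i, ∑ j, |B i j| := fun z ↦ by
    rw [abs_of_nonneg (show 0 ≤ mnorm _ from sqrt_nonneg _)]
    exact mnorm_le ƥ fun i j ↦ ((hB i j z).trans (le_abs_self _)).trans ((single_le_sum (f := fun j ↦ |B i j|) (fun _ _ ↦ abs_nonneg _) (Finset.mem_univ j)).trans (single_le_sum (f := fun i ↦ ∑ j, |B i j|) (fun _ _ ↦ by positivity) (Finset.mem_univ i)))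
  rw [mix_cong (et.mono sub), mix_cong (R := r) (f := fun z ↦ mnorm _) (g := fun z ↦ mnorm fun i j ↦ Dxx i j W z) (fun z hz ↦ by simp only [exx _ _ (sub hz)]),
    mix_cong (R := ρ) (f := fun z ↦ Dt u z + _) (g := Lf a W) (fun z hz ↦ by simp only [exx _ _ hz, et hz, Lf]), mix_cong (R := ρ) (f := fun z ↦ u z - _) (g := W) (fun z hz ↦ by rw [e0 hz]; simp only [aff, sub_eq_add_neg]),
    mixed_eq q0 p0 hW.ct.measurable b3, mixed_eq q0 p0 cm.measurable bm, mixed_eq q0 p0 (Lf_meas ha hW) b1, mixed_eq q0 p0 hW.c0.measurable b2, ← inv_pow]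
  have key := I a ha hS hs W hW r ρ hr hρ
  obtain ⟨k1, k2⟩ := fin1 hδ0 hq hp ha hS hW (r := r)
  have fA := A2_fin hq hp hW hr
  have fF : ZZ q p ρ (Lf a W) ≠ ⊤ := ZZ_fin q0 p0 ρ0 fun z _ ↦ b1 z
  replace k1 := toReal_mono ƒ (k1.trans (add_le_add_left (ZZ_mono q0 p0 hr hρ.le _) _))
  replace k2 := toReal_mono ƒ k2
  rw [toReal_add ƒ ƒ, toReal_mul, toReal_ofReal ƥ] at k1
  rw [toReal_mul, toReal_ofReal ƥ] at k2
  have x2 : 0 ≤ (ρ - r)⁻¹ ^ 2 * (ZZ q p ρ W).toReal := by positivity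
  have := mul_le_mul_of_nonneg_left key (show 0 ≤ 2 * δ⁻¹ + d by positivity)
  linarith
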